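/- For any choice of parameters as in the context, any m ∈ ℕ, and any s₁ < s₂ < ⋯ < s_m in ℝ with A = {s₁,…,s_m}, there exist a probability space (Ω, ℱ, ℙ) and a point process M on ℝ² which is determinantal with correlation kernel K((s,x),(t,y)) = K_{a,b,c}(s,x;t,y) and reference measure μ_A × λ, where μ_A is the counting measure on A and λ is Lebesgue measure on ℝ; that is, for all r ≥ 1, all n₁,…,n_r ∈ ℕ with n = n₁+⋯+n_r, and all pairwise disjoint bounded Borel sets B₁,…,B_r ⊆ ℝ², E[∏_{j=1}^r M(B_j)!/(M(B_j)−n_j)!] = ∫_{B₁^{n₁}×⋯×B_r^{n_r}} det[K_{a,b,c}(t_i,x_i;t_j,x_j)]_{i,j=1}^n (μ_A × λ)^n(d(t,x)). -/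

import Mathlib

open MeasureTheory Filter Topology Complex intervalIntegral
open scoped ENNReal

noncomputable section

/-- The parameters of the Airy wanderer kernel: four summable nonincreasing
sequences of nonnegative reals and two nonnegative constants. -/
structure AWParams where
  ap : ℕ → ℝ
  am : ℕ → ℝ
  bp : ℕ → ℝ
  bm : ℕ → ℝ
  cp : ℝ
  cm : ℝ
  ap_nonneg : ∀ i, 0 ≤ ap i
  am_nonneg : ∀ i, 0 ≤ am i
  bp_nonneg : ∀ i, 0 ≤ bp i
  bm_nonneg : ∀ i, 0 ≤ bm i
  ap_anti : Antitone ap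
  am_anti : Antitone am
  bp_anti : Antitone bp
  bm_anti : Antitone bm
  sum_fin : Summable fun i => ap i + am i + bp i + bm i
  cp_nonneg : 0 ≤ cp
  cm_nonneg : 0 ≤ cm

namespace AWParams

/-- The threshold `ā ∈ [0, ∞]`. -/
def abar (P : AWParams) : EReal :=
  if 0 < P.am 0 + P.bm 0 + P.cm then (0 : EReal)
  else if P.ap 0 = 0 then (⊤ : EReal)
  else (((P.ap 0)⁻¹ : ℝ) : EReal)

/-- The threshold `b̄ ∈ [-∞, 0]`. -/
def bbar (P : AWParams) : EReal :=
  if 0 < P.am 0 + P.bm 0 + P.cm then (0 : EReal)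
  else if P.bp 0 = 0 then (⊥ : EReal)
  else ((-(P.bp 0)⁻¹ : ℝ) : EReal)

/-- The function `Φ_{a,b,c}`. -/
def Phi (P : AWParams) (z : ℂ) : ℂ :=
  Complex.exp ((P.cp : ℂ) * z + (P.cm : ℂ) / z) *
    ∏' i : ℕ,
      ((1 + (P.bp i : ℂ) * z) * (1 + (P.bm i : ℂ) / z)) /
        ((1 - (P.ap i : ℂ) * z) * (1 - (P.am i : ℂ) / z))

end AWParams

/-- Arc-length parametrization of `Γ_a^+` (increasing imaginary part). -/
def gammaP (a y : ℝ) : ℂ :=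
  (a : ℂ) + ((|y| : ℝ) : ℂ) / ((Real.sqrt 2 : ℝ) : ℂ) +
    ((y : ℝ) : ℂ) * Complex.I / ((Real.sqrt 2 : ℝ) : ℂ)

/-- The (a.e.) derivative of the parametrization of `Γ_a^+`. -/
def gammaPD (y : ℝ) : ℂ :=
  (((Real.sign y : ℝ)) : ℂ) / ((Real.sqrt 2 : ℝ) : ℂ) +
    Complex.I / ((Real.sqrt 2 : ℝ) : ℂ)

/-- Arc-length parametrization of `Γ_a^-` (increasing imaginary part). -/
def gammaM (a y : ℝ) : ℂ :=
  (a : ℂ) - ((|y| : ℝ) : ℂ) / ((Real.sqrt 2 : ℝ) : ℂ) +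
    ((y : ℝ) : ℂ) * Complex.I / ((Real.sqrt 2 : ℝ) : ℂ)

/-- The (a.e.) derivative of the parametrization of `Γ_a^-`. -/
def gammaMD (y : ℝ) : ℂ :=
  -(((Real.sign y : ℝ)) : ℂ) / ((Real.sqrt 2 : ℝ) : ℂ) +
    Complex.I / ((Real.sqrt 2 : ℝ) : ℂ)

/-- The integrand of `K³_{a,b,c}`. -/
def K3Integrand (P : AWParams) (t₁ x₁ t₂ x₂ : ℝ) (z w : ℂ) : ℂ :=
  Complex.exp (z ^ 3 / 3 - (x₁ : ℂ) * z - w ^ 3 / 3 + (x₂ : ℂ) * w) /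
      (z + (t₁ : ℂ) - w - (t₂ : ℂ)) *
    (P.Phi (z + (t₁ : ℂ)) / P.Phi (w + (t₂ : ℂ)))

/-- The integrand of `K³_{a,b,c}` in the parametrization of `Γ_α^+ × Γ_β^-`,
including the derivative factors. -/
def K3param (P : AWParams) (α β t₁ x₁ t₂ x₂ : ℝ) (y₁ y₂ : ℝ) : ℂ :=
  K3Integrand P t₁ x₁ t₂ x₂ (gammaP α y₁) (gammaM β y₂) * gammaPD y₁ * gammaMD y₂

/-- `K³_{a,b,c}` with contours `Γ_α^+`, `Γ_β^-`. -/
def K3 (P : AWParams) (α β t₁ x₁ t₂ x₂ : ℝ) : ℂ :=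
  (1 / (2 * (Real.pi : ℂ) * Complex.I)) ^ 2 *
    ∫ p : ℝ × ℝ, K3param P α β t₁ x₁ t₂ x₂ p.1 p.2

/-- `K²_{a,b,c}`. -/
def K2 (t₁ x₁ t₂ x₂ : ℝ) : ℂ :=
  if t₁ < t₂ then
    -((((Real.sqrt (4 * Real.pi * (t₂ - t₁)))⁻¹ : ℝ) : ℂ) *
      Complex.exp
        (((-(x₂ - x₁) ^ 2 / (4 * (t₂ - t₁)) - (t₂ - t₁) * (x₂ + x₁) / 2 +
            (t₂ - t₁) ^ 3 / 12 : ℝ)) : ℂ))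
  else 0

/-- The point `w = (α+t₁+β+t₂)/2 + i s` of the vertical segment in `K¹`. -/
def K1seg (α β t₁ t₂ s : ℝ) : ℂ :=
  (((α + t₁ + β + t₂) / 2 : ℝ) : ℂ) + (s : ℂ) * Complex.I

/-- `K¹_{a,b,c}`: zero unless the contours cross, in which case it is the integral
over the vertical segment from `u₋` to `u₊` (parametrized by the imaginary part,
with `dw = i ds`). -/
def K1 (α β t₁ x₁ t₂ x₂ : ℝ) : ℂ :=
  if α + t₁ < β + t₂ then
    (1 / (2 * (Real.pi : ℂ) * Complex.I)) *
      ∫ s in (-((β + t₂ - (α + t₁)) / 2))..((β + t₂ - (α + t₁)) / 2),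
        Complex.exp
          (((t₂ - t₁ : ℝ) : ℂ) * (K1seg α β t₁ t₂ s) ^ 2 +
            ((t₁ ^ 2 - t₂ ^ 2 : ℝ) : ℂ) * K1seg α β t₁ t₂ s +
            K1seg α β t₁ t₂ s * ((x₂ - x₁ : ℝ) : ℂ) +
            ((x₁ * t₁ - x₂ * t₂ - t₁ ^ 3 / 3 + t₂ ^ 3 / 3 : ℝ) : ℂ)) * Complex.I
  else 0

/-- The Airy wanderer kernel `K_{a,b,c}`, computed with contours `Γ_α^+`, `Γ_β^-`. -/
def KabcAt (P : AWParams) (α β t₁ x₁ t₂ x₂ : ℝ) : ℂ :=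
  K1 α β t₁ x₁ t₂ x₂ + K2 t₁ x₁ t₂ x₂ + K3 P α β t₁ x₁ t₂ x₂

/-- The Airy wanderer kernel `K_{a,b,c}` (with the canonical admissible choice
`α = -t₁ - 1`, `β = -t₂ + 1`; the value is independent of the admissible choice). -/
def Kabc (P : AWParams) (t₁ x₁ t₂ x₂ : ℝ) : ℂ :=
  KabcAt P (-t₁ - 1) (-t₂ + 1) t₁ x₁ t₂ x₂


/-- A point process on `ℝ²`. -/
def IsPointProcess2 {Ω : Type*} [MeasurableSpace Ω] (M : Ω → Measure (ℝ × ℝ)) : Prop :=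
  (∀ A : Set (ℝ × ℝ), MeasurableSet A → Measurable fun ω => M ω A) ∧
  (∀ ω, ∀ B : Set (ℝ × ℝ), MeasurableSet B → Bornology.IsBounded B →
    ∃ n : ℕ, M ω B = n)

/-- Descending factorial `x (x-1) ⋯ (x-n+1)` in `ℝ≥0∞`. -/
def descFactE (x : ℝ≥0∞) (n : ℕ) : ℝ≥0∞ := ∏ i ∈ Finset.range n, (x - (i : ℝ≥0∞))

/-- The counting measure `μ_𝒜` on the finite set `{s 0, …, s (m-1)} ⊆ ℝ`. -/
def muA {m : ℕ} (s : Fin m → ℝ) : Measure ℝ :=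
  Measure.sum fun j : Fin m => Measure.dirac (s j)

instance muA_finite {m : ℕ} (s : Fin m → ℝ) : IsFiniteMeasure (muA s) := by
  constructor
  rw [muA, Measure.sum_apply _ MeasurableSet.univ]
  simp [tsum_fintype]

/-- The process `M` is determinantal with correlation kernel `Kk` and reference
measure `μ_𝒜 × λ`, in the sense of joint factorial moments: for all pairwise
disjoint bounded Borel sets `B₁,…,B_r` and positive integers `n₁,…,n_r`,
`E[∏_j M(B_j)!/(M(B_j)-n_j)!] = ∫_{B₁^{n₁}×⋯×B_r^{n_r}} det[Kk(p_i, p_j)] d(μ_𝒜 × λ)^n`. -/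
def IsDeterminantalOn {Ω : Type*} [MeasurableSpace Ω] (P : Measure Ω)
    (M : Ω → Measure (ℝ × ℝ)) (Kk : ℝ → ℝ → ℝ → ℝ → ℂ)
    {m : ℕ} (s : Fin m → ℝ) : Prop :=
  ∀ (r : ℕ) (n : Fin r → ℕ) (B : Fin r → Set (ℝ × ℝ)),
    0 < r → (∀ j, 0 < n j) →
    (∀ j, MeasurableSet (B j)) → (∀ j, Bornology.IsBounded (B j)) →
    (∀ i j, i ≠ j → Disjoint (B i) (B j)) →
    (∫⁻ ω, ∏ j, descFactE (M ω (B j)) (n j) ∂P) ≠ ⊤ ∧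
    (((∫⁻ ω, ∏ j, descFactE (M ω (B j)) (n j) ∂P).toReal : ℝ) : ℂ) =
      ∫ x in {x : ((j : Fin r) × Fin (n j)) → ℝ × ℝ | ∀ p, x p ∈ B p.1},
        Matrix.det (Matrix.of fun p q : (j : Fin r) × Fin (n j) =>
          Kk (x p).1 (x p).2 (x q).1 (x q).2)
        ∂(Measure.pi fun _ : (j : Fin r) × Fin (n j) =>
            (muA s).prod (volume : Measure ℝ))

set_option linter.unusedSectionVars false
set_option linter.unusedVariables false
namespace AW

/-! ### Determinants of integrals and total positivity -/

theorem det_integral {ι : Type*} [Fintype ι] [DecidableEq ι] (F : ι → ι → ℝ → ℝ)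
    (μ : ι → Measure ℝ) [∀ j, SigmaFinite (μ j)] (hF : ∀ i j, Integrable (F i j) (μ j)) :
    Matrix.det (Matrix.of fun i j => ∫ u, F i j u ∂(μ j)) =
      ∫ u : ι → ℝ, Matrix.det (Matrix.of fun i j => F i j (u j)) ∂(Measure.pi μ) := by
  simp only [Matrix.det_apply', Matrix.of_apply]
  rw [MeasureTheory.integral_finsetSum]
  · refine Finset.sum_congr rfl fun σ _ => ?_
    rw [MeasureTheory.integral_const_mul, integral_fintype_prod_eq_prod (fun i => F (σ i) i)]
  · intro σ _
    refine Integrable.const_mul ?_ _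
    exact Integrable.fintype_prod (f := fun i => F (σ i) i) (fun i => hF _ _)

theorem det_exp_nonneg : ∀ (n : ℕ) (a x : Fin n → ℝ), Monotone a → Monotone x →
    0 ≤ Matrix.det (Matrix.of fun i j => Real.exp (a i * x j)) := by
  intro n
  induction n with
  | zero => intro a x _ _; simp
  | succ n ih =>
    intro a x ha hx
    -- factor out the first row
    have h1 : Matrix.det (Matrix.of fun i j => Real.exp (a i * x j)) =
        (∏ j, Real.exp (a 0 * x j)) *
          Matrix.det (Matrix.of fun i j => Real.exp ((a i - a 0) * x j)) := by
      rw [← Matrix.det_mul_row]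
      congr 1
      ext i j
      simp only [Matrix.of_apply]
      rw [← Real.exp_add]
      congr 1
      ring
    rw [h1]
    refine mul_nonneg (Finset.prod_nonneg fun _ _ => (Real.exp_pos _).le) ?_
    -- subtract columns
    set B : Matrix (Fin (n+1)) (Fin (n+1)) ℝ :=
      Matrix.of fun i j => Fin.cases (Real.exp ((a i - a 0) * x 0))
        (fun k => Real.exp ((a i - a 0) * x k.succ) - Real.exp ((a i - a 0) * x k.castSucc)) j
      with hB
    have h2 : Matrix.det (Matrix.of fun i j => Real.exp ((a i - a 0) * x j)) = B.det := by
      refine Matrix.det_eq_of_forall_col_eq_smul_add_pred (fun _ => 1) ?_ ?_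
      · intro i; simp [hB]
      · intro i j; simp [hB]
    rw [h2, Matrix.det_succ_row_zero]
    have h3 : ∀ j : Fin (n+1), j ≠ 0 → B 0 j = 0 := by
      intro j hj
      obtain ⟨k, rfl⟩ := Fin.exists_succ_eq.mpr hj
      simp [hB]
    rw [Finset.sum_eq_single 0 (fun j _ hj => by rw [h3 j hj]; ring) (by simp)]
    have h4 : B 0 0 = 1 := by simp [hB]
    rw [h4]
    simp only [Fin.val_zero, pow_zero, one_mul]
    set b : Fin n → ℝ := fun i => a i.succ - a 0 with hb
    have hb0 : ∀ i, 0 ≤ b i := fun i => sub_nonneg.mpr (ha (Fin.zero_le _))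
    set μ : Fin n → Measure ℝ := fun j => volume.restrict (Set.Ioc (x j.castSucc) (x j.succ))
    have h5 : B.submatrix Fin.succ (Fin.succAbove 0) =
        Matrix.of fun i j => ∫ u, (b i * Real.exp (b i * u)) ∂(μ j) := by
      ext i j
      simp only [Matrix.submatrix_apply, Fin.succAbove_zero, Matrix.of_apply, hB, Fin.cases_succ, μ]
      rw [← intervalIntegral.integral_of_le (hx (Fin.castSucc_lt_succ).le)]
      have := intervalIntegral.integral_eq_sub_of_hasDerivAt (a := x j.castSucc) (b := x j.succ)
        (f := fun u => Real.exp (b i * u)) (f' := fun u => b i * Real.exp (b i * u)) ?_ ?_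
      · rw [this]
      · intro u _
        have := ((hasDerivAt_id u).const_mul (b i)).exp
        simpa [mul_comm] using this
      · exact (by fun_prop : Continuous fun u => b i * Real.exp (b i * u)).intervalIntegrable _ _
    rw [h5, det_integral (fun i _ u => b i * Real.exp (b i * u))]
    · refine integral_nonneg_of_ae ?_
      have hae : ∀ᵐ u ∂(Measure.pi μ), ∀ j, u j ∈ Set.Ioc (x j.castSucc) (x j.succ) := by
        rw [ae_all_iff]
        intro j
        refine Measure.tendsto_eval_ae_ae.eventually (ae_restrict_mem measurableSet_Ioc)
      filter_upwards [hae] with u hu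
      have h6 : Matrix.det (Matrix.of fun i j => b i * Real.exp (b i * u j)) =
        (∏ i, b i) * Matrix.det (Matrix.of fun i j => Real.exp (b i * u j)) := by
        rw [← Matrix.det_mul_column]; rfl
      show (0:ℝ) ≤ _
      rw [h6]
      refine mul_nonneg (Finset.prod_nonneg fun i _ => hb0 i) (ih b u ?_ ?_)
      · intro i j hij
        exact sub_le_sub_right (ha (Fin.succ_le_succ_iff.mpr hij)) _
      · intro i j hij
        rcases hij.eq_or_lt with rfl | hlt
        · exact le_rfl
        · exact ((hu i).2.trans (hx (by
            rw [Fin.le_def]; simp; exact hlt))).trans (hu j).1.le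
    · intro i j
      exact ((by fun_prop : Continuous fun u => b i * Real.exp (b i * u)).integrableOn_Icc).mono_set
        Set.Ioc_subset_Icc_self

/-- Two functions which are alternating and nonnegative on monotone tuples have a
nonnegative product. -/
theorem alt_mul_nonneg {α : Type*} [LinearOrder α] {n : ℕ} (u v : (Fin n → α) → ℝ)
    (hu : ∀ f (σ : Equiv.Perm (Fin n)), u (f ∘ σ) = (Equiv.Perm.sign σ : ℤ) * u f)
    (hv : ∀ f (σ : Equiv.Perm (Fin n)), v (f ∘ σ) = (Equiv.Perm.sign σ : ℤ) * v f)
    (hu0 : ∀ f, Monotone f → 0 ≤ u f) (hv0 : ∀ f, Monotone f → 0 ≤ v f) (f : Fin n → α) :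
    0 ≤ u f * v f := by
  have h1 := hu0 _ (Tuple.monotone_sort f)
  have h2 := hv0 _ (Tuple.monotone_sort f)
  have h3 := mul_nonneg h1 h2
  rw [hu, hv] at h3
  rcases Int.units_eq_one_or (Equiv.Perm.sign (Tuple.sort f)) with h | h <;>
    simpa [h] using h3

theorem det_comp_perm_right {ι α : Type*} [Fintype ι] [DecidableEq ι] (F : ι → α → ℝ) (f : ι → α)
    (σ : Equiv.Perm ι) :
    Matrix.det (Matrix.of fun i j => F i ((f ∘ σ) j)) =
      (Equiv.Perm.sign σ : ℤ) * Matrix.det (Matrix.of fun i j => F i (f j)) :=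
  Matrix.det_permute' σ (Matrix.of fun i j => F i (f j))

theorem det_comp_perm_left {ι α : Type*} [Fintype ι] [DecidableEq ι] (F : α → ι → ℝ) (f : ι → α)
    (σ : Equiv.Perm ι) :
    Matrix.det (Matrix.of fun i j => F ((f ∘ σ) i) j) =
      (Equiv.Perm.sign σ : ℤ) * Matrix.det (Matrix.of fun i j => F (f i) j) :=
  Matrix.det_permute σ (Matrix.of fun i j => F (f i) j)

/-- The heat kernel for `∂_x^2`. -/
def hk (τ u : ℝ) : ℝ := (Real.sqrt (4 * Real.pi * τ))⁻¹ * Real.exp (-u ^ 2 / (4 * τ))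

theorem hk_nonneg (τ u : ℝ) : 0 ≤ hk τ u := by
  unfold hk; positivity

theorem hk_minor {τ : ℝ} (hτ : 0 < τ) (d : ℝ) {n : ℕ} (x y : Fin n → ℝ) (hx : Monotone x)
    (hy : Monotone y) : 0 ≤ Matrix.det (Matrix.of fun i j => hk τ (y j - x i - d)) := by
  have h1 : Matrix.det (Matrix.of fun i j => hk τ (y j - x i - d)) =
      (∏ i, ((Real.sqrt (4 * Real.pi * τ))⁻¹ * Real.exp (-(x i) ^ 2 / (4 * τ)))) *
      ((∏ j, Real.exp (-(y j - d) ^ 2 / (4 * τ))) *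
        Matrix.det (Matrix.of fun i j => Real.exp ((x i / (2 * τ)) * (y j - d)))) := by
    rw [← Matrix.det_mul_row, ← Matrix.det_mul_column]
    congr 1
    ext i j
    simp only [Matrix.of_apply, hk]
    rw [mul_assoc (_⁻¹), ← Real.exp_add, ← Real.exp_add]
    congr 2
    field_simp
    ring
  rw [h1]
  refine mul_nonneg (Finset.prod_nonneg fun _ _ => by positivity)
    (mul_nonneg (Finset.prod_nonneg fun _ _ => by positivity) (det_exp_nonneg _ _ _ ?_ ?_))
  · intro i j hij
    have := hx hij
    show x i / (2 * τ) ≤ x j / (2 * τ)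
    gcongr
  · intro i j hij
    have := hy hij
    show y i - d ≤ y j - d
    linarith

/-- The entrance functions. -/
def phiF (B τ x : ℝ) : ℝ := ∫ y in Set.Ioi (0:ℝ), hk τ (x - y) * Real.exp (-B * y)

theorem hk_continuous {τ : ℝ} : Continuous (hk τ) := by
  unfold hk; fun_prop

theorem hk_le {τ : ℝ} (hτ : 0 < τ) (u : ℝ) : hk τ u ≤ (Real.sqrt (4 * Real.pi * τ))⁻¹ := by
  unfold hk
  refine mul_le_of_le_one_right (by positivity) ?_
  rw [Real.exp_le_one_iff]
  have : 0 ≤ u ^ 2 / (4 * τ) := by positivity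
  rw [neg_div]; linarith

theorem phiF_integrable {B τ : ℝ} (hB : 0 < B) (hτ : 0 < τ) (x : ℝ) :
    IntegrableOn (fun y => hk τ (x - y) * Real.exp (-B * y)) (Set.Ioi (0:ℝ)) := by
  have h1 : IntegrableOn (fun y => Real.exp (-B * y)) (Set.Ioi (0:ℝ)) :=
    integrableOn_exp_mul_Ioi (by linarith) 0
  refine Integrable.bdd_mul h1 (c := (Real.sqrt (4 * Real.pi * τ))⁻¹) ?_ ?_
  · exact (hk_continuous.comp (by fun_prop)).aestronglyMeasurable
  · filter_upwards with y
    rw [Real.norm_of_nonneg (hk_nonneg _ _)]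
    exact hk_le hτ _

theorem phiF_minor {τ : ℝ} (hτ : 0 < τ) {n : ℕ} (B x : Fin n → ℝ) (hB0 : ∀ i, 0 < B i)
    (hB : Antitone B) (hx : Monotone x) :
    0 ≤ Matrix.det (Matrix.of fun i j => phiF (B i) τ (x j)) := by
  set ν : Measure ℝ := volume.restrict (Set.Ioi (0:ℝ))
  set D : (Fin n → ℝ) → ℝ := fun y => Matrix.det (Matrix.of fun i j => Real.exp (-(B i) * y j))
  set H : (Fin n → ℝ) → ℝ := fun y => Matrix.det (Matrix.of fun i j => hk τ (x i - y j))
  have hDs : ∀ y (σ : Equiv.Perm (Fin n)), D (y ∘ σ) = (Equiv.Perm.sign σ : ℤ) * D y :=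
    fun y σ => det_comp_perm_right (fun i u => Real.exp (-(B i) * u)) y σ
  have hHs : ∀ y (σ : Equiv.Perm (Fin n)), H (y ∘ σ) = (Equiv.Perm.sign σ : ℤ) * H y :=
    fun y σ => det_comp_perm_right (fun i u => hk τ (x i - u)) y σ
  have e1 : Matrix.det (Matrix.of fun i j => phiF (B i) τ (x j)) =
      ∫ y, (∏ l, hk τ (x l - y l)) * D y ∂(Measure.pi fun _ => ν) := by
    have := det_integral (fun i j y => hk τ (x j - y) * Real.exp (-(B i) * y)) (fun _ => ν)
      (fun i j => phiF_integrable (hB0 i) hτ (x j))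
    unfold phiF
    rw [this]
    congr 1
    ext y
    rw [← Matrix.det_mul_row]
    rfl
  have hInt : Integrable (fun y => (∏ l, hk τ (x l - y l)) * D y) (Measure.pi fun _ => ν) := by
    simp only [D, Matrix.det_apply', Finset.mul_sum]
    refine integrable_finsetSum _ fun σ _ => ?_
    have : Integrable (fun y : Fin n → ℝ => ∏ l, (hk τ (x l - y l) * Real.exp (-(B (σ l)) * y l)))
        (Measure.pi fun _ => ν) :=
      Integrable.fintype_prod (f := fun l u => hk τ (x l - u) * Real.exp (-(B (σ l)) * u))
        (fun l => phiF_integrable (hB0 _) hτ (x l))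
    refine (this.const_mul (((Equiv.Perm.sign σ : ℤ)) : ℝ)).congr ?_
    filter_upwards with y
    rw [Finset.prod_mul_distrib]
    simp only [Matrix.of_apply]
    ring
  have e2 : ∀ σ : Equiv.Perm (Fin n), ∫ y, (∏ l, hk τ (x l - y l)) * D y ∂(Measure.pi fun _ => ν) =
      ∫ y, (Equiv.Perm.sign σ : ℤ) * (∏ l, hk τ (x l - y (σ l))) * D y ∂(Measure.pi fun _ => ν) := by
    intro σ
    have hmp := measurePreserving_piCongrLeft (fun _ : Fin n => ν) σ.symm
    rw [← hmp.integral_comp' (g := fun y => (∏ l, hk τ (x l - y l)) * D y)]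
    refine integral_congr_ae ?_
    filter_upwards with y
    have : (MeasurableEquiv.piCongrLeft (fun _ => ℝ) σ.symm) y = y ∘ σ := by
      ext l
      have := MeasurableEquiv.piCongrLeft_apply_apply (β := fun _ => ℝ) σ.symm y (σ l)
      simpa using this
    rw [this, hDs]
    simp only [Function.comp]
    ring
  have hint2 : ∀ σ : Equiv.Perm (Fin n), Integrable (fun y =>
      (Equiv.Perm.sign σ : ℤ) * (∏ l, hk τ (x l - y (σ l))) * D y) (Measure.pi fun _ => ν) := by
    intro σ
    have hmp := measurePreserving_piCongrLeft (fun _ : Fin n => ν) σ.symm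
    have := (hmp.integrable_comp_emb (MeasurableEquiv.measurableEmbedding _)).mpr hInt
    refine this.congr ?_
    filter_upwards with y
    have : (MeasurableEquiv.piCongrLeft (fun _ => ℝ) σ.symm) y = y ∘ σ := by
      ext l
      have := MeasurableEquiv.piCongrLeft_apply_apply (β := fun _ => ℝ) σ.symm y (σ l)
      simpa using this
    simp only [Function.comp_apply, this, hDs]
    ring
  have e3 : (Nat.factorial n : ℝ) * ∫ y, (∏ l, hk τ (x l - y l)) * D y ∂(Measure.pi fun _ => ν) =
      ∫ y, H y * D y ∂(Measure.pi fun _ => ν) := by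
    have : (Nat.factorial n : ℝ) * ∫ y, (∏ l, hk τ (x l - y l)) * D y ∂(Measure.pi fun _ => ν) =
      ∑ σ : Equiv.Perm (Fin n), ∫ y, (Equiv.Perm.sign σ : ℤ) * (∏ l, hk τ (x l - y (σ l))) * D y
        ∂(Measure.pi fun _ => ν) := by
      rw [Finset.sum_congr rfl (fun σ _ => (e2 σ).symm)]
      simp [Fintype.card_perm]
    rw [this, ← MeasureTheory.integral_finsetSum _ (fun σ _ => hint2 σ)]
    congr 1
    ext y
    simp only [H]
    rw [← Matrix.det_transpose, Matrix.det_apply', Finset.sum_mul]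
    rfl
  rw [e1]
  have hf : (0:ℝ) < Nat.factorial n := by positivity
  refine (mul_nonneg_iff_of_pos_left hf).mp ?_
  rw [e3]
  refine MeasureTheory.integral_nonneg fun y => ?_
  refine alt_mul_nonneg H D hHs hDs ?_ ?_ y
  · intro y hy
    have := hk_minor hτ 0 x y hx hy
    refine this.trans_eq ?_
    simp only [H, hk]
    congr 1
    ext i j
    simp only [Matrix.of_apply]
    congr 3
    ring
  · intro y hy
    exact det_exp_nonneg n (fun i => -(B i)) y (fun i j hij => neg_le_neg (hB hij)) hy

end AW
namespace AW

/-! ### Finite algebra: the Eynard-Mehta theorem -/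

theorem cauchyBinet {Y : Type*} [Fintype Y] [DecidableEq Y] {N : ℕ} (A : Fin N → Y → ℝ)
    (B : Y → Fin N → ℝ) :
    (Nat.factorial N : ℝ) * Matrix.det (Matrix.of fun i j => ∑ y, A i y * B y j) =
      ∑ f : Fin N → Y, Matrix.det (Matrix.of fun i j => A i (f j)) *
        Matrix.det (Matrix.of fun i j => B (f i) j) := by
  set D : (Fin N → Y) → ℝ := fun f => Matrix.det (Matrix.of fun i j => B (f i) j)
  have hD : ∀ f (σ : Equiv.Perm (Fin N)), D (f ∘ σ) = (Equiv.Perm.sign σ : ℤ) * D f :=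
    fun f σ => det_comp_perm_left B f σ
  have h1 : Matrix.det (Matrix.of fun i j => ∑ y, A i y * B y j) =
      ∑ f : Fin N → Y, (∏ i, A i (f i)) * D f := by
    have e : (Matrix.of fun i j => ∑ y, A i y * B y j) =
        fun i => ∑ y, A i y • B y := by
      ext i j; simp
    rw [e]
    change (Matrix.detRowAlternating (R := ℝ) (n := Fin N)).toMultilinearMap
      (fun i => ∑ y, A i y • B y) = _
    rw [MultilinearMap.map_sum]
    refine Finset.sum_congr rfl fun f _ => ?_
    rw [MultilinearMap.map_smul_univ]
    rfl
  have h2 : ∀ σ : Equiv.Perm (Fin N), ∑ f : Fin N → Y, (∏ i, A i (f i)) * D f =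
      ∑ f : Fin N → Y, (Equiv.Perm.sign σ : ℤ) * (∏ i, A i (f (σ i))) * D f := by
    intro σ
    rw [← Equiv.sum_comp (Equiv.arrowCongr σ.symm (Equiv.refl Y))]
    refine Finset.sum_congr rfl fun f _ => ?_
    have : (Equiv.arrowCongr σ.symm (Equiv.refl Y)) f = f ∘ σ := by ext; simp
    rw [this, hD]
    simp only [Function.comp]
    ring
  have h3 : (Nat.factorial N : ℝ) * ∑ f : Fin N → Y, (∏ i, A i (f i)) * D f =
      ∑ σ : Equiv.Perm (Fin N), ∑ f : Fin N → Y,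
        (Equiv.Perm.sign σ : ℤ) * (∏ i, A i (f (σ i))) * D f := by
    rw [Finset.sum_congr rfl (fun σ _ => (h2 σ).symm)]
    simp [Fintype.card_perm]
  rw [h1, h3, Finset.sum_comm]
  refine Finset.sum_congr rfl fun f _ => ?_
  rw [← Finset.sum_mul]
  congr 1
  rw [← Matrix.det_transpose, Matrix.det_apply']
  rfl

section EM

variable {Y : Type} [Fintype Y] [LinearOrder Y] {N m : ℕ}

/-- The block matrix of one-step transitions. -/
def QQ (m : ℕ) (P : ℕ → Y → Y → ℝ) : Matrix (Fin (m+1) × Y) (Fin (m+1) × Y) ℝ :=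
  Matrix.of fun p q => if q.1.val = p.1.val + 1 then P p.1 p.2 q.2 else 0

def PhiHat (m : ℕ) (φ : Fin N → Y → ℝ) : Matrix (Fin N) (Fin (m+1) × Y) ℝ :=
  Matrix.of fun i q => if q.1 = 0 then φ i q.2 else 0

def PsiHat (m : ℕ) (ψ : Y → Fin N → ℝ) : Matrix (Fin (m+1) × Y) (Fin N) ℝ :=
  Matrix.of fun q i => if q.1 = Fin.last m then ψ q.2 i else 0

theorem det_one_sub_QQ (P : ℕ → Y → Y → ℝ) (w : Fin (m+1) × Y → ℝ) :
    (1 - Matrix.diagonal w * QQ m P).det = 1 := by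
  have hbt : (1 - Matrix.diagonal w * QQ m P).BlockTriangular Prod.fst := by
    intro p q hpq
    have h1 : p ≠ q := by rintro rfl; exact lt_irrefl _ hpq
    have h2 : ¬ (q.1.val = p.1.val + 1) := by
      have : q.1.val < p.1.val := hpq
      omega
    simp [Matrix.sub_apply, h1, Matrix.diagonal_mul, QQ, h2]
  rw [hbt.det]
  refine Finset.prod_eq_one fun k _ => ?_
  have : (1 - Matrix.diagonal w * QQ m P).toSquareBlock Prod.fst k = 1 := by
    ext ⟨p, hp⟩ ⟨q, hq⟩
    have h2 : ¬ (q.1.val = p.1.val + 1) := by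
      rw [hp, hq]; omega
    simp [Matrix.toSquareBlock, Matrix.toSquareBlockProp, Matrix.sub_apply, Matrix.one_apply,
      Matrix.diagonal_mul, QQ, h2]
  rw [this, Matrix.det_one]

def Fgen (φ : Fin N → Y → ℝ) (P : ℕ → Y → Y → ℝ) (ψ : Y → Fin N → ℝ)
    (w : Fin (m+1) × Y → ℝ) : ℝ :=
  (PhiHat m φ * ((1 - Matrix.diagonal w * QQ m P)⁻¹ * (Matrix.diagonal w * PsiHat m ψ))).det

def EE (m : ℕ) (P : ℕ → Y → Y → ℝ) : Matrix (Fin (m+1) × Y) (Fin (m+1) × Y) ℝ := (1 - QQ m P)⁻¹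

def GG (m : ℕ) (φ : Fin N → Y → ℝ) (P : ℕ → Y → Y → ℝ) (ψ : Y → Fin N → ℝ) :
    Matrix (Fin N) (Fin N) ℝ := PhiHat m φ * EE m P * PsiHat m ψ

def KK (m : ℕ) (φ : Fin N → Y → ℝ) (P : ℕ → Y → Y → ℝ) (ψ : Y → Fin N → ℝ) :
    Matrix (Fin (m+1) × Y) (Fin (m+1) × Y) ℝ :=
  -(EE m P - 1) + EE m P * PsiHat m ψ * (GG m φ P ψ)⁻¹ * (PhiHat m φ * EE m P)

theorem det_one_add_KK (φ : Fin N → Y → ℝ) (P : ℕ → Y → Y → ℝ) (ψ : Y → Fin N → ℝ)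
    (hG : IsUnit (GG m φ P ψ).det) (g : Fin (m+1) × Y → ℝ) :
    (GG m φ P ψ).det * (1 + Matrix.diagonal g * KK m φ P ψ).det =
      Fgen φ P ψ (fun p => 1 + g p) := by
  set Q := QQ m P with hQ
  set W : Matrix (Fin (m+1) × Y) (Fin (m+1) × Y) ℝ := Matrix.diagonal (fun p => 1 + g p) with hW
  set D : Matrix (Fin (m+1) × Y) (Fin (m+1) × Y) ℝ := Matrix.diagonal g with hD
  have hWD : W = 1 + D := by
    rw [hW, hD, ← Matrix.diagonal_one, Matrix.diagonal_add]
  have hu0 : IsUnit (1 - Q).det := by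
    have := det_one_sub_QQ (m := m) P (fun _ => 1)
    rw [Matrix.diagonal_one, one_mul] at this
    rw [this]; exact isUnit_one
  have hdw : (1 - W * Q).det = 1 := det_one_sub_QQ P _
  have huw : IsUnit (1 - W * Q).det := by rw [hdw]; exact isUnit_one
  set E := EE m P with hE
  have hE1 : (1 - Q) * E = 1 := Matrix.mul_nonsing_inv _ hu0
  have hE2 : E * (1 - Q) = 1 := Matrix.nonsing_inv_mul _ hu0
  set R := (1 - W * Q)⁻¹ with hR
  have hR1 : (1 - W * Q) * R = 1 := Matrix.mul_nonsing_inv _ huw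
  have hR2 : R * (1 - W * Q) = 1 := Matrix.nonsing_inv_mul _ huw
  set G := GG m φ P ψ with hGdef
  set Ph := PhiHat m φ
  set Ps := PsiHat m ψ
  have hdE : E.det = 1 := by
    have h := congrArg Matrix.det hE1
    have := det_one_sub_QQ (m := m) P (fun _ => 1)
    rw [Matrix.diagonal_one, one_mul] at this
    rw [Matrix.det_mul, this, Matrix.det_one, one_mul] at h
    exact h
  -- the matrix A = (1 - W Q) E
  have hA : 1 - D * (E - 1) = (1 - W * Q) * E := by
    have : (1 - W * Q) * E = W * ((1 - Q) * E) + (1 - W) * E := by noncomm_ring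
    rw [this, hE1, hWD]; noncomm_ring
  have hfac : 1 + D * KK m φ P ψ =
      (1 - W * Q) * E * (1 + ((1 - Q) * R * (D * (E * Ps) * G⁻¹)) * (Ph * E)) := by
    have h1 : (1 - W * Q) * E * ((1 - Q) * R) = 1 := by
      calc (1 - W * Q) * E * ((1 - Q) * R) = (1 - W * Q) * (E * (1 - Q)) * R := by
            simp only [Matrix.mul_assoc]
        _ = 1 := by rw [hE2, Matrix.mul_one, hR1]
    have h2 : (1 - W * Q) * E * (((1 - Q) * R * (D * (E * Ps) * G⁻¹)) * (Ph * E)) =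
        D * (E * Ps * G⁻¹ * (Ph * E)) := by
      calc _ = ((1 - W * Q) * E * ((1 - Q) * R)) * (D * (E * Ps * G⁻¹ * (Ph * E))) := by
            simp only [Matrix.mul_assoc]
        _ = _ := by rw [h1, Matrix.one_mul]
    rw [Matrix.mul_add, Matrix.mul_one, h2, ← hA]
    have : KK m φ P ψ = -(E - 1) + E * Ps * G⁻¹ * (Ph * E) := rfl
    rw [this, Matrix.mul_add, Matrix.mul_neg]
    abel
  rw [hfac, Matrix.det_mul, Matrix.det_mul, hdw, hdE, one_mul, one_mul,
    Matrix.det_one_add_mul_comm, mul_comm, ← Matrix.det_mul]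
  unfold Fgen
  congr 1
  have hGG : G = Ph * E * Ps := rfl
  have hGi : G⁻¹ * G = 1 := Matrix.nonsing_inv_mul _ hG
  have h3 : Ph * E * ((1 - Q) * R * (D * (E * Ps) * G⁻¹)) = Ph * R * D * E * Ps * G⁻¹ := by
    calc _ = Ph * (E * (1 - Q)) * R * D * E * Ps * G⁻¹ := by simp only [Matrix.mul_assoc]
      _ = _ := by rw [hE2, Matrix.mul_one]
  rw [h3, Matrix.add_mul, Matrix.one_mul, Matrix.mul_assoc _ G⁻¹ G, hGi, Matrix.mul_one]
  have h4 : G = Ph * (R * ((1 - W * Q) * E)) * Ps := by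
    rw [← Matrix.mul_assoc R, hR2, Matrix.one_mul]
    exact hGG
  have h5 : Ph * R * D * E * Ps = Ph * (R * (D * E)) * Ps := by simp only [Matrix.mul_assoc]
  rw [h5]
  nth_rewrite 1 [h4]
  rw [← Matrix.add_mul, ← Matrix.mul_add, ← Matrix.mul_add, ← hA]
  have h6 : 1 - D * (E - 1) + D * E = W := by rw [hWD]; noncomm_ring
  rw [h6]
  simp only [Matrix.mul_assoc]
  rfl

theorem det_noninj_left {α : Type*} {N : ℕ} (F : α → Fin N → ℝ) (f : Fin N → α)
    (hf : ¬ Function.Injective f) : Matrix.det (Matrix.of fun i j => F (f i) j) = 0 := by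
  simp only [Function.Injective, not_forall] at hf
  obtain ⟨a, b, hab, hne⟩ := hf
  exact Matrix.det_zero_of_row_eq hne (by ext j; simp [hab])

theorem det_noninj_right {α : Type*} {N : ℕ} (F : Fin N → α → ℝ) (f : Fin N → α)
    (hf : ¬ Function.Injective f) : Matrix.det (Matrix.of fun i j => F i (f j)) = 0 := by
  rw [← Matrix.det_transpose]
  exact det_noninj_left (fun a i => F i a) f hf

/-- Expansion of the backward determinants. -/
theorem backward_expansion (P : ℕ → Y → Y → ℝ) (ψ : Y → Fin N → ℝ)
    (hP : ∀ k, k < m → ∀ f f' : Fin N → Y, Monotone f → Monotone f' →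
      0 ≤ Matrix.det (Matrix.of fun i j => P k (f i) (f' j)))
    (hψ : ∀ f : Fin N → Y, Monotone f → 0 ≤ Matrix.det (Matrix.of fun i j => ψ (f i) j))
    (V : (Fin (m+1) × Y → ℝ) → Matrix (Fin (m+1) × Y) (Fin N) ℝ)
    (hV1 : ∀ w y j, V w (Fin.last m, y) j = w (Fin.last m, y) * ψ y j)
    (hV2 : ∀ w (k : Fin m) y j, V w (k.castSucc, y) j =
      w (k.castSucc, y) * ∑ y', P k y y' * V w (k.succ, y') j) (k : Fin (m+1)) :
    ∃ (Ω : Type) (_ : Fintype Ω) (T : (Fin N → Y) → Ω → ℝ) (S : Ω → Finset (Fin (m+1) × Y)),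
      (∀ ω p, p ∈ S ω → k < p.1) ∧
      (∀ ω f, Monotone f → 0 ≤ T f ω) ∧
      (∀ ω f (σ : Equiv.Perm (Fin N)), T (f ∘ σ) ω = (Equiv.Perm.sign σ : ℤ) * T f ω) ∧
      (∀ ω f, ¬ Function.Injective f → T f ω = 0) ∧
      ∀ w f, Matrix.det (Matrix.of fun i j => V w (k, f i) j) =
        (∏ a, w (k, f a)) * ∑ ω, T f ω * ∏ p ∈ S ω, w p := by
  induction k using Fin.reverseInduction with
  | last =>
    refine ⟨Unit, inferInstance, fun f _ => Matrix.det (Matrix.of fun i j => ψ (f i) j),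
      fun _ => ∅, by simp, fun _ f hf => hψ f hf, fun _ f σ => det_comp_perm_left ψ f σ,
      fun _ f hf => det_noninj_left ψ f hf, ?_⟩
    intro w f
    simp only [hV1, Finset.prod_empty, mul_one, Finset.univ_unique, Finset.sum_const,
      Finset.card_singleton, one_smul]
    rw [← Matrix.det_mul_column]
    rfl
  | cast k ih =>
    obtain ⟨Ω, hΩ, T, S, hS, hT0, hTs, hTi, hTe⟩ := ih
    refine ⟨(Fin N → Y) × Ω, inferInstance,
      fun f p => (Nat.factorial N : ℝ)⁻¹ *
        (Matrix.det (Matrix.of fun i j => P k (f i) (p.1 j)) * T p.1 p.2),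
      fun p => (Finset.univ.image fun a => (k.succ, p.1 a)) ∪ S p.2, ?_, ?_, ?_, ?_, ?_⟩
    · rintro ⟨f', ω⟩ p hp
      simp only [Finset.mem_union, Finset.mem_image, Finset.mem_univ, true_and] at hp
      rcases hp with ⟨a, rfl⟩ | hp
      · exact Fin.castSucc_lt_succ
      · exact Fin.castSucc_lt_succ.trans (hS ω p hp)
    · rintro ⟨f', ω⟩ f hf
      refine mul_nonneg (by positivity) ?_
      exact alt_mul_nonneg (fun f' => Matrix.det (Matrix.of fun i j => P k (f i) (f' j)))
        (fun f' => T f' ω) (fun f' σ => det_comp_perm_right (fun i y => P k (f i) y) f' σ)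
        (hTs ω) (fun f' hf' => hP k k.2 f f' hf hf') (fun f' hf' => hT0 ω f' hf') f'
    · rintro ⟨f', ω⟩ f σ
      have := det_comp_perm_left (fun y j => P k y (f' j)) f σ
      simp only [] at this ⊢
      rw [this]; ring
    · rintro ⟨f', ω⟩ f hf
      have := det_noninj_left (fun y j => P k y (f' j)) f hf
      simp only [] at this ⊢
      rw [this]; ring
    · intro w f
      have e1 : Matrix.det (Matrix.of fun i j => V w (k.castSucc, f i) j) =
          (∏ a, w (k.castSucc, f a)) *
            Matrix.det (Matrix.of fun i j => ∑ y', P k (f i) y' * V w (k.succ, y') j) := by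
        rw [← Matrix.det_mul_column]
        simp only [hV2]
        rfl
      rw [e1]
      congr 1
      have hN : (Nat.factorial N : ℝ) ≠ 0 := by positivity
      have e2 := cauchyBinet (fun i y => P k (f i) y) (fun y j => V w (k.succ, y) j)
      rw [← eq_inv_mul_iff_mul_eq₀ hN] at e2
      rw [e2, Fintype.sum_prod_type, Finset.mul_sum]
      refine Finset.sum_congr rfl fun f' _ => ?_
      rw [hTe]
      by_cases hf' : Function.Injective f'
      · rw [Finset.mul_sum, Finset.mul_sum, Finset.mul_sum]
        refine Finset.sum_congr rfl fun ω _ => ?_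
        rw [Finset.prod_union, Finset.prod_image]
        · ring
        · intro a _ b _ hab
          exact hf' (Prod.ext_iff.mp hab).2
        · rw [Finset.disjoint_left]
          intro p hp hp'
          simp only [Finset.mem_image, Finset.mem_univ, true_and] at hp
          obtain ⟨a, rfl⟩ := hp
          exact lt_irrefl _ (hS ω _ hp')
      · have := det_noninj_right (fun i y => P k (f i) y) f' hf'
        simp only [] at this ⊢
        simp [this]

theorem Fgen_expansion (φ : Fin N → Y → ℝ) (P : ℕ → Y → Y → ℝ) (ψ : Y → Fin N → ℝ)
    (hφ : ∀ f : Fin N → Y, Monotone f → 0 ≤ Matrix.det (Matrix.of fun i j => φ i (f j)))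
    (hP : ∀ k, k < m → ∀ f f' : Fin N → Y, Monotone f → Monotone f' →
      0 ≤ Matrix.det (Matrix.of fun i j => P k (f i) (f' j)))
    (hψ : ∀ f : Fin N → Y, Monotone f → 0 ≤ Matrix.det (Matrix.of fun i j => ψ (f i) j)) :
    ∃ (Ω : Type) (_ : Fintype Ω) (T : Ω → ℝ) (S : Ω → Finset (Fin (m+1) × Y)),
      (∀ ω, 0 ≤ T ω) ∧ ∀ w, Fgen φ P ψ w = ∑ ω, T ω * ∏ p ∈ S ω, w p := by
  set V : (Fin (m+1) × Y → ℝ) → Matrix (Fin (m+1) × Y) (Fin N) ℝ := fun w =>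
    (1 - Matrix.diagonal w * QQ m P)⁻¹ * (Matrix.diagonal w * PsiHat m ψ) with hVdef
  have hVeq : ∀ w, V w = Matrix.diagonal w * PsiHat m ψ + Matrix.diagonal w * (QQ m P * V w) := by
    intro w
    have hu : IsUnit (1 - Matrix.diagonal w * QQ m P).det := by
      rw [det_one_sub_QQ]; exact isUnit_one
    have : (1 - Matrix.diagonal w * QQ m P) * V w = Matrix.diagonal w * PsiHat m ψ := by
      rw [hVdef, ← Matrix.mul_assoc, Matrix.mul_nonsing_inv _ hu, Matrix.one_mul]
    rw [← this, Matrix.sub_mul, Matrix.one_mul, Matrix.mul_assoc]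
    abel
  have hV1 : ∀ w y j, V w (Fin.last m, y) j = w (Fin.last m, y) * ψ y j := by
    intro w y j
    rw [hVeq w]
    rw [Matrix.add_apply, Matrix.diagonal_mul, Matrix.diagonal_mul, Matrix.mul_apply]
    rw [Finset.sum_eq_zero]
    · simp [PsiHat]
    · rintro ⟨l, y'⟩ _
      have : ¬ (l.val = m + 1) := by omega
      simp [QQ, this]
  have hV2 : ∀ w (k : Fin m) y j, V w (k.castSucc, y) j =
      w (k.castSucc, y) * ∑ y', P k y y' * V w (k.succ, y') j := by
    intro w k y j
    conv_lhs => rw [hVeq w]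
    rw [Matrix.add_apply, Matrix.diagonal_mul, Matrix.diagonal_mul, Matrix.mul_apply]
    have h0 : (k.castSucc : Fin (m+1)) ≠ Fin.last m := (Fin.castSucc_lt_last k).ne
    simp only [PsiHat, Matrix.of_apply, h0, if_false, mul_zero, zero_add]
    rw [Fintype.sum_prod_type, Finset.sum_eq_single k.succ]
    · simp [QQ]
    · intro l _ hl
      refine Finset.sum_eq_zero fun y' _ => ?_
      have : ¬ (l.val = k.val + 1) := fun h => hl (Fin.ext (by simp [h]))
      simp [QQ, this]
    · simp
  obtain ⟨Ω, hΩ, T, S, hS, hT0, hTs, hTi, hTe⟩ := backward_expansion P ψ hP hψ V hV1 hV2 0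
  refine ⟨(Fin N → Y) × Ω, inferInstance,
      fun p => (Nat.factorial N : ℝ)⁻¹ *
        (Matrix.det (Matrix.of fun i j => φ i (p.1 j)) * T p.1 p.2),
      fun p => (Finset.univ.image fun a => (0, p.1 a)) ∪ S p.2, ?_, ?_⟩
  · rintro ⟨f', ω⟩
    refine mul_nonneg (by positivity) ?_
    exact alt_mul_nonneg (fun f' => Matrix.det (Matrix.of fun i j => φ i (f' j)))
        (fun f' => T f' ω) (fun f' σ => det_comp_perm_right φ f' σ)
        (hTs ω) hφ (fun f' hf' => hT0 ω f' hf') f'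
  · intro w
    have e0 : Fgen φ P ψ w =
        Matrix.det (Matrix.of fun i j => ∑ y', φ i y' * V w (0, y') j) := by
      unfold Fgen
      congr 1
      ext i j
      rw [Matrix.mul_apply, Fintype.sum_prod_type, Finset.sum_eq_single 0]
      · simp [PhiHat, hVdef]
      · intro l _ hl
        exact Finset.sum_eq_zero fun y' _ => by simp [PhiHat, hl]
      · simp
    have hN : (Nat.factorial N : ℝ) ≠ 0 := by positivity
    have e2 := cauchyBinet φ (fun y j => V w (0, y) j)
    rw [← eq_inv_mul_iff_mul_eq₀ hN] at e2
    rw [e0, e2, Fintype.sum_prod_type, Finset.mul_sum]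
    refine Finset.sum_congr rfl fun f' _ => ?_
    rw [hTe]
    by_cases hf' : Function.Injective f'
    · rw [Finset.mul_sum, Finset.mul_sum, Finset.mul_sum]
      refine Finset.sum_congr rfl fun ω _ => ?_
      rw [Finset.prod_union, Finset.prod_image]
      · ring
      · intro a _ b _ hab
        exact hf' (Prod.ext_iff.mp hab).2
      · rw [Finset.disjoint_left]
        intro p hp hp'
        simp only [Finset.mem_image, Finset.mem_univ, true_and] at hp
        obtain ⟨a, rfl⟩ := hp
        exact lt_irrefl _ (hS ω _ hp')
    · have := det_noninj_right φ f' hf'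
      simp only [] at this ⊢
      simp [this]

end EM

/-- Inclusion-exclusion for a determinant. -/
theorem det_incl_excl {ι : Type*} [Fintype ι] [DecidableEq ι] (K : Matrix ι ι ℝ) :
    K.det = ∑ U : Finset ι, (-1) ^ (Uᶜ.card) *
      (1 + Matrix.diagonal (fun a => if a ∈ U then (1:ℝ) else 0) * K).det := by
  have h : K = (fun i => (1 + K) i + (-(1 : Matrix ι ι ℝ)) i) := by
    ext i j; simp
  have h0 : K.det = (Matrix.detRowAlternating (R := ℝ) (n := ι)).toMultilinearMap
      ((fun i => (1 + K) i) + (fun i => (-(1 : Matrix ι ι ℝ)) i)) := by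
    conv_lhs => rw [h]
    rfl
  rw [h0, MultilinearMap.map_add_univ]
  refine Finset.sum_congr rfl fun U _ => ?_
  have e : (U.piecewise (fun i => (1 + K) i) (fun i => (-(1 : Matrix ι ι ℝ)) i)) =
      fun i => (if i ∈ U then (1:ℝ) else -1) •
        (1 + Matrix.diagonal (fun a => if a ∈ U then (1:ℝ) else 0) * K) i := by
    ext i j
    by_cases hi : i ∈ U <;> simp [hi, Finset.piecewise, Matrix.diagonal_mul]
  change (Matrix.detRowAlternating (R := ℝ) (n := ι)).toMultilinearMap
    (U.piecewise (fun i => (1 + K) i) (fun i => (-(1 : Matrix ι ι ℝ)) i)) = _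
  have := MultilinearMap.map_smul_univ
    (Matrix.detRowAlternating (R := ℝ) (n := ι)).toMultilinearMap
    (fun i => if i ∈ U then (1:ℝ) else -1)
    (fun i j => (1 + Matrix.diagonal (fun a => if a ∈ U then (1:ℝ) else 0) * K) i j)
  refine (congrArg _ e).trans (this.trans ?_)
  rw [Finset.prod_ite]
  simp only [Finset.prod_const_one, one_mul, Finset.prod_const, smul_eq_mul]
  have hc : ({x | x ∉ U} : Finset ι) = Uᶜ := by ext; simp
  rw [hc]
  rfl

theorem corr_of_gen {I Ω : Type*} [Fintype I] [DecidableEq I] [Fintype Ω] (K : Matrix I I ℝ)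
    (T : Ω → ℝ) (S : Ω → Finset I)
    (h : ∀ g : I → ℝ, (1 + Matrix.diagonal g * K).det = ∑ ω, T ω * ∏ p ∈ S ω, (1 + g p))
    {ι : Type*} [Fintype ι] [DecidableEq ι] (v : ι → I) (hv : Function.Injective v) :
    Matrix.det (Matrix.of fun a b => K (v a) (v b)) =
      ∑ ω, T ω * if (∀ a, v a ∈ S ω) then 1 else 0 := by
  classical
  rw [det_incl_excl]
  have key : ∀ U : Finset ι, (1 + Matrix.diagonal (fun a => if a ∈ U then (1:ℝ) else 0) *
      (Matrix.of fun a b => K (v a) (v b))).det =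
      ∑ ω, T ω * ∏ a ∈ U, (1 + if v a ∈ S ω then (1:ℝ) else 0) := by
    intro U
    have e1 := h (fun p => if p ∈ U.image v then (1:ℝ) else 0)
    have e2 : (1 + Matrix.diagonal (fun p => if p ∈ U.image v then (1:ℝ) else 0) * K).det =
        (1 + Matrix.diagonal (fun a => if a ∈ U then (1:ℝ) else 0) *
      (Matrix.of fun a b => K (v a) (v b))).det := by
      set L : Matrix I ι ℝ := Matrix.of fun p a => if p = v a then (if a ∈ U then (1:ℝ) else 0) else 0
      set R : Matrix ι I ℝ := Matrix.of fun a q => K (v a) q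
      have f1 : Matrix.diagonal (fun p => if p ∈ U.image v then (1:ℝ) else 0) * K = L * R := by
        ext p q
        rw [Matrix.diagonal_mul, Matrix.mul_apply]
        simp only [L, R, Matrix.of_apply]
        by_cases hp : p ∈ U.image v
        · obtain ⟨a, ha, rfl⟩ := Finset.mem_image.mp hp
          rw [Finset.sum_eq_single a]
          · simp [hp, ha]
          · intro b _ hb
            have : v a ≠ v b := fun h => hb (hv h).symm
            simp [this]
          · simp
        · simp only [hp, if_false, zero_mul]
          symm
          refine Finset.sum_eq_zero fun a _ => ?_
          by_cases hpa : p = v a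
          · have : a ∉ U := fun ha => hp (hpa ▸ Finset.mem_image_of_mem v ha)
            simp [this]
          · simp [hpa]
      rw [f1, Matrix.det_one_add_mul_comm]
      have f2 : R * L = (Matrix.of fun a b => K (v a) (v b)) *
          Matrix.diagonal (fun a => if a ∈ U then (1:ℝ) else 0) := by
        ext a b
        rw [Matrix.mul_diagonal, Matrix.mul_apply]
        simp only [L, R, Matrix.of_apply]
        rw [Finset.sum_eq_single (v b)]
        · simp
        · intro p _ hp; simp [hp]
        · simp
      rw [f2, Matrix.det_one_add_mul_comm]
    rw [← e2, e1]
    refine Finset.sum_congr rfl fun ω _ => ?_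
    congr 1
    have e3 : ∏ p ∈ S ω, (1 + if p ∈ U.image v then (1:ℝ) else 0) =
        ∏ p ∈ S ω ∩ U.image v, 2 := by
      rw [← Finset.filter_mem_eq_inter, Finset.prod_filter]
      refine Finset.prod_congr rfl fun p _ => ?_
      split_ifs <;> norm_num
    have e4 : ∏ a ∈ U, (1 + if v a ∈ S ω then (1:ℝ) else 0) = ∏ p ∈ S ω ∩ U.image v, 2 := by
      rw [Finset.inter_comm, ← Finset.filter_mem_eq_inter, Finset.prod_filter,
        Finset.prod_image (fun a _ b _ hab => hv hab)]
      refine Finset.prod_congr rfl fun p _ => ?_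
      split_ifs <;> norm_num
    rw [e3, e4]
  simp_rw [key, Finset.mul_sum]
  rw [Finset.sum_comm]
  refine Finset.sum_congr rfl fun ω _ => ?_
  have e5 : ∏ a : ι, ((1 + if v a ∈ S ω then (1:ℝ) else 0) + (-1)) =
      ∑ U : Finset ι, (∏ a ∈ U, (1 + if v a ∈ S ω then (1:ℝ) else 0)) * (-1) ^ (Uᶜ.card) := by
    rw [Finset.prod_add]
    refine Finset.sum_congr (by simp) fun U _ => ?_
    rw [Finset.prod_const, ← Finset.compl_eq_univ_sdiff]
  have e6 : ∏ a : ι, ((1 + if v a ∈ S ω then (1:ℝ) else 0) + (-1)) =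
      if (∀ a, v a ∈ S ω) then 1 else 0 := by
    have : ∀ a, ((1 + if v a ∈ S ω then (1:ℝ) else 0) + (-1)) = if v a ∈ S ω then (1:ℝ) else 0 := by
      intro a; ring
    simp_rw [this]
    rw [Finset.prod_ite_zero]
    simp
  rw [← e6, e5, Finset.mul_sum]
  refine Finset.sum_congr rfl fun U _ => ?_
  ring

/-- Finite determinantal process attached to the data. -/
theorem finite_DPP {Y : Type} [Fintype Y] [LinearOrder Y] {N m : ℕ}
    (φ : Fin N → Y → ℝ) (P : ℕ → Y → Y → ℝ) (ψ : Y → Fin N → ℝ)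
    (hφ : ∀ f : Fin N → Y, Monotone f → 0 ≤ Matrix.det (Matrix.of fun i j => φ i (f j)))
    (hP : ∀ k, k < m → ∀ f f' : Fin N → Y, Monotone f → Monotone f' →
      0 ≤ Matrix.det (Matrix.of fun i j => P k (f i) (f' j)))
    (hψ : ∀ f : Fin N → Y, Monotone f → 0 ≤ Matrix.det (Matrix.of fun i j => ψ (f i) j))
    (hG : (GG m φ P ψ).det ≠ 0) :
    ∃ (Ω : Type) (_ : Fintype Ω) (T : Ω → ℝ) (S : Ω → Finset (Fin (m+1) × Y)),
      (∀ ω, 0 ≤ T ω) ∧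
      ∀ {ι : Type} [Fintype ι] [DecidableEq ι] (v : ι → Fin (m+1) × Y), Function.Injective v →
        Matrix.det (Matrix.of fun a b => KK m φ P ψ (v a) (v b)) =
          ∑ ω, T ω * if (∀ a, v a ∈ S ω) then 1 else 0 := by
  obtain ⟨Ω, hΩ, T, S, hT, hF⟩ := Fgen_expansion (m := m) φ P ψ hφ hP hψ
  have hu : IsUnit (GG m φ P ψ).det := isUnit_iff_ne_zero.mpr hG
  have hpos : 0 < (GG m φ P ψ).det := by
    refine lt_of_le_of_ne ?_ (Ne.symm hG)
    have := det_one_add_KK φ P ψ hu (fun _ => 0)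
    rw [hF] at this
    simp only [Matrix.diagonal_zero, zero_mul, add_zero, Matrix.det_one, mul_one,
      Finset.prod_const_one] at this
    rw [this]
    exact Finset.sum_nonneg fun ω _ => hT ω
  refine ⟨Ω, hΩ, fun ω => (GG m φ P ψ).det⁻¹ * T ω, S,
    fun ω => mul_nonneg (inv_nonneg.mpr hpos.le) (hT ω), ?_⟩
  intro ι _ _ v hv
  refine corr_of_gen (KK m φ P ψ) _ S ?_ v hv
  intro g
  have := det_one_add_KK φ P ψ hu g
  rw [hF] at this
  rw [← eq_inv_mul_iff_mul_eq₀ hG] at this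
  rw [this, Finset.mul_sum]
  refine Finset.sum_congr rfl fun ω _ => ?_
  ring

end AW
namespace AW

/-! ### Determinants of kernels -/

section DetK
variable {X : Type*}

open Classical in
/-- determinant of a kernel at a finite family of points -/
def detK (K : X → X → ℝ) {ι : Type} [Fintype ι] (x : ι → X) : ℝ :=
  Matrix.det (Matrix.of fun i j => K (x i) (x j))

theorem detK_eq (K : X → X → ℝ) {ι : Type} [Fintype ι] [DecidableEq ι] (x : ι → X) :
    detK K x = Matrix.det (Matrix.of fun i j => K (x i) (x j)) := by
  unfold detK; congr!

theorem detK_equiv (K : X → X → ℝ) {ι κ : Type} [Fintype ι] [Fintype κ] (e : ι ≃ κ) (x : κ → X) :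
    detK K (fun i => x (e i)) = detK K x := by
  classical
  rw [detK_eq, detK_eq]
  exact Matrix.det_submatrix_equiv_self e (Matrix.of fun i j => K (x i) (x j))

theorem hadamard_fin (n : ℕ) (A : Matrix (Fin n) (Fin n) ℝ) (C : ℝ)
    (h : ∀ i j, |A i j| ≤ C) : |A.det| ≤ (C * Real.sqrt n) ^ n := by
  have hfact : Fact (Module.finrank ℝ (EuclideanSpace ℝ (Fin n)) = n) := ⟨by simp⟩
  let b := EuclideanSpace.basisFun (Fin n) ℝ
  let o : Orientation ℝ (EuclideanSpace ℝ (Fin n)) (Fin n) := b.toBasis.orientation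
  have h1 := o.abs_volumeForm_apply_le (fun i => WithLp.toLp 2 (A i))
  rw [o.volumeForm_robust b rfl] at h1
  have h2 : b.toBasis.det (fun i => WithLp.toLp 2 (A i)) = A.det := by
    rw [Module.Basis.det_apply, ← Matrix.det_transpose]
    congr 1
  rw [h2] at h1
  refine h1.trans ?_
  have h3 : ∀ i, ‖(WithLp.toLp 2 (A i) : EuclideanSpace ℝ (Fin n))‖ ≤ C * Real.sqrt n := by
    intro i
    have hC : 0 ≤ C := (abs_nonneg _).trans (h i i)
    rw [EuclideanSpace.norm_eq]
    have : C * Real.sqrt n = Real.sqrt (C ^ 2 * n) := by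
      rw [Real.sqrt_mul (by positivity), Real.sqrt_sq hC]
    rw [this]
    apply Real.sqrt_le_sqrt
    calc ∑ j, ‖A i j‖ ^ 2 ≤ ∑ j : Fin n, C ^ 2 := by
          apply Finset.sum_le_sum; intro j _
          rw [Real.norm_eq_abs]; exact pow_le_pow_left₀ (abs_nonneg _) (h i j) 2
      _ = C ^ 2 * n := by simp [mul_comm]
  calc ∏ i, ‖(WithLp.toLp 2 (A i) : EuclideanSpace ℝ (Fin n))‖ ≤ ∏ _i : Fin n, (C * Real.sqrt n) :=
        Finset.prod_le_prod (fun _ _ => norm_nonneg _) (fun i _ => h3 i)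
    _ = _ := by simp

/-- the bound on determinants -/
def dbd (D : ℝ) (n : ℕ) : ℝ := D ^ n * Real.sqrt (n.factorial)

theorem dbd_nonneg {D : ℝ} (hD : 0 ≤ D) (n : ℕ) : 0 ≤ dbd D n := by unfold dbd; positivity

theorem detK_le (K : X → X → ℝ) {ι : Type} [Fintype ι] (x : ι → X) (C : ℝ) (hC : 0 ≤ C)
    (h : ∀ i j, |K (x i) (x j)| ≤ C) : |detK K x| ≤ dbd (C * Real.exp 1) (Fintype.card ι) := by
  classical
  set n := Fintype.card ι with hn
  have e := Fintype.equivFin ι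
  rw [← detK_equiv K e.symm, detK_eq]
  refine (hadamard_fin _ _ C (fun i j => h _ _)).trans ?_
  unfold dbd
  rw [mul_pow, mul_pow, mul_assoc]
  refine mul_le_mul_of_nonneg_left ?_ (by positivity)
  have h1 : (n:ℝ) ^ n / n.factorial ≤ Real.exp n := Real.pow_div_factorial_le_exp n (by positivity) n
  have h2 : Real.sqrt (n:ℝ) ^ n = Real.sqrt ((n:ℝ) ^ n) := by
    rw [Real.sqrt_eq_rpow, Real.sqrt_eq_rpow, ← Real.rpow_natCast, ← Real.rpow_natCast,
      ← Real.rpow_mul (by positivity), ← Real.rpow_mul (by positivity), mul_comm]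
  rw [h2]
  have hf : (0:ℝ) < n.factorial := by positivity
  have h3 : (n:ℝ) ^ n ≤ (Real.exp 1 ^ n) ^ 2 * n.factorial := by
    rw [div_le_iff₀ hf] at h1
    refine h1.trans ?_
    refine mul_le_mul_of_nonneg_right ?_ hf.le
    rw [← Real.exp_nat_mul, mul_one]
    have : (1:ℝ) ≤ Real.exp n := Real.one_le_exp (by positivity)
    nlinarith
  calc Real.sqrt ((n:ℝ) ^ n) ≤ Real.sqrt ((Real.exp 1 ^ n) ^ 2 * n.factorial) := Real.sqrt_le_sqrt h3
    _ = _ := by rw [Real.sqrt_mul (by positivity), Real.sqrt_sq (by positivity)]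

theorem dbd_add (D : ℝ) (hD : 0 ≤ D) (n l : ℕ) :
    dbd D (n + l) ≤ dbd (2 * D) n * dbd (2 * D) l := by
  unfold dbd
  have h1 : ((n + l).factorial : ℝ) ≤ 2 ^ (n + l) * (n.factorial * l.factorial) := by
    have h := Nat.add_choose_mul_factorial_mul_factorial n l
    have h2 : (n + l).choose l ≤ 2 ^ (n + l) := Nat.choose_le_two_pow _ _
    have : (n+l).factorial ≤ 2 ^ (n+l) * (n.factorial * l.factorial) := by
      rw [← h, mul_assoc]; exact Nat.mul_le_mul_right _ h2
    exact_mod_cast this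
  have h2 : Real.sqrt ((n + l).factorial : ℝ) ≤
      2 ^ (n + l) * (Real.sqrt n.factorial * Real.sqrt l.factorial) := by
    have h3 : ((n + l).factorial : ℝ) ≤ (2 ^ (n + l)) ^ 2 * (n.factorial * l.factorial) := by
      refine h1.trans (mul_le_mul_of_nonneg_right ?_ (by positivity))
      have : (1:ℝ) ≤ 2 ^ (n + l) := one_le_pow₀ (by norm_num)
      nlinarith
    refine (Real.sqrt_le_sqrt h3).trans ?_
    rw [Real.sqrt_mul (by positivity), Real.sqrt_sq (by positivity), Real.sqrt_mul (by positivity)]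
  calc D ^ (n + l) * Real.sqrt ((n + l).factorial : ℝ)
      ≤ D ^ (n + l) * (2 ^ (n + l) * (Real.sqrt n.factorial * Real.sqrt l.factorial)) :=
        mul_le_mul_of_nonneg_left h2 (by positivity)
    _ = _ := by rw [mul_pow, mul_pow, pow_add, pow_add]; ring

theorem dbd_summable (D : ℝ) (hD : 0 ≤ D) :
    Summable fun n : ℕ => (n.factorial : ℝ)⁻¹ * dbd D n := by
  have hs : Summable fun n : ℕ => (1 / 2 : ℝ) ^ n := summable_geometric_two
  have hs2 : Summable fun n : ℕ => (4 * D ^ 2) ^ n / (n.factorial : ℝ) :=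
    Real.summable_pow_div_factorial _
  have h3 : Summable fun n : ℕ => (1 / 4 : ℝ) ^ n :=
    summable_geometric_of_lt_one (by norm_num) (by norm_num)
  refine Summable.of_nonneg_of_le (fun n => mul_nonneg (by positivity) (dbd_nonneg hD n)) ?_
    (hs2.add h3)
  intro n
  unfold dbd
  set s := Real.sqrt (n.factorial : ℝ) with hs'
  have hf : (0:ℝ) < n.factorial := by positivity
  have hs0 : 0 < s := Real.sqrt_pos.mpr hf
  have hss : (n.factorial : ℝ) = s ^ 2 := (Real.sq_sqrt hf.le).symm
  rw [hss]
  have e : (4 * D ^ 2) ^ n = ((2:ℝ) ^ n * D ^ n) ^ 2 := by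
    rw [← mul_pow, ← pow_mul, mul_comm n 2, pow_mul]; congr 1; ring
  have e2 : (1 / 4 : ℝ) ^ n = (1 / 2 ^ n) ^ 2 := by
    rw [← one_div_pow, ← pow_mul, mul_comm n 2, pow_mul]; norm_num
  rw [e, e2]
  have e3 : (s ^ 2)⁻¹ * (D ^ n * s) = ((2 ^ n * D ^ n) / s) * (1 / 2 ^ n) := by
    field_simp
  rw [e3, ← div_pow]
  nlinarith [sq_nonneg ((2 ^ n * D ^ n) / s - 1 / 2 ^ n), sq_nonneg ((2 ^ n * D ^ n) / s + 1 / 2 ^ n)]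

end DetK

end AW
namespace AW

section Jan
variable {X : Type*} [MeasurableSpace X]

theorem pi_reindex_mp (μ : Measure X) [SigmaFinite μ] {ι κ : Type} [Fintype ι] [Fintype κ]
    (e : ι ≃ κ) : MeasurePreserving (fun (x : ι → X) (k : κ) => x (e.symm k))
      (Measure.pi fun _ => μ) (Measure.pi fun _ => μ) := by
  have h := measurePreserving_piCongrLeft (α := fun _ : κ => X) (fun _ => μ) e
  have e1 : (MeasurableEquiv.piCongrLeft (fun _ : κ => X) e : (ι → X) → (κ → X)) =
      fun (x : ι → X) (k : κ) => x (e.symm k) := by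
    funext x k
    have := Equiv.piCongrLeft_apply (fun _ : κ => X) e x k
    rw [MeasurableEquiv.coe_piCongrLeft]
    simpa using this
  rw [← e1]; exact h

theorem pi_reindex_emb {ι κ : Type} (e : ι ≃ κ) :
    MeasurableEmbedding (fun (x : ι → X) (k : κ) => x (e.symm k)) := by
  have e1 : (MeasurableEquiv.piCongrLeft (fun _ : κ => X) e : (ι → X) → (κ → X)) =
      fun (x : ι → X) (k : κ) => x (e.symm k) := by
    funext x k
    have := Equiv.piCongrLeft_apply (fun _ : κ => X) e x k
    rw [MeasurableEquiv.coe_piCongrLeft]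
    simpa using this
  rw [← e1]; exact MeasurableEquiv.measurableEmbedding _

theorem pi_sum_mp (μ : Measure X) [SigmaFinite μ] (ι κ : Type) [Fintype ι] [Fintype κ] :
    MeasurePreserving (fun p : (ι → X) × (κ → X) => (Sum.elim p.1 p.2 : ι ⊕ κ → X))
      ((Measure.pi fun _ => μ).prod (Measure.pi fun _ => μ)) (Measure.pi fun _ => μ) := by
  have h := measurePreserving_sumPiEquivProdPi_symm (ι := ι) (ι' := κ) (X := fun _ => X)
    (fun _ => μ)
  have e1 : ((MeasurableEquiv.sumPiEquivProdPi (fun _ : ι ⊕ κ => X)).symm :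
      (ι → X) × (κ → X) → (ι ⊕ κ → X)) = fun p => Sum.elim p.1 p.2 := by
    funext p k; rcases k with k | k <;> rfl
  rw [← e1]; exact h

theorem pi_sum_emb (ι κ : Type) :
    MeasurableEmbedding (fun p : (ι → X) × (κ → X) => (Sum.elim p.1 p.2 : ι ⊕ κ → X)) := by
  have e1 : ((MeasurableEquiv.sumPiEquivProdPi (fun _ : ι ⊕ κ => X)).symm :
      (ι → X) × (κ → X) → (ι ⊕ κ → X)) = fun p => Sum.elim p.1 p.2 := by
    funext p k; rcases k with k | k <;> rfl
  rw [← e1]; exact MeasurableEquiv.measurableEmbedding _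

theorem tsum_antidiag (f : ℕ × ℕ → ℝ) (hf : Summable f) :
    ∑' N, ∑ p ∈ Finset.HasAntidiagonal.antidiagonal N, f p = ∑' p, f p := by
  rw [← Finset.HasAntidiagonal.sigmaAntidiagonalEquivProd.tsum_eq f,
    Summable.tsum_sigma' (fun _ => (hasSum_fintype _).summable)]
  · congr 1; funext N
    rw [tsum_fintype]
    exact (Finset.sum_coe_sort _ f).symm
  · exact (Finset.HasAntidiagonal.sigmaAntidiagonalEquivProd.summable_iff).mpr hf

theorem measurable_detK (K : X → X → ℝ) (hK : Measurable (Function.uncurry K)) {ι : Type}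
    [Fintype ι] : Measurable fun x : ι → X => detK K x := by
  classical
  simp_rw [detK_eq, Matrix.det_apply']
  refine Finset.measurable_sum _ fun σ _ => ?_
  refine Measurable.const_mul (Finset.measurable_prod _ fun i _ => ?_) _
  have h : Measurable fun x : ι → X => (x (σ i), x i) := by fun_prop
  exact hK.comp h

/-- The hypotheses for the kernel on a window. -/
structure WK (μ : Measure X) (Λ : Set X) (K : X → X → ℝ) (C : ℝ) : Prop where
  mL : MeasurableSet Λ
  fin : μ Λ ≠ ⊤
  mK : Measurable (Function.uncurry K)
  C0 : 0 ≤ C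
  bd : ∀ x ∈ Λ, ∀ y ∈ Λ, |K x y| ≤ C

/-- weights supported on the window -/
structure WG (Λ : Set X) (g : X → ℝ) : Prop where
  mg : Measurable g
  bd : ∀ x, |g x| ≤ Λ.indicator (fun _ => (1:ℝ)) x

variable {μ : Measure X} [SigmaFinite μ] {Λ : Set X} {K : X → X → ℝ} {C : ℝ}

theorem weight_bound {ι κ : Type} [Fintype ι] [Fintype κ] (h : WK μ Λ K C) (c : ι → X → ℝ)
    (hc : ∀ i, WG Λ (c i)) (x : κ → X) (hx : ∀ k, x k ∈ Λ) (v : ι → X) :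
    |(∏ i, c i (v i)) * detK K (Sum.elim x v)| ≤
      dbd (C * Real.exp 1) (Fintype.card κ + Fintype.card ι) *
        ∏ i, Λ.indicator (fun _ => (1:ℝ)) (v i) := by
  by_cases hv : ∀ i, v i ∈ Λ
  · rw [abs_mul, mul_comm, Finset.abs_prod]
    refine mul_le_mul ?_ ?_ (by positivity) (dbd_nonneg (mul_nonneg h.C0 (Real.exp_pos 1).le) _)
    · have := detK_le K (Sum.elim x v) C h.C0 (by
        rintro (i | i) (j | j) <;> simp only [Sum.elim_inl, Sum.elim_inr] <;> apply h.bd <;>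
        first | exact hx _ | exact hv _)
      simpa using this
    · exact Finset.prod_le_prod (fun _ _ => abs_nonneg _) (fun i _ => (hc i).bd _)
  · push Not at hv
    obtain ⟨i, hi⟩ := hv
    have h0 : c i (v i) = 0 := by
      have := (hc i).bd (v i)
      rw [Set.indicator_of_notMem hi] at this
      exact abs_nonpos_iff.mp this
    rw [Finset.prod_eq_zero (Finset.mem_univ i) h0, zero_mul, abs_zero]
    refine mul_nonneg (dbd_nonneg (mul_nonneg h.C0 (Real.exp_pos 1).le) _) ?_
    exact Finset.prod_nonneg fun i _ => Set.indicator_nonneg (fun _ _ => zero_le_one) _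

theorem ind_integrable (h : WK μ Λ K C) (ι : Type) [Fintype ι] :
    Integrable (fun v : ι → X => ∏ i, Λ.indicator (fun _ => (1:ℝ)) (v i))
      (Measure.pi fun _ => μ) := by
  apply MeasureTheory.Integrable.fintype_prod (f := fun _ : ι => Λ.indicator (fun _ => (1:ℝ)))
  intro i
  exact (integrable_indicator_iff h.mL).mpr (integrableOn_const h.fin)

theorem ind_integral (h : WK μ Λ K C) (ι : Type) [Fintype ι] :
    ∫ v : ι → X, ∏ i, Λ.indicator (fun _ => (1:ℝ)) (v i) ∂(Measure.pi fun _ => μ) =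
      (μ.real Λ) ^ (Fintype.card ι) := by
  rw [MeasureTheory.integral_fintype_prod_eq_pow (𝕜 := ℝ) (Λ.indicator (fun _ => (1:ℝ))),
    MeasureTheory.integral_indicator h.mL]
  simp

theorem weight_meas {ι κ : Type} [Fintype ι] [Fintype κ] (h : WK μ Λ K C) (c : ι → X → ℝ)
    (hc : ∀ i, WG Λ (c i)) :
    Measurable fun p : (κ → X) × (ι → X) => (∏ i, c i (p.2 i)) * detK K (Sum.elim p.1 p.2) := by
  refine Measurable.mul (Finset.measurable_prod _ fun i _ =>
    (hc i).mg.comp ((measurable_pi_apply i).comp measurable_snd)) ?_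
  exact (measurable_detK K h.mK).comp (pi_sum_emb κ ι).measurable

theorem weight_integrable {ι κ : Type} [Fintype ι] [Fintype κ] (h : WK μ Λ K C) (c : ι → X → ℝ)
    (hc : ∀ i, WG Λ (c i)) (x : κ → X) (hx : ∀ k, x k ∈ Λ) :
    Integrable (fun v : ι → X => (∏ i, c i (v i)) * detK K (Sum.elim x v))
      (Measure.pi fun _ => μ) := by
  refine Integrable.mono' ((ind_integrable h ι).const_mul
    (dbd (C * Real.exp 1) (Fintype.card κ + Fintype.card ι))) ?_ ?_
  · exact ((weight_meas h c hc).comp measurable_prodMk_left).aestronglyMeasurable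
  · exact Eventually.of_forall fun v => weight_bound h c hc x hx v

theorem weight_integral_bound {ι κ : Type} [Fintype ι] [Fintype κ] (h : WK μ Λ K C)
    (c : ι → X → ℝ) (hc : ∀ i, WG Λ (c i)) (x : κ → X) (hx : ∀ k, x k ∈ Λ) :
    |∫ v : ι → X, (∏ i, c i (v i)) * detK K (Sum.elim x v) ∂(Measure.pi fun _ => μ)| ≤
      dbd (C * Real.exp 1) (Fintype.card κ + Fintype.card ι) * (μ.real Λ) ^ (Fintype.card ι) := by
  rw [← ind_integral h, ← MeasureTheory.integral_const_mul]
  rw [← Real.norm_eq_abs]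
  refine MeasureTheory.norm_integral_le_of_norm_le
    ((ind_integrable h ι).const_mul _) ?_
  exact Eventually.of_forall fun v => weight_bound h c hc x hx v

/-- The Janossy-type series. -/
def Jan (K : X → X → ℝ) (μ : Measure X) (g : X → ℝ) {κ : Type} [Fintype κ] (x : κ → X) : ℝ :=
  ∑' l : ℕ, (l.factorial : ℝ)⁻¹ *
    ∫ v : Fin l → X, (∏ i, g (v i)) * detK K (Sum.elim x v) ∂(Measure.pi fun _ => μ)

theorem Jan_equiv (K : X → X → ℝ) (μ : Measure X) (g : X → ℝ) {κ κ' : Type} [Fintype κ]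
    [Fintype κ'] (e : κ ≃ κ') (x : κ' → X) : Jan K μ g (fun i => x (e i)) = Jan K μ g x := by
  unfold Jan
  congr! 6 with l v
  rw [← detK_equiv K (e.sumCongr (Equiv.refl (Fin l)))]
  congr 1; funext i; rcases i with i | i <;> rfl

theorem Jan_zero (K : X → X → ℝ) {κ : Type} [Fintype κ] (x : κ → X) :
    Jan K μ (fun _ => 0) x = detK K x := by
  unfold Jan
  rw [tsum_eq_single 0]
  · simp only [Nat.factorial_zero, Nat.cast_one, inv_one, one_mul, Finset.univ_eq_empty,
      Finset.prod_empty]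
    have : ∀ v : Fin 0 → X, detK K (Sum.elim x v) = detK K x := by
      intro v
      rw [← detK_equiv K (Equiv.sumEmpty κ (Fin 0)).symm]
      rfl
    simp [this, Measure.real]
  · intro l hl
    obtain ⟨l, rfl⟩ := Nat.exists_eq_succ_of_ne_zero hl
    simp

theorem jterm_summable (h : WK μ Λ K C) {κ : Type} [Fintype κ] (x : κ → X)
    (hx : ∀ k, x k ∈ Λ) (n : ℕ) : Summable fun l : ℕ => (l.factorial : ℝ)⁻¹ *
      (dbd (C * Real.exp 1) (n + l) * (μ.real Λ) ^ l) := by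
  have hD : 0 ≤ C * Real.exp 1 := mul_nonneg h.C0 (Real.exp_pos 1).le
  set D := C * Real.exp 1
  have hV : 0 ≤ μ.real Λ := measureReal_nonneg
  refine Summable.of_nonneg_of_le (fun l => ?_) (fun l => ?_)
    ((dbd_summable (2 * D * μ.real Λ) (by positivity)).mul_left (dbd (2 * D) n))
  · have := dbd_nonneg hD (n + l); positivity
  · have h1 := dbd_add D hD n l
    calc (l.factorial : ℝ)⁻¹ * (dbd D (n + l) * (μ.real Λ) ^ l)
        ≤ (l.factorial : ℝ)⁻¹ * ((dbd (2 * D) n * dbd (2 * D) l) * (μ.real Λ) ^ l) := by gcongr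
      _ = dbd (2 * D) n * ((l.factorial : ℝ)⁻¹ * dbd (2 * D * μ.real Λ) l) := by
        unfold dbd; rw [mul_pow (2 * D) (μ.real Λ)]; ring

theorem Jan_bound (h : WK μ Λ K C) {g : X → ℝ} (hg : WG Λ g) {κ : Type} [Fintype κ] (x : κ → X)
    (hx : ∀ k, x k ∈ Λ) : (Summable fun l : ℕ => (l.factorial : ℝ)⁻¹ *
    ∫ v : Fin l → X, (∏ i, g (v i)) * detK K (Sum.elim x v) ∂(Measure.pi fun _ => μ)) := by
  refine Summable.of_norm_bounded (jterm_summable h x hx (Fintype.card κ)) fun l => ?_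
  rw [norm_mul, Real.norm_of_nonneg (by positivity)]
  refine mul_le_mul_of_nonneg_left ?_ (by positivity)
  simpa using weight_integral_bound h (fun _ : Fin l => g) (fun _ => hg) x hx

theorem WG.le_one {g : X → ℝ} (hg : WG Λ g) (x : X) : |g x| ≤ 1 := by
  refine (hg.bd x).trans ?_
  by_cases hx : x ∈ Λ <;> simp [hx]

/-- the mixed terms -/
def mixT (K : X → X → ℝ) (μ : Measure X) (a g : X → ℝ) {κ : Type} [Fintype κ] (x : κ → X)
    (n l : ℕ) : ℝ :=
  ∫ w : Fin n ⊕ Fin l → X, (∏ i, Sum.elim (fun _ : Fin n => a) (fun _ : Fin l => g) i (w i)) *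
    detK K (Sum.elim x w) ∂(Measure.pi fun _ => μ)

theorem split_term (h : WK μ Λ K C) {a g : X → ℝ} (ha : WG Λ a) (hg : WG Λ g)
    {κ : Type} [Fintype κ] (x : κ → X) (hx : ∀ k, x k ∈ Λ) (N : ℕ) :
    ∫ v : Fin N → X, (∏ i, (a (v i) + g (v i))) * detK K (Sum.elim x v) ∂(Measure.pi fun _ => μ) =
      ∑ p ∈ Finset.HasAntidiagonal.antidiagonal N, (N.choose p.1 : ℝ) * mixT K μ a g x p.1 p.2 := by
  classical
  have key : ∀ A : Finset (Fin N),
      ∫ v : Fin N → X, (∏ i, (if i ∈ A then a else g) (v i)) * detK K (Sum.elim x v)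
        ∂(Measure.pi fun _ => μ) = mixT K μ a g x A.card (N - A.card) := by
    intro A
    have hc : Aᶜ.card = N - A.card := by rw [Finset.card_compl, Fintype.card_fin]
    let e := finSumEquivOfFinset (m := A.card) (n := N - A.card) rfl hc
    unfold mixT
    rw [← (pi_reindex_mp μ e).integral_comp (pi_reindex_emb e)]
    refine MeasureTheory.integral_congr_ae (Eventually.of_forall fun w => ?_)
    simp only []
    congr 1
    · rw [← e.prod_comp]
      refine Finset.prod_congr rfl fun i _ => ?_
      rw [e.symm_apply_apply]
      rcases i with i | i
      · have : e (Sum.inl i) ∈ A := by simp [e]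
        simp [this]
      · have : e (Sum.inr i) ∉ A := by
          have : e (Sum.inr i) ∈ Aᶜ := by simp [e, -Finset.mem_compl]
          simpa using this
        simp [this]
    · rw [← detK_equiv K ((Equiv.refl κ).sumCongr e)]
      congr 1; funext i; rcases i with i | i <;> simp
  have h1 : ∀ v : Fin N → X, (∏ i, (a (v i) + g (v i))) * detK K (Sum.elim x v) =
      ∑ A ∈ (Finset.univ : Finset (Fin N)).powerset,
        (∏ i, (if i ∈ A then a else g) (v i)) * detK K (Sum.elim x v) := by
    intro v
    rw [Finset.prod_add, Finset.sum_mul]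
    refine Finset.sum_congr rfl fun A _ => ?_
    congr 1
    rw [← Finset.prod_mul_prod_compl A, ← Finset.compl_eq_univ_sdiff]
    congr 1
    · exact Finset.prod_congr rfl fun i hi => by simp [hi]
    · exact Finset.prod_congr rfl fun i hi => by
        rw [if_neg (Finset.mem_compl.mp hi)]
  simp_rw [h1]
  rw [MeasureTheory.integral_finsetSum]
  · simp_rw [key]
    rw [Finset.sum_powerset_apply_card (fun n => mixT K μ a g x n (N - n)),
      Finset.Nat.sum_antidiagonal_eq_sum_range_succ_mk]
    simp
  · intro A _
    exact weight_integrable h (fun i => if i ∈ A then a else g)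
      (fun i => by split_ifs <;> assumption) x hx

theorem mixT_eq (h : WK μ Λ K C) {a g : X → ℝ} (ha : WG Λ a) (hg : WG Λ g)
    {κ : Type} [Fintype κ] (x : κ → X) (hx : ∀ k, x k ∈ Λ) (n l : ℕ) :
    mixT K μ a g x n l = ∫ u : Fin n → X, (∏ i, a (u i)) *
      ∫ v : Fin l → X, (∏ i, g (v i)) * detK K (Sum.elim (Sum.elim x u) v)
        ∂(Measure.pi fun _ => μ) ∂(Measure.pi fun _ => μ) := by
  unfold mixT
  have hc : ∀ i, WG Λ (Sum.elim (fun _ : Fin n => a) (fun _ : Fin l => g) i) := by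
    rintro (i | i) <;> assumption
  have hInt := weight_integrable h _ hc x hx
  rw [← (pi_sum_mp μ (Fin n) (Fin l)).integral_comp (pi_sum_emb _ _)]
  rw [MeasureTheory.integral_prod]
  · refine MeasureTheory.integral_congr_ae (Eventually.of_forall fun u => ?_)
    simp only []
    rw [← MeasureTheory.integral_const_mul]
    refine MeasureTheory.integral_congr_ae (Eventually.of_forall fun v => ?_)
    simp only [Fintype.prod_sum_type, Sum.elim_inl, Sum.elim_inr]
    rw [mul_assoc, ← detK_equiv K (Equiv.sumAssoc κ (Fin n) (Fin l))]
    congr 3; funext i; rcases i with (i | i) | i <;> rfl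
  · exact ((pi_sum_mp μ (Fin n) (Fin l)).integrable_comp_emb (pi_sum_emb _ _)).mpr hInt

theorem mixT_summable (h : WK μ Λ K C) {a g : X → ℝ} (ha : WG Λ a) (hg : WG Λ g)
    {κ : Type} [Fintype κ] (x : κ → X) (hx : ∀ k, x k ∈ Λ) :
    Summable fun p : ℕ × ℕ => (p.1.factorial : ℝ)⁻¹ * (p.2.factorial : ℝ)⁻¹ *
      mixT K μ a g x p.1 p.2 := by
  have hD : 0 ≤ C * Real.exp 1 := mul_nonneg h.C0 (Real.exp_pos 1).le
  set D := C * Real.exp 1 with hDdef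
  have hV : 0 ≤ μ.real Λ := measureReal_nonneg
  have hs := dbd_summable (2 * (2 * D) * μ.real Λ) (by positivity)
  have hs2 := (hs.mul_of_nonneg hs (fun n => mul_nonneg (by positivity)
    (dbd_nonneg (by positivity) n)) (fun n => mul_nonneg (by positivity)
    (dbd_nonneg (by positivity) n))).mul_left (dbd (2 * D) (Fintype.card κ))
  refine Summable.of_norm_bounded hs2 ?_
  rintro ⟨n, l⟩
  have hc : ∀ i, WG Λ (Sum.elim (fun _ : Fin n => a) (fun _ : Fin l => g) i) := by
    rintro (i | i) <;> assumption
  have hb := weight_integral_bound h _ hc x hx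
  rw [← hDdef] at hb
  simp only [Fintype.card_sum, Fintype.card_fin] at hb
  rw [norm_mul, Real.norm_of_nonneg (by positivity)]
  have h1 := dbd_add D hD (Fintype.card κ) (n + l)
  have h2 := dbd_add (2 * D) (by positivity) n l
  have h0 := dbd_nonneg (D := 2 * D) (by positivity) (Fintype.card κ)
  calc _ ≤ (n.factorial : ℝ)⁻¹ * (l.factorial : ℝ)⁻¹ *
        (dbd (2 * D) (Fintype.card κ) * (dbd (2 * (2 * D)) n * dbd (2 * (2 * D)) l) *
          (μ.real Λ) ^ (n + l)) := by
        refine mul_le_mul_of_nonneg_left (hb.trans ?_) (by positivity)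
        refine mul_le_mul_of_nonneg_right (h1.trans ?_) (by positivity)
        exact mul_le_mul_of_nonneg_left h2 h0
    _ = _ := by
      unfold dbd; rw [mul_pow (2 * (2 * D)) (μ.real Λ) n, mul_pow (2 * (2 * D)) (μ.real Λ) l, pow_add]
      ring

/-- integrability and exchange -/
theorem Jan_int (h : WK μ Λ K C) {a g : X → ℝ} (ha : WG Λ a) (hg : WG Λ g)
    {κ : Type} [Fintype κ] (x : κ → X) (hx : ∀ k, x k ∈ Λ) (n : ℕ) :
    Integrable (fun u : Fin n → X => (∏ i, a (u i)) * Jan K μ g (Sum.elim x u))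
      (Measure.pi fun _ => μ) ∧
    ∫ u : Fin n → X, (∏ i, a (u i)) * Jan K μ g (Sum.elim x u) ∂(Measure.pi fun _ => μ) =
      ∑' l : ℕ, (l.factorial : ℝ)⁻¹ * mixT K μ a g x n l := by
  set F : ℕ → (Fin n → X) → ℝ := fun l u => (l.factorial : ℝ)⁻¹ * ((∏ i, a (u i)) *
      ∫ v : Fin l → X, (∏ i, g (v i)) * detK K (Sum.elim (Sum.elim x u) v)
        ∂(Measure.pi fun _ => μ)) with hF
  have hFm : ∀ l, AEStronglyMeasurable (F l) (Measure.pi fun _ => μ) := by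
    intro l
    refine (AEStronglyMeasurable.const_mul ?_ _)
    refine AEStronglyMeasurable.mul ?_ ?_
    · exact (Finset.measurable_prod _ fun i _ =>
        ha.mg.comp (measurable_pi_apply i)).aestronglyMeasurable
    · have hm : Measurable fun p : (Fin n → X) × (Fin l → X) =>
          (∏ i, g (p.2 i)) * detK K (Sum.elim (Sum.elim x p.1) p.2) := by
        have h0 := weight_meas (κ := κ ⊕ Fin n) h (fun _ : Fin l => g) (fun _ => hg)
        have h1 : Measurable fun p : (Fin n → X) × (Fin l → X) =>
            ((Sum.elim x p.1 : κ ⊕ Fin n → X), p.2) := by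
          refine Measurable.prodMk ?_ measurable_snd
          exact ((pi_sum_emb κ (Fin n)).measurable.comp measurable_prodMk_left).comp measurable_fst
        exact h0.comp h1
      exact (hm.stronglyMeasurable.integral_prod_right).aestronglyMeasurable
  have hFb : ∀ l u, ‖F l u‖ ≤ ((l.factorial : ℝ)⁻¹ *
      (dbd (C * Real.exp 1) ((Fintype.card κ + n) + l) * (μ.real Λ) ^ l)) *
      ∏ i, Λ.indicator (fun _ => (1:ℝ)) (u i) := by
    intro l u
    have hrhs0 : 0 ≤ (l.factorial : ℝ)⁻¹ *
      (dbd (C * Real.exp 1) ((Fintype.card κ + n) + l) * (μ.real Λ) ^ l) := by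
      have := dbd_nonneg (mul_nonneg h.C0 (Real.exp_pos 1).le) ((Fintype.card κ + n) + l)
      have : 0 ≤ μ.real Λ := measureReal_nonneg
      positivity
    by_cases hu : ∀ i, u i ∈ Λ
    · have hb := weight_integral_bound h (fun _ : Fin l => g) (fun _ => hg) (Sum.elim x u)
        (by rintro (i | i); exacts [hx i, hu i])
      simp only [Fintype.card_sum, Fintype.card_fin] at hb
      have h1 : ∏ i, Λ.indicator (fun _ => (1:ℝ)) (u i) = 1 :=
        Finset.prod_eq_one fun i _ => by simp [hu i]
      rw [h1, mul_one, hF]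
      simp only [norm_mul]
      rw [Real.norm_of_nonneg (by positivity)]
      refine mul_le_mul_of_nonneg_left ?_ (by positivity)
      refine le_trans (mul_le_of_le_one_left (norm_nonneg _) ?_) hb
      rw [Real.norm_eq_abs, Finset.abs_prod]
      exact Finset.prod_le_one (fun _ _ => abs_nonneg _) (fun i _ => ha.le_one _)
    · push Not at hu
      obtain ⟨i, hi⟩ := hu
      have h0 : a (u i) = 0 := by
        have := ha.bd (u i)
        rw [Set.indicator_of_notMem hi] at this
        exact abs_nonpos_iff.mp this
      rw [hF]
      simp only []
      rw [Finset.prod_eq_zero (Finset.mem_univ i) h0, zero_mul, mul_zero, norm_zero]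
      exact mul_nonneg hrhs0
        (Finset.prod_nonneg fun i _ => Set.indicator_nonneg (fun _ _ => zero_le_one) _)
  have hFi : ∀ l, Integrable (F l) (Measure.pi fun _ => μ) := fun l =>
    Integrable.mono' ((ind_integrable h (Fin n)).const_mul _) (hFm l)
      (Eventually.of_forall (hFb l))
  have hsum : Summable fun l => ∫ u, ‖F l u‖ ∂(Measure.pi fun _ => μ) := by
    refine Summable.of_nonneg_of_le (fun l => MeasureTheory.integral_nonneg fun _ => norm_nonneg _)
      (fun l => MeasureTheory.integral_mono (hFi l).norm
        ((ind_integrable h (Fin n)).const_mul _) (hFb l)) ?_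
    simp_rw [MeasureTheory.integral_const_mul]
    exact (jterm_summable h x hx (Fintype.card κ + n)).mul_right _
  have hJ : ∀ u : Fin n → X, (∏ i, a (u i)) * Jan K μ g (Sum.elim x u) = ∑' l, F l u := by
    intro u
    unfold Jan
    rw [← tsum_mul_left]
    refine tsum_congr fun l => ?_
    rw [hF]; ring
  simp_rw [hJ]
  constructor
  · refine ⟨?_, ?_⟩
    · have : ∀ᵐ u ∂(Measure.pi fun _ : Fin n => μ), HasSum (fun l => F l u) (∑' l, F l u) := by
        refine Eventually.of_forall fun u => (Summable.of_norm_bounded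
          ((jterm_summable h x hx (Fintype.card κ + n)).mul_right _) fun l => hFb l u).hasSum
      exact aestronglyMeasurable_of_tendsto_ae atTop
        (f := fun (s : Finset ℕ) u => ∑ l ∈ s, F l u)
        (fun s => Finset.aestronglyMeasurable_fun_sum s fun l _ => hFm l) this
    · have hb2 : Integrable (fun u : Fin n → X => (∑' l : ℕ, ((l.factorial : ℝ)⁻¹ *
          (dbd (C * Real.exp 1) ((Fintype.card κ + n) + l) * (μ.real Λ) ^ l))) *
          ∏ i, Λ.indicator (fun _ => (1:ℝ)) (u i)) (Measure.pi fun _ => μ) :=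
        (ind_integrable h (Fin n)).const_mul _
      refine hb2.hasFiniteIntegral.mono' (Eventually.of_forall fun u => ?_)
      rw [← tsum_mul_right]
      exact tsum_of_norm_bounded
        ((jterm_summable h x hx (Fintype.card κ + n)).mul_right _).hasSum fun l => hFb l u
  · rw [← MeasureTheory.integral_tsum_of_summable_integral_norm hFi hsum]
    refine tsum_congr fun l => ?_
    rw [hF, mixT_eq h ha hg x hx]
    simp only [MeasureTheory.integral_const_mul]

theorem Jan_consistency (h : WK μ Λ K C) {a g : X → ℝ} (ha : WG Λ a) (hg : WG Λ g)
    (hag : WG Λ (fun y => a y + g y))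
    {κ : Type} [Fintype κ] (x : κ → X) (hx : ∀ k, x k ∈ Λ) :
    HasSum (fun n : ℕ => (n.factorial : ℝ)⁻¹ * ∫ u : Fin n → X,
      (∏ i, a (u i)) * Jan K μ g (Sum.elim x u) ∂(Measure.pi fun _ => μ))
      (Jan K μ (fun y => a y + g y) x) := by
  have hs := mixT_summable h ha hg x hx
  have e1 : Jan K μ (fun y => a y + g y) x = ∑' p : ℕ × ℕ,
      (p.1.factorial : ℝ)⁻¹ * (p.2.factorial : ℝ)⁻¹ * mixT K μ a g x p.1 p.2 := by
    rw [← tsum_antidiag _ hs]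
    unfold Jan
    refine tsum_congr fun N => ?_
    rw [split_term h ha hg x hx, Finset.mul_sum]
    refine Finset.sum_congr rfl fun p hp => ?_
    rw [Finset.HasAntidiagonal.mem_antidiagonal] at hp
    have hf : ((p.1 + p.2).choose p.1 : ℝ) * p.1.factorial * p.2.factorial =
        (p.1 + p.2).factorial := by
      rw [Nat.choose_symm_add]
      exact_mod_cast Nat.add_choose_mul_factorial_mul_factorial p.1 p.2
    rw [← hp, ← hf]
    have h1 : ((p.1 + p.2).choose p.1 : ℝ) ≠ 0 := by
      exact_mod_cast (Nat.choose_pos (Nat.le_add_right _ _)).ne'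
    have h2 : (p.1.factorial : ℝ) ≠ 0 := by positivity
    have h3 : (p.2.factorial : ℝ) ≠ 0 := by positivity
    field_simp
  rw [e1]
  have := hs.hasSum.prod_fiberwise (fun n => (hs.prod_factor n).hasSum)
  convert this using 2 with n
  rw [(Jan_int h ha hg x hx n).2, ← tsum_mul_left]
  refine tsum_congr fun l => ?_
  ring

theorem detK_tendsto {Kq : ℕ → X → X → ℝ} {ι : Type} [Fintype ι] (x : ι → X)
    (hlim : ∀ i j, Tendsto (fun q => Kq q (x i) (x j)) atTop (𝓝 (K (x i) (x j)))) :
    Tendsto (fun q => detK (Kq q) x) atTop (𝓝 (detK K x)) := by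
  classical
  simp_rw [detK_eq, Matrix.det_apply']
  refine tendsto_finsetSum _ fun σ _ => ?_
  refine Tendsto.const_mul _ (tendsto_finsetProd _ fun i _ => ?_)
  exact hlim _ _

theorem Jan_tendsto {Kq : ℕ → X → X → ℝ} (h : ∀ᶠ q in atTop, WK μ Λ (Kq q) C)
    (h' : WK μ Λ K C)
    (hlim : ∀ y ∈ Λ, ∀ z ∈ Λ, Tendsto (fun q => Kq q y z) atTop (𝓝 (K y z)))
    {g : X → ℝ} (hg : WG Λ g) {κ : Type} [Fintype κ] (x : κ → X) (hx : ∀ k, x k ∈ Λ) :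
    Tendsto (fun q => Jan (Kq q) μ g x) atTop (𝓝 (Jan K μ g x)) := by
  unfold Jan
  refine tendsto_tsum_of_dominated_convergence (jterm_summable h' x hx (Fintype.card κ)) ?_ ?_
  · intro l
    refine Tendsto.const_mul _ ?_
    refine MeasureTheory.tendsto_integral_filter_of_dominated_convergence
      (fun v => dbd (C * Real.exp 1) (Fintype.card κ + Fintype.card (Fin l)) *
        ∏ i, Λ.indicator (fun _ => (1:ℝ)) (v i)) ?_ ?_ ?_ ?_
    · filter_upwards [h] with q hq
      exact (weight_integrable hq (fun _ : Fin l => g) (fun _ => hg) x hx).1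
    · filter_upwards [h] with q hq
      exact Eventually.of_forall fun v => weight_bound hq (fun _ : Fin l => g) (fun _ => hg) x hx v
    · exact (ind_integrable h' _).const_mul _
    · refine Eventually.of_forall fun v => ?_
      by_cases hv : ∀ i, v i ∈ Λ
      · refine Tendsto.const_mul _ (detK_tendsto _ ?_)
        rintro (i | i) (j | j) <;> simp only [Sum.elim_inl, Sum.elim_inr] <;> apply hlim <;>
        first | exact hx _ | exact hv _
      · push Not at hv
        obtain ⟨i, hi⟩ := hv
        have h0 : g (v i) = 0 := by
          have := hg.bd (v i)
          rw [Set.indicator_of_notMem hi] at this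
          exact abs_nonpos_iff.mp this
        have h1 : ∏ i, g (v i) = 0 := Finset.prod_eq_zero (Finset.mem_univ i) h0
        simp_rw [h1, zero_mul]
        exact tendsto_const_nhds
  · filter_upwards [h] with q hq l
    rw [norm_mul, Real.norm_of_nonneg (by positivity)]
    refine mul_le_mul_of_nonneg_left ?_ (by positivity)
    simpa using weight_integral_bound hq (fun _ : Fin l => g) (fun _ => hg) x hx

end Jan

end AW
namespace AW
section ext
variable {X : Type} [MeasurableSpace X]

/-- symmetric measurable functionals of finite configurations -/
structure SymF (H : (ι : Type) → [Fintype ι] → (ι → X) → ℝ≥0∞) : Prop where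
  sym : ∀ (ι κ : Type) [Fintype ι] [Fintype κ] (e : ι ≃ κ) (x : κ → X),
    H ι (fun i => x (e i)) = H κ x
  meas : ∀ (ι : Type) [Fintype ι], Measurable (H ι)

/-- product of indicators -/
def prI (W : Set X) {ι : Type} [Fintype ι] (x : ι → X) : ℝ≥0∞ :=
  ∏ i, W.indicator (fun _ => (1:ℝ≥0∞)) (x i)

theorem measurable_prI {W : Set X} (hW : MeasurableSet W) {ι : Type} [Fintype ι] :
    Measurable fun x : ι → X => prI W x := by
  unfold prI
  exact Finset.measurable_prod _ fun i _ =>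
    (measurable_const.indicator hW).comp (measurable_pi_apply i)

theorem prI_of_mem {W : Set X} {ι : Type} [Fintype ι] {x : ι → X} (h : ∀ i, x i ∈ W) :
    prI W x = 1 := Finset.prod_eq_one fun i _ => by simp [h i]

theorem prI_of_not {W : Set X} {ι : Type} [Fintype ι] {x : ι → X} (h : ¬ ∀ i, x i ∈ W) :
    prI W x = 0 := by
  push Not at h
  obtain ⟨i, hi⟩ := h
  exact Finset.prod_eq_zero (Finset.mem_univ i) (by simp [hi])

theorem tsum_antidiagE (f : ℕ × ℕ → ℝ≥0∞) :
    ∑' N, ∑ p ∈ Finset.HasAntidiagonal.antidiagonal N, f p = ∑' p, f p := by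
  rw [← Finset.HasAntidiagonal.sigmaAntidiagonalEquivProd.tsum_eq f,
    ENNReal.tsum_sigma']
  · congr 1; funext N
    rw [tsum_fintype]
    exact (Finset.sum_coe_sort _ f).symm

theorem split_lint (μ : Measure X) [SigmaFinite μ] {a g : X → ℝ≥0∞} (ha : Measurable a)
    (hg : Measurable g) {H : (ι : Type) → [Fintype ι] → (ι → X) → ℝ≥0∞} (hH : SymF H) (N : ℕ) :
    ∫⁻ v : Fin N → X, (∏ i, (a (v i) + g (v i))) * H _ v ∂(Measure.pi fun _ => μ) =
      ∑ p ∈ Finset.HasAntidiagonal.antidiagonal N, (N.choose p.1 : ℝ≥0∞) *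
        ∫⁻ v : Fin p.1 → X, ∫⁻ w : Fin p.2 → X, (∏ i, a (v i)) * (∏ i, g (w i)) *
          H (Fin p.1 ⊕ Fin p.2) (Sum.elim v w)
          ∂(Measure.pi fun _ => μ) ∂(Measure.pi fun _ => μ) := by
  classical
  let T : ℕ → ℕ → ℝ≥0∞ := fun n l =>
    ∫⁻ v : Fin n ⊕ Fin l → X, (∏ i, a (v (Sum.inl i))) * (∏ i, g (v (Sum.inr i))) * H _ v
      ∂(Measure.pi fun _ => μ)
  have hT : ∀ n l, T n l = ∫⁻ v : Fin n → X, ∫⁻ w : Fin l → X, (∏ i, a (v i)) * (∏ i, g (w i)) *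
          H (Fin n ⊕ Fin l) (Sum.elim v w)
          ∂(Measure.pi fun _ => μ) ∂(Measure.pi fun _ => μ) := by
    intro n l
    simp only [T]
    rw [← (pi_sum_mp μ (Fin n) (Fin l)).lintegral_comp_emb (pi_sum_emb _ _),
      MeasureTheory.lintegral_prod]
    · rfl
    · refine Measurable.aemeasurable ?_
      refine Measurable.mul (Measurable.mul ?_ ?_) ((hH.meas _).comp (pi_sum_emb _ _).measurable)
      · exact Finset.measurable_prod _ fun i _ => ha.comp ((measurable_pi_apply i).comp measurable_fst)
      · exact Finset.measurable_prod _ fun i _ => hg.comp ((measurable_pi_apply i).comp measurable_snd)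
  have key : ∀ A : Finset (Fin N),
      ∫⁻ v : Fin N → X, (∏ i, (if i ∈ A then a else g) (v i)) * H _ v
        ∂(Measure.pi fun _ => μ) = T A.card (N - A.card) := by
    intro A
    have hc : Aᶜ.card = N - A.card := by rw [Finset.card_compl, Fintype.card_fin]
    let e := finSumEquivOfFinset (m := A.card) (n := N - A.card) rfl hc
    simp only [T]
    rw [← (pi_reindex_mp μ e).lintegral_comp_emb (pi_reindex_emb e)]
    refine MeasureTheory.lintegral_congr fun w => ?_
    congr 1
    · rw [← e.prod_comp, Fintype.prod_sum_type]
      congr 1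
      · refine Finset.prod_congr rfl fun i _ => ?_
        simp only [Equiv.symm_apply_apply]
        have : e (Sum.inl i) ∈ A := by simp [e]
        simp [this]
      · refine Finset.prod_congr rfl fun i _ => ?_
        simp only [Equiv.symm_apply_apply]
        have : e (Sum.inr i) ∉ A := by
          have : e (Sum.inr i) ∈ Aᶜ := by simp [e, -Finset.mem_compl]
          simpa using this
        simp [this]
    · exact hH.sym _ _ e.symm w
  have h1 : ∀ v : Fin N → X, (∏ i, (a (v i) + g (v i))) * H _ v =
      ∑ A ∈ (Finset.univ : Finset (Fin N)).powerset,
        (∏ i, (if i ∈ A then a else g) (v i)) * H _ v := by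
    intro v
    rw [Finset.prod_add, Finset.sum_mul]
    refine Finset.sum_congr rfl fun A _ => ?_
    congr 1
    rw [← Finset.prod_mul_prod_compl A, ← Finset.compl_eq_univ_sdiff]
    congr 1
    · exact Finset.prod_congr rfl fun i hi => by simp [hi]
    · exact Finset.prod_congr rfl fun i hi => by
        rw [if_neg (Finset.mem_compl.mp hi)]
  simp_rw [h1]
  rw [MeasureTheory.lintegral_finsetSum]
  · simp_rw [key, ← hT]
    rw [Finset.sum_powerset_apply_card (fun n => T n (N - n)),
      Finset.Nat.sum_antidiagonal_eq_sum_range_succ_mk]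
    simp
  · intro A _
    refine Measurable.mul ?_ (hH.meas _)
    refine Finset.measurable_prod _ fun i _ => ?_
    split_ifs
    · exact ha.comp (measurable_pi_apply i)
    · exact hg.comp (measurable_pi_apply i)

/-- configuration space -/
abbrev EE2 (X : Type) := ℕ × (ℕ → X)

def extE [Inhabited X] (n : ℕ) (x : Fin n → X) : EE2 X :=
  (n, fun i => if h : i < n then x ⟨i, h⟩ else default)

def pts (e : EE2 X) : Fin e.1 → X := fun i => e.2 i

def app (e f : EE2 X) : EE2 X := (e.1 + f.1, fun i => if i < e.1 then e.2 i else f.2 (i - e.1))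

theorem measurable_extE [Inhabited X] (n : ℕ) : Measurable (extE n : (Fin n → X) → EE2 X) := by
  unfold extE
  refine measurable_const.prodMk (measurable_pi_lambda _ fun i => ?_)
  by_cases h : i < n
  · simp only [h, dite_true]; exact measurable_pi_apply _
  · simp only [h, dite_false]; exact measurable_const

theorem measurable_app : Measurable fun p : EE2 X × EE2 X => app p.1 p.2 := by
  unfold app
  refine Measurable.prodMk (by fun_prop) (measurable_pi_lambda _ fun i => ?_)
  refine Measurable.ite ?_ ?_ ?_
  · have : Measurable fun p : EE2 X × EE2 X => p.1.1 := by fun_prop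
    exact this (MeasurableSet.of_discrete : MeasurableSet {n : ℕ | i < n})
  · exact (measurable_pi_apply i).comp (measurable_snd.comp measurable_fst)
  · have h2 : Measurable fun q : ℕ × (ℕ → X) => q.2 q.1 :=
      measurable_from_prod_countable_right fun n => measurable_pi_apply n
    exact h2.comp (Measurable.prodMk (by
      exact (measurable_from_top (f := fun n : ℕ => i - n)).comp
        (measurable_fst.comp measurable_fst)) (measurable_snd.comp measurable_snd))

theorem SymF.lift_meas {H : (ι : Type) → [Fintype ι] → (ι → X) → ℝ≥0∞} (hH : SymF H) :
    Measurable fun e : EE2 X => H (Fin e.1) (pts e) := by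
  refine measurable_from_prod_countable_right fun n => ?_
  simp only [pts]
  exact (hH.meas (Fin n)).comp (measurable_pi_lambda _ fun i => measurable_pi_apply _)

theorem pts_extE [Inhabited X] (n : ℕ) (x : Fin n → X) : pts (extE n x) = x := by
  funext i
  have : (i : ℕ) < n := i.2
  simp only [pts, extE, this, dite_true]
  rfl

theorem SymF.lift_ext [Inhabited X] {H : (ι : Type) → [Fintype ι] → (ι → X) → ℝ≥0∞}
    (n : ℕ) (x : Fin n → X) : H (Fin (extE n x).1) (pts (extE n x)) = H (Fin n) x := by
  have := pts_extE n x
  exact congrArg (H (Fin n)) this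

theorem SymF.lift_app {H : (ι : Type) → [Fintype ι] → (ι → X) → ℝ≥0∞} (hH : SymF H)
    (e f : EE2 X) : H (Fin (app e f).1) (pts (app e f)) =
      H (Fin e.1 ⊕ Fin f.1) (Sum.elim (pts e) (pts f)) := by
  refine (hH.sym _ _ (finSumFinEquiv (m := e.1) (n := f.1)) (pts (app e f))).symm.trans ?_
  congr 1; funext i
  rcases i with i | i <;> simp [pts, app]

/-- Lebesgue-Poisson measure -/
def LP [Inhabited X] (μ : Measure X) (W : Set X) : Measure (EE2 X) :=
  Measure.sum fun n : ℕ => ((n.factorial : ℝ≥0∞)⁻¹) •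
    ((Measure.pi fun _ : Fin n => μ).withDensity (fun x => prI W x)).map (extE n)

theorem lintegral_LP [Inhabited X] (μ : Measure X) [SigmaFinite μ] {W : Set X}
    (hW : MeasurableSet W) {F : EE2 X → ℝ≥0∞} (hF : Measurable F) :
    ∫⁻ e, F e ∂(LP μ W) = ∑' n : ℕ, (n.factorial : ℝ≥0∞)⁻¹ *
      ∫⁻ x : Fin n → X, prI W x * F (extE n x) ∂(Measure.pi fun _ => μ) := by
  unfold LP
  rw [MeasureTheory.lintegral_sum_measure]
  refine tsum_congr fun n => ?_
  rw [MeasureTheory.lintegral_smul_measure, MeasureTheory.lintegral_map hF (measurable_extE n),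
    MeasureTheory.lintegral_withDensity_eq_lintegral_mul _ (measurable_prI hW)
      (g := fun x => F (extE n x)) (hF.comp (measurable_extE n))]
  rfl

theorem lintegral_LP_sym [Inhabited X] (μ : Measure X) [SigmaFinite μ] {W : Set X}
    (hW : MeasurableSet W) {H : (ι : Type) → [Fintype ι] → (ι → X) → ℝ≥0∞} (hH : SymF H) :
    ∫⁻ e, H (Fin e.1) (pts e) ∂(LP μ W) = ∑' n : ℕ, (n.factorial : ℝ≥0∞)⁻¹ *
      ∫⁻ x : Fin n → X, prI W x * H (Fin n) x ∂(Measure.pi fun _ => μ) := by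
  rw [lintegral_LP μ hW hH.lift_meas]
  refine tsum_congr fun n => ?_
  congr 1
  refine MeasureTheory.lintegral_congr fun x => ?_
  congr 1
  exact SymF.lift_ext n x

theorem lintegral_pi_prI (μ : Measure X) [SigmaFinite μ] {W : Set X} (hW : MeasurableSet W)
    (n : ℕ) : ∫⁻ x : Fin n → X, prI W x ∂(Measure.pi fun _ => μ) = (μ W) ^ n := by
  have : ∀ x : Fin n → X, prI W x = (Set.univ.pi fun _ => W).indicator (fun _ => 1) x := by
    intro x
    by_cases h : ∀ i, x i ∈ W
    · rw [prI_of_mem h, Set.indicator_of_mem (by simpa using h)]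
    · rw [prI_of_not h, Set.indicator_of_notMem (by simpa using h)]
  simp_rw [this]
  rw [MeasureTheory.lintegral_indicator (MeasurableSet.univ_pi fun _ => hW)]
  simp [Measure.pi_pi]

theorem LP_finite [Inhabited X] (μ : Measure X) [SigmaFinite μ] {W : Set X}
    (hW : MeasurableSet W) (hf : μ W ≠ ⊤) : IsFiniteMeasure (LP μ W) := by
  constructor
  have := lintegral_LP μ hW (F := fun _ => 1) measurable_const
  simp only [MeasureTheory.lintegral_const, one_mul, mul_one] at this
  rw [this]
  simp_rw [lintegral_pi_prI μ hW]
  have h2 : ∀ n : ℕ, (n.factorial : ℝ≥0∞)⁻¹ * μ W ^ n =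
      ENNReal.ofReal ((μ W).toReal ^ n / n.factorial) := by
    intro n
    rw [ENNReal.ofReal_div_of_pos (by positivity), ENNReal.ofReal_pow ENNReal.toReal_nonneg,
      ENNReal.ofReal_toReal hf, ENNReal.ofReal_natCast, ENNReal.div_eq_inv_mul]
  simp_rw [h2]
  rw [← ENNReal.ofReal_tsum_of_nonneg (fun n => by positivity)
    (Real.summable_pow_div_factorial _)]
  exact ENNReal.ofReal_lt_top

theorem superpos [Inhabited X] (μ : Measure X) [SigmaFinite μ] {Λ W : Set X}
    (hΛ : MeasurableSet Λ) (hW : MeasurableSet W) (hd : Disjoint Λ W)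
    {H : (ι : Type) → [Fintype ι] → (ι → X) → ℝ≥0∞} (hH : SymF H) :
    ∫⁻ f, ∫⁻ e, H (Fin (app e f).1) (pts (app e f)) ∂(LP μ Λ) ∂(LP μ W) =
      ∫⁻ e, H (Fin e.1) (pts e) ∂(LP μ (Λ ∪ W)) := by
  classical
  rw [lintegral_LP_sym μ (hΛ.union hW) hH]
  let a : X → ℝ≥0∞ := W.indicator fun _ => 1
  let g : X → ℝ≥0∞ := Λ.indicator fun _ => 1
  have hpr : ∀ (n : ℕ) (x : Fin n → X), prI (Λ ∪ W) x = ∏ i, (a (x i) + g (x i)) := by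
    intro n x
    refine Finset.prod_congr rfl fun i _ => ?_
    rw [Set.indicator_union_of_disjoint hd]
    simp only [a, g]; rw [add_comm]
  have ha : Measurable a := measurable_const.indicator hW
  have hg : Measurable g := measurable_const.indicator hΛ
  simp_rw [hpr, split_lint μ ha hg hH, Finset.mul_sum]
  have e1 : ∀ N : ℕ, ∑ p ∈ Finset.HasAntidiagonal.antidiagonal N, (N.factorial : ℝ≥0∞)⁻¹ *
      ((N.choose p.1 : ℝ≥0∞) *
        ∫⁻ v : Fin p.1 → X, ∫⁻ w : Fin p.2 → X, (∏ i, a (v i)) * (∏ i, g (w i)) *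
          H (Fin p.1 ⊕ Fin p.2) (Sum.elim v w)
          ∂(Measure.pi fun _ => μ) ∂(Measure.pi fun _ => μ)) =
      ∑ p ∈ Finset.HasAntidiagonal.antidiagonal N, (p.1.factorial : ℝ≥0∞)⁻¹ *
        ((p.2.factorial : ℝ≥0∞)⁻¹ *
        ∫⁻ v : Fin p.1 → X, ∫⁻ w : Fin p.2 → X, (∏ i, a (v i)) * (∏ i, g (w i)) *
          H (Fin p.1 ⊕ Fin p.2) (Sum.elim v w)
          ∂(Measure.pi fun _ => μ) ∂(Measure.pi fun _ => μ)) := by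
    intro N
    refine Finset.sum_congr rfl fun p hp => ?_
    rw [Finset.HasAntidiagonal.mem_antidiagonal] at hp
    rw [← mul_assoc, ← mul_assoc]
    congr 1
    rw [← hp]
    have hf : ((p.1 + p.2).choose p.1) * p.1.factorial * p.2.factorial =
        (p.1 + p.2).factorial := by
      rw [Nat.choose_symm_add]
      exact_mod_cast Nat.add_choose_mul_factorial_mul_factorial p.1 p.2
    rw [← hf]
    have hc : ((p.1 + p.2).choose p.1 : ℝ≥0∞) ≠ 0 := by
      exact_mod_cast (Nat.choose_pos (Nat.le_add_right _ _)).ne'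
    push_cast
    rw [ENNReal.mul_inv, ENNReal.mul_inv]
    · rw [mul_comm, ← mul_assoc, ← mul_assoc, ENNReal.mul_inv_cancel hc (by simp), one_mul]
    · left; exact hc
    · left; simp
    · left
      simp [hc, Nat.factorial_ne_zero]
    · left; exact ENNReal.mul_ne_top (by simp) (by simp)
  simp_rw [e1]
  rw [tsum_antidiagE, ENNReal.tsum_prod']
  have hmeas := (hH.lift_meas.comp measurable_app)
  have hfinΛ : ∀ f, ∫⁻ e, H (Fin (app e f).1) (pts (app e f)) ∂(LP μ Λ) =
      ∑' n : ℕ, (n.factorial : ℝ≥0∞)⁻¹ *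
      ∫⁻ x : Fin n → X, prI Λ x * H (Fin f.1 ⊕ Fin n) (Sum.elim (pts f) x)
        ∂(Measure.pi fun _ => μ) := by
    intro f
    rw [lintegral_LP μ hΛ (F := fun e => H (Fin (app e f).1) (pts (app e f)))
      (hmeas.comp (measurable_id.prodMk measurable_const))]
    refine tsum_congr fun n => ?_
    congr 1
    refine MeasureTheory.lintegral_congr fun x => ?_
    congr 1
    refine (hH.lift_app _ _).trans ?_
    refine Eq.trans (congrArg (fun y => H (Fin n ⊕ Fin f.1) (Sum.elim y (pts f))) (pts_extE n x)) ?_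
    refine Eq.trans (hH.sym _ _ (Equiv.sumComm (Fin f.1) (Fin n)) (Sum.elim x (pts f))).symm ?_
    congr 1
    funext i
    rcases i with i | i <;> rfl
  simp_rw [hfinΛ]
  have hm1 : ∀ n k : ℕ, Measurable fun y : Fin n → X =>
      ∫⁻ x : Fin k → X, prI Λ x * H (Fin n ⊕ Fin k) (Sum.elim y x) ∂(Measure.pi fun _ => μ) := by
    intro n k
    refine Measurable.lintegral_prod_right' (f := fun p : (Fin n → X) × (Fin k → X) =>
      prI Λ p.2 * H (Fin n ⊕ Fin k) (Sum.elim p.1 p.2)) ?_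
    exact ((measurable_prI hΛ).comp measurable_snd).mul
      ((hH.meas _).comp (pi_sum_emb _ _).measurable)
  rw [lintegral_LP μ hW]
  · refine tsum_congr fun n => ?_
    rw [ENNReal.tsum_mul_left]
    congr 1
    have e2 : ∀ x : Fin n → X, (∑' k : ℕ, (k.factorial : ℝ≥0∞)⁻¹ *
        ∫⁻ z : Fin k → X, prI Λ z * H (Fin (extE n x).1 ⊕ Fin k) (Sum.elim (pts (extE n x)) z)
          ∂(Measure.pi fun _ => μ)) = ∑' k : ℕ, (k.factorial : ℝ≥0∞)⁻¹ *
        ∫⁻ z : Fin k → X, prI Λ z * H (Fin n ⊕ Fin k) (Sum.elim x z)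
          ∂(Measure.pi fun _ => μ) := by
      intro x
      refine tsum_congr fun k => ?_
      congr 1
      refine MeasureTheory.lintegral_congr fun z => ?_
      congr 1
      have := pts_extE n x
      exact congrArg (fun y => H (Fin n ⊕ Fin k) (Sum.elim y z)) this
    simp_rw [e2, ← ENNReal.tsum_mul_left]
    rw [MeasureTheory.lintegral_tsum]
    · refine tsum_congr fun k => ?_
      rw [← MeasureTheory.lintegral_const_mul]
      · refine MeasureTheory.lintegral_congr fun x => ?_
        rw [mul_left_comm, ← MeasureTheory.lintegral_const_mul]
        · congr 1
          refine MeasureTheory.lintegral_congr fun z => ?_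
          rw [← mul_assoc]; rfl
        · exact (measurable_prI hΛ).mul
            ((hH.meas _).comp ((pi_sum_emb _ _).measurable.comp measurable_prodMk_left))
      · refine Measurable.lintegral_prod_right' (f := fun p : (Fin n → X) × (Fin k → X) =>
          (∏ i, a (p.1 i)) * (∏ i, g (p.2 i)) * H (Fin n ⊕ Fin k) (Sum.elim p.1 p.2)) ?_
        refine Measurable.mul (Measurable.mul ?_ ?_) ((hH.meas _).comp (pi_sum_emb _ _).measurable)
        · exact (measurable_prI hW).comp measurable_fst
        · exact (measurable_prI hΛ).comp measurable_snd
    · intro k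
      exact ((measurable_prI hW).mul ((hm1 n k).const_mul _)).aemeasurable
  · refine measurable_from_prod_countable_right fun n => ?_
    simp only [pts]
    refine Measurable.tsum fun k => Measurable.const_mul ?_ _
    exact (hm1 n k).comp (measurable_pi_lambda _ fun i => measurable_pi_apply _)

end ext
end AW
namespace AW
section chain
open ProbabilityTheory

theorem chain_exists {S : Type} [MeasurableSpace S] [StandardBorelSpace S] [Nonempty S]
    (ρ : ℕ → Measure (S × S)) [∀ n, IsProbabilityMeasure (ρ n)]
    (hρ : ∀ n, (ρ n).snd = (ρ (n+1)).fst) :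
    ∃ Q : Measure (ℕ → S), IsProbabilityMeasure Q ∧
      ∀ n, Q.map (fun ω => (ω n, ω (n+1))) = ρ n := by
  let last : ∀ n : ℕ, ((i : Finset.Iic n) → S) → S := fun n x => x ⟨n, by simp⟩
  have hlast : ∀ n, Measurable (last n) := fun n => measurable_pi_apply _
  let κ : (n : ℕ) → Kernel ((i : Finset.Iic n) → (fun _ : ℕ => S) i) ((fun _ : ℕ => S) (n+1)) :=
    fun n => ((ρ n).condKernel).comap (last n) (hlast n)
  have : ∀ n, IsMarkovKernel (κ n) := fun n => by
    show IsMarkovKernel (((ρ n).condKernel).comap (last n) (hlast n))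
    infer_instance
  let μ₀ : Measure ((fun _ : ℕ => S) 0) := (ρ 0).fst
  have : IsProbabilityMeasure μ₀ := by
    show IsProbabilityMeasure (ρ 0).fst
    infer_instance
  let Q : Measure (ℕ → S) := Kernel.trajMeasure (X := fun _ : ℕ => S) μ₀ κ
  have hQ : IsProbabilityMeasure Q := by
    show IsProbabilityMeasure (Kernel.trajMeasure (X := fun _ : ℕ => S) μ₀ κ)
    infer_instance
  have h0 : Q.map (fun ω => ω 0) = (ρ 0).fst := by
    have e1 : (fun ω : ℕ → S => ω 0) = (last 0) ∘ (Preorder.frestrictLe (π := fun _ : ℕ => S) 0) := by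
      funext ω; rfl
    rw [e1, ← Measure.map_map (hlast 0) (by fun_prop)]
    have e2 : Q.map (Preorder.frestrictLe (π := fun _ : ℕ => S) 0) =
        μ₀.map (MeasurableEquiv.piUnique (fun i : Finset.Iic 0 => S)).symm := by
      show (Kernel.trajMeasure (X := fun _ : ℕ => S) μ₀ κ).map _ = _
      rw [Kernel.trajMeasure, Measure.map_comp _ _ (by fun_prop), Kernel.traj_map_frestrictLe,
        Kernel.partialTraj_self, Measure.id_comp]
    rw [e2, Measure.map_map (hlast 0) (MeasurableEquiv.measurable _)]
    have e3 : (last 0) ∘ (MeasurableEquiv.piUnique (fun i : Finset.Iic 0 => S)).symm = id := by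
      funext x; rfl
    rw [e3, Measure.map_id]
  have hm1 : ∀ n, Measurable fun ω : ℕ → S => (ω n, ω (n+1)) := fun n => by fun_prop
  have step : ∀ n, Q.map (fun ω => ω n) = (ρ n).fst → Q.map (fun ω => (ω n, ω (n+1))) = ρ n := by
    intro n hn
    have key := Kernel.map_frestrictLe_trajMeasure_compProd_eq_map_trajMeasure
      (X := fun _ : ℕ => S) (κ := κ) (μ₀ := μ₀) (a := n)
    have e1 : (fun ω : ℕ → S => (ω n, ω (n+1))) = (Prod.map (last n) id) ∘
        (fun x : ℕ → S => (Preorder.frestrictLe (π := fun _ : ℕ => S) n x, x (n+1))) := by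
      funext ω; rfl
    have hmp : Measurable (Prod.map (last n) (id : S → S)) := (hlast n).prodMap measurable_id
    have hmf : Measurable (fun x : ℕ → S => (Preorder.frestrictLe (π := fun _ : ℕ => S) n x, x (n+1))) := by
      fun_prop
    rw [e1, ← Measure.map_map hmp hmf]
    change ((Kernel.trajMeasure (X := fun _ : ℕ => S) μ₀ κ).map _).map _ = _
    rw [← key]
    conv_rhs => rw [← (ρ n).disintegrate (ρ n).condKernel, ← hn]
    have : IsProbabilityMeasure (Q.map (fun ω => ω n)) :=
      Measure.isProbabilityMeasure_map (measurable_pi_apply n).aemeasurable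
    have : IsProbabilityMeasure (Q.map (Preorder.frestrictLe (π := fun _ : ℕ => S) n)) :=
      Measure.isProbabilityMeasure_map (by fun_prop)
    refine Measure.ext_of_lintegral _ fun f hf => ?_
    rw [MeasureTheory.lintegral_map hf hmp]
    change ∫⁻ a, f (Prod.map (last n) id a) ∂((Q.map (Preorder.frestrictLe (π := fun _ : ℕ => S) n)) ⊗ₘ κ n) = _
    rw [Measure.lintegral_compProd (f := fun a => f (Prod.map (last n) id a)) (hf.comp hmp),
      Measure.lintegral_compProd hf]
    have hmI : Measurable fun s => ∫⁻ b, f (s, b) ∂((ρ n).condKernel s) := hf.lintegral_kernel_prod_right'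
    rw [MeasureTheory.lintegral_map hmI (measurable_pi_apply n)]
    rw [MeasureTheory.lintegral_map]
    · rfl
    · exact (hf.comp hmp).lintegral_kernel_prod_right'
    · fun_prop
  have all : ∀ n, Q.map (fun ω => ω n) = (ρ n).fst := by
    intro n
    induction n with
    | zero => exact h0
    | succ n ih =>
      rw [← hρ n, ← step n ih, Measure.snd, Measure.map_map measurable_snd (hm1 n)]
      rfl
  exact ⟨Q, hQ, fun n => step n (all n)⟩

end chain
end AW
namespace AW
section mom
variable {X : Type} [MeasurableSpace X] {μ : Measure X} [SigmaFinite μ] {K : X → X → ℝ}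
  {Λ S : Set X} {C : ℝ}

def nI (Λ : Set X) : X → ℝ := fun y => -(Λ.indicator (fun _ => (1:ℝ)) y)
def pI (Λ : Set X) : X → ℝ := fun y => Λ.indicator (fun _ => (1:ℝ)) y

theorem WG_pI (hS : MeasurableSet S) (hSL : S ⊆ Λ) : WG Λ (pI S) := by
  refine ⟨measurable_const.indicator hS, fun x => ?_⟩
  unfold pI
  by_cases h : x ∈ S
  · simp [h, hSL h]
  · simp only [h, not_false_eq_true, Set.indicator_of_notMem, abs_zero]
    exact Set.indicator_nonneg (fun _ _ => zero_le_one) _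

theorem WG_nI (hL : MeasurableSet Λ) : WG Λ (nI Λ) := by
  refine ⟨(measurable_const.indicator hL).neg, fun x => ?_⟩
  unfold nI
  rw [abs_neg]
  by_cases h : x ∈ Λ <;> simp [h]

theorem pI_sum (hSL : S ⊆ Λ) : (fun y => pI S y + nI Λ y) = nI (Λ \ S) := by
  funext y
  unfold pI nI
  by_cases h : y ∈ S
  · simp [h, hSL h]
  · by_cases h' : y ∈ Λ <;> simp [h, h']

theorem pI_nonneg (S : Set X) (y : X) : 0 ≤ pI S y :=
  Set.indicator_nonneg (fun _ _ => zero_le_one) _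

theorem prod_pI {ι : Type} [Fintype ι] (S : ι → Set X) (x : ι → X) :
    ENNReal.ofReal (∏ i, pI (S i) (x i)) =
      ∏ i, (S i).indicator (fun _ => (1:ℝ≥0∞)) (x i) := by
  rw [ENNReal.ofReal_prod_of_nonneg
    (fun i _ => pI_nonneg _ _)]
  refine Finset.prod_congr rfl fun i _ => ?_
  unfold pI
  by_cases h : x i ∈ S i <;> simp [h]

/-- Janossy positivity on a window -/
def JPos (K : X → X → ℝ) (μ : Measure X) (Λ : Set X) : Prop :=
  ∀ (n : ℕ) (x : Fin n → X), (∀ i, x i ∈ Λ) → 0 ≤ Jan K μ (nI Λ) x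

theorem JPos.gen (h : JPos K μ Λ) {κ : Type} [Fintype κ] (x : κ → X) (hx : ∀ i, x i ∈ Λ) :
    0 ≤ Jan K μ (nI Λ) x := by
  rw [← Jan_equiv K μ _ (Fintype.equivFin κ).symm]
  exact h _ _ fun i => hx _

def jH (K : X → X → ℝ) (μ : Measure X) (Λ : Set X) (ι : Type) [Fintype ι] (x : ι → X) : ℝ≥0∞ :=
  prI Λ x * ENNReal.ofReal (Jan K μ (nI Λ) x)

theorem prI_equiv (Λ : Set X) {ι κ : Type} [Fintype ι] [Fintype κ] (e : ι ≃ κ) (x : κ → X) :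
    prI Λ (fun i => x (e i)) = prI Λ x :=
  e.prod_comp (fun k => Λ.indicator (fun _ => (1:ℝ≥0∞)) (x k))

theorem Jan_meas (hK : Measurable (Function.uncurry K)) {g : X → ℝ} (hg : Measurable g)
    (ι : Type) [Fintype ι] : Measurable fun x : ι → X => Jan K μ g x := by
  unfold Jan
  refine Measurable.tsum fun l => Measurable.const_mul ?_ _
  refine StronglyMeasurable.measurable ?_
  refine StronglyMeasurable.integral_prod_right (f := fun (x : ι → X) (v : Fin l → X) =>
    (∏ i, g (v i)) * detK K (Sum.elim x v)) ?_
  refine Measurable.stronglyMeasurable ?_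
  refine Measurable.mul ?_ ((measurable_detK K hK).comp (pi_sum_emb _ _).measurable)
  exact Finset.measurable_prod _ fun i _ => hg.comp ((measurable_pi_apply i).comp measurable_snd)

theorem SymF_jH (h : WK μ Λ K C) : SymF (jH K μ Λ) := by
  refine ⟨fun ι κ _ _ e x => ?_, fun ι _ => ?_⟩
  · unfold jH
    rw [prI_equiv, Jan_equiv]
  · exact (measurable_prI h.mL).mul (Jan_meas h.mK (WG_nI h.mL).mg ι).ennreal_ofReal

theorem prI_sum (Λ : Set X) {ι κ : Type} [Fintype ι] [Fintype κ] (x : ι → X) (y : κ → X) :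
    prI Λ (Sum.elim x y) = prI Λ x * prI Λ y := by
  unfold prI
  simp [Fintype.prod_sum_type]

theorem cons_lint (h : WK μ Λ K C) (hp : JPos K μ Λ) (hS : MeasurableSet S) (hSL : S ⊆ Λ)
    {κ : Type} [Fintype κ] (x : κ → X) (hx : ∀ k, x k ∈ Λ) :
    ∑' n : ℕ, (n.factorial : ℝ≥0∞)⁻¹ * ∫⁻ u : Fin n → X, prI S u *
      jH K μ Λ (κ ⊕ Fin n) (Sum.elim x u) ∂(Measure.pi fun _ => μ) =
      ENNReal.ofReal (Jan K μ (nI (Λ \ S)) x) ∧ 0 ≤ Jan K μ (nI (Λ \ S)) x := by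
  have hc := Jan_consistency h (WG_pI hS hSL) (WG_nI h.mL)
    (by rw [pI_sum hSL]; refine ⟨(WG_nI (h.mL.diff hS)).mg, fun y => ?_⟩
        refine ((WG_nI (h.mL.diff hS)).bd y).trans ?_
        exact Set.indicator_le_indicator_of_subset Set.sdiff_subset (fun _ => zero_le_one) y) x hx
  rw [pI_sum hSL] at hc
  have hpt : ∀ (n : ℕ) (u : Fin n → X), 0 ≤ (∏ i, pI S (u i)) * Jan K μ (nI Λ) (Sum.elim x u) := by
    intro n u
    by_cases hu : ∀ i, u i ∈ S
    · refine mul_nonneg (Finset.prod_nonneg fun i _ => Set.indicator_nonneg (fun _ _ => zero_le_one) _) ?_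
      refine hp.gen _ ?_
      rintro (i | i)
      · exact hx i
      · exact hSL (hu i)
    · push Not at hu
      obtain ⟨i, hi⟩ := hu
      rw [Finset.prod_eq_zero (Finset.mem_univ i) (by simp [pI, hi]), zero_mul]
  have hnn : ∀ n : ℕ, 0 ≤ (n.factorial : ℝ)⁻¹ * ∫ u : Fin n → X, (∏ i, pI S (u i)) *
      Jan K μ (nI Λ) (Sum.elim x u) ∂(Measure.pi fun _ => μ) := fun n =>
    mul_nonneg (by positivity) (MeasureTheory.integral_nonneg (hpt n))
  refine ⟨?_, ?_⟩
  · rw [← hc.tsum_eq, ENNReal.ofReal_tsum_of_nonneg hnn hc.summable]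
    refine tsum_congr fun n => ?_
    rw [ENNReal.ofReal_mul (by positivity), ENNReal.ofReal_inv_of_pos (by positivity),
      ENNReal.ofReal_natCast]
    congr 1
    rw [MeasureTheory.ofReal_integral_eq_lintegral_ofReal
      (Jan_int h (WG_pI hS hSL) (WG_nI h.mL) x hx n).1 (Eventually.of_forall (hpt n))]
    refine MeasureTheory.lintegral_congr fun u => ?_
    rw [ENNReal.ofReal_mul (Finset.prod_nonneg fun i _ => pI_nonneg _ _), prod_pI (fun _ => S)]
    unfold jH
    rw [prI_sum, prI_of_mem hx, one_mul, ← mul_assoc]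
    congr 1
    by_cases hu : ∀ i, u i ∈ S
    · rw [prI_of_mem hu, prI_of_mem (fun i => hSL (hu i)), one_mul]
      exact (prI_of_mem hu).symm
    · rw [prI_of_not hu, zero_mul]; exact (prI_of_not hu).symm
  · exact hc.nonneg hnn

/-- factorial moment functional -/
def momH {J : Type} [Fintype J] [DecidableEq J] (B : J → Set X) (ι : Type) [Fintype ι]
    (x : ι → X) : ℝ≥0∞ :=
  haveI : DecidableEq ι := Classical.decEq ι
  ∑ f : J ↪ ι, ∏ p, (B p).indicator (fun _ => (1:ℝ≥0∞)) (x (f p))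

theorem SymF_momH {J : Type} [Fintype J] [DecidableEq J] {B : J → Set X}
    (hB : ∀ p, MeasurableSet (B p)) : SymF (momH B) := by
  refine ⟨fun ι κ _ _ e x => ?_, fun ι _ => ?_⟩
  · unfold momH
    classical
    refine Fintype.sum_equiv ((Equiv.refl J).embeddingCongr e) _ _ fun f => ?_
    rfl
  · unfold momH
    exact Finset.measurable_sum _ fun f _ => Finset.measurable_prod _ fun p _ =>
      (measurable_const.indicator (hB p)).comp (measurable_pi_apply _)

theorem extend_emb {J : Type} [Fintype J] {N l : ℕ} (hN : N = l + Fintype.card J) (f : J ↪ Fin N) :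
    ∃ e : J ⊕ Fin l ≃ Fin N, ∀ p, e (Sum.inl p) = f p := by
  classical
  have hcard : Fintype.card ((Set.range f)ᶜ : Set (Fin N)) = l := by
    rw [Fintype.card_compl_set, Fintype.card_fin, Set.card_range_of_injective f.injective]
    omega
  let e1 : Fin l ≃ ((Set.range f)ᶜ : Set (Fin N)) := (Fintype.equivFinOfCardEq hcard).symm
  refine ⟨((Equiv.ofInjective f f.injective).sumCongr e1).trans (Equiv.Set.sumCompl (Set.range f)), ?_⟩
  intro p
  simp

set_option maxHeartbeats 400000 in
theorem mom_jH (h : WK μ Λ K C) (hp : JPos K μ Λ) [Inhabited X] {J : Type} [Fintype J]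
    [DecidableEq J] {B : J → Set X} (hB : ∀ p, MeasurableSet (B p)) (hBL : ∀ p, B p ⊆ Λ) :
    ∫⁻ e, momH B (Fin e.1) (pts e) * jH K μ Λ (Fin e.1) (pts e) ∂(LP μ Λ) =
      ENNReal.ofReal (∫ y : J → X, (∏ p, pI (B p) (y p)) * detK K y ∂(Measure.pi fun _ => μ)) ∧
    0 ≤ ∫ y : J → X, (∏ p, pI (B p) (y p)) * detK K y ∂(Measure.pi fun _ => μ) := by
  classical
  have hj := SymF_jH h
  have hm := SymF_momH hB
  have hmj : SymF (fun ι [Fintype ι] (x : ι → X) => momH B ι x * jH K μ Λ ι x) :=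
    ⟨fun ι κ _ _ e x => by rw [hm.sym, hj.sym], fun ι _ => (hm.meas ι).mul (hj.meas ι)⟩
  have hdet : ∀ y : J → X, (∀ p, y p ∈ B p) → 0 ≤ detK K y := by
    intro y hy
    have := (cons_lint h hp h.mL subset_rfl y (fun p => hBL p (hy p))).2
    have e0 : nI (Λ \ Λ) = fun _ : X => (0:ℝ) := by funext y; simp [nI]
    rwa [e0, Jan_zero] at this
  have hnn : ∀ y : J → X, 0 ≤ (∏ p, pI (B p) (y p)) * detK K y := by
    intro y
    by_cases hy : ∀ p, y p ∈ B p
    · exact mul_nonneg (Finset.prod_nonneg fun i _ => Set.indicator_nonneg (fun _ _ => zero_le_one) _)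
        (hdet y hy)
    · push Not at hy
      obtain ⟨i, hi⟩ := hy
      rw [Finset.prod_eq_zero (Finset.mem_univ i) (by simp [pI, hi]), zero_mul]
  refine ⟨?_, MeasureTheory.integral_nonneg hnn⟩
  have hLP := lintegral_LP_sym μ h.mL hmj
  rw [hLP]
  let T : ℕ → ℝ≥0∞ := fun l => ∫⁻ y : J → X, ∫⁻ z : Fin l → X,
    (∏ p, (B p).indicator (fun _ => (1:ℝ≥0∞)) (y p)) * (prI Λ z * jH K μ Λ (J ⊕ Fin l) (Sum.elim y z))
      ∂(Measure.pi fun _ => μ) ∂(Measure.pi fun _ => μ)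
  have hmB : Measurable fun y : J → X => ∏ p, (B p).indicator (fun _ => (1:ℝ≥0∞)) (y p) :=
    Finset.measurable_prod _ fun p _ =>
      (measurable_const.indicator (hB p)).comp (measurable_pi_apply _)
  have hterm : ∀ (N : ℕ) (l : ℕ), N = l + Fintype.card J → ∀ f : J ↪ Fin N,
      ∫⁻ x : Fin N → X, prI Λ x * ((∏ p, (B p).indicator (fun _ => (1:ℝ≥0∞)) (x (f p))) *
        jH K μ Λ (Fin N) x) ∂(Measure.pi fun _ => μ) = T l := by
    intro N l hN f
    obtain ⟨e, he⟩ := extend_emb hN f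
    simp only [T]
    rw [← (pi_reindex_mp μ e).lintegral_comp_emb (pi_reindex_emb e),
      ← (pi_sum_mp μ J (Fin l)).lintegral_comp_emb (pi_sum_emb _ _), MeasureTheory.lintegral_prod]
    · refine MeasureTheory.lintegral_congr fun y => MeasureTheory.lintegral_congr fun z => ?_
      simp only [← he, Equiv.symm_apply_apply, Sum.elim_inl]
      rw [prI_equiv Λ e.symm (Sum.elim y z), hj.sym _ _ e.symm (Sum.elim y z), prI_sum]
      by_cases hy : ∀ p, y p ∈ B p
      · rw [prI_of_mem (fun p => hBL p (hy p)), one_mul]; ring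
      · push Not at hy
        obtain ⟨i, hi⟩ := hy
        rw [Finset.prod_eq_zero (Finset.mem_univ i) (by simp [hi])]; simp
    · refine Measurable.aemeasurable ?_
      refine Measurable.comp (g := fun x : Fin N → X => prI Λ x * ((∏ p, (B p).indicator
        (fun _ => (1:ℝ≥0∞)) (x (f p))) * jH K μ Λ (Fin N) x)) ?_
        ((pi_reindex_emb e).measurable.comp (pi_sum_emb _ _).measurable)
      exact (measurable_prI h.mL).mul ((Finset.measurable_prod _ fun p _ =>
        (measurable_const.indicator (hB p)).comp (measurable_pi_apply _)).mul (hj.meas _))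
  have hmain : ∀ l : ℕ, (((l + Fintype.card J).factorial : ℝ≥0∞)⁻¹ *
      ∫⁻ x : Fin (l + Fintype.card J) → X, prI Λ x * (momH B _ x * jH K μ Λ _ x)
        ∂(Measure.pi fun _ => μ)) = (l.factorial : ℝ≥0∞)⁻¹ * T l := by
    intro l
    have e1 : ∀ x : Fin (l + Fintype.card J) → X, prI Λ x * (momH B _ x * jH K μ Λ _ x) =
        ∑ f : J ↪ Fin (l + Fintype.card J), prI Λ x *
          ((∏ p, (B p).indicator (fun _ => (1:ℝ≥0∞)) (x (f p))) * jH K μ Λ _ x) := by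
      intro x
      unfold momH
      rw [Finset.sum_mul, Finset.mul_sum]
    simp_rw [e1]
    rw [MeasureTheory.lintegral_finsetSum]
    · simp_rw [hterm _ l rfl]
      rw [Finset.sum_const, Finset.card_univ, Fintype.card_embedding_eq, Fintype.card_fin,
        nsmul_eq_mul, ← mul_assoc]
      congr 1
      have h2 := Nat.factorial_mul_descFactorial (n := l + Fintype.card J) (k := Fintype.card J) (by omega)
      rw [Nat.add_sub_cancel] at h2
      rw [← h2]
      push_cast
      have hne : ((l + Fintype.card J).descFactorial (Fintype.card J) : ℝ≥0∞) ≠ 0 := by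
        simp [Nat.descFactorial_eq_zero_iff_lt]
      rw [ENNReal.mul_inv (by left; simp [Nat.factorial_ne_zero]) (by left; simp), mul_assoc,
        ENNReal.inv_mul_cancel hne (by simp), mul_one]
    · intro f _
      exact (measurable_prI h.mL).mul ((Finset.measurable_prod _ fun p _ =>
        (measurable_const.indicator (hB p)).comp (measurable_pi_apply _)).mul (hj.meas _))
  have hshift : ∀ (A : ℕ → ℝ≥0∞) (D : ℕ → ℝ≥0∞), (∀ N, N < Fintype.card J → A N = 0) →
      (∀ l, A (l + Fintype.card J) = D l) → ∑' N, A N = ∑' l, D l := by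
    intro A D h1 h2
    have h3 := Summable.sum_add_tsum_nat_add' (k := Fintype.card J)
      (f := A) (ENNReal.summable (f := fun n => A (n + Fintype.card J)))
    rw [Finset.sum_eq_zero (fun N hN => h1 N (Finset.mem_range.mp hN)), zero_add] at h3
    rw [← h3]
    exact tsum_congr h2
  refine (hshift _ _ ?_ hmain).trans ?_
  rotate_left
  · have hin : ∀ (l : ℕ) (y : J → X), Measurable fun z : Fin l → X =>
        prI Λ z * jH K μ Λ (J ⊕ Fin l) (Sum.elim y z) := fun l y =>
      (measurable_prI h.mL).mul ((hj.meas _).comp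
        ((pi_sum_emb _ _).measurable.comp measurable_prodMk_left))
    have hin2 : ∀ l : ℕ, Measurable fun y : J → X => ∫⁻ z : Fin l → X,
        prI Λ z * jH K μ Λ (J ⊕ Fin l) (Sum.elim y z) ∂(Measure.pi fun _ => μ) := by
      intro l
      refine Measurable.lintegral_prod_right' (f := fun p : (J → X) × (Fin l → X) =>
        prI Λ p.2 * jH K μ Λ (J ⊕ Fin l) (Sum.elim p.1 p.2)) ?_
      exact ((measurable_prI h.mL).comp measurable_snd).mul
        ((hj.meas _).comp (pi_sum_emb _ _).measurable)
    have hT : ∀ l, (l.factorial : ℝ≥0∞)⁻¹ * T l = ∫⁻ y : J → X,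
        (∏ p, (B p).indicator (fun _ => (1:ℝ≥0∞)) (y p)) * ((l.factorial : ℝ≥0∞)⁻¹ *
        ∫⁻ z : Fin l → X, prI Λ z * jH K μ Λ (J ⊕ Fin l) (Sum.elim y z)
          ∂(Measure.pi fun _ => μ)) ∂(Measure.pi fun _ => μ) := by
      intro l
      have : T l = ∫⁻ y : J → X,
        (∏ p, (B p).indicator (fun _ => (1:ℝ≥0∞)) (y p)) *
        ∫⁻ z : Fin l → X, prI Λ z * jH K μ Λ (J ⊕ Fin l) (Sum.elim y z)
          ∂(Measure.pi fun _ => μ) ∂(Measure.pi fun _ => μ) := by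
        refine MeasureTheory.lintegral_congr fun y => ?_
        rw [MeasureTheory.lintegral_const_mul _ (hin l y)]
      rw [this]
      refine (MeasureTheory.lintegral_const_mul _ (hmB.mul (hin2 l))).symm.trans ?_
      refine MeasureTheory.lintegral_congr fun y => ?_
      simp only [Pi.mul_apply]
      rw [mul_left_comm]
    simp_rw [hT]
    rw [← MeasureTheory.lintegral_tsum]
    · rw [MeasureTheory.ofReal_integral_eq_lintegral_ofReal _ (Eventually.of_forall hnn)]
      · refine MeasureTheory.lintegral_congr fun y => ?_
        rw [ENNReal.tsum_mul_left]
        by_cases hy : ∀ p, y p ∈ B p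
        · rw [(cons_lint h hp h.mL subset_rfl y (fun p => hBL p (hy p))).1]
          have e0 : nI (Λ \ Λ) = fun _ : X => (0:ℝ) := by funext y; simp [nI]
          rw [e0, Jan_zero, ENNReal.ofReal_mul (Finset.prod_nonneg fun i _ => pI_nonneg _ _), prod_pI]
        · push Not at hy
          obtain ⟨i, hi⟩ := hy
          rw [Finset.prod_eq_zero (Finset.mem_univ i) (by simp [hi]),
            Finset.prod_eq_zero (Finset.mem_univ i) (by simp [pI, hi])]
          simp
      · have := weight_integrable h (fun p => pI (B p)) (fun p => WG_pI (hB p) (hBL p))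
          (Empty.elim : Empty → X) (fun k => k.elim)
        refine this.congr (Eventually.of_forall fun y => ?_)
        simp only []
        congr 1
        rw [← detK_equiv K (Equiv.emptySum Empty J).symm]
        rfl
    · intro l
      exact (hmB.mul ((hin2 l).const_mul _)).aemeasurable
  · intro N hN'
    have : IsEmpty (J ↪ Fin N) := by
      rw [← Fintype.card_eq_zero_iff, Fintype.card_embedding_eq, Fintype.card_fin]
      exact Nat.descFactorial_eq_zero_iff_lt.mpr hN'
    have h0 : ∀ x : Fin N → X, momH B (Fin N) x = 0 := by
      intro x; unfold momH; simp
    simp [h0]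

end mom
end AW
namespace AW
section proc
variable {X : Type} [MeasurableSpace X] [StandardBorelSpace X] [Inhabited X]
  {μ : Measure X} [SigmaFinite μ] {K : X → X → ℝ} {Λ : ℕ → Set X} {C : ℕ → ℝ}

structure Sys (μ : Measure X) (K : X → X → ℝ) (Λ : ℕ → Set X) (C : ℕ → ℝ) : Prop where
  mono : Monotone Λ
  zero : Λ 0 = ∅
  wk : ∀ k, WK μ (Λ k) K (C k)
  pos : ∀ k, JPos K μ (Λ k)

def RR (μ : Measure X) (Λ : ℕ → Set X) : ℕ → Measure (EE2 X)
  | 0 => LP μ (Λ 0)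
  | (k+1) => ((RR μ Λ k).prod (LP μ (Λ (k+1) \ Λ k))).map (fun p => app p.1 p.2)

theorem Sys.mW (h : Sys μ K Λ C) (k : ℕ) : MeasurableSet (Λ (k+1) \ Λ k) :=
  (h.wk (k+1)).mL.diff (h.wk k).mL

theorem Sys.finW (h : Sys μ K Λ C) (k : ℕ) : IsFiniteMeasure (LP μ (Λ (k+1) \ Λ k)) :=
  LP_finite μ (h.mW k) (ne_top_of_le_ne_top (h.wk (k+1)).fin (measure_mono Set.sdiff_subset))

theorem Sys.finR (h : Sys μ K Λ C) (k : ℕ) : IsFiniteMeasure (RR μ Λ k) := by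
  induction k with
  | zero => exact LP_finite μ (h.wk 0).mL (h.wk 0).fin
  | succ k ih =>
    have := h.finW k
    unfold RR
    infer_instance

theorem Sys.R_sym (h : Sys μ K Λ C) (k : ℕ) {H : (ι : Type) → [Fintype ι] → (ι → X) → ℝ≥0∞}
    (hH : SymF H) :
    ∫⁻ e, H (Fin e.1) (pts e) ∂(RR μ Λ k) = ∫⁻ e, H (Fin e.1) (pts e) ∂(LP μ (Λ k)) := by
  induction k generalizing H with
  | zero => rfl
  | succ k ih =>
    have h1 := h.finW k
    have h2 := h.finR k
    unfold RR
    rw [MeasureTheory.lintegral_map hH.lift_meas measurable_app,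
      MeasureTheory.lintegral_prod_symm (fun p : EE2 X × EE2 X => H (Fin (app p.1 p.2).1) (pts (app p.1 p.2)))
        ((hH.lift_meas.comp measurable_app).aemeasurable)]
    have hd : Disjoint (Λ k) (Λ (k+1) \ Λ k) := Set.disjoint_sdiff_right
    have hu : Λ k ∪ (Λ (k+1) \ Λ k) = Λ (k+1) := Set.union_sdiff_cancel (h.mono (Nat.le_succ k))
    rw [← hu, ← superpos μ (h.wk k).mL (h.mW k) hd hH, hu]
    refine MeasureTheory.lintegral_congr fun f => ?_
    simp_rw [hH.lift_app]
    exact ih (H := fun ι [Fintype ι] x => H (ι ⊕ Fin f.1) (Sum.elim x (pts f)))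
      ⟨fun ι κ _ _ e x => by
        rw [← hH.sym _ _ (e.sumCongr (Equiv.refl (Fin f.1)))]
        congr 1; funext i; rcases i with i | i <;> rfl,
      fun ι _ => (hH.meas _).comp ((pi_sum_emb _ _).measurable.comp measurable_prodMk_right)⟩

theorem LP_supp {W : Set X} (hW : MeasurableSet W) : ∀ᵐ e ∂(LP μ W), ∀ i, pts e i ∈ W := by
  have hs : SymF (fun ι [Fintype ι] (x : ι → X) => 1 - prI W x) :=
    ⟨fun ι κ _ _ e x => by rw [prI_equiv], fun ι _ => (measurable_prI hW).const_sub 1⟩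
  have h0 : ∫⁻ e, (1 - prI W (pts e)) ∂(LP μ W) = 0 := by
    have := lintegral_LP_sym μ hW hs
    rw [this]
    refine ENNReal.tsum_eq_zero.mpr fun n => ?_
    have hz : ∀ x : Fin n → X, prI W x * (1 - prI W x) = 0 := by
      intro x
      by_cases hx : ∀ i, x i ∈ W
      · simp [prI_of_mem hx]
      · simp [prI_of_not hx]
    simp [hz]
  rw [MeasureTheory.lintegral_eq_zero_iff hs.lift_meas] at h0
  filter_upwards [h0] with e he
  by_contra hc
  simp [prI_of_not hc] at he

theorem Sys.R_supp (h : Sys μ K Λ C) (k : ℕ) : ∀ᵐ e ∂(RR μ Λ k), ∀ i, pts e i ∈ Λ k := by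
  have hs : SymF (fun ι [Fintype ι] (x : ι → X) => 1 - prI (Λ k) x) :=
    ⟨fun ι κ _ _ e x => by rw [prI_equiv], fun ι _ => (measurable_prI (h.wk k).mL).const_sub 1⟩
  have h1 := h.R_sym k hs
  have h2 := LP_supp (μ := μ) (h.wk k).mL
  have h0 : ∫⁻ e, (1 - prI (Λ k) (pts e)) ∂(RR μ Λ k) = 0 := by
    rw [h1, MeasureTheory.lintegral_eq_zero_iff hs.lift_meas]
    filter_upwards [h2] with e he
    simp [prI_of_mem he]
  rw [MeasureTheory.lintegral_eq_zero_iff hs.lift_meas] at h0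
  filter_upwards [h0] with e he
  by_contra hc
  simp [prI_of_not hc] at he

def jE (K : X → X → ℝ) (μ : Measure X) (Λ : ℕ → Set X) (k : ℕ) (e : EE2 X) : ℝ≥0∞ :=
  jH K μ (Λ k) (Fin e.1) (pts e)

def PP (K : X → X → ℝ) (μ : Measure X) (Λ : ℕ → Set X) (k : ℕ) : Measure (EE2 X) :=
  (RR μ Λ k).withDensity (jE K μ Λ k)

def coup (K : X → X → ℝ) (μ : Measure X) (Λ : ℕ → Set X) (k : ℕ) : Measure (EE2 X × EE2 X) :=
  (((RR μ Λ k).prod (LP μ (Λ (k+1) \ Λ k))).withDensity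
    (fun p => jE K μ Λ (k+1) (app p.1 p.2))).map (fun p => (p.1, app p.1 p.2))

theorem Sys.mj (h : Sys μ K Λ C) (k : ℕ) : Measurable (jE K μ Λ k) :=
  (SymF_jH (h.wk k)).lift_meas

theorem Sys.PP_mom (h : Sys μ K Λ C) (k : ℕ) {J : Type} [Fintype J]
    [DecidableEq J] {B : J → Set X} (hB : ∀ p, MeasurableSet (B p)) (hBL : ∀ p, B p ⊆ Λ k) :
    ∫⁻ e, momH B (Fin e.1) (pts e) ∂(PP K μ Λ k) =
      ENNReal.ofReal (∫ y : J → X, (∏ p, pI (B p) (y p)) * detK K y ∂(Measure.pi fun _ => μ)) := by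
  have hj := SymF_jH (h.wk k)
  have hm := SymF_momH hB
  have hmj : SymF (fun ι [Fintype ι] (x : ι → X) => momH B ι x * jH K μ (Λ k) ι x) :=
    ⟨fun ι κ _ _ e x => by rw [hm.sym, hj.sym], fun ι _ => (hm.meas ι).mul (hj.meas ι)⟩
  rw [← (mom_jH (h.wk k) (h.pos k) hB hBL).1]
  rw [← h.R_sym k hmj]
  unfold PP
  rw [MeasureTheory.lintegral_withDensity_eq_lintegral_mul _ (h.mj k) hm.lift_meas]
  refine MeasureTheory.lintegral_congr fun e => ?_
  simp only [Pi.mul_apply, jE]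
  rw [mul_comm]

theorem Sys.PP_prob (h : Sys μ K Λ C) (k : ℕ) : IsProbabilityMeasure (PP K μ Λ k) := by
  constructor
  have := h.PP_mom k (J := Empty) (B := Empty.elim) (fun p => p.elim) (fun p => p.elim)
  have e1 : ∀ e : EE2 X, momH (J := Empty) (X := X) Empty.elim (Fin e.1) (pts e) = 1 := by
    intro e; unfold momH; simp
  have e2 : ∀ y : Empty → X, detK K y = 1 := by
    intro y; classical rw [detK_eq]; simp
  simp only [e1, e2] at this
  simpa [Measure.real] using this

theorem Sys.coup_snd (h : Sys μ K Λ C) (k : ℕ) : (coup K μ Λ k).snd = PP K μ Λ (k+1) := by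
  have h1 := h.finW k
  have h2 := h.finR k
  have hmm : Measurable fun p : EE2 X × EE2 X => (p.1, app p.1 p.2) :=
    measurable_fst.prodMk measurable_app
  refine Measure.ext_of_lintegral _ fun F hF => ?_
  unfold coup PP
  rw [Measure.snd, MeasureTheory.lintegral_map hF measurable_snd,
    MeasureTheory.lintegral_map (f := fun a : EE2 X × EE2 X => F a.2) (hF.comp measurable_snd) hmm,
    MeasureTheory.lintegral_withDensity_eq_lintegral_mul _
      (f := fun p : EE2 X × EE2 X => jE K μ Λ (k+1) (app p.1 p.2)) ((h.mj (k+1)).comp measurable_app)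
      (g := fun p : EE2 X × EE2 X => F (p.1, app p.1 p.2).2) (hF.comp measurable_app),
    MeasureTheory.lintegral_withDensity_eq_lintegral_mul _ (h.mj (k+1)) hF]
  conv_rhs => unfold RR
  rw [MeasureTheory.lintegral_map ((h.mj (k+1)).mul hF) measurable_app]
  rfl

theorem Sys.coup_fst (h : Sys μ K Λ C) (k : ℕ) : (coup K μ Λ k).fst = PP K μ Λ k := by
  have h1 := h.finW k
  have h2 := h.finR k
  have hmm : Measurable fun p : EE2 X × EE2 X => (p.1, app p.1 p.2) :=
    measurable_fst.prodMk measurable_app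
  have hja : Measurable fun p : EE2 X × EE2 X => jE K μ Λ (k+1) (app p.1 p.2) :=
    (h.mj (k+1)).comp measurable_app
  refine Measure.ext_of_lintegral _ fun F hF => ?_
  unfold coup PP
  rw [Measure.fst, MeasureTheory.lintegral_map hF measurable_fst,
    MeasureTheory.lintegral_map (f := fun a : EE2 X × EE2 X => F a.1) (hF.comp measurable_fst) hmm,
    MeasureTheory.lintegral_withDensity_eq_lintegral_mul _ hja
      (g := fun p : EE2 X × EE2 X => F (p.1, app p.1 p.2).1) (hF.comp measurable_fst),
    MeasureTheory.lintegral_withDensity_eq_lintegral_mul _ (h.mj k) hF]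
  refine (MeasureTheory.lintegral_prod (fun p : EE2 X × EE2 X => jE K μ Λ (k + 1) (app p.1 p.2) * F p.1)
      (hja.mul (hF.comp measurable_fst)).aemeasurable).trans ?_
  refine MeasureTheory.lintegral_congr_ae ?_
  filter_upwards [h.R_supp k] with e he
  simp only [Pi.mul_apply]
  rw [MeasureTheory.lintegral_mul_const (f := fun y => jE K μ Λ (k+1) (app e y)) _
    (hja.comp measurable_prodMk_left)]
  congr 1
  have hsub : Λ k ⊆ Λ (k+1) := h.mono (Nat.le_succ k)
  have hc := (cons_lint (h.wk (k+1)) (h.pos (k+1)) (h.mW k) Set.sdiff_subset (pts e)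
    (fun i => hsub (he i))).1
  rw [Set.sdiff_sdiff_cancel_left hsub] at hc
  unfold jE
  conv_rhs => rw [jH, prI_of_mem he, one_mul, ← hc]
  have hj := SymF_jH (h.wk (k+1))
  simp_rw [hj.lift_app]
  have hs : SymF (fun ι [Fintype ι] x => jH K μ (Λ (k+1)) (Fin e.1 ⊕ ι) (Sum.elim (pts e) x)) :=
    ⟨fun ι κ _ _ e' x => by
        rw [← hj.sym _ _ ((Equiv.refl (Fin e.1)).sumCongr e')]
        congr 1; funext i; rcases i with i | i <;> rfl,
      fun ι _ => (hj.meas _).comp ((pi_sum_emb _ _).measurable.comp measurable_prodMk_left)⟩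
  exact lintegral_LP_sym μ (h.mW k) hs

theorem Sys.coup_prob (h : Sys μ K Λ C) (k : ℕ) : IsProbabilityMeasure (coup K μ Λ k) := by
  have := h.PP_prob (k+1)
  rw [← h.coup_snd k] at this
  constructor
  have h1 := this.measure_univ
  rwa [Measure.snd_univ] at h1

/-- the second configuration extends the first one by points outside the window -/
def Good (Λ : Set X) : Set (EE2 X × EE2 X) :=
  {p | p.1.1 ≤ p.2.1 ∧ ∀ i : ℕ, (i < p.1.1 → p.2.2 i = p.1.2 i) ∧
    (p.1.1 ≤ i → i < p.2.1 → p.2.2 i ∉ Λ)}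

theorem measurable_Good {Λ : Set X} (hΛ : MeasurableSet Λ) : MeasurableSet (Good Λ) := by
  have m11 : Measurable fun p : EE2 X × EE2 X => p.1.1 := measurable_fst.comp measurable_fst
  have m21 : Measurable fun p : EE2 X × EE2 X => p.2.1 := measurable_fst.comp measurable_snd
  have m12 : ∀ i, Measurable fun p : EE2 X × EE2 X => p.1.2 i := fun i =>
    (measurable_pi_apply i).comp (measurable_snd.comp measurable_fst)
  have m22 : ∀ i, Measurable fun p : EE2 X × EE2 X => p.2.2 i := fun i =>
    (measurable_pi_apply i).comp (measurable_snd.comp measurable_snd)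
  have e : Good Λ = {p : EE2 X × EE2 X | p.1.1 ≤ p.2.1} ∩ ⋂ i : ℕ,
      ({p | i < p.1.1 → p.2.2 i = p.1.2 i} ∩ {p | p.1.1 ≤ i → i < p.2.1 → p.2.2 i ∉ Λ}) := by
    ext p; simp [Good]
  rw [e]
  refine MeasurableSet.inter (measurableSet_le m11 m21) (MeasurableSet.iInter fun i =>
    MeasurableSet.inter ?_ ?_)
  · exact MeasurableSet.imp (measurableSet_lt measurable_const m11)
      (measurableSet_eq_fun (m22 i) (m12 i))
  · exact MeasurableSet.imp (measurableSet_le m11 measurable_const)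
      (MeasurableSet.imp (measurableSet_lt measurable_const m21) (m22 i hΛ.compl))

theorem Sys.coup_good (h : Sys μ K Λ C) (k : ℕ) : ∀ᵐ p ∂(coup K μ Λ k), p ∈ Good (Λ k) := by
  have h1 := h.finW k
  have h2 := h.finR k
  have hmm : Measurable fun p : EE2 X × EE2 X => (p.1, app p.1 p.2) :=
    measurable_fst.prodMk measurable_app
  unfold coup
  refine (MeasureTheory.ae_map_iff (p := fun p => p ∈ Good (Λ k)) hmm.aemeasurable
    (measurable_Good (h.wk k).mL)).mpr ?_
  refine (withDensity_absolutelyContinuous _ _).ae_le ?_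
  have hq : ∀ᵐ p ∂((RR μ Λ k).prod (LP μ (Λ (k+1) \ Λ k))), ∀ i, pts p.2 i ∈ Λ (k+1) \ Λ k :=
    Measure.quasiMeasurePreserving_snd.ae (LP_supp (h.mW k))
  filter_upwards [hq] with p hp
  refine ⟨by simp [app], fun i => ⟨fun hi => by simp [app, hi], fun hi hi2 => ?_⟩⟩
  simp only [app] at hi hi2 ⊢
  rw [if_neg (by omega)]
  exact (hp ⟨i - p.1.1, by omega⟩).2

def cnt (e : EE2 X) : Measure X := ∑ i ∈ Finset.range e.1, Measure.dirac (e.2 i)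

theorem cnt_apply (e : EE2 X) {B : Set X} (hB : MeasurableSet B) :
    cnt e B = ∑ i ∈ Finset.range e.1, B.indicator (fun _ => (1:ℝ≥0∞)) (e.2 i) := by
  unfold cnt
  rw [Measure.finsetSum_apply]
  refine Finset.sum_congr rfl fun i _ => ?_
  rw [Measure.dirac_apply' _ hB]
  rfl

theorem cnt_nat (e : EE2 X) {B : Set X} (hB : MeasurableSet B) : ∃ n : ℕ, cnt e B = n := by
  classical
  refine ⟨((Finset.range e.1).filter fun i => e.2 i ∈ B).card, ?_⟩
  rw [cnt_apply e hB, Finset.card_filter]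
  push_cast
  refine Finset.sum_congr rfl fun i _ => ?_
  by_cases hi : e.2 i ∈ B <;> simp [hi]

theorem cnt_meas {B : Set X} (hB : MeasurableSet B) : Measurable fun e : EE2 X => cnt e B := by
  simp_rw [cnt_apply _ hB]
  refine measurable_from_prod_countable_right fun n => ?_
  refine Finset.measurable_sum (f := fun i (x : ℕ → X) => B.indicator (fun _ => (1:ℝ≥0∞)) (x i))
    (Finset.range n) fun i _ => ?_
  exact (measurable_const.indicator hB).comp (measurable_pi_apply i)

theorem cnt_good {Λ : Set X} {e e' : EE2 X} (h : (e, e') ∈ Good Λ) {B : Set X}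
    (hB : MeasurableSet B) (hBL : B ⊆ Λ) : cnt e' B = cnt e B := by
  rw [cnt_apply _ hB, cnt_apply _ hB]
  obtain ⟨hle, h2⟩ := h
  simp only at hle h2
  rw [← Finset.sum_range_add_sum_Ico _ hle]
  rw [Finset.sum_eq_zero (s := Finset.Ico _ _), add_zero]
  · exact Finset.sum_congr rfl fun i hi => by rw [(h2 i).1 (Finset.mem_range.mp hi)]
  · intro i hi
    rw [Finset.mem_Ico] at hi
    have := (h2 i).2 hi.1 hi.2
    exact Set.indicator_of_notMem (fun hc => this (hBL hc)) _

/-- factorial moments as sums over embeddings -/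
theorem descFact_mom {r : ℕ} (n : Fin r → ℕ) (B : Fin r → Set X) (hB : ∀ j, MeasurableSet (B j))
    (hd : ∀ i j, i ≠ j → Disjoint (B i) (B j)) (e : EE2 X) :
    ∏ j, descFactE (cnt e (B j)) (n j) =
      momH (J := (j : Fin r) × Fin (n j)) (fun p => B p.1) (Fin e.1) (pts e) := by
  classical
  have hc : ∀ j, cnt e (B j) = (Fintype.card {i : Fin e.1 // pts e i ∈ B j} : ℝ≥0∞) := by
    intro j
    rw [cnt_apply e (hB j), Fintype.card_subtype, Finset.card_filter, Finset.sum_range]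
    push_cast
    refine Finset.sum_congr rfl fun i _ => ?_
    by_cases hi : e.2 i ∈ B j <;> simp [hi, pts]
  have hdf : ∀ c k : ℕ, descFactE (c : ℝ≥0∞) k = (c.descFactorial k : ℝ≥0∞) := by
    intro c k
    rw [Nat.descFactorial_eq_prod_range]
    unfold descFactE
    push_cast
    rfl
  simp_rw [hc, hdf]
  have hcard : ∏ j, (Fintype.card {i : Fin e.1 // pts e i ∈ B j}).descFactorial (n j) =
      Fintype.card {f : ((j : Fin r) × Fin (n j)) ↪ Fin e.1 // ∀ p, pts e (f p) ∈ B p.1} := by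
    have : ∀ j, (Fintype.card {i : Fin e.1 // pts e i ∈ B j}).descFactorial (n j) =
        Fintype.card (Fin (n j) ↪ {i : Fin e.1 // pts e i ∈ B j}) := by
      intro j; rw [Fintype.card_embedding_eq, Fintype.card_fin]
    simp_rw [this]
    rw [← Fintype.card_pi]
    refine Fintype.card_congr ?_
    refine
      { toFun := fun g => ⟨⟨fun p => (g p.1 p.2).1, ?_⟩, fun p => (g p.1 p.2).2⟩
        invFun := fun f j => ⟨fun i => ⟨f.1 ⟨j, i⟩, f.2 ⟨j, i⟩⟩, ?_⟩
        left_inv := fun g => rfl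
        right_inv := fun f => rfl }
    · rintro ⟨j, i⟩ ⟨j', i'⟩ hg
      simp only at hg
      by_cases hj : j = j'
      · subst hj
        have := (g j).injective (Subtype.ext hg)
        rw [this]
      · exfalso
        have h1 := (g j i).2
        rw [hg] at h1
        exact Set.disjoint_left.mp (hd j j' hj) h1 (g j' i').2
    · intro i i' hii
      have := f.1.injective (congrArg Subtype.val hii)
      simpa using this
  rw [← Nat.cast_prod, hcard, Fintype.card_subtype, Finset.card_filter]
  unfold momH
  push_cast
  refine Finset.sum_congr (by congr!) fun f _ => ?_
  by_cases hf : ∀ p, pts e (f p) ∈ B p.1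
  · rw [if_pos hf, Finset.prod_eq_one]
    intro p _
    simp [hf p]
  · rw [if_neg hf]
    push Not at hf
    obtain ⟨p, hp⟩ := hf
    rw [Finset.prod_eq_zero (Finset.mem_univ p)]
    simp [hp]

theorem Sys.exists_process (h : Sys μ K Λ C) :
    ∃ (Q : Measure (ℕ → EE2 X)) (M : (ℕ → EE2 X) → Measure X), IsProbabilityMeasure Q ∧
      (∀ A, MeasurableSet A → Measurable fun ω => M ω A) ∧
      (∀ ω k B, MeasurableSet B → B ⊆ Λ k → ∃ n : ℕ, M ω B = n) ∧
      ∀ (r : ℕ) (n : Fin r → ℕ) (B : Fin r → Set X) (k : ℕ), (∀ j, MeasurableSet (B j)) →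
        (∀ j, B j ⊆ Λ k) → (∀ i j, i ≠ j → Disjoint (B i) (B j)) →
        ∫⁻ ω, ∏ j, descFactE (M ω (B j)) (n j) ∂Q = ENNReal.ofReal
          (∫ y : ((j : Fin r) × Fin (n j)) → X, (∏ p, pI (B p.1) (y p)) * detK K y
            ∂(Measure.pi fun _ => μ)) ∧
        0 ≤ ∫ y : ((j : Fin r) × Fin (n j)) → X, (∏ p, pI (B p.1) (y p)) * detK K y
            ∂(Measure.pi fun _ => μ) := by
  have hpr := h.coup_prob
  obtain ⟨Q, hQ, hQm⟩ := chain_exists (coup K μ Λ) (fun n => by rw [h.coup_snd, h.coup_fst])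
  have hm2 : ∀ n, Measurable fun ω : ℕ → EE2 X => (ω n, ω (n+1)) := fun n =>
    (measurable_pi_apply n).prodMk (measurable_pi_apply (n+1))
  have hgood : ∀ᵐ ω ∂Q, ∀ k, (ω k, ω (k+1)) ∈ Good (Λ k) := by
    rw [ae_all_iff]
    intro k
    have := h.coup_good k
    rw [← hQm k] at this
    exact (MeasureTheory.ae_map_iff (p := fun p => p ∈ Good (Λ k)) (hm2 k).aemeasurable
      (measurable_Good (h.wk k).mL)).mp this
  let M : (ℕ → EE2 X) → Measure X := fun ω =>
    Measure.sum fun k => (cnt (ω (k+1))).restrict (Λ (k+1) \ Λ k)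
  have hMa : ∀ ω A, MeasurableSet A → M ω A = ∑' k, cnt (ω (k+1)) (A ∩ (Λ (k+1) \ Λ k)) := by
    intro ω A hA
    simp only [M]
    rw [Measure.sum_apply _ hA]
    refine tsum_congr fun k => ?_
    rw [Measure.restrict_apply hA]
  have hMf : ∀ ω k A, MeasurableSet A → A ⊆ Λ k →
      M ω A = ∑ i ∈ Finset.range k, cnt (ω (i+1)) (A ∩ (Λ (i+1) \ Λ i)) := by
    intro ω k A hA hAL
    rw [hMa ω A hA]
    refine tsum_eq_sum fun i hi => ?_
    have hki : k ≤ i := by simpa using hi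
    have : A ∩ (Λ (i+1) \ Λ i) = ∅ := by
      ext x
      simp only [Set.mem_inter_iff, Set.mem_sdiff, Set.mem_empty_iff_false, iff_false]
      rintro ⟨h1, _, h3⟩
      exact h3 (h.mono hki (hAL h1))
    rw [this]; simp
  refine ⟨Q, M, hQ, ?_, ?_, ?_⟩
  · intro A hA
    simp_rw [hMa _ A hA]
    exact Measurable.tsum fun k => (cnt_meas (hA.inter (h.mW k))).comp (measurable_pi_apply _)
  · intro ω k B hB hBL
    rw [hMf ω k B hB hBL]
    choose f hf using fun i => cnt_nat (ω (i+1)) (hB.inter (h.mW i))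
    exact ⟨∑ i ∈ Finset.range k, f i, by push_cast; exact Finset.sum_congr rfl fun i _ => hf i⟩
  · intro r n B k hB hBL hd
    refine ⟨?_, (mom_jH (h.wk k) (h.pos k) (B := fun p : (j : Fin r) × Fin (n j) => B p.1)
      (fun p => hB _) (fun p => hBL _)).2⟩
    have hMc : ∀ᵐ ω ∂Q, ∀ j, M ω (B j) = cnt (ω k) (B j) := by
      filter_upwards [hgood] with ω hω j
      rw [hMf ω k _ (hB j) (hBL j)]
      have : ∀ l, ∑ i ∈ Finset.range l, cnt (ω (i+1)) (B j ∩ (Λ (i+1) \ Λ i)) =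
          cnt (ω l) (B j ∩ Λ l) := by
        intro l
        induction l with
        | zero => simp [h.zero]
        | succ l ih =>
          rw [Finset.sum_range_succ, ih, ← cnt_good (hω l) ((hB j).inter (h.wk l).mL)
            Set.inter_subset_right, ← measure_union]
          · congr 1
            rw [← Set.inter_union_distrib_left, Set.union_sdiff_cancel (h.mono (Nat.le_succ l))]
          · exact Set.disjoint_left.mpr fun x hx hx2 => hx2.2.2 hx.2
          · exact (hB j).inter (h.mW l)
      rw [this k, Set.inter_eq_left.mpr (hBL j)]
    have hlaw : Q.map (fun ω => ω k) = PP K μ Λ k := by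
      rw [← h.coup_fst k, ← hQm k, Measure.fst, Measure.map_map measurable_fst (hm2 k)]
      rfl
    have hmm := SymF_momH (X := X) (B := fun p : (j : Fin r) × Fin (n j) => B p.1) (fun p => hB _)
    rw [← h.PP_mom k (B := fun p : (j : Fin r) × Fin (n j) => B p.1) (fun p => hB _)
      (fun p => hBL _), ← hlaw, MeasureTheory.lintegral_map hmm.lift_meas (measurable_pi_apply k)]
    refine MeasureTheory.lintegral_congr_ae ?_
    filter_upwards [hMc] with ω hω
    simp_rw [hω]
    exact descFact_mom n B hB hd (ω k)

end proc
end AW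
namespace AW

theorem alt_choose_hasSum (M : ℕ) :
    HasSum (fun l : ℕ => (-1:ℝ)^l * (M.choose l : ℝ)) (if M = 0 then 1 else 0) := by
  have h1 : (∑ l ∈ Finset.range (M+1), (-1:ℝ)^l * (M.choose l : ℝ)) = if M = 0 then 1 else 0 := by
    have := Int.alternating_sum_range_choose (n := M)
    have h2 := congrArg (fun z : ℤ => (z:ℝ)) this
    push_cast at h2
    rw [h2]
  rw [← h1]
  refine hasSum_sum_of_ne_finset_zero fun l hl => ?_
  have : M < l := by simpa using hl
  rw [Nat.choose_eq_zero_of_lt this]; simp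

open Classical in
theorem count_inj {Z : Type} {n l : ℕ} (F S : Finset Z) (x : Fin n → Z) :
    (∑ w : Fin l → F, if Function.Injective (Sum.elim x (fun i => (w i : Z))) ∧
        (∀ a, Sum.elim x (fun i => (w i : Z)) a ∈ S) then (1:ℝ) else 0) =
      if Function.Injective x ∧ (∀ a, x a ∈ S) then
        ((((F ∩ S) \ Finset.univ.image x).card.descFactorial l : ℕ) : ℝ) else 0 := by
  by_cases hx : Function.Injective x ∧ (∀ a, x a ∈ S)
  · rw [if_pos hx, Finset.sum_boole]
    norm_cast
    rw [← Fintype.card_coe ((F ∩ S) \ Finset.univ.image x), ← Fintype.card_fin l,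
      ← Fintype.card_embedding_eq, ← Fintype.card_subtype, Fintype.card_fin]
    symm
    refine Fintype.card_congr
      { toFun := fun g => ⟨fun i => ⟨(g i).1, ?_⟩, ?_, ?_⟩
        invFun := fun w => ⟨fun i => ⟨(w.1 i).1, ?_⟩, ?_⟩
        left_inv := fun g => rfl
        right_inv := fun w => rfl }
    · have := (g i).2
      simp only [Finset.mem_sdiff, Finset.mem_inter] at this
      exact this.1.1
    · rw [Sum.elim_injective]
      refine ⟨hx.1, fun i j hij => g.injective (Subtype.ext hij), fun a b hab => ?_⟩
      have := (g b).2
      simp only [Finset.mem_sdiff, Finset.mem_inter, Finset.mem_image, Finset.mem_univ,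
        true_and, not_exists] at this
      exact this.2 a hab
    · rintro (a | i)
      · exact hx.2 a
      · have := (g i).2
        simp only [Finset.mem_sdiff, Finset.mem_inter] at this
        exact this.1.2
    · have h1 := w.2.1
      have h2 := w.2.2
      simp only [Finset.mem_sdiff, Finset.mem_inter, Finset.mem_image, Finset.mem_univ,
        true_and, not_exists]
      refine ⟨⟨(w.1 i).2, h2 (Sum.inr i)⟩, fun a ha => ?_⟩
      have := @h1 (Sum.inl a) (Sum.inr i) ha
      cases this
    · intro i j hij
      have h3 : (w.1 i : Z) = w.1 j := congrArg (fun z : {z // z ∈ (F ∩ S) \ Finset.univ.image x} => (z : Z)) hij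
      have := @w.2.1 (Sum.inr i) (Sum.inr j) h3
      simpa using this
  · rw [if_neg hx]
    refine Finset.sum_eq_zero fun w _ => ?_
    rw [if_neg]
    rintro ⟨h1, h2⟩
    exact hx ⟨(Sum.elim_injective.mp h1).1, fun a => h2 (Sum.inl a)⟩

theorem detK_noninj {X : Type} (K : X → X → ℝ) {ι : Type} [Fintype ι] (x : ι → X)
    (hx : ¬ Function.Injective x) : detK K x = 0 := by
  classical
  rw [detK_eq]
  rw [Function.Injective] at hx
  push Not at hx
  obtain ⟨a, b, hab, hne⟩ := hx
  refine Matrix.det_zero_of_row_eq hne ?_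
  funext j
  simp [hab]

section step
open Classical in
def Dst {Z Ω : Type} [Fintype Ω] (T : Ω → ℝ) (S : Ω → Finset Z) {ι : Type} (v : ι → Z) : ℝ :=
  ∑ ω, T ω * if (Function.Injective v ∧ ∀ a, v a ∈ S ω) then (1:ℝ) else 0

variable {X Z : Type} [MeasurableSpace X] {μ : Measure X} [SigmaFinite μ]

open Classical in
theorem JPos_step (c : X → Z) (F : Finset Z) (hc : ∀ i ∈ F, MeasurableSet (c ⁻¹' {i}))
    (h : ℝ) (hh : 0 < h) (hμ : ∀ i ∈ F, μ (c ⁻¹' {i}) = ENNReal.ofReal h) (κ : Z → Z → ℝ)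
    {Ω : Type} [Fintype Ω] (T : Ω → ℝ) (S : Ω → Finset Z) (hT : ∀ ω, 0 ≤ T ω)
    (hD : ∀ {ι : Type} [Fintype ι] (v : ι → Z), Function.Injective v → (∀ a, v a ∈ F) →
      detK κ v = ∑ ω, T ω * if (∀ a, v a ∈ S ω) then 1 else 0) :
    JPos (fun x y => h⁻¹ * κ (c x) (c y)) μ (c ⁻¹' (F : Set Z)) := by
  intro n x hx
  set K : X → X → ℝ := fun x y => h⁻¹ * κ (c x) (c y) with hK
  have hdet : ∀ {ι : Type} [Fintype ι] (y : ι → X),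
      detK K y = h⁻¹ ^ (Fintype.card ι) * detK κ (fun i => c (y i)) := by
    intro ι _ y
    rw [detK_eq, detK_eq, ← Matrix.det_smul]
    rfl
  have hD' : ∀ {ι : Type} [Fintype ι] (v : ι → Z), (∀ a, v a ∈ F) → detK κ v = Dst T S v := by
    intro ι _ v hv
    unfold Dst
    by_cases hi : Function.Injective v
    · rw [hD v hi hv]
      simp [hi]
    · rw [detK_noninj κ v hi]
      simp [hi]
  have hx' : ∀ i, c (x i) ∈ F := fun i => hx i
  -- one-point weights
  set e : Z → X → ℝ := fun z y => if c y = z then 1 else 0 with he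
  have heint : ∀ z ∈ F, Integrable (e z) μ ∧ ∫ y, e z y ∂μ = h := by
    intro z hz
    have h1 : e z = (c ⁻¹' {z}).indicator (fun _ => (1:ℝ)) := by
      funext y; simp [he, Set.indicator_apply]
    rw [h1]
    constructor
    · exact (MeasureTheory.integrable_indicator_iff (hc z hz)).mpr
        (MeasureTheory.integrableOn_const (by rw [hμ z hz]; exact ENNReal.ofReal_ne_top))
    · rw [MeasureTheory.integral_indicator_const _ (hc z hz), Measure.real, hμ z hz,
        ENNReal.toReal_ofReal hh.le]; simp
  have hterm : ∀ l : ℕ, (l.factorial : ℝ)⁻¹ *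
      ∫ v : Fin l → X, (∏ i, nI (c ⁻¹' (F : Set Z)) (v i)) * detK K (Sum.elim x v)
        ∂(Measure.pi fun _ => μ) =
      h⁻¹ ^ n * ∑ ω, T ω * (if Function.Injective (fun i => c (x i)) ∧ (∀ a, c (x a) ∈ S ω) then
        (-1:ℝ)^l * ((((F ∩ S ω) \ Finset.univ.image (fun i => c (x i))).card.choose l : ℕ) : ℝ)
        else 0) := by
    intro l
    have hpt : ∀ v : Fin l → X, (∏ i, nI (c ⁻¹' (F : Set Z)) (v i)) * detK K (Sum.elim x v) =
        ∑ w : Fin l → F, (∏ i, e (w i) (v i)) * ((-1)^l * (h⁻¹ ^ (n+l) *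
          Dst T S (Sum.elim (fun i => c (x i)) (fun i => (w i : Z))))) := by
      intro v
      by_cases hv : ∀ i, c (v i) ∈ F
      · have e1 : ∀ w : Fin l → F, (∏ i, e (w i) (v i)) =
            if w = (fun i => ⟨c (v i), hv i⟩) then 1 else 0 := by
          intro w
          split_ifs with hw
          · subst hw; simp [he]
          · have : ∃ i, c (v i) ≠ w i := by
              by_contra hcon
              push Not at hcon
              exact hw (funext fun i => Subtype.ext (hcon i).symm)
            obtain ⟨i, hi⟩ := this
            exact Finset.prod_eq_zero (Finset.mem_univ i) (by simp [he, hi])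
        simp_rw [e1, ite_mul, one_mul, zero_mul]
        rw [Finset.sum_ite_eq' Finset.univ, if_pos (Finset.mem_univ _)]
        have e2 : (∏ i, nI (c ⁻¹' (F : Set Z)) (v i)) = (-1)^l := by
          have : ∀ i, nI (c ⁻¹' (F : Set Z)) (v i) = -1 := by
            intro i; simp [nI, hv i]
          simp [this]
        rw [e2, hdet]
        have e3 : (fun i => c (Sum.elim x v i)) =
            Sum.elim (fun i => c (x i)) (fun i => c (v i)) := by
          funext i; rcases i with i | i <;> rfl
        rw [e3, hD' _ (by rintro (i | i); exacts [hx' i, hv i])]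
        simp
      · push Not at hv
        obtain ⟨i, hi⟩ := hv
        rw [Finset.prod_eq_zero (Finset.mem_univ i) (by simp [nI, hi]), zero_mul]
        symm
        refine Finset.sum_eq_zero fun w _ => ?_
        rw [Finset.prod_eq_zero (Finset.mem_univ i), zero_mul]
        have : c (v i) ≠ w i := fun hc' => hi (hc' ▸ (w i).2)
        simp [he, this]
    simp_rw [hpt]
    rw [MeasureTheory.integral_finsetSum]
    · have e4 : ∀ w : Fin l → F, ∫ v : Fin l → X, (∏ i, e (w i) (v i)) * ((-1)^l * (h⁻¹ ^ (n+l) *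
          Dst T S (Sum.elim (fun i => c (x i)) (fun i => (w i : Z))))) ∂(Measure.pi fun _ => μ) =
          h⁻¹ ^ n * ((-1)^l * Dst T S (Sum.elim (fun i => c (x i)) (fun i => (w i : Z)))) := by
        intro w
        rw [MeasureTheory.integral_mul_const,
          MeasureTheory.integral_fintype_prod_eq_prod (fun i : Fin l => e (w i))]
        rw [Finset.prod_congr rfl fun i _ => (heint (w i) (w i).2).2]
        simp only [Finset.prod_const, Finset.card_univ, Fintype.card_fin]
        rw [pow_add]
        have : h ^ l * h⁻¹ ^ l = 1 := by rw [← mul_pow, mul_inv_cancel₀ hh.ne', one_pow]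
        linear_combination (h⁻¹ ^ n * (-1)^l *
          Dst T S (Sum.elim (fun i => c (x i)) (fun i => (w i : Z)))) * this
      simp_rw [e4]
      rw [← Finset.mul_sum, ← Finset.mul_sum]
      unfold Dst
      rw [Finset.sum_comm]
      simp_rw [← Finset.mul_sum]
      rw [mul_left_comm, Finset.mul_sum, Finset.mul_sum]
      congr 1
      refine Finset.sum_congr rfl fun ω _ => ?_
      have hcnt := count_inj (l := l) F (S ω) (fun i => c (x i))
      have hcnt2 : (∑ w : Fin l → F, if Function.Injective (Sum.elim (fun i => c (x i))
          (fun i => (w i : Z))) ∧ (∀ a, Sum.elim (fun i => c (x i)) (fun i => (w i : Z)) a ∈ S ω)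
          then (1:ℝ) else 0) = _ := Eq.trans (by congr!) hcnt
      refine (congrArg (fun q => (l.factorial:ℝ)⁻¹ * ((-1)^l * (T ω * q)))
        (Eq.trans (by congr!) hcnt2)).trans ?_
      split_ifs with hif
      · rw [Nat.descFactorial_eq_factorial_mul_choose]
        push_cast
        have : (l.factorial : ℝ) ≠ 0 := by positivity
        field_simp
      · simp
    · intro w _
      refine Integrable.mul_const ?_ _
      exact Integrable.fintype_prod fun i => (heint (w i) (w i).2).1
  unfold Jan
  simp_rw [hterm]
  rw [tsum_mul_left]
  refine mul_nonneg (by positivity) ?_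
  have hs : ∀ ω, HasSum (fun l : ℕ => T ω * (if Function.Injective (fun i => c (x i)) ∧
      (∀ a, c (x a) ∈ S ω) then
        (-1:ℝ)^l * ((((F ∩ S ω) \ Finset.univ.image (fun i => c (x i))).card.choose l : ℕ) : ℝ)
        else 0)) (T ω * if Function.Injective (fun i => c (x i)) ∧
      (∀ a, c (x a) ∈ S ω) then (if ((F ∩ S ω) \ Finset.univ.image (fun i => c (x i))).card = 0
        then 1 else 0) else 0) := by
    intro ω
    refine HasSum.mul_left _ ?_
    split_ifs with h1 h2
    · have := alt_choose_hasSum ((F ∩ S ω) \ Finset.univ.image (fun i => c (x i))).card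
      rwa [if_pos h2] at this
    · have := alt_choose_hasSum ((F ∩ S ω) \ Finset.univ.image (fun i => c (x i))).card
      rwa [if_neg h2] at this
    · exact hasSum_zero
  rw [(hasSum_sum fun ω _ => hs ω).tsum_eq]
  refine Finset.sum_nonneg fun ω _ => mul_nonneg (hT ω) ?_
  split_ifs <;> norm_num

end step
end AW
namespace AW
section mrec
variable {Y : Type} [Fintype Y] [LinearOrder Y] {m : ℕ}

theorem EE_isUnit (P : ℕ → Y → Y → ℝ) : IsUnit (1 - QQ m P).det := by
  have := det_one_sub_QQ (m := m) P (fun _ => 1)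
  rw [Matrix.diagonal_one, Matrix.one_mul] at this
  rw [this]; exact isUnit_one

theorem EE_row {α : Type} (P : ℕ → Y → Y → ℝ) (A : Matrix (Fin (m+1) × Y) α ℝ)
    (k : Fin (m+1)) (y : Y) (a : α) :
    (EE m P * A) (k, y) a = A (k, y) a +
      if h : k.val < m then ∑ z, P k y z * (EE m P * A) (⟨k.val+1, by omega⟩, z) a else 0 := by
  have h1 : EE m P * A = A + QQ m P * (EE m P * A) := by
    have : (1 - QQ m P) * (EE m P * A) = A := by
      rw [EE, ← Matrix.mul_assoc, Matrix.mul_nonsing_inv _ (EE_isUnit P), Matrix.one_mul]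
    rw [Matrix.sub_mul, Matrix.one_mul] at this
    rw [← sub_eq_iff_eq_add]; exact this
  conv_lhs => rw [h1]
  rw [Matrix.add_apply]
  congr 1
  rw [Matrix.mul_apply, Fintype.sum_prod_type]
  split_ifs with h
  · rw [Finset.sum_eq_single ⟨k.val+1, by omega⟩]
    · simp [QQ]
    · intro l _ hl
      refine Finset.sum_eq_zero fun y' _ => ?_
      have : ¬ (l.val = k.val + 1) := fun h => hl (Fin.ext (by simp [h]))
      simp [QQ, this]
    · simp
  · refine Finset.sum_eq_zero fun l _ => Finset.sum_eq_zero fun y' _ => ?_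
    have : ¬ (l.val = k.val + 1) := by omega
    simp [QQ, this]

theorem EE_col {α : Type} (P : ℕ → Y → Y → ℝ) (A : Matrix α (Fin (m+1) × Y) ℝ)
    (k : ℕ) (hk : k < m) (y : Y) (a : α) :
    (A * EE m P) a (⟨k+1, by omega⟩, y) = A a (⟨k+1, by omega⟩, y) +
      ∑ z, (A * EE m P) a (⟨k, by omega⟩, z) * P k z y := by
  have h1 : A * EE m P = A + (A * EE m P) * QQ m P := by
    have : (A * EE m P) * (1 - QQ m P) = A := by
      rw [EE, Matrix.mul_assoc, Matrix.nonsing_inv_mul _ (EE_isUnit P), Matrix.mul_one]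
    rw [Matrix.mul_sub, Matrix.mul_one] at this
    rw [← sub_eq_iff_eq_add]; exact this
  conv_lhs => rw [h1]
  rw [Matrix.add_apply]
  congr 1
  rw [Matrix.mul_apply, Fintype.sum_prod_type]
  rw [Finset.sum_eq_single ⟨k, by omega⟩]
  · simp [QQ]
  · intro l _ hl
    refine Finset.sum_eq_zero fun y' _ => ?_
    have : ¬ (k = l.val) := fun h => hl (Fin.ext (by simp [h]))
    simp [QQ, this]
  · simp

theorem EE_col0 {α : Type} (P : ℕ → Y → Y → ℝ) (A : Matrix α (Fin (m+1) × Y) ℝ) (y : Y) (a : α) :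
    (A * EE m P) a (0, y) = A a (0, y) := by
  have h1 : A * EE m P = A + (A * EE m P) * QQ m P := by
    have : (A * EE m P) * (1 - QQ m P) = A := by
      rw [EE, Matrix.mul_assoc, Matrix.nonsing_inv_mul _ (EE_isUnit P), Matrix.mul_one]
    rw [Matrix.mul_sub, Matrix.mul_one] at this
    rw [← sub_eq_iff_eq_add]; exact this
  rw [h1, Matrix.add_apply, Matrix.mul_apply, Finset.sum_eq_zero, add_zero]
  rintro ⟨l, z⟩ _
  simp [QQ]

theorem EE_ge (P : ℕ → Y → Y → ℝ) (k l : Fin (m+1)) (y y' : Y) (h : l ≤ k) :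
    EE m P (k, y) (l, y') = (1 : Matrix (Fin (m+1) × Y) (Fin (m+1) × Y) ℝ) (k, y) (l, y') := by
  obtain ⟨d, hd⟩ : ∃ d, d = m - k.val := ⟨_, rfl⟩
  induction d generalizing k y with
  | zero =>
    have := EE_row P (1 : Matrix (Fin (m+1) × Y) (Fin (m+1) × Y) ℝ) k y (l, y')
    rw [Matrix.mul_one, dif_neg (by omega), add_zero] at this
    exact this
  | succ d ih =>
    have := EE_row P (1 : Matrix (Fin (m+1) × Y) (Fin (m+1) × Y) ℝ) k y (l, y')
    rw [Matrix.mul_one, dif_pos (by omega)] at this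
    rw [this, Finset.sum_eq_zero, add_zero]
    intro z _
    rw [ih ⟨k.val+1, by omega⟩ z (by rw [Fin.le_def] at h ⊢; simp; omega) (by simp; omega)]
    rw [Matrix.one_apply_ne, mul_zero]
    intro hc
    have := congrArg (fun p => p.1.val) hc
    simp only at this
    rw [Fin.le_def] at h; omega

theorem EE_succ (P : ℕ → Y → Y → ℝ) (k : ℕ) (hk : k < m) (y y' : Y) :
    EE m P (⟨k, by omega⟩, y) (⟨k+1, by omega⟩, y') = P k y y' := by
  have := EE_row P (1 : Matrix (Fin (m+1) × Y) (Fin (m+1) × Y) ℝ) ⟨k, by omega⟩ y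
    (⟨k+1, by omega⟩, y')
  rw [Matrix.mul_one, dif_pos hk] at this
  rw [this, Matrix.one_apply_ne (by intro hc; simp at hc), zero_add]
  rw [Finset.sum_eq_single y']
  · rw [EE_ge P _ _ _ _ le_rfl]; simp
  · intro z _ hz
    rw [EE_ge P _ _ _ _ le_rfl, Matrix.one_apply_ne (by simpa using hz), mul_zero]
  · simp

theorem EE_lt (P : ℕ → Y → Y → ℝ) (k l : ℕ) (hkl : k + 1 < l) (hl : l ≤ m) (y y' : Y) :
    EE m P (⟨k, by omega⟩, y) (⟨l, by omega⟩, y') =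
      ∑ z, P k y z * EE m P (⟨k+1, by omega⟩, z) (⟨l, by omega⟩, y') := by
  have := EE_row P (1 : Matrix (Fin (m+1) × Y) (Fin (m+1) × Y) ℝ) ⟨k, by omega⟩ y
    (⟨l, by omega⟩, y')
  rw [Matrix.mul_one, dif_pos (by simp only; omega)] at this
  rw [this, Matrix.one_apply_ne (by intro hc; simp at hc; omega), zero_add]

end mrec

/-! ### grids -/
abbrev Gr (q : ℕ) : Type := {i : ℤ // i ∈ Finset.Ico (-(q:ℤ)^2) ((q:ℤ)^2)}

def pos {q : ℕ} (y : Gr q) : ℝ := (y.1 : ℝ) / q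

def ext (q : ℕ) (f : Gr q → ℝ) (x : ℝ) : ℝ :=
  if h : ⌊(q:ℝ) * x⌋ ∈ Finset.Ico (-(q:ℤ)^2) ((q:ℤ)^2) then f ⟨⌊(q:ℝ) * x⌋, h⟩ else 0

theorem ext_mul (q : ℕ) (f g : Gr q → ℝ) (x : ℝ) : ext q (fun y => f y * g y) x = ext q f x * ext q g x := by
  unfold ext; split_ifs <;> simp

theorem Gr_q {q : ℕ} (y : Gr q) : 0 < q := by
  rcases Nat.eq_zero_or_pos q with rfl | h
  · exfalso
    have := y.2
    simp at this
  · exact h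

theorem cell_measure {q : ℕ} (hq : 0 < q) (i : ℤ) :
    MeasurableSet {x : ℝ | ⌊(q:ℝ) * x⌋ = i} ∧ volume {x : ℝ | ⌊(q:ℝ) * x⌋ = i} = ENNReal.ofReal (1/q) := by
  have hq' : (0:ℝ) < q := by exact_mod_cast hq
  have : {x : ℝ | ⌊(q:ℝ) * x⌋ = i} = Set.Ico ((i:ℝ)/q) ((i+1:ℝ)/q) := by
    ext x
    simp only [Set.mem_ofPred_eq, Set.mem_Ico]
    rw [Int.floor_eq_iff, div_le_iff₀ hq', lt_div_iff₀ hq', mul_comm x]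
  rw [this]
  refine ⟨measurableSet_Ico, ?_⟩
  rw [Real.volume_Ico]
  congr 1
  ring

theorem ext_integral {q : ℕ} (f : Gr q → ℝ) :
    Integrable (ext q f) volume ∧ ∫ x, ext q f x = ∑ y, f y / q := by
  rcases Nat.eq_zero_or_pos q with rfl | hq
  · have : ext 0 f = fun _ => 0 := by
      funext x; unfold ext; simp
    rw [this]
    simp
  have h1 : ext q f = fun x => ∑ y : Gr q, {x : ℝ | ⌊(q:ℝ) * x⌋ = y.1}.indicator (fun _ => f y) x := by
    funext x
    unfold ext
    split_ifs with h
    · rw [Finset.sum_eq_single ⟨⌊(q:ℝ) * x⌋, h⟩]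
      · simp
      · intro y _ hy
        rw [Set.indicator_of_notMem]
        intro hc
        exact hy (Subtype.ext hc.symm)
      · simp
    · symm
      refine Finset.sum_eq_zero fun y _ => ?_
      rw [Set.indicator_of_notMem]
      intro hc
      exact h (by rw [show ⌊(q:ℝ) * x⌋ = y.1 from hc]; exact y.2)
  have h2 : ∀ y : Gr q, Integrable ({x : ℝ | ⌊(q:ℝ) * x⌋ = y.1}.indicator (fun _ => f y)) volume := by
    intro y
    refine (MeasureTheory.integrable_indicator_iff (cell_measure hq _).1).mpr ?_
    exact MeasureTheory.integrableOn_const (by rw [(cell_measure hq _).2]; exact ENNReal.ofReal_ne_top)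
  rw [h1]
  refine ⟨MeasureTheory.integrable_finsetSum _ fun y _ => h2 y, ?_⟩
  rw [MeasureTheory.integral_finsetSum _ fun y _ => h2 y]
  refine Finset.sum_congr rfl fun y _ => ?_
  rw [MeasureTheory.integral_indicator_const _ (cell_measure hq _).1, Measure.real,
    (cell_measure hq _).2, ENNReal.toReal_ofReal (by positivity)]
  simp; ring

theorem RS {F : ∀ q, Gr q → ℝ} {u b : ℝ → ℝ} (hb : Integrable b)
    (hbd : ∀ᶠ q in atTop, ∀ z, |ext q (F q) z| ≤ b z)
    (hl : ∀ z, Tendsto (fun q => ext q (F q) z) atTop (𝓝 (u z))) :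
    Tendsto (fun q => ∑ y, F q y / q) atTop (𝓝 (∫ z, u z)) := by
  simp_rw [← (ext_integral (F _)).2]
  refine MeasureTheory.tendsto_integral_filter_of_dominated_convergence b ?_ ?_ hb ?_
  · exact Eventually.of_forall fun q => (ext_integral (F q)).1.aestronglyMeasurable
  · filter_upwards [hbd] with q hq
    exact Eventually.of_forall fun z => hq z
  · exact Eventually.of_forall hl

/-- hat is close -/
theorem floor_close {q : ℕ} (hq : 0 < q) (x : ℝ) : |(⌊(q:ℝ) * x⌋ : ℝ) / q - x| ≤ 1 / q := by
  have hq' : (0:ℝ) < q := by exact_mod_cast hq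
  have h1 := Int.floor_le ((q:ℝ) * x)
  have h2 := Int.lt_floor_add_one ((q:ℝ) * x)
  have : (⌊(q:ℝ) * x⌋ : ℝ) / q - x = (⌊(q:ℝ) * x⌋ - q * x) / q := by field_simp
  rw [this, abs_div, abs_of_pos hq']
  refine div_le_div_of_nonneg_right ?_ hq'.le
  rw [abs_le]; constructor <;> linarith

theorem floor_close1 {q : ℕ} (hq : 0 < q) (x : ℝ) : |(⌊(q:ℝ) * x⌋ : ℝ) / q - x| ≤ 1 := by
  refine (floor_close hq x).trans ?_
  have : (1:ℝ) ≤ q := by exact_mod_cast hq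
  rw [div_le_one (by linarith)]; exact this

theorem hat_tendsto {y : ℕ → ℝ} {x : ℝ} (hy : Tendsto y atTop (𝓝 x)) :
    Tendsto (fun q : ℕ => (⌊(q:ℝ) * y q⌋ : ℝ) / q) atTop (𝓝 x) := by
  have h0 : Tendsto (fun q : ℕ => (⌊(q:ℝ) * y q⌋ : ℝ) / q - y q) atTop (𝓝 0) := by
    refine squeeze_zero_norm' (a := fun q : ℕ => 1 / (q:ℝ)) ?_ tendsto_one_div_atTop_nhds_zero_nat
    filter_upwards [eventually_gt_atTop 0] with q hq
    exact floor_close hq _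
  simpa using h0.add hy

theorem ext_eventually {y : ℕ → ℝ} {x : ℝ} (hy : Tendsto y atTop (𝓝 x)) :
    ∀ᶠ q : ℕ in atTop, ⌊(q:ℝ) * y q⌋ ∈ Finset.Ico (-(q:ℤ)^2) ((q:ℤ)^2) := by
  have h1 : ∀ᶠ q in atTop, |y q| < |x| + 1 := hy.abs.eventually_lt_const (by linarith)
  have h2 : ∀ᶠ q : ℕ in atTop, |x| + 1 < (q:ℝ) :=
    (tendsto_natCast_atTop_atTop (R := ℝ)).eventually_gt_atTop _
  filter_upwards [h1, h2] with q h1 h2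
  have hq : (0:ℝ) < q := by linarith [abs_nonneg x]
  have h3 : |y q| < q := h1.trans h2
  rw [abs_lt] at h3
  rw [Finset.mem_Ico]
  constructor
  · rw [Int.le_floor]; push_cast; nlinarith
  · rw [Int.floor_lt]; push_cast; nlinarith

/-- controlled convergence of grid functions -/
structure CC (W : ℝ → ℝ) (C : ℝ) (f : ∀ q, Gr q → ℝ) (u : ℝ → ℝ) : Prop where
  bd : ∀ q (y : Gr q), |f q y| ≤ C * W (pos y)
  conv : ∀ (y : ℕ → ℝ) (x : ℝ), Tendsto y atTop (𝓝 x) →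
    Tendsto (fun q => ext q (f q) (y q)) atTop (𝓝 (u x))

structure WW (c : ℝ) (W : ℝ → ℝ) : Prop where
  pos : ∀ x, 0 < W x
  lip : ∀ x y, W x ≤ W y * Real.exp (c * |x - y|)

theorem CC.of_cont {c C : ℝ} {W : ℝ → ℝ} {u : ℝ → ℝ} (hu : Continuous u)
    (hb : ∀ x, |u x| ≤ C * W x) : CC W C (fun q y => u (AW.pos y)) u := by
  refine ⟨fun q y => hb _, fun y x hy => ?_⟩
  refine ((hu.tendsto x).comp (hat_tendsto hy)).congr' ?_
  filter_upwards [ext_eventually hy] with q hq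
  unfold ext
  rw [dif_pos hq]
  rfl

theorem CC.ext_bd {c C : ℝ} {W : ℝ → ℝ} {f : ∀ q, Gr q → ℝ} {u : ℝ → ℝ} (h : CC W C f u)
    (hc : 0 ≤ c) (hC : 0 ≤ C) (hW : WW c W) (q : ℕ) (z : ℝ) :
    |ext q (f q) z| ≤ C * Real.exp c * W z := by
  have hW0 := hW.pos z
  unfold ext
  split_ifs with hz
  · have hq := Gr_q ⟨_, hz⟩
    refine (h.bd q _).trans ?_
    rw [mul_assoc]
    refine mul_le_mul_of_nonneg_left ?_ hC
    refine (hW.lip _ z).trans ?_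
    rw [mul_comm]
    refine mul_le_mul_of_nonneg_right ?_ hW0.le
    refine Real.exp_le_exp.mpr ?_
    have := floor_close1 hq z
    unfold pos
    nlinarith
  · rw [abs_zero]; positivity

theorem int_exp_abs : Integrable (fun x : ℝ => Real.exp (-|x|)) := by
  rw [← MeasureTheory.integrableOn_univ, ← Set.Iic_union_Ioi (a := (0:ℝ))]
  refine IntegrableOn.union ?_ ?_
  · refine (integrableOn_exp_Iic 0).congr_fun (fun x hx => ?_) measurableSet_Iic
    rw [Set.mem_Iic] at hx
    simp only [abs_of_nonpos hx, neg_neg]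
  · refine (integrableOn_exp_neg_Ioi 0).congr_fun (fun x hx => ?_) measurableSet_Ioi
    rw [Set.mem_Ioi] at hx
    simp only [abs_of_pos hx]

theorem int_exp_abs_sub (x : ℝ) : Integrable (fun z : ℝ => Real.exp (-|x - z|)) :=
  int_exp_abs.comp_sub_left x

theorem int_exp_abs_sub_eq (x : ℝ) :
    ∫ z : ℝ, Real.exp (-|x - z|) = ∫ z : ℝ, Real.exp (-|z|) :=
  MeasureTheory.integral_sub_left_eq_self (fun z : ℝ => Real.exp (-|z|)) volume x

section stepl
variable {c C Cp : ℝ} {W : ℝ → ℝ} {f : ∀ q, Gr q → ℝ} {u : ℝ → ℝ} {p : ℝ → ℝ → ℝ}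

theorem CC.kbd (h : CC W C f u) (hc : 0 ≤ c) (hC : 0 ≤ C) (hW : WW c W) (hCp : 0 ≤ Cp)
    (hp : ∀ x z, |p x z| ≤ Cp * Real.exp (-((c+1) * |x - z|))) (q : ℕ) (x z : ℝ) :
    |ext q (fun y => p x (pos y) * f q y) z| ≤
      Cp * C * Real.exp (2*c+1) * W x * Real.exp (-|x - z|) := by
  rw [ext_mul, abs_mul]
  have h1 : |ext q (fun y => p x (pos y)) z| ≤ Cp * (Real.exp (c+1) * Real.exp (-((c+1) * |x - z|))) := by
    unfold ext
    split_ifs with hz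
    · have hq := Gr_q ⟨_, hz⟩
      refine (hp _ _).trans (mul_le_mul_of_nonneg_left ?_ hCp)
      rw [← Real.exp_add]
      refine Real.exp_le_exp.mpr ?_
      have h2 := floor_close1 hq z
      have h3 : |x - z| ≤ |x - (⌊(q:ℝ) * z⌋ : ℝ) / q| + |(⌊(q:ℝ) * z⌋ : ℝ) / q - z| :=
        abs_sub_le _ _ _
      unfold pos
      simp only
      nlinarith
    · rw [abs_zero]; positivity
  have h2 := h.ext_bd hc hC hW q z
  have h3 := hW.lip z x
  have hWx := hW.pos x
  have hWz := hW.pos z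
  calc _ ≤ Cp * (Real.exp (c+1) * Real.exp (-((c+1) * |x - z|))) * (C * Real.exp c * W z) :=
        mul_le_mul h1 h2 (abs_nonneg _) (by positivity)
    _ ≤ Cp * (Real.exp (c+1) * Real.exp (-((c+1) * |x - z|))) *
        (C * Real.exp c * (W x * Real.exp (c * |z - x|))) := by gcongr
    _ = _ := by
      rw [abs_sub_comm z x]
      have e1 : Real.exp (2*c+1) = Real.exp (c+1) * Real.exp c := by rw [← Real.exp_add]; ring_nf
      have e2 : Real.exp (-|x - z|) = Real.exp (-((c+1) * |x - z|)) * Real.exp (c * |x - z|) := by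
        rw [← Real.exp_add]; ring_nf
      rw [e1, e2]; ring

theorem CC.step (h : CC W C f u) (hc : 0 ≤ c) (hC : 0 ≤ C) (hW : WW c W) (hCp : 0 ≤ Cp)
    (hp : ∀ x z, |p x z| ≤ Cp * Real.exp (-((c+1) * |x - z|)))
    (hpc : Continuous (Function.uncurry p)) :
    CC W (Cp * C * Real.exp (2*c+1) * ∫ z : ℝ, Real.exp (-|z|))
      (fun q y => ∑ z, p (pos y) (pos z) / q * f q z) (fun x => ∫ z, p x z * u z) := by
  refine ⟨fun q y => ?_, fun y x hy => ?_⟩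
  · have e1 : ∑ z, p (pos y) (pos z) / q * f q z = ∫ z, ext q (fun z => p (pos y) (pos z) * f q z) z := by
      rw [(ext_integral _).2]
      exact Finset.sum_congr rfl fun z _ => by ring
    rw [e1]
    refine (MeasureTheory.norm_integral_le_integral_norm (G := ℝ)
      (fun z => ext q (fun z => p (pos y) (pos z) * f q z) z)).trans ?_
    calc _ ≤ ∫ z, Cp * C * Real.exp (2*c+1) * W (pos y) * Real.exp (-|pos y - z|) := by
          refine MeasureTheory.integral_mono_of_nonneg (Eventually.of_forall fun z => norm_nonneg _)
            ((int_exp_abs_sub _).const_mul _) (Eventually.of_forall fun z => ?_)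
          exact h.kbd hc hC hW hCp hp q _ z
      _ = _ := by
          rw [MeasureTheory.integral_const_mul, int_exp_abs_sub_eq]; ring
  · have hx := hat_tendsto hy
    set xq : ℕ → ℝ := fun q : ℕ => (⌊(q:ℝ) * y q⌋ : ℝ) / q with hxq
    have key : Tendsto (fun q => ∑ z : Gr q, p (xq q) (pos z) * f q z / q) atTop
        (𝓝 (∫ z, p x z * u z)) := by
      refine RS (b := fun z => Cp * C * Real.exp (2*c+1) * (W x * Real.exp (c+1)) *
        Real.exp (-|x - z|)) ((int_exp_abs_sub x).const_mul _) ?_ ?_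
      · have h1 : ∀ᶠ q in atTop, |xq q - x| < 1 := by
          have := (hx.sub_const x).abs
          rw [sub_self, abs_zero] at this
          exact this.eventually_lt_const one_pos
        filter_upwards [h1] with q hq z
        refine (h.kbd hc hC hW hCp hp q (xq q) z).trans ?_
        have e1 : W (xq q) ≤ W x * Real.exp c := by
          refine (hW.lip (xq q) x).trans (mul_le_mul_of_nonneg_left ?_ (hW.pos x).le)
          exact Real.exp_le_exp.mpr (by nlinarith)
        have e2 : Real.exp (-|xq q - z|) ≤ Real.exp 1 * Real.exp (-|x - z|) := by
          rw [← Real.exp_add]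
          refine Real.exp_le_exp.mpr ?_
          have : |x - z| ≤ |x - xq q| + |xq q - z| := abs_sub_le _ _ _
          rw [abs_sub_comm x (xq q)] at this
          linarith
        have hWx := hW.pos x
        have hWq := hW.pos (xq q)
        calc _ ≤ Cp * C * Real.exp (2*c+1) * (W x * Real.exp c) *
              (Real.exp 1 * Real.exp (-|x - z|)) := by gcongr
          _ = _ := by rw [Real.exp_add c 1]; ring
      · intro z
        have h2 := h.conv (fun _ => z) z tendsto_const_nhds
        simp_rw [ext_mul]
        refine Tendsto.mul ?_ h2
        have h3 := hat_tendsto (y := fun _ => z) (x := z) tendsto_const_nhds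
        have h4 : Tendsto (fun q => p (xq q) ((⌊(q:ℝ) * z⌋ : ℝ) / q)) atTop (𝓝 (p x z)) :=
          (hpc.tendsto (x, z)).comp (hx.prodMk_nhds h3)
        refine h4.congr' ?_
        filter_upwards [ext_eventually (y := fun _ => z) (x := z) tendsto_const_nhds] with q hq
        unfold ext
        rw [dif_pos hq]
        rfl
    refine key.congr' ?_
    filter_upwards [ext_eventually hy] with q hq
    unfold ext
    rw [dif_pos hq]
    refine Finset.sum_congr rfl fun z _ => ?_
    simp only [pos, hxq]
    ring

theorem CC.pair {f' : ∀ q, Gr q → ℝ} {u' W' : ℝ → ℝ} {C' : ℝ}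
    (h : CC W C f u) (h' : CC W' C' f' u') (hc : 0 ≤ c) (hC : 0 ≤ C) (hC' : 0 ≤ C')
    (hW : WW c W) (hW' : WW c W') (hi : Integrable fun z => W z * W' z) :
    Tendsto (fun q => ∑ z : Gr q, f q z * f' q z / q) atTop (𝓝 (∫ z, u z * u' z)) := by
  refine RS (b := fun z => C * Real.exp c * (C' * Real.exp c) * (W z * W' z)) (hi.const_mul _) ?_ ?_
  · refine Eventually.of_forall fun q z => ?_
    rw [ext_mul, abs_mul]
    have hWx := hW.pos z
    have hWq := hW'.pos z
    calc _ ≤ (C * Real.exp c * W z) * (C' * Real.exp c * W' z) :=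
          mul_le_mul (h.ext_bd hc hC hW q z) (h'.ext_bd hc hC' hW' q z) (abs_nonneg _) (by positivity)
      _ = _ := by ring
  · intro z
    simp_rw [ext_mul]
    exact (h.conv (fun _ => z) z tendsto_const_nhds).mul
      (h'.conv (fun _ => z) z tendsto_const_nhds)

end stepl
end AW
namespace AW

structure Chain (m N : ℕ) (φ ψ : ℕ → Fin N → ℝ → ℝ) (p : ℕ → ℝ → ℝ → ℝ)
    (pp : ℕ → ℕ → ℝ → ℝ → ℝ) (c C Cp : ℝ) (W1 W2 : ℝ → ℝ) : Prop where
  hc : 0 ≤ c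
  hC : 0 ≤ C
  hCp : 0 ≤ Cp
  w1 : WW c W1
  w2 : WW c W2
  wi : Integrable fun z => W2 z * W1 z
  pc : ∀ k < m, Continuous (Function.uncurry (p k))
  pb : ∀ k < m, ∀ x z, |p k x z| ≤ Cp * Real.exp (-((c+1) * |x - z|))
  phc : ∀ j, Continuous (φ 0 j)
  phb : ∀ j x, |φ 0 j x| ≤ C * W2 x
  psc : ∀ i, Continuous (ψ m i)
  psb : ∀ i x, |ψ m i x| ≤ C * W1 x
  phr : ∀ l < m, ∀ j y, φ (l+1) j y = ∫ z, p l z y * φ l j z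
  psr : ∀ k < m, ∀ i y, ψ k i y = ∫ z, p k y z * ψ (k+1) i z
  pp1 : ∀ k < m, ∀ x y, pp k (k+1) x y = p k x y
  ppr : ∀ k l, k + 1 < l → l ≤ m → ∀ x y, pp k l x y = ∫ z, p k x z * pp (k+1) l z y
  mph : ∀ f : Fin N → ℝ, Monotone f → 0 ≤ Matrix.det (Matrix.of fun i j => φ 0 i (f j))
  mps : ∀ f : Fin N → ℝ, Monotone f → 0 ≤ Matrix.det (Matrix.of fun i j => ψ m j (f i))
  mp : ∀ k < m, ∀ f f' : Fin N → ℝ, Monotone f → Monotone f' →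
      0 ≤ Matrix.det (Matrix.of fun i j => p k (f i) (f' j))
  dG : (Matrix.of fun j i => ∫ z, φ 0 j z * ψ 0 i z).det ≠ 0

section chain
variable {m N : ℕ} {φ ψ : ℕ → Fin N → ℝ → ℝ} {p : ℕ → ℝ → ℝ → ℝ}
  {pp : ℕ → ℕ → ℝ → ℝ → ℝ} {c C Cp : ℝ} {W1 W2 : ℝ → ℝ}

def Gc (φ ψ : ℕ → Fin N → ℝ → ℝ) : Matrix (Fin N) (Fin N) ℝ :=
  Matrix.of fun j i => ∫ z, φ 0 j z * ψ 0 i z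

def Kc (m : ℕ) (φ ψ : ℕ → Fin N → ℝ → ℝ) (pp : ℕ → ℕ → ℝ → ℝ → ℝ) (a b : Fin (m+1) × ℝ) : ℝ :=
  (if a.1 < b.1 then -pp a.1 b.1 a.2 b.2 else 0) +
    ∑ i, ∑ j, ψ a.1 i a.2 * (Gc φ ψ)⁻¹ i j * φ b.1 j b.2

def fq (φ : ℕ → Fin N → ℝ → ℝ) (q : ℕ) : Fin N → Gr q → ℝ := fun j y => φ 0 j (pos y)
def pq (p : ℕ → ℝ → ℝ → ℝ) (q : ℕ) : ℕ → Gr q → Gr q → ℝ := fun k y z => p k (pos y) (pos z) / q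
def sq (m : ℕ) (ψ : ℕ → Fin N → ℝ → ℝ) (q : ℕ) : Gr q → Fin N → ℝ := fun y i => ψ m i (pos y) / q

def Uq (m : ℕ) (p : ℕ → ℝ → ℝ → ℝ) (ψ : ℕ → Fin N → ℝ → ℝ) (k : Fin (m+1)) (i : Fin N) (q : ℕ)
    (a : Gr q) : ℝ := q * (EE m (pq p q) * PsiHat m (sq m ψ q)) (k, a) i
def Vq (m : ℕ) (p : ℕ → ℝ → ℝ → ℝ) (φ : ℕ → Fin N → ℝ → ℝ) (l : Fin (m+1)) (j : Fin N) (q : ℕ)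
    (a : Gr q) : ℝ := (PhiHat m (fq φ q) * EE m (pq p q)) j (l, a)
def Eq' (m : ℕ) (p : ℕ → ℝ → ℝ → ℝ) (k l : Fin (m+1)) (y : ℝ) (q : ℕ) (a : Gr q) : ℝ :=
  ext q (fun b => q * EE m (pq p q) (k, a) (l, b)) y

theorem cancelq {q : ℕ} (a : Gr q) (x : ℝ) : (q:ℝ) * (x / q) = x := by
  have : (q:ℝ) ≠ 0 := by have := Gr_q a; positivity
  field_simp

theorem Chain.U_CC (h : Chain m N φ ψ p pp c C Cp W1 W2) (k : Fin (m+1)) (i : Fin N) :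
    ∃ D, 0 ≤ D ∧ CC W1 D (Uq m p ψ k i) (ψ k i) := by
  obtain ⟨d, hd⟩ : ∃ d, d = m - k.val := ⟨_, rfl⟩
  induction d generalizing k with
  | zero =>
    have hk : k = Fin.last m := Fin.ext (by simp; omega)
    refine ⟨C, h.hC, ?_⟩
    have := CC.of_cont (c := c) (h.psc i) (h.psb i)
    have e : Uq m p ψ k i = fun q y => ψ m i (pos y) := by
      funext q y
      unfold Uq
      rw [EE_row, dif_neg (by omega), add_zero]
      simp only [PsiHat, Matrix.of_apply, hk, if_true, sq]
      exact cancelq y _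
    rw [e, hk]; exact this
  | succ d ih =>
    have hk : k.val < m := by omega
    obtain ⟨D, hD, hCC⟩ := ih ⟨k.val+1, by omega⟩ (by simp; omega)
    refine ⟨Cp * D * Real.exp (2*c+1) * ∫ z : ℝ, Real.exp (-|z|), ?_, ?_⟩
    rotate_left
    · have := hCC.step h.hc hD h.w1 h.hCp (h.pb k hk) (h.pc k hk)
      have e : Uq m p ψ k i = fun q y => ∑ z, p k (pos y) (pos z) / q *
          Uq m p ψ ⟨k.val+1, by omega⟩ i q z := by
        funext q y
        unfold Uq
        rw [EE_row, dif_pos hk]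
        have : k ≠ Fin.last m := fun hc => by rw [hc] at hk; simp at hk
        simp only [PsiHat, Matrix.of_apply, this, if_false, zero_add]
        rw [Finset.mul_sum]
        refine Finset.sum_congr rfl fun z _ => ?_
        simp only [pq]
        ring
      rw [e]
      have e2 : ψ k i = fun x => ∫ z, p k x z * ψ (k.val+1) i z := by
        funext x; exact h.psr k hk i x
      rw [e2]; exact this
    · have := MeasureTheory.integral_nonneg (μ := volume) (f := fun z : ℝ => Real.exp (-|z|))
        (fun z => (Real.exp_pos _).le)
      have := h.hCp
      positivity

theorem Chain.V_CC (h : Chain m N φ ψ p pp c C Cp W1 W2) (l : ℕ) (hl : l ≤ m) (j : Fin N) :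
    ∃ D, 0 ≤ D ∧ CC W2 D (Vq m p φ ⟨l, by omega⟩ j) (φ l j) := by
  induction l with
  | zero =>
    refine ⟨C, h.hC, ?_⟩
    have := CC.of_cont (c := c) (h.phc j) (h.phb j)
    have e : Vq m p φ ⟨0, by omega⟩ j = fun q y => φ 0 j (pos y) := by
      funext q y
      unfold Vq
      refine (EE_col0 _ _ _ _).trans ?_
      simp [PhiHat, fq]
    rw [e]; exact this
  | succ l ih =>
    obtain ⟨D, hD, hCC⟩ := ih (by omega)
    have hl' : l < m := by omega
    refine ⟨Cp * D * Real.exp (2*c+1) * ∫ z : ℝ, Real.exp (-|z|), ?_, ?_⟩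
    rotate_left
    · have := hCC.step (p := fun x z => p l z x) h.hc hD h.w2 h.hCp
        (fun x z => by rw [abs_sub_comm]; exact h.pb l hl' z x)
        ((h.pc l hl').comp continuous_swap)
      have e : Vq m p φ ⟨l+1, by omega⟩ j = fun q y => ∑ z, p l (pos z) (pos y) / q *
          Vq m p φ ⟨l, by omega⟩ j q z := by
        funext q y
        unfold Vq
        rw [EE_col _ _ l hl']
        simp only [PhiHat, Matrix.of_apply]
        rw [if_neg (by intro hc; simp [Fin.ext_iff] at hc), zero_add]
        refine Finset.sum_congr rfl fun z _ => ?_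
        simp only [pq]
        ring
      rw [e]
      have e2 : φ (l+1) j = fun x => ∫ z, p l z x * φ l j z := by
        funext x; exact h.phr l hl' j x
      rw [e2]; exact this
    · have := MeasureTheory.integral_nonneg (μ := volume) (f := fun z : ℝ => Real.exp (-|z|))
        (fun z => (Real.exp_pos _).le)
      have := h.hCp
      positivity

theorem WW_exp (c : ℝ) (hc : 0 ≤ c) (y : ℝ) : WW c (fun x => Real.exp (-(c * |x - y|))) := by
  refine ⟨fun x => Real.exp_pos _, fun x z => ?_⟩
  rw [← Real.exp_add]
  refine Real.exp_le_exp.mpr ?_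
  have : |z - y| ≤ |x - y| + |x - z| := by
    have := abs_sub_le z x y
    rw [abs_sub_comm z x] at this
    linarith
  nlinarith

theorem Chain.E_CC (h : Chain m N φ ψ p pp c C Cp W1 W2) (l : ℕ) (hl : l ≤ m) (k : ℕ) (hk : k < l) :
    ∃ D, 0 ≤ D ∧ ∀ y, CC (fun x => Real.exp (-(c * |x - y|))) D
      (Eq' m p ⟨k, by omega⟩ ⟨l, by omega⟩ y) (fun x => pp k l x y) := by
  obtain ⟨d, hd⟩ : ∃ d, d = l - 1 - k := ⟨_, rfl⟩
  induction d generalizing k with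
  | zero =>
    have hk' : l = k + 1 := by omega
    subst hk'
    have hkm : k < m := by omega
    have hc := h.hc
    have hCp := h.hCp
    refine ⟨Cp * Real.exp (c+1), by positivity, fun y => ⟨fun q a => ?_, fun s x hs => ?_⟩⟩
    · unfold Eq' ext
      split_ifs with hy
      · beta_reduce
        rw [EE_succ _ k hkm]
        simp only [pq]
        rw [cancelq a]
        refine (h.pb k hkm _ _).trans ?_
        rw [mul_assoc, ← Real.exp_add]
        refine mul_le_mul_of_nonneg_left (Real.exp_le_exp.mpr ?_) hCp
        have h2 := floor_close1 (Gr_q a) y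
        have h3 : |pos a - y| ≤ |pos a - (⌊(q:ℝ) * y⌋ : ℝ) / q| + |(⌊(q:ℝ) * y⌋ : ℝ) / q - y| :=
          abs_sub_le _ _ _
        simp only [pos] at h3 ⊢
        nlinarith [abs_nonneg ((a.1:ℝ) / q - y), abs_nonneg ((a.1:ℝ) / q - (⌊(q:ℝ) * y⌋ : ℝ) / q)]
      · rw [abs_zero]; positivity
    · have h1 := hat_tendsto hs
      have h2 := hat_tendsto (y := fun _ => y) (x := y) tendsto_const_nhds
      have h4 : Tendsto (fun q : ℕ => p k ((⌊(q:ℝ) * s q⌋ : ℝ) / q) ((⌊(q:ℝ) * y⌋ : ℝ) / q)) atTop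
          (𝓝 (pp k (k+1) x y)) := by
        rw [h.pp1 k hkm]
        exact ((h.pc k hkm).tendsto (x, y)).comp (h1.prodMk_nhds h2)
      refine h4.congr' ?_
      filter_upwards [ext_eventually hs,
        ext_eventually (y := fun _ => y) (x := y) tendsto_const_nhds] with q hq1 hq2
      unfold Eq' ext
      rw [dif_pos hq1]; beta_reduce
      rw [dif_pos hq2]
      rw [EE_succ _ k hkm]
      simp only [pq]
      rw [cancelq ⟨_, hq1⟩]
      rfl
  | succ d ih =>
    obtain ⟨D, hD, hCC⟩ := ih (k+1) (by omega) (by omega)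
    have hkm : k < m := by omega
    refine ⟨Cp * D * Real.exp (2*c+1) * ∫ z : ℝ, Real.exp (-|z|), ?_, fun y => ?_⟩
    rotate_left
    · have := (hCC y).step h.hc hD (WW_exp c h.hc y) h.hCp (h.pb k hkm) (h.pc k hkm)
      have e : Eq' m p ⟨k, by omega⟩ ⟨l, by omega⟩ y = fun q a => ∑ z, p k (pos a) (pos z) / q *
          Eq' m p ⟨k+1, by omega⟩ ⟨l, by omega⟩ y q z := by
        funext q a
        unfold Eq' ext
        split_ifs with hy
        · beta_reduce
          rw [EE_lt _ k l (by omega) hl, Finset.mul_sum]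
          refine Finset.sum_congr rfl fun z _ => ?_
          simp only [pq]
          ring
        · simp
      rw [e]
      have e2 : (fun x => pp k l x y) = fun x => ∫ z, p k x z * pp (k+1) l z y := by
        funext x; exact h.ppr k l (by omega) hl x y
      rw [e2]; exact this
    · have := MeasureTheory.integral_nonneg (μ := volume) (f := fun z : ℝ => Real.exp (-|z|))
        (fun z => (Real.exp_pos _).le)
      have := h.hCp
      positivity

def Gq (m : ℕ) (φ ψ : ℕ → Fin N → ℝ → ℝ) (p : ℕ → ℝ → ℝ → ℝ) (q : ℕ) : Matrix (Fin N) (Fin N) ℝ :=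
  GG m (fq φ q) (pq p q) (sq m ψ q)

theorem Chain.G_lim (h : Chain m N φ ψ p pp c C Cp W1 W2) :
    Tendsto (Gq m φ ψ p) atTop (𝓝 (Gc φ ψ)) := by
  refine tendsto_pi_nhds.mpr fun j => tendsto_pi_nhds.mpr fun i => ?_
  obtain ⟨D, hD, h1⟩ := h.U_CC 0 i
  obtain ⟨D', hD', h2⟩ := h.V_CC 0 (by omega) j
  have := h2.pair h1 h.hc hD' hD h.w2 h.w1 h.wi
  refine this.congr fun q => ?_
  unfold Gq GG
  symm
  rw [Matrix.mul_assoc, Matrix.mul_apply, Fintype.sum_prod_type, Finset.sum_eq_single 0]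
  · refine Finset.sum_congr rfl fun z _ => ?_
    unfold Vq Uq
    rw [show (PhiHat m (fq φ q) * EE m (pq p q)) j (⟨0, by omega⟩, z) = PhiHat m (fq φ q) j (0, z)
      from EE_col0 _ _ _ _]
    have := cancelq z
    have hq : (q:ℝ) ≠ 0 := by have := Gr_q z; positivity
    field_simp
  · intro l _ hl
    exact Finset.sum_eq_zero fun y' _ => by simp [PhiHat, hl]
  · simp

theorem Chain.Ginv_lim (h : Chain m N φ ψ p pp c C Cp W1 W2) :
    Tendsto (fun q => (Gq m φ ψ p q)⁻¹) atTop (𝓝 (Gc φ ψ)⁻¹) := by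
  simp_rw [Matrix.inv_def, Ring.inverse_eq_inv']
  have hG := h.G_lim
  refine Tendsto.smul ?_ ?_
  · refine Tendsto.inv₀ ?_ h.dG
    exact ((continuous_id.matrix_det).tendsto (Gc φ ψ)).comp hG
  · exact ((continuous_id.matrix_adjugate).tendsto (Gc φ ψ)).comp hG

def Kq (m : ℕ) (φ ψ : ℕ → Fin N → ℝ → ℝ) (p : ℕ → ℝ → ℝ → ℝ) (q : ℕ) (a b : Fin (m+1) × ℝ) : ℝ :=
  (if a.1 < b.1 then -ext q (Eq' m p a.1 b.1 b.2 q) a.2 else 0) +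
    ∑ i, ∑ j, ext q (Uq m p ψ a.1 i q) a.2 * (Gq m φ ψ p q)⁻¹ i j * ext q (Vq m p φ b.1 j q) b.2

theorem Chain.K_lim (h : Chain m N φ ψ p pp c C Cp W1 W2) (a b : Fin (m+1) × ℝ) :
    Tendsto (fun q => Kq m φ ψ p q a b) atTop (𝓝 (Kc m φ ψ pp a b)) := by
  unfold Kq Kc
  refine Tendsto.add ?_ ?_
  · split_ifs with hab
    · obtain ⟨D, hD, hE⟩ := h.E_CC b.1.val (by omega) a.1.val hab
      exact ((hE b.2).conv (fun _ => a.2) a.2 tendsto_const_nhds).neg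
    · exact tendsto_const_nhds
  · refine tendsto_finsetSum _ fun i _ => tendsto_finsetSum _ fun j _ => ?_
    obtain ⟨D, hD, h1⟩ := h.U_CC a.1 i
    obtain ⟨D', hD', h2⟩ := h.V_CC b.1.val (by omega) j
    refine Tendsto.mul (Tendsto.mul ?_ ?_) ?_
    · exact h1.conv (fun _ => a.2) a.2 tendsto_const_nhds
    · exact (tendsto_pi_nhds.mp (tendsto_pi_nhds.mp h.Ginv_lim i)) j
    · exact h2.conv (fun _ => b.2) b.2 tendsto_const_nhds

def UB {T : Type} (f : ℕ → T → ℝ) : Prop := ∃ C, 0 ≤ C ∧ ∀ᶠ q in atTop, ∀ t, |f q t| ≤ C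

theorem UB.add {T : Type} {f g : ℕ → T → ℝ} (hf : UB f) (hg : UB g) : UB (fun q t => f q t + g q t) := by
  obtain ⟨C, hC, h1⟩ := hf
  obtain ⟨D, hD, h2⟩ := hg
  refine ⟨C + D, by positivity, ?_⟩
  filter_upwards [h1, h2] with q h1 h2 t
  exact (abs_add_le _ _).trans (add_le_add (h1 t) (h2 t))

theorem UB.mul {T : Type} {f g : ℕ → T → ℝ} (hf : UB f) (hg : UB g) : UB (fun q t => f q t * g q t) := by
  obtain ⟨C, hC, h1⟩ := hf
  obtain ⟨D, hD, h2⟩ := hg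
  refine ⟨C * D, by positivity, ?_⟩
  filter_upwards [h1, h2] with q h1 h2 t
  rw [abs_mul]
  exact mul_le_mul (h1 t) (h2 t) (abs_nonneg _) hC

theorem UB.sum {T ι : Type} (s : Finset ι) {f : ι → ℕ → T → ℝ} (hf : ∀ i, UB (f i)) :
    UB (fun q t => ∑ i ∈ s, f i q t) := by
  classical
  induction s using Finset.induction_on with
  | empty => exact ⟨0, le_rfl, by simp⟩
  | insert a s ha ih =>
    simp only [Finset.sum_insert ha]
    exact (hf a).add ih

theorem UB.of_tendsto {T : Type} {f : ℕ → ℝ} {a : ℝ} (hf : Tendsto f atTop (𝓝 a)) :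
    UB (fun q (_ : T) => f q) := by
  refine ⟨|a| + 1, by positivity, ?_⟩
  filter_upwards [hf.abs.eventually (gt_mem_nhds (lt_add_one |a|))] with q hq t
  exact hq.le

theorem UB.of_CC {T : Type} {c D : ℝ} {W : ℝ → ℝ} {f : ∀ q, Gr q → ℝ} {u : ℝ → ℝ} (h : CC W D f u)
    (hc : 0 ≤ c) (hD : 0 ≤ D) (hW : WW c W) (L : ℝ) (x : T → ℝ) (hx : ∀ t, |x t| ≤ L) :
    UB (fun q t => ext q (f q) (x t)) := by
  have hW0 := hW.pos 0
  refine ⟨D * Real.exp c * (W 0 * Real.exp (c * L)), by positivity, Eventually.of_forall fun q t => ?_⟩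
  refine (h.ext_bd hc hD hW q _).trans ?_
  refine mul_le_mul_of_nonneg_left ((hW.lip _ 0).trans ?_) (by positivity)
  refine mul_le_mul_of_nonneg_left (Real.exp_le_exp.mpr ?_) hW0.le
  rw [sub_zero]
  exact mul_le_mul_of_nonneg_left (hx t) hc

abbrev IP (L : ℕ) : Type := {x : ℝ // |x| ≤ L} × {x : ℝ // |x| ≤ L}

theorem Chain.K_bd (h : Chain m N φ ψ p pp c C Cp W1 W2) (L : ℕ) :
    ∃ D, 0 ≤ D ∧ ∀ᶠ q in atTop, ∀ a b : Fin (m+1) × ℝ, |a.2| ≤ L → |b.2| ≤ L →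
      |Kq m φ ψ p q a b| ≤ D := by
  have key : ∀ k l : Fin (m+1), ∃ D, 0 ≤ D ∧ ∀ᶠ q in atTop, ∀ x y : ℝ, |x| ≤ L → |y| ≤ L →
      |Kq m φ ψ p q (k, x) (l, y)| ≤ D := by
    intro k l
    have u1 : UB fun (q : ℕ) (t : IP L) =>
        if k < l then -ext q (Eq' m p k l t.2.1 q) t.1.1 else 0 := by
      by_cases hkl : k < l
      · obtain ⟨D, hD, hE⟩ := h.E_CC l.val (by omega) k.val hkl
        refine ⟨D * Real.exp c, by positivity, Eventually.of_forall fun q t => ?_⟩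
        beta_reduce
        rw [if_pos hkl, abs_neg]
        refine ((hE t.2.1).ext_bd h.hc hD (WW_exp c h.hc _) q t.1.1).trans ?_
        refine mul_le_of_le_one_right (by positivity) ?_
        rw [Real.exp_le_one_iff]
        have := h.hc
        have : 0 ≤ c * |t.1.1 - t.2.1| := by positivity
        linarith
      · refine ⟨0, le_rfl, Eventually.of_forall fun q t => ?_⟩
        beta_reduce
        rw [if_neg hkl, abs_zero]
    have u2 : ∀ i, UB fun (q : ℕ) (t : IP L) => ext q (Uq m p ψ k i q) t.1.1 := fun i => by
      obtain ⟨D, hD, h1⟩ := h.U_CC k i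
      exact UB.of_CC h1 h.hc hD h.w1 L (fun t : IP L => t.1.1) (fun t => t.1.2)
    have u3 : ∀ i j, UB fun (q : ℕ) (t : IP L) => (Gq m φ ψ p q)⁻¹ i j := fun i j =>
      UB.of_tendsto ((tendsto_pi_nhds.mp (tendsto_pi_nhds.mp h.Ginv_lim i)) j)
    have u4 : ∀ j, UB fun (q : ℕ) (t : IP L) => ext q (Vq m p φ l j q) t.2.1 := fun j => by
      obtain ⟨D, hD, h1⟩ := h.V_CC l.val (by omega) j
      exact UB.of_CC h1 h.hc hD h.w2 L (fun t : IP L => t.2.1) (fun t => t.2.2)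
    have u5 := u1.add (UB.sum Finset.univ fun i => UB.sum Finset.univ fun j =>
      ((u2 i).mul (u3 i j)).mul (u4 j))
    have : UB (T := IP L) (fun q t => Kq m φ ψ p q (k, t.1.1) (l, t.2.1)) := u5
    obtain ⟨D, hD, h1⟩ := this
    refine ⟨D, hD, ?_⟩
    filter_upwards [h1] with q h1 x y hx hy
    exact h1 (⟨x, hx⟩, ⟨y, hy⟩)
  choose D hD0 hD using key
  refine ⟨∑ k, ∑ l, D k l, Finset.sum_nonneg fun _ _ => Finset.sum_nonneg fun _ _ => hD0 _ _, ?_⟩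
  have : ∀ᶠ q in atTop, ∀ k l : Fin (m+1), ∀ x y : ℝ, |x| ≤ L → |y| ≤ L →
      |Kq m φ ψ p q (k, x) (l, y)| ≤ D k l :=
    eventually_all.mpr fun k => eventually_all.mpr fun l => hD k l
  filter_upwards [this] with q hq a b ha hb
  refine (hq a.1 b.1 a.2 b.2 ha hb).trans ?_
  refine le_trans ?_ (Finset.single_le_sum (f := fun k => ∑ l, D k l)
    (fun k _ => Finset.sum_nonneg fun _ _ => hD0 _ _) (Finset.mem_univ a.1))
  exact Finset.single_le_sum (f := fun l => D a.1 l) (fun l _ => hD0 _ _) (Finset.mem_univ b.1)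

def κq (m : ℕ) (φ ψ : ℕ → Fin N → ℝ → ℝ) (p : ℕ → ℝ → ℝ → ℝ) (q : ℕ) (z w : Fin (m+1) × ℤ) : ℝ :=
  if hz : z.2 ∈ Finset.Ico (-(q:ℤ)^2) ((q:ℤ)^2) then
    if hw : w.2 ∈ Finset.Ico (-(q:ℤ)^2) ((q:ℤ)^2) then
      KK m (fq φ q) (pq p q) (sq m ψ q) (z.1, ⟨z.2, hz⟩) (w.1, ⟨w.2, hw⟩) else 0 else 0

def cellq (m : ℕ) (q : ℕ) (a : Fin (m+1) × ℝ) : Fin (m+1) × ℤ := (a.1, ⌊(q:ℝ) * a.2⌋)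

theorem Kq_eq (q : ℕ) (a b : Fin (m+1) × ℝ) :
    Kq m φ ψ p q a b = q * κq m φ ψ p q (cellq m q a) (cellq m q b) := by
  obtain ⟨k, x⟩ := a
  obtain ⟨l, y⟩ := b
  unfold Kq κq cellq
  by_cases hx : ⌊(q:ℝ) * x⌋ ∈ Finset.Ico (-(q:ℤ)^2) ((q:ℤ)^2)
  swap
  · simp only [ext, hx, dif_neg, not_false_eq_true]; simp only [neg_zero, ite_self, zero_mul, Finset.sum_const_zero, mul_zero, add_zero]
  by_cases hy : ⌊(q:ℝ) * y⌋ ∈ Finset.Ico (-(q:ℤ)^2) ((q:ℤ)^2)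
  swap
  · have : ∀ f : Gr q → ℝ, ext q f y = 0 := fun f => by unfold ext; rw [dif_neg hy]
    have h2 : ∀ f : Gr q → ℝ, (∀ a, f a = 0) → ext q f x = 0 := fun f hf => by
      unfold ext; rw [dif_pos hx]; exact hf _
    simp only [this, hy, dif_neg, not_false_eq_true]
    rw [h2 _ fun a => by unfold Eq'; exact this _]
    simp
  have ex : ∀ f : Gr q → ℝ, ext q f x = f ⟨_, hx⟩ := fun f => by unfold ext; rw [dif_pos hx]
  have ey : ∀ f : Gr q → ℝ, ext q f y = f ⟨_, hy⟩ := fun f => by unfold ext; rw [dif_pos hy]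
  rw [dif_pos hx, dif_pos hy]
  simp only [ex, ey, Eq']
  unfold KK
  rw [Matrix.add_apply, mul_add]
  congr 1
  · rw [Matrix.neg_apply, Matrix.sub_apply]
    by_cases hkl : k < l
    · rw [if_pos hkl, Matrix.one_apply_ne (fun hc => by
        rw [Prod.mk.injEq] at hc; exact hkl.ne hc.1)]
      ring
    · rw [if_neg hkl, EE_ge _ _ _ _ _ (not_lt.mp hkl)]; ring
  · rw [Matrix.mul_apply, Finset.mul_sum, Finset.sum_comm]
    refine Finset.sum_congr rfl fun j _ => ?_
    rw [Matrix.mul_apply, Finset.sum_mul, Finset.mul_sum]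
    refine Finset.sum_congr rfl fun i _ => ?_
    unfold Uq Vq Gq
    ring

theorem cellq_meas (q : ℕ) : Measurable (cellq m q) := by
  unfold cellq
  exact measurable_fst.prodMk (Int.measurable_floor.comp (measurable_snd.const_mul _))

theorem Kq_meas (q : ℕ) : Measurable (Function.uncurry (Kq m φ ψ p q)) := by
  have : Function.uncurry (Kq m φ ψ p q) = (fun z : (Fin (m+1) × ℤ) × (Fin (m+1) × ℤ) =>
      q * κq m φ ψ p q z.1 z.2) ∘ (fun a => (cellq m q a.1, cellq m q a.2)) := by
    funext ⟨a, b⟩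
    exact Kq_eq q a b
  rw [this]
  exact (measurable_of_countable _).comp
    (((cellq_meas q).comp measurable_fst).prodMk ((cellq_meas q).comp measurable_snd))

def Win (m : ℕ) (L : ℕ) : Set (Fin (m+1) × ℝ) := Set.univ ×ˢ Set.Ico (-(L:ℝ)) L

def muW (m : ℕ) : Measure (Fin (m+1) × ℝ) := Measure.count.prod volume

theorem Win_meas (L : ℕ) : MeasurableSet (Win m L) := MeasurableSet.univ.prod measurableSet_Ico

theorem Win_fin (L : ℕ) : muW m (Win m L) ≠ ⊤ := by
  unfold muW Win
  rw [Measure.prod_prod]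
  refine ENNReal.mul_ne_top ?_ (by simp)
  exact (measure_lt_top _ _).ne

theorem Win_abs {L : ℕ} {a : Fin (m+1) × ℝ} (ha : a ∈ Win m L) : |a.2| ≤ L := by
  have := ha.2
  exact abs_le.mpr ⟨this.1, this.2.le⟩

theorem Kq_JPos (h : Chain m N φ ψ p pp c C Cp W1 W2) (L q : ℕ) (hq : 0 < q) (hL : L ≤ q)
    (hG : (Gq m φ ψ p q).det ≠ 0) : JPos (Kq m φ ψ p q) (muW m) (Win m L) := by
  classical
  have mon : ∀ f : Fin N → Gr q, Monotone f → Monotone (fun i => pos (f i)) := by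
    intro f hf i j hij
    have h1 : (f i).1 ≤ (f j).1 := hf hij
    have h2 : ((f i).1 : ℝ) ≤ (f j).1 := by exact_mod_cast h1
    simp only [pos]
    gcongr
  have smul : ∀ A : Matrix (Fin N) (Fin N) ℝ, 0 ≤ A.det →
      0 ≤ Matrix.det (Matrix.of fun i j => A i j / q) := by
    intro A hA
    have : (Matrix.of fun i j => A i j / q) = (q:ℝ)⁻¹ • A := by
      ext i j; simp [div_eq_inv_mul]
    rw [this, Matrix.det_smul]; positivity
  obtain ⟨Ω, hΩ, T, S, hT, hS⟩ := finite_DPP (m := m) (fq φ q) (pq p q) (sq m ψ q)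
    (fun f hf => h.mph _ (mon f hf))
    (fun k hk f f' hf hf' => smul (Matrix.of fun i j => p k (pos (f i)) (pos (f' j)))
      (h.mp k hk _ _ (mon f hf) (mon f' hf')))
    (fun f hf => smul (Matrix.of fun i j => ψ m j (pos (f i))) (h.mps _ (mon f hf)))
    hG
  have hqR : (0:ℝ) < q := by exact_mod_cast hq
  have hLq : ∀ i : ℤ, i ∈ Finset.Ico (-((L:ℤ) * q)) (L * q) →
      i ∈ Finset.Ico (-(q:ℤ)^2) ((q:ℤ)^2) := by
    intro i hi
    rw [Finset.mem_Ico] at hi ⊢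
    have : (L:ℤ) * q ≤ q ^ 2 := by
      rw [_root_.sq]; exact mul_le_mul_of_nonneg_right (by exact_mod_cast hL) (by positivity)
    omega
  have hsf : SigmaFinite (muW m) := by unfold muW; infer_instance
  have key := JPos_step (μ := muW m) (cellq m q)
    (Finset.univ ×ˢ Finset.Ico (-((L:ℤ) * q)) (L * q))
    (fun i _ => cellq_meas q (measurableSet_singleton i)) (1 / q) (by positivity)
    (fun i _ => by
      have e : cellq m q ⁻¹' {i} = {i.1} ×ˢ ((fun x : ℝ => ⌊(q:ℝ) * x⌋) ⁻¹' {i.2}) := by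
        ext a
        simp [cellq, Prod.ext_iff]
      rw [e, muW, Measure.prod_prod, Measure.count_singleton, one_mul]
      exact (cell_measure hq i.2).2)
    (κq m φ ψ p q) T
    (fun ω => (S ω).image (fun z => (z.1, z.2.1))) hT
    (fun {ι} _ v hv hF => by
      have hm : ∀ a, (v a).2 ∈ Finset.Ico (-(q:ℤ)^2) ((q:ℤ)^2) := fun a =>
        hLq _ (Finset.mem_product.mp (hF a)).2
      have := hS (fun a => ((v a).1, (⟨(v a).2, hm a⟩ : Gr q))) (fun a b hab => by
        apply hv
        simp only [Prod.mk.injEq, Subtype.mk.injEq] at hab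
        exact Prod.ext hab.1 hab.2)
      rw [detK_eq]
      have e : (Matrix.of fun a b => κq m φ ψ p q (v a) (v b)) =
        (Matrix.of fun a b => KK m (fq φ q) (pq p q) (sq m ψ q) ((v a).1, (⟨(v a).2, hm a⟩ : Gr q))
          ((v b).1, (⟨(v b).2, hm b⟩ : Gr q))) := by
        ext a b
        simp only [Matrix.of_apply, κq]
        rw [dif_pos (hm a), dif_pos (hm b)]
      rw [e, this]
      refine Finset.sum_congr rfl fun ω _ => ?_
      congr 1
      have hiff : (∀ a, ((v a).1, (⟨(v a).2, hm a⟩ : Gr q)) ∈ S ω) ↔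
          ∀ a, v a ∈ (S ω).image (fun z => (z.1, z.2.1)) := by
        refine forall_congr' fun a => ?_
        rw [Finset.mem_image]
        constructor
        · intro hh; exact ⟨_, hh, rfl⟩
        · rintro ⟨z, hz, hza⟩
          have : z = ((v a).1, (⟨(v a).2, hm a⟩ : Gr q)) :=
            Prod.ext (show z.1 = (v a).1 by rw [← hza]) (Subtype.ext (show z.2.1 = (v a).2 by rw [← hza]))
          rw [← this]; exact hz
      by_cases hA : ∀ a, ((v a).1, (⟨(v a).2, hm a⟩ : Gr q)) ∈ S ω
      · rw [if_pos hA]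
        exact (if_pos (by convert hiff.mp hA)).symm
      · rw [if_neg hA]
        refine (if_neg fun hc => hA (hiff.mpr ?_)).symm
        convert hc)
  have e1 : (fun x y => ((1:ℝ) / q)⁻¹ * κq m φ ψ p q (cellq m q x) (cellq m q y)) = Kq m φ ψ p q := by
    funext x y
    rw [Kq_eq]; simp
  have e2 : cellq m q ⁻¹' (((Finset.univ : Finset (Fin (m+1))) ×ˢ
      Finset.Ico (-((L:ℤ) * q)) (L * q) : Finset (Fin (m+1) × ℤ)) : Set (Fin (m+1) × ℤ)) = Win m L := by
    ext a
    simp only [Set.mem_preimage, Finset.mem_coe, Finset.mem_product, cellq, Finset.mem_univ, true_and,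
      Finset.mem_Ico, Win, Set.mem_prod, Set.mem_univ, Set.mem_Ico, Int.le_floor, Int.floor_lt]
    push_cast
    constructor
    · rintro ⟨h1, h2⟩
      constructor <;> nlinarith
    · rintro ⟨h1, h2⟩
      constructor <;> nlinarith
  rw [e1, e2] at key
  exact key

theorem Chain.result (h : Chain m N φ ψ p pp c C Cp W1 W2) (L : ℕ) :
    (∃ D, WK (muW m) (Win m L) (Kc m φ ψ pp) D) ∧ JPos (Kc m φ ψ pp) (muW m) (Win m L) := by
  obtain ⟨D, hD, hb⟩ := h.K_bd L
  have hW : WK (muW m) (Win m L) (Kc m φ ψ pp) D := by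
    refine ⟨Win_meas L, Win_fin L, ?_, hD, fun x hx y hy => ?_⟩
    · refine measurable_of_tendsto_metrizable (f := fun q => Function.uncurry (Kq m φ ψ p q))
        (fun q => Kq_meas q) ?_
      exact tendsto_pi_nhds.mpr fun a => h.K_lim a.1 a.2
    · refine le_of_tendsto (h.K_lim x y).abs ?_
      filter_upwards [hb] with q hq
      exact hq x y (Win_abs hx) (Win_abs hy)
  refine ⟨⟨D, hW⟩, fun n x hx => ?_⟩
  have hWq : ∀ᶠ q in atTop, WK (muW m) (Win m L) (Kq m φ ψ p q) D := by
    filter_upwards [hb] with q hq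
    exact ⟨Win_meas L, Win_fin L, Kq_meas q, hD, fun x hx y hy => hq x y (Win_abs hx) (Win_abs hy)⟩
  have hsf : SigmaFinite (muW m) := by unfold muW; infer_instance
  have hl := Jan_tendsto hWq hW (fun y _ z _ => h.K_lim y z) (WG_nI (Win_meas L)) x hx
  refine ge_of_tendsto hl ?_
  have hdet : ∀ᶠ q in atTop, (Gq m φ ψ p q).det ≠ 0 := by
    have : Tendsto (fun q => (Gq m φ ψ p q).det) atTop (𝓝 (Gc φ ψ).det) :=
      ((continuous_id.matrix_det).tendsto (Gc φ ψ)).comp h.G_lim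
    exact this.eventually_ne h.dG
  filter_upwards [hdet, eventually_ge_atTop (L+1)] with q h1 h2
  exact Kq_JPos h L q (by omega) (by omega) h1 n x hx

end chain
end AW
namespace AW

theorem hk_integrable {τ : ℝ} (hτ : 0 < τ) (a : ℝ) : Integrable (fun z => hk τ (z - a)) := by
  have h1 : Integrable (fun z : ℝ => hk τ z) := by
    unfold hk
    have := (integrable_exp_neg_mul_sq (b := 1 / (4 * τ)) (by positivity)).const_mul
      (Real.sqrt (4 * Real.pi * τ))⁻¹
    refine this.congr (Eventually.of_forall fun z => ?_)
    simp only
    congr 2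
    ring
  exact h1.comp_sub_right a

theorem hk_integral {τ : ℝ} (hτ : 0 < τ) (a : ℝ) : ∫ z, hk τ (z - a) = 1 := by
  rw [MeasureTheory.integral_sub_right_eq_self (fun z => hk τ z) a]
  unfold hk
  rw [MeasureTheory.integral_const_mul]
  have : ∀ u : ℝ, Real.exp (-u^2 / (4*τ)) = Real.exp (-(1 / (4 * τ)) * u ^ 2) := fun u => by
    congr 1; ring
  simp_rw [this]
  rw [integral_gaussian, show Real.pi / (1 / (4 * τ)) = 4 * Real.pi * τ by field_simp]
  exact inv_mul_cancel₀ (by positivity)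

theorem hk_exp {τ : ℝ} (hτ : 0 < τ) (x σ z : ℝ) :
    hk τ (z - x) * Real.exp (σ * z) = Real.exp (σ * x + τ * σ^2) * hk τ (z - (x + 2 * τ * σ)) := by
  unfold hk
  rw [mul_assoc, ← Real.exp_add, mul_left_comm, ← Real.exp_add]
  congr 2
  field_simp
  ring

theorem hk_exp_integral {τ : ℝ} (hτ : 0 < τ) (x σ : ℝ) :
    Integrable (fun z => hk τ (z - x) * Real.exp (σ * z)) ∧
    ∫ z, hk τ (z - x) * Real.exp (σ * z) = Real.exp (σ * x + τ * σ^2) := by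
  simp_rw [hk_exp hτ]
  refine ⟨(hk_integrable hτ _).const_mul _, ?_⟩
  rw [MeasureTheory.integral_const_mul, hk_integral hτ, mul_one]

theorem hk_symm (τ u : ℝ) : hk τ (-u) = hk τ u := by unfold hk; rw [neg_sq]

theorem hk_conv {σ τ : ℝ} (hσ : 0 < σ) (hτ : 0 < τ) (x y z : ℝ) :
    hk σ (x - z) * hk τ (z - y) = hk (σ + τ) (x - y) *
      hk (σ * τ / (σ + τ)) (z - (τ * x + σ * y) / (σ + τ)) := by
  unfold hk
  rw [mul_mul_mul_comm, mul_mul_mul_comm (b := Real.exp _), ← Real.exp_add, ← Real.exp_add,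
    ← mul_inv, ← mul_inv, ← Real.sqrt_mul (by positivity), ← Real.sqrt_mul (by positivity)]
  congr 1
  · congr 2; field_simp
  · congr 1; field_simp; ring

theorem hk_conv_integral {σ τ : ℝ} (hσ : 0 < σ) (hτ : 0 < τ) (x y : ℝ) :
    Integrable (fun z => hk σ (x - z) * hk τ (z - y)) ∧
    ∫ z, hk σ (x - z) * hk τ (z - y) = hk (σ + τ) (x - y) := by
  simp_rw [hk_conv hσ hτ]
  refine ⟨(hk_integrable (by positivity) _).const_mul _, ?_⟩
  rw [MeasureTheory.integral_const_mul, hk_integral (by positivity), mul_one]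

theorem hk_bd {τ : ℝ} (hτ : 0 < τ) (s u : ℝ) :
    hk τ u ≤ (Real.sqrt (4 * Real.pi * τ))⁻¹ * Real.exp (τ * s^2) * Real.exp (-(s * |u|)) := by
  unfold hk
  rw [mul_assoc (Real.sqrt _)⁻¹, ← Real.exp_add]
  refine mul_le_mul_of_nonneg_left (Real.exp_le_exp.mpr ?_) (by positivity)
  rw [div_le_iff₀ (by positivity)]
  nlinarith [sq_nonneg (2 * τ * s - |u|), sq_abs u]

theorem phiF_nonneg (B τ x : ℝ) : 0 ≤ phiF B τ x :=
  MeasureTheory.integral_nonneg fun y => mul_nonneg (hk_nonneg _ _) (Real.exp_pos _).le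

theorem phiF_bd {B τ : ℝ} (hB : 0 < B) (hτ : 0 < τ) (x σ : ℝ) (hσ : -B ≤ σ) :
    phiF B τ x ≤ Real.exp (σ * x + τ * σ^2) := by
  obtain ⟨h1, h2⟩ := hk_exp_integral hτ x σ
  rw [← h2]
  unfold phiF
  refine le_trans ?_ (MeasureTheory.setIntegral_le_integral (s := Set.Ioi (0:ℝ)) h1
    (Eventually.of_forall fun z => mul_nonneg (hk_nonneg _ _) (Real.exp_pos _).le))
  refine MeasureTheory.setIntegral_mono_on (phiF_integrable hB hτ x) h1.integrableOn
    measurableSet_Ioi fun y hy => ?_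
  rw [← hk_symm, neg_sub]
  refine mul_le_mul_of_nonneg_left (Real.exp_le_exp.mpr ?_) (hk_nonneg _ _)
  exact mul_le_mul_of_nonneg_right hσ (le_of_lt hy)

theorem phiF_cont {B τ : ℝ} (hB : 0 < B) (hτ : 0 < τ) : Continuous (phiF B τ) := by
  unfold phiF
  refine MeasureTheory.continuous_of_dominated
    (bound := fun y => (Real.sqrt (4 * Real.pi * τ))⁻¹ * Real.exp (-B * y)) ?_ ?_ ?_ ?_
  · intro x
    exact (phiF_integrable hB hτ x).aestronglyMeasurable
  · intro x
    refine Eventually.of_forall fun y => ?_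
    rw [Real.norm_of_nonneg (mul_nonneg (hk_nonneg _ _) (Real.exp_pos _).le)]
    exact mul_le_mul_of_nonneg_right (hk_le hτ _) (Real.exp_pos _).le
  · exact (integrableOn_exp_mul_Ioi (by linarith) 0).const_mul _
  · refine Eventually.of_forall fun y => ?_
    exact (hk_continuous.comp (by fun_prop)).mul continuous_const

theorem phiF_fubini {B τ : ℝ} (hB : 0 < B) (hτ : 0 < τ) (g : ℝ → ℝ) (hg : Continuous g)
    (hg0 : ∀ z, 0 ≤ g z) (G : ℝ → ℝ)
    (hG : ∀ y, Integrable (fun z => g z * hk τ (z - y)) ∧ ∫ z, g z * hk τ (z - y) = G y)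
    (hi : IntegrableOn (fun y => G y * Real.exp (-B * y)) (Set.Ioi 0)) :
    ∫ z, g z * phiF B τ z = ∫ y in Set.Ioi (0:ℝ), G y * Real.exp (-B * y) := by
  unfold phiF
  simp_rw [← MeasureTheory.integral_const_mul]
  rw [MeasureTheory.integral_integral_swap]
  · refine MeasureTheory.integral_congr_ae (Eventually.of_forall fun y => ?_)
    simp only
    rw [← (hG y).2, ← MeasureTheory.integral_mul_const]
    refine MeasureTheory.integral_congr_ae (Eventually.of_forall fun z => ?_)
    simp only; ring
  · have hc : Continuous (Function.uncurry fun z y => g z * (hk τ (z - y) * Real.exp (-B * y))) := by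
      have h1 : Continuous fun a : ℝ × ℝ => hk τ (a.1 - a.2) :=
        hk_continuous.comp (by fun_prop)
      have h2 : Continuous fun a : ℝ × ℝ => g a.1 := hg.comp continuous_fst
      have : Continuous fun a : ℝ × ℝ => g a.1 * (hk τ (a.1 - a.2) * Real.exp (-B * a.2)) := by fun_prop
      exact this
    rw [MeasureTheory.integrable_prod_iff' hc.aestronglyMeasurable]
    have e : ∀ y z, g z * (hk τ (z - y) * Real.exp (-B * y)) =
      Real.exp (-B * y) * (g z * hk τ (z - y)) := fun y z => by ring
    constructor
    · refine Eventually.of_forall fun y => ?_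
      simp only [Function.uncurry, e]
      exact (hG y).1.const_mul _
    · refine hi.congr (Eventually.of_forall fun y => ?_)
      simp only [Function.uncurry, e]
      rw [← (hG y).2, mul_comm, ← MeasureTheory.integral_const_mul]
      refine MeasureTheory.integral_congr_ae (Eventually.of_forall fun z => ?_)
      simp only
      rw [Real.norm_of_nonneg (mul_nonneg (Real.exp_pos _).le (mul_nonneg (hg0 _) (hk_nonneg _ _)))]

theorem phiF_conv {B σ τ : ℝ} (hB : 0 < B) (hσ : 0 < σ) (hτ : 0 < τ) (x : ℝ) :
    ∫ z, hk σ (x - z) * phiF B τ z = phiF B (σ + τ) x := by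
  rw [phiF_fubini hB hτ (fun z => hk σ (x - z)) (hk_continuous.comp (by fun_prop))
    (fun z => hk_nonneg _ _) (fun y => hk (σ + τ) (x - y)) (fun y => hk_conv_integral hσ hτ x y)
    (phiF_integrable hB (by positivity) x)]
  rfl

theorem phiF_pair {A B τ : ℝ} (hA : 0 < A) (hB : 0 < B) (hτ : 0 < τ) :
    ∫ z, phiF B τ z * Real.exp (-τ * A^2 - z * A) = 1 / (A + B) := by
  have h1 : ∀ z, phiF B τ z * Real.exp (-τ * A^2 - z * A) =
      Real.exp (-τ * A^2 - z * A) * phiF B τ z := fun z => by ring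
  simp_rw [h1]
  have key : ∀ y z : ℝ, Real.exp (-τ * A^2 - z * A) * hk τ (z - y) =
      Real.exp (-τ * A^2) * (hk τ (z - y) * Real.exp (-A * z)) := fun y z => by
    rw [show -τ * A^2 - z * A = -τ * A^2 + -A * z by ring, Real.exp_add]; ring
  have e2 : ∀ y : ℝ, Real.exp (-A * y) * Real.exp (-B * y) = Real.exp (-(A+B) * y) := fun y => by
    rw [← Real.exp_add]; congr 1; ring
  rw [phiF_fubini hB hτ (fun z => Real.exp (-τ * A^2 - z * A)) (by fun_prop)
    (fun z => (Real.exp_pos _).le) (fun y => Real.exp (-A * y))]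
  · simp_rw [e2]
    rw [integral_exp_mul_Ioi (by linarith)]
    have : A + B ≠ 0 := by positivity
    have h4 : -(A+B) ≠ 0 := neg_ne_zero.mpr this
    rw [mul_zero, Real.exp_zero, neg_div, div_neg, neg_neg]
  · intro y
    simp_rw [key]
    obtain ⟨h2, h3⟩ := hk_exp_integral hτ y (-A)
    refine ⟨h2.const_mul _, ?_⟩
    rw [MeasureTheory.integral_const_mul, h3, ← Real.exp_add]
    congr 1; ring
  · simp_rw [e2]
    exact integrableOn_exp_mul_Ioi (by linarith) 0

theorem cauchy_det {N : ℕ} {A B : Fin N → ℝ} (hA : Function.Injective A) (hB : Function.Injective B)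
    (hA0 : ∀ i, 0 < A i) (hB0 : ∀ i, 0 < B i) :
    (Matrix.of fun j i => 1 / (A i + B j)).det ≠ 0 := by
  intro h0
  obtain ⟨v, hv, hz⟩ := Matrix.exists_mulVec_eq_zero_iff.mpr h0
  apply hv
  set P : Polynomial ℝ := ∑ i, Polynomial.C (v i) *
    ∏ k ∈ Finset.univ.erase i, (Polynomial.X + Polynomial.C (A k)) with hP
  have hdeg : P.degree < (Finset.univ : Finset (Fin N)).card := by
    rw [Finset.card_univ, Fintype.card_fin]
    rcases Nat.eq_zero_or_pos N with rfl | hN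
    · simp [hP]
    refine (Polynomial.degree_sum_le _ _).trans_lt ?_
    rw [Finset.sup_lt_iff (by exact_mod_cast WithBot.bot_lt_coe N)]
    intro i _
    refine ((Polynomial.degree_mul_le _ _).trans (add_le_add Polynomial.degree_C_le le_rfl)).trans_lt ?_
    rw [zero_add, Polynomial.degree_prod]
    simp only [Polynomial.degree_X_add_C, Finset.sum_const, Finset.card_erase_of_mem (Finset.mem_univ i),
      Finset.card_univ, Fintype.card_fin]
    rw [nsmul_one]
    exact_mod_cast Nat.sub_lt hN one_pos
  have hP0 : P = 0 := by
    refine Polynomial.eq_zero_of_degree_lt_of_eval_index_eq_zero (v := B) (s := Finset.univ)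
      hB.injOn hdeg fun j _ => ?_
    have h1 := congrFun hz j
    simp only [Matrix.mulVec, dotProduct, Matrix.of_apply, Pi.zero_apply] at h1
    have : P.eval (B j) = (∏ k, (B j + A k)) * ∑ i, 1 / (A i + B j) * v i := by
      rw [hP, Polynomial.eval_finsetSum, Finset.mul_sum]
      refine Finset.sum_congr rfl fun i _ => ?_
      rw [Polynomial.eval_mul, Polynomial.eval_prod, ← Finset.mul_prod_erase _ _ (Finset.mem_univ i)]
      simp only [Polynomial.eval_C, Polynomial.eval_add, Polynomial.eval_X]
      have := hA0 i; have := hB0 j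
      field_simp
      ring
    rw [this, h1, mul_zero]
  funext i
  have h2 : P.eval (-A i) = v i * ∏ k ∈ Finset.univ.erase i, (-A i + A k) := by
    rw [hP, Polynomial.eval_finsetSum, Finset.sum_eq_single i]
    · rw [Polynomial.eval_mul, Polynomial.eval_prod]; simp
    · intro k _ hk
      rw [Polynomial.eval_mul, Polynomial.eval_prod,
        Finset.prod_eq_zero (i := i) (Finset.mem_erase.mpr ⟨hk.symm, Finset.mem_univ _⟩) (by simp), mul_zero]
    · simp
  rw [hP0, Polynomial.eval_zero] at h2
  rcases mul_eq_zero.mp h2.symm with h3 | h3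
  · exact h3
  · exfalso
    obtain ⟨k, hk, hk0⟩ := Finset.prod_eq_zero_iff.mp h3
    exact (Finset.mem_erase.mp hk).1 (hA (by linarith))

def wA (a x : ℝ) : ℝ := Real.exp (a * max (-x) 0)
def wB (β s x : ℝ) : ℝ := Real.exp (-(β * max x 0) - s * max (-x) 0)

theorem wA_WW {a c : ℝ} (ha : 0 ≤ a) (hc : a ≤ c) (l : ℝ) : WW c (fun x => wA a (x - l)) := by
  refine ⟨fun x => Real.exp_pos _, fun x y => ?_⟩
  unfold wA
  rw [← Real.exp_add]
  refine Real.exp_le_exp.mpr ?_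
  have h1 : max (-(x - l)) 0 ≤ max (-(y - l)) 0 + |x - y| := by
    refine max_le ?_ (by positivity)
    have := le_max_left (-(y - l)) 0
    have := neg_abs_le (x - y)
    linarith
  have h2 := abs_nonneg (x - y)
  nlinarith

theorem wB_WW {β s c : ℝ} (hβ : 0 ≤ β) (hs : β ≤ s) (hc : s ≤ c) (l : ℝ) :
    WW c (fun x => wB β s (x - l)) := by
  refine ⟨fun x => Real.exp_pos _, fun x y => ?_⟩
  unfold wB
  rw [← Real.exp_add]
  refine Real.exp_le_exp.mpr ?_
  have h2 := abs_nonneg (x - y)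
  have h3 := neg_abs_le (x - y)
  have h4 := le_abs_self (x - y)
  have h5 : s * |x - y| ≤ c * |x - y| := mul_le_mul_of_nonneg_right hc h2
  have e : ∀ u : ℝ, max (-u) 0 = max u 0 - u := fun u => by
    rcases le_total u 0 with h | h
    · rw [max_eq_left (by linarith), max_eq_right h]; ring
    · rw [max_eq_right (by linarith), max_eq_left h]; ring
  rw [e, e]
  have h6 : max (y - l) 0 ≤ max (x - l) 0 + max (-(x - y)) 0 := by
    refine max_le ?_ (by positivity)
    have := le_max_left (x - l) 0
    have := le_max_left (-(x-y)) 0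
    linarith
  have h7 : max (-(x - y)) 0 - |x - y| ≤ 0 := by
    rw [sub_nonpos]; exact max_le (by linarith) h2
  have h8 : max (-(x - y)) 0 + (x - y) ≤ |x - y| := by
    rw [e]
    have : max (x - y) 0 ≤ |x - y| := max_le h4 h2
    linarith
  have h9 : (0:ℝ) ≤ max (-(x-y)) 0 := le_max_right _ _
  have h10 : β * (max (y - l) 0 - max (x - l) 0) ≤ β * max (-(x-y)) 0 :=
    mul_le_mul_of_nonneg_left (by linarith) hβ
  have h10' : (s+β) * (max (y - l) 0 - max (x - l) 0) ≤ (s+β) * max (-(x-y)) 0 :=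
    mul_le_mul_of_nonneg_left (by linarith) (by linarith)
  have h11 : s * (max (-(x - y)) 0 + (x - y)) ≤ s * |x - y| :=
    mul_le_mul_of_nonneg_left h8 (by linarith)
  have h12 : β * max (-(x-y)) 0 ≤ s * max (-(x-y)) 0 := mul_le_mul_of_nonneg_right hs h9
  rcases le_total (x - y) 0 with hxy | hxy
  · rw [abs_of_nonpos hxy] at *
    have : max (y - l) 0 ≥ max (x - l) 0 := max_le_max (by linarith) le_rfl
    have h13 : max (-(x-y)) 0 = -(x-y) := max_eq_left (by linarith)
    rw [h13] at *
    nlinarith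
  · rw [abs_of_nonneg hxy] at *
    have : max (y - l) 0 ≤ max (x - l) 0 := max_le_max (by linarith) le_rfl
    have h14 : max (x - l) 0 ≤ max (y - l) 0 + (x - y) := by
      refine max_le ?_ (by positivity)
      have := le_max_left (y - l) 0
      linarith
    nlinarith

theorem wAB_int {a β s : ℝ} (hβ : 0 < β) (hβ1 : β ≤ 1) (hs : s = a + 1) (l : ℝ) :
    Integrable fun z => wB β s (z - l) * wA a (z - l) := by
  have h0 : Integrable fun z => wB β s z * wA a z := by
    have h1 : Integrable fun z : ℝ => Real.exp (-β * |z|) := by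
      have := int_exp_abs.comp_mul_left' hβ.ne'
      refine this.congr (Eventually.of_forall fun z => ?_)
      simp only [abs_mul, abs_of_pos hβ, neg_mul]
    refine h1.mono' ?_ ?_
    · unfold wA wB
      exact (by fun_prop : Continuous _).aestronglyMeasurable
    · refine Eventually.of_forall fun z => ?_
      unfold wA wB
      rw [← Real.exp_add, Real.norm_of_nonneg (Real.exp_pos _).le]
      refine Real.exp_le_exp.mpr ?_
      rcases le_total z 0 with h | h
      · rw [max_eq_left (by linarith : (0:ℝ) ≤ -z), max_eq_right h, abs_of_nonpos h]
        subst hs; nlinarith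
      · rw [max_eq_right (by linarith : -z ≤ (0:ℝ)), max_eq_left h, abs_of_nonneg h]
        linarith
  exact h0.comp_sub_right l

section model
variable {m N : ℕ}

def psM (A : Fin N → ℝ) (τ : ℕ → ℝ) (l : ℝ) (k : ℕ) (i : Fin N) (x : ℝ) : ℝ :=
  Real.exp (-τ k * (A i)^2 - (x - l) * A i)
def phM (B : Fin N → ℝ) (τ : ℕ → ℝ) (l : ℝ) (k : ℕ) (j : Fin N) (x : ℝ) : ℝ :=
  phiF (B j) (τ k) (x - l)
def pM (τ : ℕ → ℝ) (k : ℕ) (x z : ℝ) : ℝ := hk (τ (k+1) - τ k) (z - x)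
def ppM (τ : ℕ → ℝ) (k k' : ℕ) (x z : ℝ) : ℝ := hk (τ k' - τ k) (z - x)

theorem Gc_model {A B : Fin N → ℝ} {τ : ℕ → ℝ} (l : ℝ) (hA0 : ∀ i, 0 < A i) (hB0 : ∀ i, 0 < B i)
    (hτ : ∀ k, 0 < τ k) :
    Gc (phM B τ l) (psM A τ l) = Matrix.of fun j i => 1 / (A i + B j) := by
  ext j i
  simp only [Gc, Matrix.of_apply, phM, psM]
  rw [MeasureTheory.integral_sub_right_eq_self
    (fun z => phiF (B j) (τ 0) z * Real.exp (-τ 0 * (A i)^2 - z * A i)) l]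
  exact phiF_pair (hA0 i) (hB0 j) (hτ 0)

theorem chain_model {A B : Fin N → ℝ} {τ : ℕ → ℝ} (l : ℝ) (hA : StrictAnti A) (hB : StrictAnti B)
    (hA0 : ∀ i, 0 < A i) (hB0 : ∀ i, 0 < B i) (hτ : ∀ k, 0 < τ k) (hτm : StrictMono τ) :
    ∃ c C Cp W1 W2, Chain m N (phM B τ l) (psM A τ l) (pM τ) (ppM τ) c C Cp W1 W2 := by
  obtain ⟨a, ha, haA⟩ : ∃ a : ℝ, 0 ≤ a ∧ ∀ i, A i ≤ a :=
    ⟨∑ i, A i, Finset.sum_nonneg fun i _ => (hA0 i).le,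
      fun i => Finset.single_le_sum (fun i _ => (hA0 i).le) (Finset.mem_univ i)⟩
  obtain ⟨β, hβ, hβ1, hβB⟩ : ∃ β : ℝ, 0 < β ∧ β ≤ 1 ∧ ∀ i, β ≤ B i := by
    rcases Nat.eq_zero_or_pos N with rfl | hN
    · exact ⟨1, one_pos, le_rfl, fun i => i.elim0⟩
    · refine ⟨min 1 (B ⟨N-1, by omega⟩), lt_min one_pos (hB0 _), min_le_left _ _, fun i => ?_⟩
      refine (min_le_right _ _).trans (hB.antitone ?_)
      rw [Fin.le_def]; simp only; omega
  have hd : ∀ k, 0 < τ (k+1) - τ k := fun k => sub_pos.mpr (hτm (Nat.lt_succ_self k))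
  set s := a + 1 with hs
  obtain ⟨Cp, hCp0, hCp⟩ : ∃ Cp : ℝ, 0 ≤ Cp ∧ ∀ k < m, (Real.sqrt (4 * Real.pi * (τ (k+1) - τ k)))⁻¹ *
      Real.exp ((τ (k+1) - τ k) * (s+1)^2) ≤ Cp := by
    refine ⟨∑ k ∈ Finset.range m, (Real.sqrt (4 * Real.pi * (τ (k+1) - τ k)))⁻¹ *
      Real.exp ((τ (k+1) - τ k) * (s+1)^2), Finset.sum_nonneg fun k _ => by positivity, fun k hkm => ?_⟩
    exact Finset.single_le_sum (f := fun k => (Real.sqrt (4 * Real.pi * (τ (k+1) - τ k)))⁻¹ *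
      Real.exp ((τ (k+1) - τ k) * (s+1)^2)) (fun k _ => by positivity) (Finset.mem_range.mpr hkm)
  have hτ0 := hτ 0
  set C := Real.exp (τ 0 * s^2) with hC
  have hC1 : 1 ≤ C := Real.one_le_exp (by positivity)
  refine ⟨s, C, Cp, fun x => wA a (x - l), fun x => wB β s (x - l), ?_⟩
  refine
  { hc := by positivity
    hC := by positivity
    hCp := hCp0
    w1 := wA_WW ha (by linarith) l
    w2 := wB_WW hβ.le (by linarith) le_rfl l
    wi := wAB_int hβ hβ1 hs l
    pc := fun k hkm => ?_
    pb := fun k hkm x z => ?_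
    phc := fun j => (phiF_cont (hB0 j) (hτ 0)).comp (by fun_prop)
    phb := fun j x => ?_
    psc := fun i => by unfold psM; fun_prop
    psb := fun i x => ?_
    phr := fun k hkm j y => ?_
    psr := fun k hkm i y => ?_
    pp1 := fun k hkm x y => rfl
    ppr := fun k k' hkk hl x y => ?_
    mph := fun f hf => phiF_minor (hτ 0) B (fun j => f j - l) hB0 hB.antitone
      (fun i j hij => sub_le_sub_right (hf hij) l)
    mps := fun f hf => ?_
    mp := fun k hkm f f' hf hf' => ?_
    dG := ?_ }
  · have : Continuous fun a : ℝ × ℝ => hk (τ (k+1) - τ k) (a.2 - a.1) := hk_continuous.comp (by fun_prop)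
    exact this
  · unfold pM
    rw [abs_of_nonneg (hk_nonneg _ _), abs_sub_comm x z]
    exact (hk_bd (hd k) (s+1) _).trans (mul_le_mul_of_nonneg_right (hCp k hkm) (Real.exp_pos _).le)
  · unfold phM wB
    rw [abs_of_nonneg (phiF_nonneg _ _ _)]
    set u := x - l
    rcases le_total u 0 with h | h
    · rw [max_eq_left (by linarith : (0:ℝ) ≤ -u), max_eq_right h, hC, ← Real.exp_add]
      refine (phiF_bd (hB0 j) hτ0 u s (by have := hB0 j; linarith)).trans (Real.exp_le_exp.mpr ?_)
      linarith
    · rw [max_eq_right (by linarith : -u ≤ (0:ℝ)), max_eq_left h, hC, ← Real.exp_add]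
      refine (phiF_bd (hB0 j) hτ0 u (-β) (by linarith [hβB j])).trans (Real.exp_le_exp.mpr ?_)
      have : β^2 ≤ s^2 := pow_le_pow_left₀ hβ.le (by linarith) 2
      nlinarith
  · unfold psM wA
    rw [abs_of_nonneg (Real.exp_pos _).le]
    refine le_trans ?_ (le_mul_of_one_le_left (Real.exp_pos _).le hC1)
    refine Real.exp_le_exp.mpr ?_
    have h1 : 0 ≤ τ m * (A i)^2 := mul_nonneg (hτ m).le (sq_nonneg _)
    have h2 : -(x - l) * A i ≤ max (-(x - l)) 0 * A i :=
      mul_le_mul_of_nonneg_right (le_max_left _ _) (hA0 i).le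
    have h3 : max (-(x - l)) 0 * A i ≤ max (-(x - l)) 0 * a :=
      mul_le_mul_of_nonneg_left (haA i) (le_max_right _ _)
    linarith
  · unfold phM pM
    have := phiF_conv (hB0 j) (hd k) (hτ k) (y - l)
    rw [show τ (k+1) - τ k + τ k = τ (k+1) by ring] at this
    rw [← this]
    rw [← MeasureTheory.integral_sub_right_eq_self
      (fun z => hk (τ (k+1) - τ k) (y - l - z) * phiF (B j) (τ k) z) l]
    refine MeasureTheory.integral_congr_ae (Eventually.of_forall fun z => ?_)
    simp only
    congr 2; ring
  · unfold psM pM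
    have := (hk_exp_integral (hd k) y (-A i)).2
    have e : ∀ z, hk (τ (k+1) - τ k) (z - y) * Real.exp (-τ (k+1) * (A i)^2 - (z - l) * A i) =
      Real.exp (-τ (k+1) * (A i)^2 + l * A i) * (hk (τ (k+1) - τ k) (z - y) * Real.exp (-A i * z)) := by
      intro z
      rw [mul_left_comm, ← Real.exp_add]
      congr 2; ring
    simp_rw [e]
    rw [MeasureTheory.integral_const_mul, this, ← Real.exp_add]
    congr 1; ring
  · unfold ppM pM
    have h1 : 0 < τ k' - τ (k+1) := sub_pos.mpr (hτm hkk)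
    have := (hk_conv_integral h1 (hd k) y x).2
    rw [show τ k' - τ (k+1) + (τ (k+1) - τ k) = τ k' - τ k by ring] at this
    rw [← this]
    refine MeasureTheory.integral_congr_ae (Eventually.of_forall fun z => ?_)
    simp only; ring
  · have e : (Matrix.of fun i j => psM A τ l m j (f i)) =
        (Matrix.of fun i j => Real.exp (-A i * (f j - l))).transpose *
          Matrix.diagonal (fun j => Real.exp (-τ m * (A j)^2)) := by
      ext i j
      rw [Matrix.mul_diagonal, Matrix.transpose_apply, Matrix.of_apply, Matrix.of_apply, ← Real.exp_add]
      unfold psM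
      congr 1; ring
    rw [e, Matrix.det_mul, Matrix.det_transpose, Matrix.det_diagonal]
    refine mul_nonneg (det_exp_nonneg N (fun i => -A i) (fun j => f j - l) ?_ ?_)
      (Finset.prod_nonneg fun _ _ => (Real.exp_pos _).le)
    · exact fun i j hij => neg_le_neg (hA.antitone hij)
    · exact fun i j hij => sub_le_sub_right (hf hij) l
  · have := hk_minor (hd k) 0 f f' hf hf'
    simpa [pM] using this
  · have h1 : (Gc (phM B τ l) (psM A τ l)).det ≠ 0 := by
      rw [Gc_model l hA0 hB0 hτ]
      exact cauchy_det hA.injective hB.injective hA0 hB0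
    exact h1

end model
end AW
namespace AW

/-- the rational function of the finite model -/
def Rat {N : ℕ} (A B : Fin N → ℝ) (z : ℂ) : ℂ := (∏ i, (z + B i)) / ∏ i, ((A i : ℂ) - z)

theorem rat_identity {N : ℕ} {A B : Fin N → ℝ} (hA : Function.Injective A) (hB : Function.Injective B)
    (hA0 : ∀ i, 0 < A i) (hB0 : ∀ i, 0 < B i) (z w : ℂ) (hz : ∀ i, (A i : ℂ) ≠ z)
    (hw : ∀ j, w + B j ≠ 0) :
    Rat A B z / Rat A B w = 1 + (z - w) * ∑ i, ∑ j,
      (((Matrix.of fun j i => 1 / (A i + B j))⁻¹ i j : ℝ) : ℂ) / ((A i - z) * (w + B j)) := by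
  set G : Matrix (Fin N) (Fin N) ℝ := Matrix.of fun j i => 1 / (A i + B j) with hG
  have hdet : IsUnit G.det := isUnit_iff_ne_zero.mpr (cauchy_det hA hB hA0 hB0)
  set c : Matrix (Fin N) (Fin N) ℝ := G⁻¹ with hc
  have hGc : ∀ l j, ∑ i, (c i j : ℂ) / (A i + B l) = if l = j then 1 else 0 := by
    intro l j
    have h1 := congrFun (congrFun (Matrix.mul_nonsing_inv G hdet) l) j
    rw [Matrix.mul_apply, Matrix.one_apply] at h1
    have h2 : ((∑ i, G l i * c i j : ℝ) : ℂ) = ((if l = j then 1 else 0 : ℝ) : ℂ) := by rw [← h1]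
    rw [show (if l = j then (1:ℂ) else 0) = ((if l = j then 1 else 0 : ℝ) : ℂ) by split_ifs <;> simp, ← h2]
    push_cast
    refine Finset.sum_congr rfl fun i _ => ?_
    simp only [hG, Matrix.of_apply]
    push_cast
    ring
  set W : ℂ := ∏ l, (w + B l) with hW
  have hW0 : W ≠ 0 := Finset.prod_ne_zero_iff.mpr fun j _ => hw j
  set V : ℂ := ∏ i, ((A i : ℂ) - w) with hV
  set P : Polynomial ℂ := ∏ i, (Polynomial.C (A i : ℂ) - Polynomial.X) + ∑ i, ∑ j,
    Polynomial.C ((c i j : ℂ) / (w + B j)) * ((Polynomial.X - Polynomial.C w) *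
      ∏ k ∈ Finset.univ.erase i, (Polynomial.C (A k : ℂ) - Polynomial.X)) with hP
  set Q : Polynomial ℂ := Polynomial.C (V / W) * ∏ l, (Polynomial.X + Polynomial.C (B l : ℂ)) with hQ
  have prodA : ∀ s : Finset (Fin N), (∏ k ∈ s, (Polynomial.C (A k : ℂ) - Polynomial.X)).natDegree ≤ s.card := by
    intro s
    refine (Polynomial.natDegree_prod_le _ _).trans ?_
    refine (Finset.sum_le_card_nsmul _ _ 1 fun i _ => ?_).trans (by simp)
    compute_degree
  have dP : P.degree < (Finset.univ : Finset (Option (Fin N))).card := by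
    refine lt_of_le_of_lt (b := (N : WithBot ℕ)) ?_ (by simp; exact_mod_cast Nat.lt_succ_self N)
    refine Polynomial.degree_le_of_natDegree_le ?_
    refine Polynomial.natDegree_add_le_of_degree_le ?_ ?_
    · exact (prodA Finset.univ).trans (by simp)
    · refine Polynomial.natDegree_sum_le_of_forall_le _ _ fun i _ => ?_
      refine Polynomial.natDegree_sum_le_of_forall_le _ _ fun j _ => ?_
      refine (Polynomial.natDegree_C_mul_le _ _).trans ?_
      refine (Polynomial.natDegree_mul_le_of_le (m := 1) (n := N - 1) ?_ ?_).trans ?_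
      · compute_degree
      · exact (prodA _).trans (by simp)
      · have := i.2; omega
  have dQ : Q.degree < (Finset.univ : Finset (Option (Fin N))).card := by
    refine lt_of_le_of_lt (b := (N : WithBot ℕ)) ?_ (by simp; exact_mod_cast Nat.lt_succ_self N)
    refine Polynomial.degree_le_of_natDegree_le ?_
    refine (Polynomial.natDegree_C_mul_le _ _).trans ?_
    refine (Polynomial.natDegree_prod_le _ _).trans ?_
    refine (Finset.sum_le_card_nsmul _ _ 1 fun i _ => ?_).trans (by simp)
    compute_degree
  have evP : ∀ u : ℂ, P.eval u = ∏ i, ((A i : ℂ) - u) + ∑ i, ∑ j, (c i j : ℂ) / (w + B j) * ((u - w) *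
      ∏ k ∈ Finset.univ.erase i, ((A k : ℂ) - u)) := by
    intro u
    rw [hP]
    simp only [Polynomial.eval_add, Polynomial.eval_prod, Polynomial.eval_finsetSum, Polynomial.eval_mul,
      Polynomial.eval_sub, Polynomial.eval_C, Polynomial.eval_X]
  have evQ : ∀ u : ℂ, Q.eval u = V / W * ∏ l, (u + B l) := by
    intro u
    rw [hQ]
    simp only [Polynomial.eval_add, Polynomial.eval_prod, Polynomial.eval_mul,
      Polynomial.eval_C, Polynomial.eval_X]
  have evP' : ∀ u : ℂ, (∀ i, (A i : ℂ) ≠ u) → P.eval u = (∏ i, ((A i : ℂ) - u)) * (1 + (u - w) *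
      ∑ i, ∑ j, (c i j : ℂ) / ((A i - u) * (w + B j))) := by
    intro u hu
    rw [evP, mul_add, mul_one, Finset.mul_sum, Finset.mul_sum]
    congr 1
    refine Finset.sum_congr rfl fun i _ => ?_
    rw [Finset.mul_sum, Finset.mul_sum]
    refine Finset.sum_congr rfl fun j _ => ?_
    rw [← Finset.mul_prod_erase _ _ (Finset.mem_univ i)]
    have h1 : (A i : ℂ) - u ≠ 0 := sub_ne_zero.mpr (hu i)
    have h2 := hw j
    field_simp
  have hPQ : P = Q := by
    refine Polynomial.eq_of_degrees_lt_of_eval_index_eq (s := Finset.univ)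
      (v := fun o : Option (Fin N) => o.elim w (fun l => -(B l : ℂ))) ?_ dP dQ ?_
    · rintro (_ | a) - (_ | b) - hab
      · rfl
      · exact absurd hab (by simp only [Option.elim]; intro h; exact hw b (by rw [h]; ring))
      · exact absurd hab (by simp only [Option.elim]; intro h; exact hw a (by rw [← h]; ring))
      · simp only [Option.elim, neg_inj] at hab
        exact congrArg some (hB (by exact_mod_cast hab))
    · rintro (_ | l) -
      · simp only [Option.elim]
        rw [evP, evQ, sub_self]
        simp only [zero_mul, mul_zero, Finset.sum_const_zero, add_zero]
        field_simp
        rfl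
      · simp only [Option.elim]
        rw [evP' _ (fun i h => by
          have h1 : ((A i + B l : ℝ) : ℂ) = 0 := by push_cast; rw [h]; ring
          have := hA0 i; have := hB0 l
          have h2 : A i + B l = 0 := by exact_mod_cast h1
          linarith), evQ, Finset.prod_eq_zero (i := l) (f := fun k => -(B l : ℂ) + B k) (Finset.mem_univ l)
            (by ring), mul_zero]
        have : ∑ i, ∑ j, (c i j : ℂ) / ((A i - -(B l : ℂ)) * (w + B j)) = 1 / (w + B l) := by
          rw [Finset.sum_comm]
          have : ∀ j, ∑ i, (c i j : ℂ) / ((A i - -(B l : ℂ)) * (w + B j)) =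
              (if l = j then 1 else 0) / (w + B j) := by
            intro j
            rw [← hGc l j, Finset.sum_div]
            refine Finset.sum_congr rfl fun i _ => ?_
            rw [sub_neg_eq_add, div_div]
          simp_rw [this]
          rw [Finset.sum_eq_single l]
          · simp
          · intro j _ hj; rw [if_neg (Ne.symm hj), zero_div]
          · simp
        rw [this]
        have h2 := hw l
        have : 1 + (-(B l : ℂ) - w) * (1 / (w + B l)) = 0 := by field_simp; ring
        rw [this, mul_zero]
  have h1 := evP' z hz
  rw [hPQ, evQ] at h1
  have hz0 : (∏ i, ((A i : ℂ) - z)) ≠ 0 := Finset.prod_ne_zero_iff.mpr fun i _ => sub_ne_zero.mpr (hz i)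
  have h2 : 1 + (z - w) * ∑ i, ∑ j, (c i j : ℂ) / ((A i - z) * (w + B j)) =
      (V / W * ∏ l, (z + B l)) / ∏ i, ((A i : ℂ) - z) := by
    rw [h1]; field_simp
  rw [h2]
  unfold Rat
  rw [← hW, ← hV, div_div_eq_mul_div]
  field_simp

end AW
namespace AW

theorem sqrt2_pos : 0 < Real.sqrt 2 := by positivity
theorem sqrt2_sq : Real.sqrt 2 ^ 2 = 2 := Real.sq_sqrt (by norm_num)

theorem gammaP_eq (a y : ℝ) : gammaP a y = ((a + |y| / Real.sqrt 2 : ℝ) : ℂ) + ((y / Real.sqrt 2 : ℝ) : ℂ) * I := by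
  unfold gammaP; push_cast; ring
theorem gammaM_eq (a y : ℝ) : gammaM a y = ((a - |y| / Real.sqrt 2 : ℝ) : ℂ) + ((y / Real.sqrt 2 : ℝ) : ℂ) * I := by
  unfold gammaM; push_cast; ring
theorem gammaP_re (a y : ℝ) : (gammaP a y).re = a + |y| / Real.sqrt 2 := by rw [gammaP_eq]; simp
theorem gammaP_im (a y : ℝ) : (gammaP a y).im = y / Real.sqrt 2 := by rw [gammaP_eq]; simp
theorem gammaM_re (a y : ℝ) : (gammaM a y).re = a - |y| / Real.sqrt 2 := by rw [gammaM_eq]; simp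
theorem gammaM_im (a y : ℝ) : (gammaM a y).im = y / Real.sqrt 2 := by rw [gammaM_eq]; simp
theorem gammaP_cont (a : ℝ) : Continuous (gammaP a) := by
  have : gammaP a = fun y => ((a + |y| / Real.sqrt 2 : ℝ) : ℂ) + ((y / Real.sqrt 2 : ℝ) : ℂ) * I :=
    funext (gammaP_eq a)
  rw [this]; fun_prop
theorem gammaM_cont (a : ℝ) : Continuous (gammaM a) := by
  have : gammaM a = fun y => ((a - |y| / Real.sqrt 2 : ℝ) : ℂ) + ((y / Real.sqrt 2 : ℝ) : ℂ) * I :=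
    funext (gammaM_eq a)
  rw [this]; fun_prop
theorem gammaPD_eq (y : ℝ) : gammaPD y = ((Real.sign y / Real.sqrt 2 : ℝ) : ℂ) + ((1 / Real.sqrt 2 : ℝ) : ℂ) * I := by
  unfold gammaPD; push_cast; ring
theorem gammaMD_eq (y : ℝ) : gammaMD y = ((-Real.sign y / Real.sqrt 2 : ℝ) : ℂ) + ((1 / Real.sqrt 2 : ℝ) : ℂ) * I := by
  unfold gammaMD; push_cast; ring

theorem sign_meas : Measurable Real.sign := by
  unfold Real.sign
  exact Measurable.ite measurableSet_Iio measurable_const (Measurable.ite measurableSet_Ioi measurable_const measurable_const)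

theorem sign_abs (y : ℝ) : |Real.sign y| ≤ 1 := by
  rcases Real.sign_apply_eq y with h | h | h <;> rw [h] <;> simp

theorem gammaPD_meas : Measurable gammaPD := by
  have : gammaPD = fun y => ((Real.sign y / Real.sqrt 2 : ℝ) : ℂ) + ((1 / Real.sqrt 2 : ℝ) : ℂ) * I :=
    funext gammaPD_eq
  rw [this]
  exact (Complex.measurable_ofReal.comp (sign_meas.div_const _)).add_const _
theorem gammaMD_meas : Measurable gammaMD := by
  have : gammaMD = fun y => ((-Real.sign y / Real.sqrt 2 : ℝ) : ℂ) + ((1 / Real.sqrt 2 : ℝ) : ℂ) * I :=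
    funext gammaMD_eq
  rw [this]
  exact (Complex.measurable_ofReal.comp (sign_meas.neg.div_const _)).add_const _

theorem inv_sqrt2_le : 1 / Real.sqrt 2 ≤ 1 := by
  rw [div_le_one sqrt2_pos]; exact Real.one_le_sqrt.mpr (by norm_num)

theorem gammaPD_norm (y : ℝ) : ‖gammaPD y‖ ≤ 2 := by
  rw [gammaPD_eq]
  refine (norm_add_le _ _).trans ?_
  rw [norm_mul, Complex.norm_I, Complex.norm_real, Complex.norm_real, Real.norm_eq_abs, Real.norm_eq_abs,
    abs_div, abs_div, abs_of_pos sqrt2_pos, abs_one]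
  have h1 := inv_sqrt2_le
  have h2 := sign_abs y
  have h3 : |Real.sign y| / Real.sqrt 2 ≤ 1 / Real.sqrt 2 := by gcongr
  linarith
theorem gammaMD_norm (y : ℝ) : ‖gammaMD y‖ ≤ 2 := by
  rw [gammaMD_eq]
  refine (norm_add_le _ _).trans ?_
  rw [norm_mul, Complex.norm_I, Complex.norm_real, Complex.norm_real, Real.norm_eq_abs, Real.norm_eq_abs,
    abs_div, abs_div, abs_of_pos sqrt2_pos, abs_one, abs_neg]
  have h1 := inv_sqrt2_le
  have h2 := sign_abs y
  have h3 : |Real.sign y| / Real.sqrt 2 ≤ 1 / Real.sqrt 2 := by gcongr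
  linarith

theorem abs_deriv {y : ℝ} (hy : y ≠ 0) : HasDerivAt (fun y : ℝ => |y|) (Real.sign y) y := by
  rcases lt_or_gt_of_ne hy with h | h
  · rw [Real.sign_of_neg h]; exact hasDerivAt_abs_neg h
  · rw [Real.sign_of_pos h]; exact hasDerivAt_abs_pos h

theorem gammaP_deriv (a : ℝ) {y : ℝ} (hy : y ≠ 0) : HasDerivAt (gammaP a) (gammaPD y) y := by
  have : gammaP a = fun y => ((a + |y| / Real.sqrt 2 : ℝ) : ℂ) + ((y / Real.sqrt 2 : ℝ) : ℂ) * I :=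
    funext (gammaP_eq a)
  rw [this, gammaPD_eq]
  exact ((((abs_deriv hy).div_const _).const_add a).ofReal_comp).add
    ((((hasDerivAt_id y).div_const _).ofReal_comp).mul_const I)
theorem gammaM_deriv (a : ℝ) {y : ℝ} (hy : y ≠ 0) : HasDerivAt (gammaM a) (gammaMD y) y := by
  have : gammaM a = fun y => ((a - |y| / Real.sqrt 2 : ℝ) : ℂ) + ((y / Real.sqrt 2 : ℝ) : ℂ) * I :=
    funext (gammaM_eq a)
  rw [this, gammaMD_eq, neg_div]
  exact ((((abs_deriv hy).div_const _).const_sub a).ofReal_comp).add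
    ((((hasDerivAt_id y).div_const _).ofReal_comp).mul_const I)

/-- FTC along a path, differentiable off zero with bounded derivative -/
theorem path_ftc {γ γ' : ℝ → ℂ} (hγ : Continuous γ) (hγ' : Measurable γ') {C : ℝ} (hC : ∀ y, ‖γ' y‖ ≤ C)
    (hd : ∀ y, y ≠ 0 → HasDerivAt γ (γ' y) y) {F f : ℂ → ℂ} {a b : ℝ} (hab : a ≤ b)
    (hF : ∀ y ∈ Set.Icc a b, HasDerivAt F (f (γ y)) (γ y)) (hf : ContinuousOn (fun y => f (γ y)) (Set.Icc a b)) :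
    ∫ y in a..b, f (γ y) * γ' y = F (γ b) - F (γ a) := by
  refine MeasureTheory.integral_eq_of_hasDerivAt_off_countable (fun y => F (γ y)) _
    (s := {0}) (Set.countable_singleton 0) ?_ ?_ ?_
  · rw [Set.uIcc_of_le hab]
    intro y hy
    exact ((hF y hy).continuousAt.comp hγ.continuousAt).continuousWithinAt
  · rw [min_eq_left hab, max_eq_right hab]
    intro y hy
    exact (hF y (Set.Ioo_subset_Icc_self hy.1)).comp y (hd y hy.2)
  · rw [intervalIntegrable_iff, Set.uIoc_of_le hab]
    have h1 : IntegrableOn (fun y => f (γ y)) (Set.Ioc a b) :=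
      (hf.integrableOn_compact isCompact_Icc).mono_set Set.Ioc_subset_Icc_self
    exact h1.mul_bdd hγ'.aestronglyMeasurable (Eventually.of_forall hC)

theorem ftcP {F f : ℂ → ℂ} {a b : ℝ} (hab : a ≤ b)
    (hF : ∀ y ∈ Set.Icc a b, HasDerivAt F (f (gammaP (-1) y)) (gammaP (-1) y))
    (hf : ContinuousOn (fun y => f (gammaP (-1) y)) (Set.Icc a b)) :
    ∫ y in a..b, f (gammaP (-1) y) * gammaPD y = F (gammaP (-1) b) - F (gammaP (-1) a) :=
  path_ftc (gammaP_cont _) gammaPD_meas gammaPD_norm (fun y hy => gammaP_deriv _ hy) hab hF hf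
theorem ftcM {F f : ℂ → ℂ} {a b : ℝ} (hab : a ≤ b)
    (hF : ∀ y ∈ Set.Icc a b, HasDerivAt F (f (gammaM 1 y)) (gammaM 1 y))
    (hf : ContinuousOn (fun y => f (gammaM 1 y)) (Set.Icc a b)) :
    ∫ y in a..b, f (gammaM 1 y) * gammaMD y = F (gammaM 1 b) - F (gammaM 1 a) :=
  path_ftc (gammaM_cont _) gammaMD_meas gammaMD_norm (fun y hy => gammaM_deriv _ hy) hab hF hf

/-- vertical lines -/
theorem ftcV {F f : ℂ → ℂ} (x : ℝ) {a b : ℝ} (hab : a ≤ b)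
    (hF : ∀ y ∈ Set.Icc a b, HasDerivAt F (f (x + y * I)) (x + y * I))
    (hf : ContinuousOn (fun y : ℝ => f (x + y * I)) (Set.Icc a b)) :
    ∫ y in a..b, f (x + y * I) * I = F (x + b * I) - F (x + a * I) :=
  path_ftc (γ := fun y : ℝ => (x : ℂ) + y * I) (γ' := fun _ => I) (by fun_prop) measurable_const
    (C := 1) (by simp) (fun y hy => by
      simpa using (((hasDerivAt_id y).ofReal_comp).mul_const I).const_add (x : ℂ)) hab hF hf
theorem ftcH {F f : ℂ → ℂ} (s : ℝ) {a b : ℝ} (hab : a ≤ b)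
    (hF : ∀ y ∈ Set.Icc a b, HasDerivAt F (f (y + s * I)) (y + s * I))
    (hf : ContinuousOn (fun y : ℝ => f (y + s * I)) (Set.Icc a b)) :
    ∫ y in a..b, f (y + s * I) = F (b + s * I) - F (a + s * I) := by
  have := path_ftc (γ := fun y : ℝ => (y : ℂ) + s * I) (γ' := fun _ => 1) (by fun_prop) measurable_const
    (C := 1) (by simp) (fun y hy => by
      simpa using ((hasDerivAt_id y).ofReal_comp).add_const ((s : ℂ) * I)) hab hF hf
  simpa using this

/-- crossing segment -/
theorem cross_seg {E : ℂ → ℂ} (hE : Differentiable ℂ E) :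
    ∫ y in (-Real.sqrt 2)..(Real.sqrt 2), E (gammaM 1 y) * gammaMD y =
      ∫ s in (-1:ℝ)..1, E (s * I) * I := by
  obtain ⟨F, hF⟩ := hE.isExactOn_univ
  have h2 := sqrt2_pos
  rw [ftcM (F := F) (by linarith) (fun y _ => hF _ trivial)
    (hE.continuous.comp (gammaM_cont 1)).continuousOn]
  have h3 := ftcV (F := F) (f := E) 0 (a := -1) (b := 1) (by norm_num) (fun y _ => hF _ trivial)
    (hE.continuous.comp (by fun_prop)).continuousOn
  simp only [ofReal_zero, zero_add] at h3
  rw [h3]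
  congr 2 <;> · rw [gammaM_eq]; simp [abs_of_pos h2, h2.ne']

end AW
namespace AW

theorem gammaP_end {r : ℝ} (hr : 0 ≤ r) : gammaP (-1) (Real.sqrt 2 * r) = ((r - 1 : ℝ) : ℂ) + (r : ℂ) * I := by
  have h2 := sqrt2_pos
  rw [gammaP_eq, abs_of_nonneg (by positivity)]
  push_cast; field_simp; ring
theorem gammaP_end' {r : ℝ} (hr : 0 ≤ r) :
    gammaP (-1) (-(Real.sqrt 2 * r)) = ((r - 1 : ℝ) : ℂ) + ((-r : ℝ) : ℂ) * I := by
  have h2 := sqrt2_pos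
  rw [gammaP_eq, abs_neg, abs_of_nonneg (by positivity)]
  push_cast; field_simp; ring

theorem dslope_diff {h : ℂ → ℂ} (hh : Differentiable ℂ h) (w : ℂ) : Differentiable ℂ (dslope h w) :=
  differentiableOn_univ.mp ((Complex.differentiableOn_dslope (by simp)).mpr hh.differentiableOn)

theorem quot_cont {h : ℂ → ℂ} (hh : Continuous h) {γ : ℝ → ℂ} (hγ : Continuous γ) {w : ℂ} {s : Set ℝ}
    (hs : ∀ y ∈ s, γ y ≠ w) : ContinuousOn (fun y => h (γ y) / (γ y - w)) s :=
  ((hh.comp hγ).continuousOn).div ((hγ.sub continuous_const).continuousOn) fun y hy => sub_ne_zero.mpr (hs y hy)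

theorem prim_deriv {h : ℂ → ℂ} {D L : ℂ → ℂ} {w : ℂ} (hD : ∀ z, HasDerivAt D (dslope h w z) z) {z : ℂ}
    (hz : z ≠ w) (hL : HasDerivAt L (1 / (z - w)) z) :
    HasDerivAt (fun z => D z + h w * L z) (h z / (z - w)) z := by
  have := (hD z).add (hL.const_mul (h w))
  have e : dslope h w z + h w * (1 / (z - w)) = h z / (z - w) := by
    rw [dslope_of_ne _ hz, slope_def_field]
    have : z - w ≠ 0 := sub_ne_zero.mpr hz
    field_simp; ring
  rw [e] at this
  exact this

theorem truncX {h : ℂ → ℂ} (hh : Differentiable ℂ h) {w : ℂ} {r : ℝ} (hr : 0 ≤ r) {L1 L2 : ℂ → ℂ}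
    (h1 : ∀ y, gammaP (-1) y ≠ w ∧ HasDerivAt L1 (1 / (gammaP (-1) y - w)) (gammaP (-1) y))
    (h2 : ∀ y ∈ Set.Icc (-r) r, (((r - 1 : ℝ) : ℂ) + y * I) ≠ w ∧
      HasDerivAt L2 (1 / ((((r - 1 : ℝ) : ℂ) + y * I) - w)) (((r - 1 : ℝ) : ℂ) + y * I)) :
    ∫ y in (-(Real.sqrt 2 * r))..(Real.sqrt 2 * r), h (gammaP (-1) y) / (gammaP (-1) y - w) * gammaPD y =
    (∫ s in (-r)..r, h (((r - 1 : ℝ) : ℂ) + s * I) / ((((r - 1 : ℝ) : ℂ) + s * I) - w) * I) +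
      h w * ((L1 (((r - 1 : ℝ) : ℂ) + (r : ℂ) * I) - L1 (((r - 1 : ℝ) : ℂ) + ((-r : ℝ) : ℂ) * I)) -
       (L2 (((r - 1 : ℝ) : ℂ) + (r : ℂ) * I) - L2 (((r - 1 : ℝ) : ℂ) + ((-r : ℝ) : ℂ) * I))) := by
  obtain ⟨D, hD⟩ := (dslope_diff hh w).isExactOn_univ
  have hD' : ∀ z, HasDerivAt D (dslope h w z) z := fun z => hD z trivial
  have hp := mul_nonneg sqrt2_pos.le hr
  rw [ftcP (F := fun z => D z + h w * L1 z) (f := fun z => h z / (z - w)) (by linarith)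
    (fun y _ => prim_deriv hD' (h1 y).1 (h1 y).2)
    (quot_cont hh.continuous (gammaP_cont _) fun y _ => (h1 y).1),
    ftcV (F := fun z => D z + h w * L2 z) (f := fun z => h z / (z - w)) (r - 1) (by linarith)
    (fun y hy => prim_deriv hD' (h2 y hy).1 (h2 y hy).2)
    (quot_cont hh.continuous (by fun_prop) fun y hy => (h2 y hy).1),
    gammaP_end hr, gammaP_end' hr]
  ring

/-- decay on the right wedge -/
def DecR (h : ℂ → ℂ) : Prop := ∃ C δ : ℝ, 0 ≤ C ∧ 0 < δ ∧ ∀ z : ℂ, |z.im| ≤ z.re + 1 → ‖h z‖ ≤ C * Real.exp (-δ * z.re)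

theorem gammaP_wedge (y : ℝ) : |(gammaP (-1) y).im| = (gammaP (-1) y).re + 1 := by
  rw [gammaP_re, gammaP_im, abs_div, abs_of_pos sqrt2_pos]; ring
theorem gammaM_wedge (y : ℝ) : |(gammaM 1 y).im| = 1 - (gammaM 1 y).re := by
  rw [gammaM_re, gammaM_im, abs_div, abs_of_pos sqrt2_pos]; ring

theorem distP (w : ℂ) (y : ℝ) : |(w.re + 1 - |w.im| : ℝ)| ≤ 2 * ‖gammaP (-1) y - w‖ := by
  have h1 := Complex.abs_re_le_norm (gammaP (-1) y - w)
  have h2 := Complex.abs_im_le_norm (gammaP (-1) y - w)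
  have h3 := gammaP_wedge y
  rw [Complex.sub_re] at h1
  rw [Complex.sub_im] at h2
  have h4 := abs_abs_sub_abs_le (gammaP (-1) y).im w.im
  rw [h3] at h4
  have h5 : w.re + 1 - |w.im| = ((gammaP (-1) y).re + 1 - |w.im|) - ((gammaP (-1) y).re - w.re) := by ring
  rw [h5]
  refine (abs_sub _ _).trans ?_
  linarith

theorem exp_abs_integrable {a : ℝ} (ha : 0 < a) : Integrable (fun y : ℝ => Real.exp (-(a * |y|))) := by
  have h1 : IntegrableOn (fun y : ℝ => Real.exp (-(a * |y|))) (Set.Ioi 0) := by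
    refine (integrableOn_exp_mul_Ioi (a := -a) (by linarith) 0).congr_fun (fun y hy => ?_) measurableSet_Ioi
    simp only [abs_of_pos (Set.mem_Ioi.mp hy)]; congr 1; ring
  have h2 : IntegrableOn (fun y : ℝ => Real.exp (-(a * |y|))) (Set.Iic 0) := by
    refine (integrableOn_exp_mul_Iic (a := a) ha 0).congr_fun (fun y hy => ?_) measurableSet_Iic
    simp only [abs_of_nonpos (Set.mem_Iic.mp hy)]; congr 1; ring
  have := h2.union h1
  rwa [Set.Iic_union_Ioi, integrableOn_univ] at this

theorem X_integrable {h : ℂ → ℂ} (hh : Continuous h) (hd : DecR h) {w : ℂ} (hw : |w.im| ≠ w.re + 1) :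
    Integrable (fun y => h (gammaP (-1) y) / (gammaP (-1) y - w) * gammaPD y) := by
  obtain ⟨C, δ, hC, hδ, hb⟩ := hd
  set d := |(w.re + 1 - |w.im| : ℝ)| with hdef
  have hd0 : 0 < d := abs_pos.mpr (sub_ne_zero.mpr (Ne.symm hw))
  have hne : ∀ y, gammaP (-1) y ≠ w := by
    intro y hy
    have := distP w y
    rw [hy, sub_self, norm_zero, mul_zero] at this
    linarith
  have hdiv : 0 < δ / Real.sqrt 2 := div_pos hδ sqrt2_pos
  refine Integrable.mono' ((exp_abs_integrable hdiv).const_mul (C * Real.exp δ * (2 / d) * 2)) ?_ ?_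
  · exact ((continuousOn_univ.mp (quot_cont hh (gammaP_cont _) fun y _ => hne y)).aestronglyMeasurable).mul
      gammaPD_meas.aestronglyMeasurable
  · refine Eventually.of_forall fun y => ?_
    rw [norm_mul, norm_div]
    have h1 := hb _ (gammaP_wedge y).le
    have h2 := distP w y
    rw [← hdef] at h2
    have h3 : ‖h (gammaP (-1) y)‖ / ‖gammaP (-1) y - w‖ ≤ (C * Real.exp (-δ * (gammaP (-1) y).re)) / (d / 2) := by
      gcongr; linarith
    have h4 : Real.exp (-δ * (gammaP (-1) y).re) = Real.exp δ * Real.exp (-(δ / Real.sqrt 2 * |y|)) := by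
      rw [gammaP_re, ← Real.exp_add]; congr 1; ring
    rw [h4] at h3
    calc _ ≤ (C * (Real.exp δ * Real.exp (-(δ / Real.sqrt 2 * |y|)))) / (d / 2) * 2 :=
          mul_le_mul h3 (gammaPD_norm y) (norm_nonneg _) (by positivity)
      _ = _ := by field_simp

theorem X_chord {h : ℂ → ℂ} (hd : DecR h) (w : ℂ) :
    Tendsto (fun r : ℝ => ∫ s in (-r)..r, h (((r - 1 : ℝ) : ℂ) + s * I) / ((((r - 1 : ℝ) : ℂ) + s * I) - w) * I)
      atTop (𝓝 0) := by
  obtain ⟨C, δ, hC, hδ, hb⟩ := hd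
  have hlim : Tendsto (fun r : ℝ => C * Real.exp δ * 2 * (r * Real.exp (-(δ * r)))) atTop (𝓝 0) := by
    have h1 := (Real.tendsto_pow_mul_exp_neg_atTop_nhds_zero 1).comp (tendsto_id.const_mul_atTop hδ)
    have h2 := h1.const_mul (C * Real.exp δ * 2 / δ)
    rw [mul_zero] at h2
    refine h2.congr fun r => ?_
    simp only [Function.comp, pow_one, id]
    field_simp
  refine squeeze_zero_norm' ?_ hlim
  filter_upwards [eventually_ge_atTop (w.re + 2), eventually_ge_atTop 0] with r hr hr0
  have := intervalIntegral.norm_integral_le_of_norm_le_const (a := -r) (b := r) (C := C * Real.exp (-δ * (r - 1)))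
    (f := fun s : ℝ => h (((r - 1 : ℝ) : ℂ) + s * I) / ((((r - 1 : ℝ) : ℂ) + s * I) - w) * I) ?_
  · refine this.trans (le_of_eq ?_)
    rw [abs_of_nonneg (by linarith), show -δ * (r - 1) = δ + -(δ * r) by ring, Real.exp_add]
    ring
  · intro s hs
    rw [Set.uIoc_of_le (by linarith)] at hs
    rw [norm_mul, norm_I, mul_one, norm_div]
    have h1 := hb (((r - 1 : ℝ) : ℂ) + s * I) (by simpa using abs_le.mpr ⟨hs.1.le, hs.2⟩)
    have e : ((((r - 1 : ℝ) : ℂ) + s * I)).re = r - 1 := by simp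
    rw [e] at h1
    have h2 := Complex.re_le_norm ((((r - 1 : ℝ) : ℂ) + s * I) - w)
    rw [Complex.sub_re, e] at h2
    refine (div_le_self (norm_nonneg _) (by linarith)).trans h1

theorem X_limit {h : ℂ → ℂ} (hh : Differentiable ℂ h) (hd : DecR h) {w : ℂ} (hw : |w.im| ≠ w.re + 1) {c : ℂ}
    (H : ∀ᶠ r : ℝ in atTop,
      ∫ y in (-(Real.sqrt 2 * r))..(Real.sqrt 2 * r), h (gammaP (-1) y) / (gammaP (-1) y - w) * gammaPD y =
      (∫ s in (-r)..r, h (((r - 1 : ℝ) : ℂ) + s * I) / ((((r - 1 : ℝ) : ℂ) + s * I) - w) * I) + c) :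
    ∫ y, h (gammaP (-1) y) / (gammaP (-1) y - w) * gammaPD y = c := by
  have h1 : Tendsto (fun r : ℝ => Real.sqrt 2 * r) atTop atTop := tendsto_id.const_mul_atTop sqrt2_pos
  have h2 := intervalIntegral_tendsto_integral (X_integrable hh.continuous hd hw)
    (tendsto_neg_atTop_atBot.comp h1) h1
  have h3 := (X_chord hd w).add_const c
  rw [zero_add] at h3
  refine tendsto_nhds_unique h2 (h3.congr' ?_)
  filter_upwards [H] with r hr
  exact hr.symm

theorem ne_of_wedge {w : ℂ} (hw : |w.im| ≠ w.re + 1) (y : ℝ) : gammaP (-1) y ≠ w := by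
  intro hy; apply hw; rw [← hy]; exact gammaP_wedge y

theorem X_left {h : ℂ → ℂ} (hh : Differentiable ℂ h) (hd : DecR h) {w : ℂ} (hw : w.re + 1 < |w.im|) :
    ∫ y, h (gammaP (-1) y) / (gammaP (-1) y - w) * gammaPD y = 0 := by
  refine X_limit hh hd hw.ne' ?_
  obtain ⟨κ, hκ⟩ : ∃ κ : ℂ, ∀ z : ℂ, |z.im| ≤ z.re + 1 → 0 < (κ * (z - w)).re := by
    rcases le_total 0 w.im with h0 | h0
    · refine ⟨1 + I, fun z hz => ?_⟩
      rw [abs_of_nonneg h0] at hw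
      have := le_abs_self z.im
      simp; linarith
    · refine ⟨1 - I, fun z hz => ?_⟩
      rw [abs_of_nonpos h0] at hw
      have := neg_abs_le z.im
      simp; linarith
  have key : ∀ z : ℂ, |z.im| ≤ z.re + 1 → z ≠ w ∧ HasDerivAt (fun z => Complex.log (κ * (z - w))) (1 / (z - w)) z := by
    intro z hz
    have h1 := hκ z hz
    have h2 : κ * (z - w) ≠ 0 := fun h => by rw [h] at h1; simp at h1
    refine ⟨fun h => h2 (by rw [h]; ring), ?_⟩
    have h3 : HasDerivAt (fun z => κ * (z - w)) (κ * 1) z := ((hasDerivAt_id z).sub_const w).const_mul κ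
    have := h3.clog (Or.inl h1)
    convert this using 1
    have hk1 : κ ≠ 0 := left_ne_zero_of_mul h2
    have hk2 := right_ne_zero_of_mul h2
    field_simp
  filter_upwards [eventually_ge_atTop 0] with r hr
  rw [truncX hh hr (fun y => key _ (gammaP_wedge y).le) (fun y hy => key _ (by simpa using abs_le.mpr hy))]
  ring

theorem X_right {h : ℂ → ℂ} (hh : Differentiable ℂ h) (hd : DecR h) {w : ℂ} (hw : |w.im| < w.re + 1) :
    ∫ y, h (gammaP (-1) y) / (gammaP (-1) y - w) * gammaPD y = -(2 * Real.pi * I) * h w := by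
  refine X_limit hh hd hw.ne ?_
  filter_upwards [eventually_ge_atTop 0, eventually_gt_atTop (w.re + 1)] with r hr hr2
  have hne := ne_of_wedge hw.ne
  have hv := abs_lt.mp hw
  rw [truncX hh hr (L1 := fun z => Complex.log (w - z)) (L2 := fun z => Complex.log (z - w)) (fun y => ⟨hne y, ?_⟩)
    (fun y hy => ⟨?_, ?_⟩)]
  · congr 1
    rw [← neg_sub (((r - 1 : ℝ) : ℂ) + (r : ℂ) * I) w, ← neg_sub (((r - 1 : ℝ) : ℂ) + ((-r : ℝ) : ℂ) * I) w]
    set u := ((r - 1 : ℝ) : ℂ) + (r : ℂ) * I - w with hu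
    set v := ((r - 1 : ℝ) : ℂ) + ((-r : ℝ) : ℂ) * I - w with hv'
    have hui : 0 < u.im := by simp [hu]; linarith
    have hvi : v.im < 0 := by simp [hv']; linarith
    simp only [Complex.log, norm_neg, arg_neg_eq_arg_sub_pi_of_im_pos hui, arg_neg_eq_arg_add_pi_of_im_neg hvi]
    push_cast
    ring
  · have h3 : HasDerivAt (fun z => w - z) (-1) (gammaP (-1) y) := (hasDerivAt_id _).const_sub w
    have := h3.clog (by
      rw [Complex.mem_slitPlane_iff]
      by_cases him : (w - gammaP (-1) y).im = 0
      · left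
        have h4 := gammaP_wedge y
        rw [Complex.sub_im, sub_eq_zero] at him
        rw [← him] at h4
        rw [Complex.sub_re]
        linarith
      · exact Or.inr him)
    convert this using 1
    rw [neg_div, ← div_neg, neg_sub]
  · intro h
    have := congrArg Complex.re h
    simp at this
    linarith
  · have h3 : HasDerivAt (fun z => z - w) 1 (((r - 1 : ℝ) : ℂ) + (y : ℂ) * I) := (hasDerivAt_id _).sub_const w
    exact h3.clog (Or.inl (by simp; linarith))

end AW
namespace AW

/-- the Gaussian exponentials -/
def E2 (τ x : ℝ) (w : ℂ) : ℂ := cexp (τ * w ^ 2 + x * w)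

theorem E2_diff (τ x : ℝ) : Differentiable ℂ (E2 τ x) := by unfold E2; fun_prop
theorem E2_cont (τ x : ℝ) : Continuous (E2 τ x) := (E2_diff τ x).continuous

theorem E2_norm (τ x : ℝ) (w : ℂ) : ‖E2 τ x w‖ = Real.exp (τ * (w.re ^ 2 - w.im ^ 2) + x * w.re) := by
  unfold E2
  rw [Complex.norm_exp]
  congr 1
  simp [pow_two]

theorem E2_vert (τ x s : ℝ) : E2 τ x (1 + s * I) = cexp (-(τ : ℂ) * s ^ 2 + ((2 * τ + x : ℝ) : ℂ) * I * s + ((τ + x : ℝ) : ℂ)) := by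
  unfold E2
  congr 1
  push_cast
  ring_nf
  rw [I_sq]; ring

theorem E2_vert_integrable {τ : ℝ} (hτ : 0 < τ) (x : ℝ) : Integrable (fun s : ℝ => E2 τ x (1 + s * I)) := by
  simp_rw [E2_vert]
  exact integrable_cexp_quadratic (by simpa using hτ) _ _

theorem E2_vert_integral {τ : ℝ} (hτ : 0 < τ) (x : ℝ) :
    ∫ s : ℝ, E2 τ x (1 + s * I) = 2 * Real.pi * (hk τ x : ℂ) := by
  simp_rw [E2_vert]
  rw [integral_cexp_quadratic (by simpa using hτ)]
  have h1 : ((Real.pi : ℂ) / - -(τ : ℂ)) ^ (1 / 2 : ℂ) = ((2 * Real.pi * (Real.sqrt (4 * Real.pi * τ))⁻¹ : ℝ) : ℂ) := by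
    rw [neg_neg, ← Complex.ofReal_div, show (1 / 2 : ℂ) = ((1 / 2 : ℝ) : ℂ) by push_cast; rfl,
      ← Complex.ofReal_cpow (by positivity), ← Real.sqrt_eq_rpow]
    congr 1
    rw [Real.sqrt_eq_iff_mul_self_eq (by positivity) (by positivity)]
    have : Real.sqrt (4 * Real.pi * τ) * Real.sqrt (4 * Real.pi * τ) = 4 * Real.pi * τ :=
      Real.mul_self_sqrt (by positivity)
    have e : (Real.sqrt (4 * Real.pi * τ))⁻¹ * (Real.sqrt (4 * Real.pi * τ))⁻¹ = (4 * Real.pi * τ)⁻¹ := by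
      rw [← mul_inv, this]
    symm
    calc _ = 4 * Real.pi ^ 2 * ((Real.sqrt (4 * Real.pi * τ))⁻¹ * (Real.sqrt (4 * Real.pi * τ))⁻¹) := by ring
      _ = _ := by rw [e]; field_simp
  have h2 : ((τ + x : ℝ) : ℂ) - (((2 * τ + x : ℝ) : ℂ) * I) ^ 2 / (4 * -(τ : ℂ)) = ((-x ^ 2 / (4 * τ) : ℝ) : ℂ) := by
    have : (τ : ℂ) ≠ 0 := by exact_mod_cast hτ.ne'
    rw [mul_pow, I_sq]; push_cast; field_simp; ring
  rw [h1, h2, ← Complex.ofReal_exp]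
  unfold hk
  push_cast
  ring

theorem E2_shift (τ x y : ℝ) (w : ℂ) : E2 τ x w * cexp (-(y * w)) = E2 τ (x - y) w := by
  unfold E2
  rw [← Complex.exp_add]; congr 1; push_cast; ring

theorem vert_eval {τ B : ℝ} (hτ : 0 < τ) (hB : 0 < B) (x : ℝ) :
    ∫ s : ℝ, E2 τ x (1 + s * I) / ((1 + s * I) - ((-B : ℝ) : ℂ)) = 2 * Real.pi * (phiF B τ x : ℂ) := by
  have h1 : ∀ s : ℝ, E2 τ x (1 + s * I) / ((1 + s * I) - ((-B : ℝ) : ℂ)) =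
      ∫ y in Set.Ioi (0:ℝ), E2 τ x (1 + s * I) * cexp (-((1 + s * I) + B) * y) := by
    intro s
    rw [MeasureTheory.integral_const_mul, integral_exp_mul_complex_Ioi (by simp; linarith)]
    simp only [ofReal_zero, mul_zero, Complex.exp_zero, ofReal_neg, sub_neg_eq_add]
    rw [neg_div_neg_eq, mul_one_div]
  simp_rw [h1]
  have hInt : Integrable (Function.uncurry fun s y : ℝ => E2 τ x (1 + s * I) * cexp (-((1 + s * I) + B) * y))
      (volume.prod (volume.restrict (Set.Ioi (0:ℝ)))) := by
    have h2 : Integrable (fun p : ℝ × ℝ => ‖E2 τ x (1 + p.1 * I)‖ * Real.exp (-(1 + B) * p.2))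
        (volume.prod (volume.restrict (Set.Ioi (0:ℝ)))) :=
      (E2_vert_integrable hτ x).norm.mul_prod (integrableOn_exp_mul_Ioi (by linarith) 0)
    refine h2.mono' ?_ ?_
    · apply Continuous.aestronglyMeasurable
      unfold Function.uncurry
      exact ((E2_cont τ x).comp (by fun_prop)).mul (by fun_prop)
    · refine Eventually.of_forall fun p => ?_
      simp only [Function.uncurry]
      rw [norm_mul, Complex.norm_exp]
      simp
  rw [MeasureTheory.integral_integral_swap hInt]
  have h3 : ∀ y : ℝ, ∫ s : ℝ, E2 τ x (1 + s * I) * cexp (-((1 + s * I) + B) * y) =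
      2 * Real.pi * ((hk τ (x - y) * Real.exp (-B * y) : ℝ) : ℂ) := by
    intro y
    have : ∀ s : ℝ, E2 τ x (1 + s * I) * cexp (-((1 + s * I) + B) * y) =
        E2 τ (x - y) (1 + s * I) * cexp (-(B * y)) := by
      intro s
      rw [← E2_shift, mul_assoc, ← Complex.exp_add]
      congr 2; ring
    simp_rw [this]
    rw [MeasureTheory.integral_mul_const, E2_vert_integral hτ]
    push_cast
    ring_nf
  simp_rw [h3]
  rw [MeasureTheory.integral_const_mul, integral_complex_ofReal]
  rfl

theorem gammaM_end {r : ℝ} (hr : 0 ≤ r) : gammaM 1 (Real.sqrt 2 * r) = ((1 - r : ℝ) : ℂ) + (r : ℂ) * I := by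
  have h2 := sqrt2_pos
  rw [gammaM_eq, abs_of_nonneg (by positivity)]
  push_cast; field_simp
theorem gammaM_end' {r : ℝ} (hr : 0 ≤ r) :
    gammaM 1 (-(Real.sqrt 2 * r)) = ((1 - r : ℝ) : ℂ) + ((-r : ℝ) : ℂ) * I := by
  have h2 := sqrt2_pos
  rw [gammaM_eq, abs_neg, abs_of_nonneg (by positivity)]
  push_cast; field_simp

theorem distM {B : ℝ} (hB : 0 < B) (y : ℝ) : 1 / 2 ≤ ‖gammaM 1 y - ((-B : ℝ) : ℂ)‖ := by
  have h1 := Complex.abs_re_le_norm (gammaM 1 y - ((-B : ℝ) : ℂ))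
  have h2 := Complex.abs_im_le_norm (gammaM 1 y - ((-B : ℝ) : ℂ))
  have h3 := gammaM_wedge y
  rw [Complex.sub_re, ofReal_re] at h1
  rw [Complex.sub_im, ofReal_im, sub_zero, h3] at h2
  have := le_abs_self ((gammaM 1 y).re - -B)
  linarith

theorem E2_gammaM (τ x y : ℝ) : ‖E2 τ x (gammaM 1 y)‖ = Real.exp (τ + x) * Real.exp (-((2 * τ + x) / Real.sqrt 2 * |y|)) := by
  rw [E2_norm, ← Real.exp_add]
  congr 1
  have h := gammaM_wedge y
  rw [← sq_abs (gammaM 1 y).im, h, gammaM_re]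
  ring

theorem Y_integrable {τ B x : ℝ} (hB : 0 < B) (hx : -(2 * τ) < x) :
    Integrable (fun y => E2 τ x (gammaM 1 y) / (gammaM 1 y - ((-B : ℝ) : ℂ)) * gammaMD y) := by
  have hne : ∀ y, gammaM 1 y ≠ ((-B : ℝ) : ℂ) := by
    intro y hy
    have := distM hB y
    rw [hy, sub_self, norm_zero] at this
    linarith
  refine Integrable.mono' ((exp_abs_integrable (a := (2 * τ + x) / Real.sqrt 2) (div_pos (by linarith) sqrt2_pos)).const_mul
    (Real.exp (τ + x) * 4)) ?_ ?_
  · exact ((continuousOn_univ.mp (quot_cont (E2_cont τ x) (gammaM_cont _) fun y _ => hne y)).aestronglyMeasurable).mul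
      gammaMD_meas.aestronglyMeasurable
  · refine Eventually.of_forall fun y => ?_
    rw [norm_mul, norm_div, E2_gammaM]
    have h2 := distM hB y
    have h3 : (Real.exp (τ + x) * Real.exp (-((2 * τ + x) / Real.sqrt 2 * |y|))) / ‖gammaM 1 y - ((-B : ℝ) : ℂ)‖ ≤
      (Real.exp (τ + x) * Real.exp (-((2 * τ + x) / Real.sqrt 2 * |y|))) / (1 / 2) := by
      gcongr
    calc _ ≤ (Real.exp (τ + x) * Real.exp (-((2 * τ + x) / Real.sqrt 2 * |y|))) / (1 / 2) * 2 :=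
          mul_le_mul h3 (gammaMD_norm y) (norm_nonneg _) (by positivity)
      _ = _ := by ring

theorem Y_horiz {τ B x : ℝ} (hτ : 0 < τ) (hB : 0 < B) (hx : -(2 * τ) < x) (σ : ℝ) (hσ : |σ| = 1) :
    Tendsto (fun r : ℝ => ∫ u in (1 - r)..1, E2 τ x (u + ((σ * r : ℝ) : ℂ) * I) /
      ((u + ((σ * r : ℝ) : ℂ) * I) - ((-B : ℝ) : ℂ))) atTop (𝓝 0) := by
  set δ := min (2 * τ + x) τ with hδ
  have hδ0 : 0 < δ := lt_min (by linarith) hτ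
  have hlim : Tendsto (fun r : ℝ => Real.exp (τ + x) * (r * Real.exp (-(δ * r)))) atTop (𝓝 0) := by
    have h1 := (Real.tendsto_pow_mul_exp_neg_atTop_nhds_zero 1).comp (tendsto_id.const_mul_atTop hδ0)
    have h2 := h1.const_mul (Real.exp (τ + x) / δ)
    rw [mul_zero] at h2
    refine h2.congr fun r => ?_
    simp only [Function.comp, pow_one, id]
    field_simp
  refine squeeze_zero_norm' ?_ hlim
  filter_upwards [eventually_ge_atTop 1] with r hr
  have := intervalIntegral.norm_integral_le_of_norm_le_const (a := 1 - r) (b := 1)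
    (C := Real.exp (τ + x) * Real.exp (-(δ * r)))
    (f := fun u : ℝ => E2 τ x (u + ((σ * r : ℝ) : ℂ) * I) /
      ((u + ((σ * r : ℝ) : ℂ) * I) - ((-B : ℝ) : ℂ))) ?_
  · refine this.trans (le_of_eq ?_)
    rw [abs_of_nonneg (by linarith)]
    ring
  · intro u hu
    rw [Set.uIoc_of_le (by linarith)] at hu
    rw [norm_div, E2_norm]
    have h2 := Complex.abs_im_le_norm ((u + ((σ * r : ℝ) : ℂ) * I) - ((-B : ℝ) : ℂ))
    have e : (((u : ℂ) + ((σ * r : ℝ) : ℂ) * I) - ((-B : ℝ) : ℂ)).im = σ * r := by simp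
    rw [e, abs_mul, hσ, one_mul, abs_of_nonneg (by linarith)] at h2
    refine (div_le_self (Real.exp_pos _).le (by linarith)).trans ?_
    rw [← Real.exp_add, Real.exp_le_exp]
    have hre : ((u : ℂ) + ((σ * r : ℝ) : ℂ) * I).re = u := by simp
    have him : ((u : ℂ) + ((σ * r : ℝ) : ℂ) * I).im = σ * r := by simp
    have hσ2 : σ ^ 2 = 1 := by rw [← sq_abs, hσ]; norm_num
    rw [hre, him, mul_pow, hσ2, one_mul]
    have d1 : δ ≤ 2 * τ + x := min_le_left _ _
    have d2 : δ ≤ τ := min_le_right _ _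
    set q := 1 - u with hq
    have hq0 : 0 ≤ q := by linarith [hu.2]
    have hqr : q ≤ r := by linarith [hu.1]
    have hu' : u = 1 - q := by ring
    rw [hu']
    have h5 : δ * q ≤ (2 * τ + x) * q := mul_le_mul_of_nonneg_right d1 hq0
    have h6 : δ * (r - q) ≤ τ * (r - q) := mul_le_mul_of_nonneg_right d2 (by linarith)
    have h7 : τ * (r - q) * 1 ≤ τ * (r - q) * (r + q) :=
      mul_le_mul_of_nonneg_left (by linarith) (mul_nonneg hτ.le (by linarith))
    nlinarith

theorem lemY {τ B x : ℝ} (hτ : 0 < τ) (hB : 0 < B) (hx : -(2 * τ) < x) :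
    ∫ y, E2 τ x (gammaM 1 y) / (gammaM 1 y - ((-B : ℝ) : ℂ)) * gammaMD y = 2 * Real.pi * I * (phiF B τ x : ℂ) := by
  set b : ℂ := ((-B : ℝ) : ℂ) with hb
  obtain ⟨D, hD⟩ := (dslope_diff (E2_diff τ x) b).isExactOn_univ
  have hD' : ∀ z, HasDerivAt D (dslope (E2 τ x) b z) z := fun z => hD z trivial
  set F : ℂ → ℂ := fun z => D z + E2 τ x b * Complex.log (z - b) with hF
  have key : ∀ z : ℂ, (0 < z.re + B ∨ z.im ≠ 0) → z ≠ b ∧ HasDerivAt F (E2 τ x z / (z - b)) z := by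
    intro z hz
    have hs : z - b ∈ slitPlane := by
      rw [Complex.mem_slitPlane_iff]
      simpa [hb] using hz
    have hne : z ≠ b := sub_ne_zero.mp (slitPlane_ne_zero hs)
    refine ⟨hne, prim_deriv hD' hne ?_⟩
    have h3 : HasDerivAt (fun z => z - b) 1 z := (hasDerivAt_id _).sub_const b
    exact h3.clog hs
  have kM : ∀ y, 0 < (gammaM 1 y).re + B ∨ (gammaM 1 y).im ≠ 0 := by
    intro y
    by_cases h : (gammaM 1 y).im = 0
    · left
      have := gammaM_wedge y
      rw [h, abs_zero] at this
      linarith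
    · exact Or.inr h
  have h1 : Tendsto (fun r : ℝ => Real.sqrt 2 * r) atTop atTop := tendsto_id.const_mul_atTop sqrt2_pos
  have h2 := intervalIntegral_tendsto_integral (Y_integrable (τ := τ) hB hx)
    (tendsto_neg_atTop_atBot.comp h1) h1
  have hvi : Integrable (fun s : ℝ => E2 τ x (1 + s * I) / ((1 + s * I) - b) * I) := by
    refine Integrable.mul_const ?_ I
    refine (E2_vert_integrable hτ x).mono ?_ ?_
    · have := quot_cont (s := Set.univ) (w := b) (E2_cont τ x) (γ := fun s : ℝ => 1 + s * I) (by fun_prop)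
        (fun y _ => (key _ (by left; simp; linarith)).1)
      exact (continuousOn_univ.mp this).aestronglyMeasurable
    · refine Eventually.of_forall fun s => ?_
      rw [norm_div]
      refine div_le_self (norm_nonneg _) ?_
      have := Complex.re_le_norm (1 + s * I - b)
      have e : (1 + s * I - b).re = 1 + B := by simp [hb]
      rw [e] at this
      linarith
  have h3 := intervalIntegral_tendsto_integral hvi tendsto_neg_atTop_atBot (tendsto_id (α := ℝ))
  have h4 := (h3.sub (Y_horiz hτ hB hx 1 (by simp))).add (Y_horiz hτ hB hx (-1) (by simp))
  rw [sub_zero, add_zero, MeasureTheory.integral_mul_const, vert_eval hτ hB] at h4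
  refine (tendsto_nhds_unique h2 (h4.congr' ?_)).trans (by ring)
  filter_upwards [eventually_gt_atTop 0] with r hr
  have hp := mul_pos sqrt2_pos hr
  simp only [Function.comp, id]
  rw [ftcM (F := F) (f := fun z => E2 τ x z / (z - b)) (by linarith) (fun y _ => (key _ (kM y)).2)
    (quot_cont (E2_cont τ x) (gammaM_cont _) fun y _ => (key _ (kM y)).1), gammaM_end hr.le, gammaM_end' hr.le]
  have v := ftcV (F := F) (f := fun z => E2 τ x z / (z - b)) 1 (a := -r) (b := r) (by linarith)
    (fun y _ => (key _ (by left; simp; linarith)).2)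
    (quot_cont (E2_cont τ x) (by fun_prop) fun y _ => (key _ (by left; simp; linarith)).1)
  have hz : ∀ σ : ℝ, σ ≠ 0 → ∀ y : ℝ, 0 < ((y : ℂ) + ((σ * r : ℝ) : ℂ) * I).re + B ∨ ((y : ℂ) + ((σ * r : ℝ) : ℂ) * I).im ≠ 0 := by
    intro σ hσ y
    right
    simpa using ⟨hσ, hr.ne'⟩
  have hh : ∀ σ : ℝ, σ ≠ 0 → _ := fun σ hσ => ftcH (F := F) (f := fun z => E2 τ x z / (z - b)) (σ * r) (a := 1 - r) (b := 1) (by linarith)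
    (fun y _ => (key _ (hz σ hσ y)).2)
    (quot_cont (E2_cont τ x) (by fun_prop) fun y _ => (key _ (hz σ hσ y)).1)
  simp only [ofReal_one] at v
  rw [v, hh 1 (by norm_num), hh (-1) (by norm_num)]
  simp only [one_mul, neg_one_mul, ofReal_one]
  ring

end AW
namespace AW

def q0 (y : ℝ) : ℝ := (Set.Ioc (0:ℝ) 1).indicator (fun y => y ^ (-(1/2) : ℝ)) y
def kq (y : ℝ) : ℝ := q0 y + q0 (-y)
def QW (y : ℝ) : ℝ := 2 + (kq (y - Real.sqrt 2) + kq (y + Real.sqrt 2))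

theorem q0_nonneg (y : ℝ) : 0 ≤ q0 y := Set.indicator_nonneg (fun y hy => Real.rpow_nonneg hy.1.le _) y
theorem kq_nonneg (y : ℝ) : 0 ≤ kq y := add_nonneg (q0_nonneg _) (q0_nonneg _)
theorem QW_nonneg (y : ℝ) : 0 ≤ QW y := by
  have := kq_nonneg (y - Real.sqrt 2); have := kq_nonneg (y + Real.sqrt 2); unfold QW; linarith

theorem q0_integrable : Integrable q0 := by
  have h := intervalIntegral.intervalIntegrable_rpow' (a := 0) (b := 1) (r := -(1/2)) (by norm_num)
  rw [intervalIntegrable_iff, Set.uIoc_of_le zero_le_one] at h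
  exact h.integrable_indicator measurableSet_Ioc
theorem kq_integrable : Integrable kq := q0_integrable.add q0_integrable.comp_neg

theorem kq_bd {y : ℝ} (hy : y ≠ 0) : |y| ^ (-(1/2) : ℝ) ≤ 1 + kq y := by
  by_cases h : |y| ≤ 1
  · have : |y| ^ (-(1/2) : ℝ) ≤ kq y := by
      unfold kq
      rcases lt_or_gt_of_ne hy with h0 | h0
      · have h1 : q0 (-y) = |y| ^ (-(1/2) : ℝ) := by
          unfold q0; rw [abs_of_neg h0] at h ⊢; exact Set.indicator_of_mem (show -y ∈ Set.Ioc (0:ℝ) 1 from ⟨by linarith, h⟩) _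
        have := q0_nonneg y; linarith
      · have h1 : q0 y = |y| ^ (-(1/2) : ℝ) := by
          unfold q0; rw [abs_of_pos h0] at h ⊢; exact Set.indicator_of_mem (show y ∈ Set.Ioc (0:ℝ) 1 from ⟨by linarith, h⟩) _
        have := q0_nonneg (-y); linarith
    linarith
  · have h1 := Real.rpow_le_one_of_one_le_of_nonpos (x := |y|) (z := -(1/2)) (by linarith) (by norm_num)
    have := kq_nonneg y
    linarith

theorem QW_bd {y : ℝ} (hy : |y| ≠ Real.sqrt 2) : |(|y| - Real.sqrt 2)| ^ (-(1/2) : ℝ) ≤ QW y := by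
  unfold QW
  have h1 := kq_nonneg (y - Real.sqrt 2)
  have h2 := kq_nonneg (y + Real.sqrt 2)
  rcases le_total 0 y with h | h
  · rw [abs_of_nonneg h] at hy ⊢
    have := kq_bd (sub_ne_zero.mpr hy)
    linarith
  · rw [abs_of_nonpos h] at hy ⊢
    have := kq_bd (y := y + Real.sqrt 2) (fun h => hy (by linarith))
    rw [← abs_neg (y + Real.sqrt 2), neg_add, ← sub_eq_add_neg] at this
    linarith

def dom (a y : ℝ) : ℝ := Real.exp (-(a * |y|)) * QW y
theorem dom_nonneg (a y : ℝ) : 0 ≤ dom a y := mul_nonneg (Real.exp_pos _).le (QW_nonneg y)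

theorem dom_integrable {a : ℝ} (ha : 0 < a) : Integrable (dom a) := by
  have h1 : Integrable (fun y => kq (y - Real.sqrt 2) + kq (y + Real.sqrt 2)) :=
    (kq_integrable.comp_sub_right _).add (kq_integrable.comp_add_right _)
  have h2 := (exp_abs_integrable ha).mul_const 2
  have h3 : Integrable (fun y => Real.exp (-(a * |y|)) * (kq (y - Real.sqrt 2) + kq (y + Real.sqrt 2))) := by
    refine h1.bdd_mul (c := 1) (by fun_prop) (Eventually.of_forall fun y => ?_)
    rw [Real.norm_eq_abs, abs_of_pos (Real.exp_pos _), Real.exp_le_one_iff]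
    have := abs_nonneg y
    nlinarith
  refine (h2.add h3).congr (Eventually.of_forall fun y => ?_)
  simp only [dom, QW, Pi.add_apply]; ring

theorem dist_ZW (y1 y2 : ℝ) : |(|y1| - Real.sqrt 2)| * |(|y2| - Real.sqrt 2)| ≤ ‖gammaP (-1) y1 - gammaM 1 y2‖ ^ 2 := by
  have e : ‖gammaP (-1) y1 - gammaM 1 y2‖ ^ 2 = ((gammaP (-1) y1).re - (gammaM 1 y2).re) ^ 2 +
      ((gammaP (-1) y1).im - (gammaM 1 y2).im) ^ 2 := by
    rw [← Complex.normSq_eq_norm_sq, Complex.normSq_apply]; simp; ring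
  rw [e, gammaP_re, gammaM_re, gammaP_im, gammaM_im]
  have h2 := sqrt2_pos
  have hs := sqrt2_sq
  have e1 : (-1 + |y1| / Real.sqrt 2 - (1 - |y2| / Real.sqrt 2)) ^ 2 = (|y1| + |y2| - 2 * Real.sqrt 2) ^ 2 / 2 := by
    have e0 : (-1 + |y1| / Real.sqrt 2 - (1 - |y2| / Real.sqrt 2)) = (|y1| + |y2| - 2 * Real.sqrt 2) / Real.sqrt 2 := by
      field_simp; ring
    rw [e0, div_pow, hs]
  have e2 : (y1 / Real.sqrt 2 - y2 / Real.sqrt 2) ^ 2 = (y1 - y2) ^ 2 / 2 := by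
    rw [← sub_div, div_pow, hs]
  rw [e1, e2]
  have h3 : (|y1| - |y2|) ^ 2 ≤ (y1 - y2) ^ 2 := by
    rw [← sq_abs (y1 - y2), ← sq_abs (|y1| - |y2|)]
    exact pow_le_pow_left₀ (abs_nonneg _) (abs_abs_sub_abs_le y1 y2) 2
  set X := |(|y1| - Real.sqrt 2)| with hX
  set Y := |(|y2| - Real.sqrt 2)| with hY
  have hX2 : X ^ 2 = (|y1| - Real.sqrt 2) ^ 2 := sq_abs _
  have hY2 : Y ^ 2 = (|y2| - Real.sqrt 2) ^ 2 := sq_abs _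
  nlinarith [sq_nonneg (X - Y), sq_nonneg X, sq_nonneg Y]

theorem inv_ZW {y1 y2 : ℝ} (h1 : |y1| ≠ Real.sqrt 2) (h2 : |y2| ≠ Real.sqrt 2) :
    ‖gammaP (-1) y1 - gammaM 1 y2‖⁻¹ ≤ QW y1 * QW y2 := by
  have p1 : 0 < |(|y1| - Real.sqrt 2)| := abs_pos.mpr (sub_ne_zero.mpr h1)
  have p2 : 0 < |(|y2| - Real.sqrt 2)| := abs_pos.mpr (sub_ne_zero.mpr h2)
  refine le_trans ?_ (mul_le_mul (QW_bd h1) (QW_bd h2) (by positivity) (QW_nonneg _))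
  rw [← Real.mul_rpow p1.le p2.le, Real.rpow_neg (by positivity), ← Real.sqrt_eq_rpow]
  refine inv_anti₀ (Real.sqrt_pos.mpr (by positivity)) ?_
  rw [Real.sqrt_le_left (norm_nonneg _)]
  exact dist_ZW y1 y2

theorem ae_ne : ∀ᵐ y : ℝ, |y| ≠ Real.sqrt 2 := by
  have : ({Real.sqrt 2, -Real.sqrt 2} : Set ℝ).Countable := (Set.toFinite _).countable
  filter_upwards [this.ae_notMem volume] with y hy h
  apply hy
  rcases abs_eq sqrt2_pos.le |>.mp h with h | h <;> simp [h]

theorem ae_ne2 : ∀ᵐ p : ℝ × ℝ, |p.1| ≠ Real.sqrt 2 ∧ |p.2| ≠ Real.sqrt 2 := by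
  have h1 := (Measure.quasiMeasurePreserving_fst (μ := (volume : Measure ℝ)) (ν := (volume : Measure ℝ))).ae ae_ne
  have h2 := (Measure.quasiMeasurePreserving_snd (μ := (volume : Measure ℝ)) (ν := (volume : Measure ℝ))).ae ae_ne
  rw [← Measure.volume_eq_prod] at h1 h2
  filter_upwards [h1, h2] with p a b using ⟨a, b⟩

/-- the Cauchy type integrand on the product of contours -/
def kcore (f g : ℝ → ℂ) (p : ℝ × ℝ) : ℂ :=
  f p.1 * g p.2 / (gammaP (-1) p.1 - gammaM 1 p.2) * gammaPD p.1 * gammaMD p.2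

theorem kcore_meas {f g : ℝ → ℂ} (hf : Measurable f) (hg : Measurable g) : Measurable (kcore f g) := by
  unfold kcore
  exact (((((hf.comp measurable_fst).mul (hg.comp measurable_snd))).div
    (((gammaP_cont _).measurable.comp measurable_fst).sub ((gammaM_cont _).measurable.comp measurable_snd))).mul
    (gammaPD_meas.comp measurable_fst)).mul (gammaMD_meas.comp measurable_snd)

theorem kcore_bd {f g : ℝ → ℂ} {C D a : ℝ} (hf : ∀ y, ‖f y‖ ≤ C * Real.exp (-(a * |y|)))
    (hg : ∀ y, ‖g y‖ ≤ D * Real.exp (-(a * |y|))) {p : ℝ × ℝ} (hp : |p.1| ≠ Real.sqrt 2 ∧ |p.2| ≠ Real.sqrt 2) :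
    ‖kcore f g p‖ ≤ 4 * C * D * (dom a p.1 * dom a p.2) := by
  unfold kcore dom
  rw [norm_mul, norm_mul, norm_div, norm_mul, div_eq_mul_inv]
  have h1 := inv_ZW hp.1 hp.2
  have hC : 0 ≤ C * Real.exp (-(a * |p.1|)) := (norm_nonneg _).trans (hf p.1)
  have hD : 0 ≤ D * Real.exp (-(a * |p.2|)) := (norm_nonneg _).trans (hg p.2)
  have hQ := mul_nonneg (QW_nonneg p.1) (QW_nonneg p.2)
  calc _ ≤ (C * Real.exp (-(a * |p.1|))) * (D * Real.exp (-(a * |p.2|))) * (QW p.1 * QW p.2) * 2 * 2 := by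
        refine mul_le_mul (mul_le_mul (mul_le_mul (mul_le_mul (hf _) (hg _) (norm_nonneg _) hC) h1
          (by positivity) (mul_nonneg hC hD)) (gammaPD_norm _) (norm_nonneg _) (mul_nonneg (mul_nonneg hC hD) hQ))
          (gammaMD_norm _) (norm_nonneg _) (mul_nonneg (mul_nonneg (mul_nonneg hC hD) hQ) (by norm_num))
    _ = _ := by ring

theorem dom2_integrable {a : ℝ} (ha : 0 < a) : Integrable (fun p : ℝ × ℝ => dom a p.1 * dom a p.2) := by
  rw [Measure.volume_eq_prod]
  exact (dom_integrable ha).mul_prod (dom_integrable ha)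

theorem kcore_integrable {f g : ℝ → ℂ} (mf : Measurable f) (mg : Measurable g) {C D a : ℝ} (ha : 0 < a)
    (hf : ∀ y, ‖f y‖ ≤ C * Real.exp (-(a * |y|))) (hg : ∀ y, ‖g y‖ ≤ D * Real.exp (-(a * |y|))) :
    Integrable (kcore f g) := by
  refine ((dom2_integrable ha).const_mul (4 * C * D)).mono' (kcore_meas mf mg).aestronglyMeasurable ?_
  filter_upwards [ae_ne2] with p hp
  exact kcore_bd hf hg hp

/-- the kernel in the gauge where the transition is Brownian -/
def kap (Ψ : ℂ → ℂ) (t₁ x₁ t₂ x₂ : ℝ) : ℂ :=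
  (if t₁ < t₂ then -(hk (t₂ - t₁) (x₂ - x₁) : ℂ) else 0) +
  (1 / (2 * (Real.pi : ℂ) * I)) * (∫ s in (-1:ℝ)..1, E2 (t₂ - t₁) (x₂ - x₁) (s * I) * I) +
  (1 / (2 * (Real.pi : ℂ) * I)) ^ 2 * ∫ p : ℝ × ℝ,
    kcore (fun y => E2 (-t₁) (-x₁) (gammaP (-1) y) * Ψ (gammaP (-1) y))
      (fun y => E2 t₂ x₂ (gammaM 1 y) / Ψ (gammaM 1 y)) p

theorem E2_mul (τ x τ' x' : ℝ) (w : ℂ) : E2 τ x w * E2 τ' x' w = E2 (τ + τ') (x + x') w := by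
  unfold E2; rw [← Complex.exp_add]; congr 1; push_cast; ring

theorem E2_gammaP (τ x y : ℝ) : ‖E2 τ x (gammaP (-1) y)‖ = Real.exp (τ - x) * Real.exp (-((2 * τ - x) / Real.sqrt 2 * |y|)) := by
  rw [E2_norm, ← Real.exp_add]
  congr 1
  have h := gammaP_wedge y
  rw [← sq_abs (gammaP (-1) y).im, h, gammaP_re]
  ring

theorem E2_decR {τ x : ℝ} (hτ : 0 < τ) (hx : 2 * τ < x) : DecR (E2 (-τ) (-x)) := by
  refine ⟨Real.exp τ, x - 2 * τ, (Real.exp_pos _).le, by linarith, fun z hz => ?_⟩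
  rw [E2_norm, ← Real.exp_add, Real.exp_le_exp]
  have h0 := abs_nonneg z.im
  have : z.im ^ 2 ≤ (z.re + 1) ^ 2 := by rw [← sq_abs]; exact pow_le_pow_left₀ h0 hz 2
  nlinarith

theorem core_eval {τ₁ x₁ τ₂ x₂ : ℝ} (h1 : 0 < τ₁) (h1' : 2 * τ₁ < x₁) (h2 : 0 < τ₂) (h2' : 0 < x₂) :
    Integrable (kcore (fun y => E2 (-τ₁) (-x₁) (gammaP (-1) y)) (fun y => E2 τ₂ x₂ (gammaM 1 y))) ∧
    ∫ p, kcore (fun y => E2 (-τ₁) (-x₁) (gammaP (-1) y)) (fun y => E2 τ₂ x₂ (gammaM 1 y)) p =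
      -(2 * Real.pi * I) * ∫ s in (-1:ℝ)..1, E2 (τ₂ - τ₁) (x₂ - x₁) (s * I) * I := by
  have hInt : Integrable (kcore (fun y => E2 (-τ₁) (-x₁) (gammaP (-1) y)) (fun y => E2 τ₂ x₂ (gammaM 1 y))) := by
    set a := min ((2 * -τ₁ - -x₁) / Real.sqrt 2) ((2 * τ₂ + x₂) / Real.sqrt 2) with ha
    have ha0 : 0 < a := lt_min (div_pos (by linarith) sqrt2_pos) (div_pos (by linarith) sqrt2_pos)
    refine kcore_integrable (C := Real.exp (-τ₁ - -x₁)) (D := Real.exp (τ₂ + x₂)) (a := a)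
      ((E2_cont _ _).comp (gammaP_cont _)).measurable ((E2_cont _ _).comp (gammaM_cont _)).measurable
      ha0 (fun y => ?_) (fun y => ?_)
    · rw [E2_gammaP]
      gcongr
      exact min_le_left _ _
    · rw [E2_gammaM]
      gcongr
      exact min_le_right _ _
  refine ⟨hInt, ?_⟩
  rw [Measure.volume_eq_prod] at hInt ⊢
  rw [MeasureTheory.integral_prod_symm _ hInt]
  have key : ∀ᵐ y : ℝ, (∫ x : ℝ, kcore (fun y => E2 (-τ₁) (-x₁) (gammaP (-1) y)) (fun y => E2 τ₂ x₂ (gammaM 1 y)) (x, y)) =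
      (Set.Ioc (-Real.sqrt 2) (Real.sqrt 2)).indicator
        (fun y => -(2 * Real.pi * I) * (E2 (τ₂ - τ₁) (x₂ - x₁) (gammaM 1 y) * gammaMD y)) y := by
    filter_upwards [ae_ne] with y hy
    have e : ∀ x : ℝ, kcore (fun y => E2 (-τ₁) (-x₁) (gammaP (-1) y)) (fun y => E2 τ₂ x₂ (gammaM 1 y)) (x, y) =
        (E2 (-τ₁) (-x₁) (gammaP (-1) x) / (gammaP (-1) x - gammaM 1 y) * gammaPD x) *
          (E2 τ₂ x₂ (gammaM 1 y) * gammaMD y) := by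
      intro x; unfold kcore; ring
    simp_rw [e]
    rw [MeasureTheory.integral_mul_const]
    have hw := gammaM_wedge y
    have hre := gammaM_re 1 y
    by_cases hc : |y| < Real.sqrt 2
    · have h3 : |y| / Real.sqrt 2 < 1 := by rw [div_lt_one sqrt2_pos]; exact hc
      rw [X_right (E2_diff _ _) (E2_decR h1 h1') (by rw [hw]; linarith), Set.indicator_of_mem
        (show y ∈ Set.Ioc (-Real.sqrt 2) (Real.sqrt 2) from ⟨(abs_lt.mp hc).1, (abs_lt.mp hc).2.le⟩)]
      rw [show τ₂ - τ₁ = -τ₁ + τ₂ by ring, show x₂ - x₁ = -x₁ + x₂ by ring, ← E2_mul]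
      ring
    · have hc' : Real.sqrt 2 < |y| := lt_of_le_of_ne (not_lt.mp hc) (Ne.symm hy)
      have h3 : 1 < |y| / Real.sqrt 2 := by rw [one_lt_div sqrt2_pos]; exact hc'
      rw [X_left (E2_diff _ _) (E2_decR h1 h1') (by rw [hw]; linarith), zero_mul, Set.indicator_of_notMem]
      rintro ⟨h4, h5⟩
      have := abs_le.mpr ⟨h4.le, h5⟩
      linarith
  rw [MeasureTheory.integral_congr_ae key, MeasureTheory.integral_indicator measurableSet_Ioc,
    MeasureTheory.integral_const_mul, ← intervalIntegral.integral_of_le (by linarith [sqrt2_pos]),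
    cross_seg (E2_diff _ _)]

theorem kap_model {N : ℕ} {A B : Fin N → ℝ} (hA : Function.Injective A) (hB : Function.Injective B)
    (hA0 : ∀ i, 0 < A i) (hB0 : ∀ i, 0 < B i) {T l : ℝ} {t₁ x₁ t₂ x₂ : ℝ} (h1 : 0 < t₁ + T)
    (h1' : 2 * (t₁ + T) < x₁ - l) (h2 : 0 < t₂ + T) (h2' : 0 < x₂ - l) :
    kap (fun z => Rat A B z * E2 (-T) l z) t₁ x₁ t₂ x₂ =
      (((if t₁ < t₂ then -hk (t₂ - t₁) (x₂ - x₁) else 0) + ∑ i, ∑ j,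
        Real.exp (-(t₁ + T) * (A i)^2 - (x₁ - l) * A i) * (Matrix.of fun j i => 1 / (A i + B j))⁻¹ i j *
          phiF (B j) (t₂ + T) (x₂ - l) : ℝ) : ℂ) := by
  set c := (Matrix.of fun j i => 1 / (A i + B j))⁻¹ with hc
  set u : Fin N → ℝ → ℂ := fun i y => E2 (-(t₁ + T)) (-(x₁ - l)) (gammaP (-1) y) / (gammaP (-1) y - A i) * gammaPD y with hu
  set v : Fin N → ℝ → ℂ := fun j y => E2 (t₂ + T) (x₂ - l) (gammaM 1 y) / (gammaM 1 y - ((-B j : ℝ) : ℂ)) * gammaMD y with hv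
  have hAne : ∀ i y, gammaP (-1) y ≠ A i := fun i y => ne_of_wedge (by simp; linarith [hA0 i]) y
  have hBne : ∀ j y, gammaM 1 y + B j ≠ 0 := by
    intro j y h
    have := distM (hB0 j) y
    rw [ofReal_neg, sub_neg_eq_add, h, norm_zero] at this
    linarith
  obtain ⟨ci, cv⟩ := core_eval h1 h1' h2 h2'
  have hae : ∀ᵐ p : ℝ × ℝ, kcore (fun y => E2 (-t₁) (-x₁) (gammaP (-1) y) * (Rat A B (gammaP (-1) y) * E2 (-T) l (gammaP (-1) y)))
      (fun y => E2 t₂ x₂ (gammaM 1 y) / (Rat A B (gammaM 1 y) * E2 (-T) l (gammaM 1 y))) p =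
      kcore (fun y => E2 (-(t₁ + T)) (-(x₁ - l)) (gammaP (-1) y)) (fun y => E2 (t₂ + T) (x₂ - l) (gammaM 1 y)) p
       + ∑ i, ∑ j, (-(c i j : ℂ)) * (u i p.1 * v j p.2) := by
    filter_upwards [ae_ne2] with p hp
    have hne : gammaP (-1) p.1 - gammaM 1 p.2 ≠ 0 := by
      intro h
      have := dist_ZW p.1 p.2
      rw [h, norm_zero] at this
      have p1 : 0 < |(|p.1| - Real.sqrt 2)| := abs_pos.mpr (sub_ne_zero.mpr hp.1)
      have p2 : 0 < |(|p.2| - Real.sqrt 2)| := abs_pos.mpr (sub_ne_zero.mpr hp.2)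
      have := mul_pos p1 p2
      linarith
    have e1 : E2 (-(t₁ + T)) (-(x₁ - l)) (gammaP (-1) p.1) = E2 (-t₁) (-x₁) (gammaP (-1) p.1) * E2 (-T) l (gammaP (-1) p.1) := by
      rw [E2_mul]; congr 1 <;> ring
    have e2 : E2 (t₂ + T) (x₂ - l) (gammaM 1 p.2) = E2 t₂ x₂ (gammaM 1 p.2) / E2 (-T) l (gammaM 1 p.2) := by
      have h0 : E2 (-T) l (gammaM 1 p.2) ≠ 0 := Complex.exp_ne_zero _
      rw [eq_div_iff h0, E2_mul]; congr 1 <;> ring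
    have hr := rat_identity hA hB hA0 hB0 (gammaP (-1) p.1) (gammaM 1 p.2) (fun i => (hAne i p.1).symm) (fun j => hBne j p.2)
    rw [← hc] at hr
    set Z := gammaP (-1) p.1 with hZ
    set W := gammaM 1 p.2 with hW
    have e3 : ∑ i, ∑ j, (-(c i j : ℂ)) * (u i p.1 * v j p.2) =
        (E2 (-(t₁ + T)) (-(x₁ - l)) Z * E2 (t₂ + T) (x₂ - l) W * gammaPD p.1 * gammaMD p.2) *
          ∑ i, ∑ j, (c i j : ℂ) / ((A i - Z) * (W + B j)) := by
      rw [Finset.mul_sum]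
      refine Finset.sum_congr rfl fun i _ => ?_
      rw [Finset.mul_sum]
      refine Finset.sum_congr rfl fun j _ => ?_
      simp only [hu, hv, ← hZ, ← hW]
      have n1 : Z - A i ≠ 0 := sub_ne_zero.mpr (hAne i p.1)
      have n1' : (A i : ℂ) - Z ≠ 0 := sub_ne_zero.mpr (hAne i p.1).symm
      have n2 : W + B j ≠ 0 := hBne j p.2
      rw [ofReal_neg, sub_neg_eq_add, show Z - A i = -(A i - Z) by ring]
      field_simp
    rw [e3]
    simp only [kcore, ← hZ, ← hW]
    have e4 : ∑ i, ∑ j, (c i j : ℂ) / ((A i - Z) * (W + B j)) = (Rat A B Z / Rat A B W - 1) / (Z - W) := by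
      rw [hr]; field_simp; ring
    rw [e4, e1, e2]
    generalize hX : gammaPD p.1 = X
    generalize hY : gammaMD p.2 = Y
    have : Rat A B Z / Rat A B W = Rat A B Z * (Rat A B W)⁻¹ := div_eq_mul_inv _ _
    rw [this]
    simp only [div_eq_mul_inv, mul_inv]
    ring
  have hui : ∀ i, Integrable (u i) ∧ ∫ y, u i y = -(2 * Real.pi * I) *
      (Real.exp (-(t₁ + T) * (A i)^2 - (x₁ - l) * A i) : ℝ) := by
    intro i
    have hw : |((A i : ℂ)).im| < ((A i : ℂ)).re + 1 := by simp; linarith [hA0 i]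
    refine ⟨X_integrable (E2_cont _ _) (E2_decR h1 h1') hw.ne, ?_⟩
    have e : E2 (-(t₁ + T)) (-(x₁ - l)) (A i : ℂ) = (Real.exp (-(t₁ + T) * (A i)^2 - (x₁ - l) * A i) : ℝ) := by
      unfold E2; rw [Complex.ofReal_exp]; congr 1; push_cast; ring
    rw [← e]
    exact X_right (E2_diff _ _) (E2_decR h1 h1') hw
  have hvj : ∀ j, Integrable (v j) ∧ ∫ y, v j y = 2 * Real.pi * I * (phiF (B j) (t₂ + T) (x₂ - l) : ℝ) := fun j =>
    ⟨Y_integrable (hB0 j) (by linarith), lemY h2 (hB0 j) (by linarith)⟩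
  have huv : ∀ i j, Integrable (fun p : ℝ × ℝ => (-(c i j : ℂ)) * (u i p.1 * v j p.2)) := by
    intro i j
    rw [Measure.volume_eq_prod]
    exact ((hui i).1.mul_prod (hvj j).1).const_mul _
  unfold kap
  rw [MeasureTheory.integral_congr_ae hae, MeasureTheory.integral_add ci
    (MeasureTheory.integrable_finsetSum _ fun i _ => MeasureTheory.integrable_finsetSum _ fun j _ => huv i j), cv,
    MeasureTheory.integral_finsetSum _ fun i _ => MeasureTheory.integrable_finsetSum _ fun j _ => huv i j]
  simp_rw [MeasureTheory.integral_finsetSum _ fun j _ => huv _ j, MeasureTheory.integral_const_mul, Measure.volume_eq_prod,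
    MeasureTheory.integral_prod_mul, (hui _).2, (hvj _).2]
  rw [show t₂ + T - (t₁ + T) = t₂ - t₁ by ring, show x₂ - l - (x₁ - l) = x₂ - x₁ by ring]
  push_cast
  have hpi : (2 * (Real.pi : ℂ) * I) ≠ 0 := by simp [Real.pi_ne_zero]
  have e5 : ∀ S J P : ℂ, P + 1 / (2 * (Real.pi : ℂ) * I) * J + (1 / (2 * (Real.pi : ℂ) * I)) ^ 2 *
      (-(2 * Real.pi * I) * J + S) = P + S / (2 * (Real.pi : ℂ) * I) ^ 2 := by
    intro S J P; field_simp; ring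
  rw [e5]
  congr 1
  · split_ifs <;> simp
  · rw [Finset.sum_div]
    refine Finset.sum_congr rfl fun i _ => ?_
    rw [Finset.sum_div]
    refine Finset.sum_congr rfl fun j _ => ?_
    field_simp

end AW
namespace AW

/-- measurability and exponential decay along the two contours -/
structure Dec (Ψ : ℂ → ℂ) (M C : ℝ) : Prop where
  mP : Measurable fun y => Ψ (gammaP (-1) y)
  mM : Measurable fun y => Ψ (gammaM 1 y)
  dP : ∀ y, ‖Ψ (gammaP (-1) y)‖ ≤ C * Real.exp (-(M * |y|))
  dM : ∀ y, ‖(Ψ (gammaM 1 y))⁻¹‖ ≤ C * Real.exp (-(M * |y|))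

structure LimTo (Ψn : ℕ → ℂ → ℂ) (Ψ : ℂ → ℂ) : Prop where
  dec : ∀ M, ∃ C, ∀ᶠ n in atTop, Dec (Ψn n) M C
  limP : ∀ y, Tendsto (fun n => Ψn n (gammaP (-1) y)) atTop (𝓝 (Ψ (gammaP (-1) y)))
  limM : ∀ y, Tendsto (fun n => (Ψn n (gammaM 1 y))⁻¹) atTop (𝓝 (Ψ (gammaM 1 y))⁻¹)

theorem LimTo.meas {Ψn : ℕ → ℂ → ℂ} {Ψ : ℂ → ℂ} (h : LimTo Ψn Ψ) :
    (Measurable fun y => Ψ (gammaP (-1) y)) ∧ Measurable fun y => Ψ (gammaM 1 y) := by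
  obtain ⟨C, hC⟩ := h.dec 0
  obtain ⟨N, hN⟩ := eventually_atTop.mp hC
  constructor
  · refine measurable_of_tendsto_metrizable (f := fun n y => Ψn (n + N) (gammaP (-1) y))
      (fun n => (hN _ (by lia)).mP) ?_
    rw [tendsto_pi_nhds]
    exact fun y => (h.limP y).comp (tendsto_add_atTop_nat N)
  · have h2 : Measurable fun y => (Ψ (gammaM 1 y))⁻¹ := by
      refine measurable_of_tendsto_metrizable (f := fun n y => (Ψn (n + N) (gammaM 1 y))⁻¹)
        (fun n => (hN _ (by lia)).mM.inv) ?_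
      rw [tendsto_pi_nhds]
      exact fun y => (h.limM y).comp (tendsto_add_atTop_nat N)
    have h3 : (fun y => Ψ (gammaM 1 y)) = fun y => ((Ψ (gammaM 1 y))⁻¹)⁻¹ := funext fun y => (inv_inv _).symm
    rw [h3]; exact h2.inv

theorem LimTo.decL {Ψn : ℕ → ℂ → ℂ} {Ψ : ℂ → ℂ} (h : LimTo Ψn Ψ) (M : ℝ) :
    ∃ C, Dec Ψ M C := by
  obtain ⟨C, hC⟩ := h.dec M
  refine ⟨C, h.meas.1, h.meas.2, fun y => ?_, fun y => ?_⟩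
  · exact le_of_tendsto (h.limP y).norm (hC.mono fun n hn => hn.dP y)
  · exact le_of_tendsto (h.limM y).norm (hC.mono fun n hn => hn.dM y)

theorem kap_f_bd {Ψ : ℂ → ℂ} {R C t x : ℝ} (h : Dec Ψ (3 * R + 1) C) (ht : |t| ≤ R) (hx : |x| ≤ R) (y : ℝ) :
    ‖E2 (-t) (-x) (gammaP (-1) y) * Ψ (gammaP (-1) y)‖ ≤ (Real.exp (2 * R) * C) * Real.exp (-(1 * |y|)) := by
  rw [norm_mul, E2_gammaP]
  have h1 := h.dP y
  have ht' := abs_le.mp ht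
  have hx' := abs_le.mp hx
  have hy := abs_nonneg y
  have e1 : Real.exp (-t - -x) ≤ Real.exp (2 * R) := Real.exp_le_exp.mpr (by linarith)
  have hs : 1 ≤ Real.sqrt 2 := Real.one_le_sqrt.mpr (by norm_num)
  have e2 : Real.exp (-((2 * -t - -x) / Real.sqrt 2 * |y|)) ≤ Real.exp (3 * R * |y|) := by
    refine Real.exp_le_exp.mpr ?_
    rw [← neg_mul]
    refine mul_le_mul_of_nonneg_right ?_ hy
    rw [← neg_div, div_le_iff₀ sqrt2_pos]
    have : 0 ≤ R := (abs_nonneg _).trans ht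
    nlinarith
  calc _ ≤ Real.exp (2 * R) * Real.exp (3 * R * |y|) * (C * Real.exp (-((3 * R + 1) * |y|))) :=
        mul_le_mul (mul_le_mul e1 e2 (Real.exp_pos _).le (Real.exp_pos _).le) h1 (norm_nonneg _) (by positivity)
    _ = Real.exp (2 * R) * C * (Real.exp (3 * R * |y|) * Real.exp (-((3 * R + 1) * |y|))) := by ring
    _ = _ := by rw [← Real.exp_add]; congr 2; ring

theorem kap_g_bd {Ψ : ℂ → ℂ} {R C t x : ℝ} (h : Dec Ψ (3 * R + 1) C) (ht : |t| ≤ R) (hx : |x| ≤ R) (y : ℝ) :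
    ‖E2 t x (gammaM 1 y) / Ψ (gammaM 1 y)‖ ≤ (Real.exp (2 * R) * C) * Real.exp (-(1 * |y|)) := by
  rw [div_eq_mul_inv, norm_mul, E2_gammaM]
  have h1 := h.dM y
  have ht' := abs_le.mp ht
  have hx' := abs_le.mp hx
  have hy := abs_nonneg y
  have e1 : Real.exp (t + x) ≤ Real.exp (2 * R) := Real.exp_le_exp.mpr (by linarith)
  have hs : 1 ≤ Real.sqrt 2 := Real.one_le_sqrt.mpr (by norm_num)
  have e2 : Real.exp (-((2 * t + x) / Real.sqrt 2 * |y|)) ≤ Real.exp (3 * R * |y|) := by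
    refine Real.exp_le_exp.mpr ?_
    rw [← neg_mul]
    refine mul_le_mul_of_nonneg_right ?_ hy
    rw [← neg_div, div_le_iff₀ sqrt2_pos]
    have : 0 ≤ R := (abs_nonneg _).trans ht
    nlinarith
  calc _ ≤ Real.exp (2 * R) * Real.exp (3 * R * |y|) * (C * Real.exp (-((3 * R + 1) * |y|))) :=
        mul_le_mul (mul_le_mul e1 e2 (Real.exp_pos _).le (Real.exp_pos _).le) h1 (norm_nonneg _) (by positivity)
    _ = Real.exp (2 * R) * C * (Real.exp (3 * R * |y|) * Real.exp (-((3 * R + 1) * |y|))) := by ring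
    _ = _ := by rw [← Real.exp_add]; congr 2; ring

theorem kap_tendsto {Ψn : ℕ → ℂ → ℂ} {Ψ : ℂ → ℂ} (h : LimTo Ψn Ψ) (t₁ x₁ t₂ x₂ : ℝ) :
    Tendsto (fun n => kap (Ψn n) t₁ x₁ t₂ x₂) atTop (𝓝 (kap Ψ t₁ x₁ t₂ x₂)) := by
  unfold kap
  refine tendsto_const_nhds.add (tendsto_const_nhds.mul ?_)
  set R := max (max |t₁| |x₁|) (max |t₂| |x₂|) with hR
  obtain ⟨C, hC⟩ := h.dec (3 * R + 1)
  have r1 : |t₁| ≤ R := (le_max_left _ _).trans (le_max_left _ _)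
  have r2 : |x₁| ≤ R := (le_max_right _ _).trans (le_max_left _ _)
  have r3 : |t₂| ≤ R := (le_max_left _ _).trans (le_max_right _ _)
  have r4 : |x₂| ≤ R := (le_max_right _ _).trans (le_max_right _ _)
  refine MeasureTheory.tendsto_integral_filter_of_dominated_convergence
    (fun p => 4 * (Real.exp (2 * R) * C) * (Real.exp (2 * R) * C) * (dom 1 p.1 * dom 1 p.2)) ?_ ?_
    ((dom2_integrable one_pos).const_mul _) ?_
  · filter_upwards [hC] with n hn
    exact (kcore_meas (((E2_cont _ _).comp (gammaP_cont _)).measurable.mul hn.mP)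
      (((E2_cont _ _).comp (gammaM_cont _)).measurable.div hn.mM)).aestronglyMeasurable
  · filter_upwards [hC] with n hn
    filter_upwards [ae_ne2] with p hp
    exact kcore_bd (kap_f_bd hn r1 r2) (kap_g_bd hn r3 r4) hp
  · refine Eventually.of_forall fun p => ?_
    unfold kcore
    simp only [div_eq_mul_inv (E2 _ _ (gammaM _ _))]
    exact ((((tendsto_const_nhds.mul (h.limP _)).mul (tendsto_const_nhds.mul (h.limM _))).div_const _).mul_const _).mul_const _

theorem kap_bd {R t₁ t₂ : ℝ} (r1 : |t₁| ≤ R) (r2 : |t₂| ≤ R) (C : ℝ) : ∃ D, 0 ≤ D ∧ ∀ Ψ, Dec Ψ (3 * R + 1) C →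
    ∀ x₁ x₂, |x₁| ≤ R → |x₂| ≤ R → ‖kap Ψ t₁ x₁ t₂ x₂‖ ≤ D := by
  have hR : 0 ≤ R := (abs_nonneg _).trans r1
  set I0 := ∫ p : ℝ × ℝ, 4 * (Real.exp (2 * R) * C) * (Real.exp (2 * R) * C) * (dom 1 p.1 * dom 1 p.2) with hI0
  set c := ‖(1 / (2 * (Real.pi : ℂ) * I))‖ with hc
  refine ⟨(Real.sqrt (4 * Real.pi * (t₂ - t₁)))⁻¹ + c * (Real.exp (2 * R) * 2) + c ^ 2 * |I0|, by positivity, ?_⟩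
  intro Ψ h x₁ x₂ h1 h2
  unfold kap
  refine norm_add₃_le.trans (add_le_add (add_le_add ?_ ?_) ?_)
  · split_ifs with ht
    · rw [norm_neg, Complex.norm_real, Real.norm_eq_abs, abs_of_nonneg (hk_nonneg _ _)]
      unfold hk
      refine mul_le_of_le_one_right (by positivity) ?_
      rw [Real.exp_le_one_iff]
      exact div_nonpos_of_nonpos_of_nonneg (by nlinarith [sq_nonneg (x₂ - x₁)]) (by linarith)
    · rw [norm_zero]; positivity
  · rw [norm_mul]
    refine mul_le_mul_of_nonneg_left ?_ (norm_nonneg _)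
    have := intervalIntegral.norm_integral_le_of_norm_le_const (a := (-1:ℝ)) (b := 1)
      (f := fun s : ℝ => E2 (t₂ - t₁) (x₂ - x₁) (s * I) * I) (C := Real.exp (2 * R)) (fun s hs => ?_)
    · refine this.trans (le_of_eq ?_); norm_num
    · rw [norm_mul, Complex.norm_I, mul_one, E2_norm, Real.exp_le_exp]
      rw [Set.uIoc_of_le (by norm_num)] at hs
      have := abs_le.mp r1; have := abs_le.mp r2
      have s2 : s ^ 2 ≤ 1 := by nlinarith [hs.1, hs.2]
      simp
      nlinarith [sq_nonneg s]
  · rw [norm_mul, norm_pow]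
    refine mul_le_mul_of_nonneg_left ?_ (by positivity)
    refine (MeasureTheory.norm_integral_le_of_norm_le ((dom2_integrable one_pos).const_mul (4 * (Real.exp (2 * R) * C) * (Real.exp (2 * R) * C))) ?_).trans
      (le_abs_self _)
    filter_upwards [ae_ne2] with p hp
    exact kcore_bd (kap_f_bd h r1 h1) (kap_g_bd h r2 h2) hp

theorem hk_meas (τ : ℝ) : Measurable (hk τ) := hk_continuous.measurable

theorem E2_joint (τ : ℝ) : Continuous (fun q : ℝ × ℂ => E2 τ q.1 q.2) := by unfold E2; fun_prop

theorem kap_meas {Ψ : ℂ → ℂ} (hP : Measurable fun y => Ψ (gammaP (-1) y)) (hM : Measurable fun y => Ψ (gammaM 1 y))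
    (t₁ t₂ : ℝ) : Measurable (fun q : ℝ × ℝ => kap Ψ t₁ q.1 t₂ q.2) := by
  unfold kap
  refine (Measurable.add ?_ (Measurable.const_mul ?_ _)).add (Measurable.const_mul ?_ _)
  · split_ifs
    · exact (Complex.measurable_ofReal.comp ((hk_meas _).comp (measurable_snd.sub measurable_fst))).neg
    · exact measurable_const
  · have : (fun q : ℝ × ℝ => ∫ s in (-1:ℝ)..1, E2 (t₂ - t₁) (q.2 - q.1) (s * I) * I) =
        fun q => ∫ s in Set.Ioc (-1:ℝ) 1, E2 (t₂ - t₁) (q.2 - q.1) (s * I) * I := by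
      funext q; rw [intervalIntegral.integral_of_le (by norm_num)]
    rw [this]
    refine (MeasureTheory.StronglyMeasurable.integral_prod_right
      (f := fun (q : ℝ × ℝ) (s : ℝ) => E2 (t₂ - t₁) (q.2 - q.1) (s * I) * I) ?_).measurable
    refine Continuous.stronglyMeasurable ?_
    unfold E2 Function.uncurry; fun_prop
  · refine (MeasureTheory.StronglyMeasurable.integral_prod_right
      (f := fun (q : ℝ × ℝ) (p : ℝ × ℝ) => kcore (fun y => E2 (-t₁) (-q.1) (gammaP (-1) y) * Ψ (gammaP (-1) y))
      (fun y => E2 t₂ q.2 (gammaM 1 y) / Ψ (gammaM 1 y)) p) ?_).measurable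
    refine Measurable.stronglyMeasurable ?_
    unfold kcore Function.uncurry
    have gp := (gammaP_cont (-1)).measurable.comp (measurable_fst.comp (measurable_snd : Measurable (Prod.snd : (ℝ × ℝ) × (ℝ × ℝ) → _)))
    have gm := (gammaM_cont 1).measurable.comp (measurable_snd.comp (measurable_snd : Measurable (Prod.snd : (ℝ × ℝ) × (ℝ × ℝ) → _)))
    have q1 : Measurable (fun q : (ℝ × ℝ) × (ℝ × ℝ) => -q.1.1) := (measurable_fst.comp measurable_fst).neg
    have q2 : Measurable (fun q : (ℝ × ℝ) × (ℝ × ℝ) => q.1.2) := (measurable_snd.comp measurable_fst)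
    have a1 := (E2_joint (-t₁)).measurable.comp (q1.prodMk gp)
    have a2 := (E2_joint t₂).measurable.comp (q2.prodMk gm)
    have b1 := hP.comp (measurable_fst.comp (measurable_snd : Measurable (Prod.snd : (ℝ × ℝ) × (ℝ × ℝ) → _)))
    have b2 := hM.comp (measurable_snd.comp (measurable_snd : Measurable (Prod.snd : (ℝ × ℝ) × (ℝ × ℝ) → _)))
    exact (((((a1.mul b1).mul (a2.div b2))).div (gp.sub gm)).mul
      (gammaPD_meas.comp (measurable_fst.comp measurable_snd))).mul (gammaMD_meas.comp (measurable_snd.comp measurable_snd))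

variable {m : ℕ}

/-- real part of the gauged kernel at the levels `t` -/
def kR (Ψ : ℂ → ℂ) (t : Fin (m+1) → ℝ) (a b : Fin (m+1) × ℝ) : ℝ := (kap Ψ (t a.1) a.2 (t b.1) b.2).re

def PosC (t : Fin (m+1) → ℝ) (L : ℕ) (Ψ : ℂ → ℂ) : Prop :=
  (∀ a ∈ Win m L, ∀ b ∈ Win m L, (kap Ψ (t a.1) a.2 (t b.1) b.2).im = 0) ∧ JPos (kR Ψ t) (muW m) (Win m L)

theorem kR_WK (t : Fin (m+1) → ℝ) (L : ℕ) : ∃ M, ∀ C, ∃ D, ∀ Ψ, Dec Ψ M C → WK (muW m) (Win m L) (kR Ψ t) D := by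
  set R : ℝ := L + ∑ k, |t k| with hR
  have hL : (L:ℝ) ≤ R := by
    have : 0 ≤ ∑ k, |t k| := Finset.sum_nonneg fun k _ => abs_nonneg _
    linarith
  have ht : ∀ k, |t k| ≤ R := by
    intro k
    have := Finset.single_le_sum (f := fun k => |t k|) (fun k _ => abs_nonneg _) (Finset.mem_univ k)
    have h0 : (0:ℝ) ≤ L := Nat.cast_nonneg L
    linarith
  refine ⟨3 * R + 1, fun C => ?_⟩
  choose D hD0 hD using fun k k' => kap_bd (ht k) (ht k') C
  refine ⟨∑ k, ∑ k', D k k', fun Ψ h => ⟨Win_meas L, Win_fin L, ?_, Finset.sum_nonneg fun k _ => Finset.sum_nonneg fun k' _ => hD0 k k', ?_⟩⟩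
  · have : ∀ k k', Measurable (fun q : ℝ × ℝ => (kap Ψ (t k) q.1 (t k') q.2).re) := fun k k' =>
      Complex.measurable_re.comp (kap_meas h.mP h.mM _ _)
    have h2 : Measurable (fun r : (Fin (m+1) × Fin (m+1)) × (ℝ × ℝ) => (kap Ψ (t r.1.1) r.2.1 (t r.1.2) r.2.2).re) :=
      measurable_from_prod_countable_right fun k => this k.1 k.2
    exact h2.comp (((measurable_fst.comp measurable_fst).prodMk (measurable_fst.comp measurable_snd)).prodMk
      ((measurable_snd.comp measurable_fst).prodMk (measurable_snd.comp measurable_snd)))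
  · intro a ha b hb
    refine (Complex.abs_re_le_norm _).trans ((hD a.1 b.1 Ψ h _ _ ((Win_abs ha).trans hL) ((Win_abs hb).trans hL)).trans ?_)
    exact (Finset.single_le_sum (f := fun k' => D a.1 k') (fun k' _ => hD0 _ k') (Finset.mem_univ b.1)).trans
      (Finset.single_le_sum (f := fun k => ∑ k', D k k') (fun k _ => Finset.sum_nonneg fun k' _ => hD0 k k') (Finset.mem_univ a.1))

theorem LimTo.posC {Ψn : ℕ → ℂ → ℂ} {Ψ : ℂ → ℂ} (h : LimTo Ψn Ψ) {t : Fin (m+1) → ℝ} {L : ℕ}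
    (hp : ∀ᶠ n in atTop, PosC t L (Ψn n)) : PosC t L Ψ := by
  have : SigmaFinite (muW m) := by unfold muW; infer_instance
  obtain ⟨M, hM⟩ := kR_WK t L
  obtain ⟨C1, hC1⟩ := h.dec M
  obtain ⟨C2, hC2⟩ := h.decL M
  obtain ⟨D1, hD1⟩ := hM C1
  obtain ⟨D2, hD2⟩ := hM C2
  constructor
  · intro a ha b hb
    have h1 := (Complex.continuous_im.tendsto _).comp (kap_tendsto h (t a.1) a.2 (t b.1) b.2)
    refine tendsto_nhds_unique h1 (tendsto_const_nhds.congr' ?_)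
    filter_upwards [hp] with n hn
    exact (hn.1 a ha b hb).symm
  · intro n x hx
    have mono : ∀ {K : Fin (m+1) × ℝ → Fin (m+1) × ℝ → ℝ} {D}, WK (muW m) (Win m L) K D → D ≤ max D1 D2 →
        WK (muW m) (Win m L) K (max D1 D2) := fun w hw =>
      ⟨w.mL, w.fin, w.mK, w.C0.trans hw, fun x hx y hy => (w.bd x hx y hy).trans hw⟩
    refine ge_of_tendsto (Jan_tendsto (C := max D1 D2) (Kq := fun q => kR (Ψn q) t) ?_ (mono (hD2 Ψ hC2) (le_max_right _ _)) ?_ (WG_nI (Win_meas L)) x hx)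
      (hp.mono fun q hq => hq.2 n x hx)
    · filter_upwards [hC1] with q hq
      exact mono (hD1 _ hq) (le_max_left _ _)
    · intro a ha b hb
      exact (Complex.continuous_re.tendsto _).comp (kap_tendsto h (t a.1) a.2 (t b.1) b.2)

end AW
namespace AW

section
variable {X : Type} [MeasurableSpace X]

theorem JPos_congr {K K' : X → X → ℝ} {μ : Measure X} {Λ : Set X} (h : JPos K μ Λ)
    (he : ∀ a ∈ Λ, ∀ b ∈ Λ, K' a b = K a b) : JPos K' μ Λ := by
  intro n x hx
  have : Jan K' μ (nI Λ) x = Jan K μ (nI Λ) x := by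
    unfold Jan
    congr! 5 with l v
    by_cases hv : ∀ i, v i ∈ Λ
    · congr 1
      unfold detK
      congr 1
      ext i j
      have : ∀ i, Sum.elim x v i ∈ Λ := by rintro (i | i); exacts [hx i, hv i]
      exact he _ (this i) _ (this j)
    · push Not at hv
      obtain ⟨i, hi⟩ := hv
      rw [Finset.prod_eq_zero (Finset.mem_univ i) (by simp [nI, hi]), zero_mul, zero_mul]
  rw [this]
  exact h n x hx
end

theorem exists_sort {N : ℕ} {A : Fin N → ℝ} (hA : Function.Injective A) :
    ∃ σ : Equiv.Perm (Fin N), StrictAnti (A ∘ σ) := by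
  refine ⟨Tuple.sort (fun i => -A i), ?_⟩
  have h := Tuple.monotone_sort (fun i => -A i)
  have h2 : StrictMono ((fun i => -A i) ∘ Tuple.sort (fun i => -A i)) :=
    h.strictMono_of_injective ((neg_injective.comp hA).comp (Equiv.injective _))
  intro i j hij
  have := h2 hij
  simp only [Function.comp] at this ⊢
  linarith

theorem Rat_perm {N : ℕ} (A B : Fin N → ℝ) (σ ρ : Equiv.Perm (Fin N)) : Rat (A ∘ σ) (B ∘ ρ) = Rat A B := by
  funext z
  unfold Rat
  congr 1
  · exact Equiv.prod_comp ρ (fun i => z + (B i : ℂ))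
  · exact Equiv.prod_comp σ (fun i => (A i : ℂ) - z)

variable {m : ℕ}

theorem posC_model {N : ℕ} {A B : Fin N → ℝ} (hA : Function.Injective A) (hB : Function.Injective B)
    (hA0 : ∀ i, 0 < A i) (hB0 : ∀ i, 0 < B i) {T l : ℝ} {t : Fin (m+1) → ℝ} (ht : StrictMono t) {L : ℕ}
    (h1 : ∀ k, 0 < t k + T) (h2 : ∀ k, 2 * (t k + T) < -L - l) :
    PosC t L (fun z => Rat A B z * E2 (-T) l z) := by
  obtain ⟨σ, hσ⟩ := exists_sort hA
  obtain ⟨ρ, hρ⟩ := exists_sort hB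
  rw [← Rat_perm A B σ ρ]
  have hA0' : ∀ i, 0 < (A ∘ σ) i := fun i => hA0 _
  have hB0' : ∀ i, 0 < (B ∘ ρ) i := fun i => hB0 _
  generalize A ∘ σ = A at hσ hA0'
  generalize B ∘ ρ = B at hρ hB0'
  set τ : ℕ → ℝ := fun k => if h : k < m + 1 then t ⟨k, h⟩ + T else t (Fin.last m) + T + (k - m) with hτ
  have τk : ∀ k : Fin (m+1), τ k = t k + T := fun k => by simp only [hτ, k.2, dif_pos]
  have τpos : ∀ k, 0 < τ k := by
    intro k
    simp only [hτ]
    split_ifs with h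
    · exact h1 _
    · have := h1 (Fin.last m)
      have : (m:ℝ) ≤ k := by exact_mod_cast (by lia : m ≤ k)
      linarith
  have τm : StrictMono τ := by
    refine strictMono_nat_of_lt_succ fun k => ?_
    by_cases h : k + 1 < m + 1
    · simp only [hτ, h, show k < m + 1 by lia, dif_pos]
      have := ht (show (⟨k, by lia⟩ : Fin (m+1)) < ⟨k+1, h⟩ from by simp [Fin.lt_def])
      linarith
    · simp only [hτ, h, dif_neg, not_false_eq_true]
      by_cases h' : k < m + 1
      · have : k = m := by lia
        subst this
        simp only [h', dif_pos, Fin.last]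
        push_cast; linarith
      · simp only [h', dif_neg, not_false_eq_true]
        push_cast; linarith
  obtain ⟨c, C, Cp, W1, W2, hch⟩ := chain_model (m := m) l hσ hρ hA0' hB0' τpos τm
  obtain ⟨-, hJ⟩ := hch.result L
  have key : ∀ a ∈ Win m L, ∀ b ∈ Win m L, kap (fun z => Rat A B z * E2 (-T) l z) (t a.1) a.2 (t b.1) b.2 =
      ((Kc m (phM B τ l) (psM A τ l) (ppM τ) a b : ℝ) : ℂ) := by
    intro a ha b hb
    have ha' := ha.2.1
    have hb' := hb.2.1
    rw [kap_model hσ.injective hρ.injective hA0' hB0' (h1 _) (by linarith [h2 a.1]) (h1 _)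
      (by linarith [h2 b.1, h1 b.1])]
    congr 1
    unfold Kc
    rw [Gc_model l hA0' hB0' τpos]
    simp only [psM, phM, ppM, τk, ht.lt_iff_lt]
    congr! 4
    ring
  constructor
  · intro a ha b hb
    rw [key a ha b hb, Complex.ofReal_im]
  · refine JPos_congr hJ fun a ha b hb => ?_
    unfold kR
    rw [key a ha b hb, Complex.ofReal_re]

end AW
namespace AW

theorem gM_neg (y : ℝ) : gammaM 1 y = -gammaP (-1) (-y) := by
  rw [gammaM_eq, gammaP_eq, abs_neg]; push_cast; ring

theorem gP_nsq (r : ℝ) (δ y : ℝ) : Complex.normSq ((r : ℂ) + δ * gammaP (-1) y) =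
    (r - δ + δ * (|y| / Real.sqrt 2)) ^ 2 + δ ^ 2 * (|y| / Real.sqrt 2) ^ 2 := by
  rw [Complex.normSq_apply, gammaP_eq]
  have : (|y| / Real.sqrt 2) ^ 2 = (y / Real.sqrt 2) ^ 2 := by rw [div_pow, div_pow, sq_abs]
  rw [this]
  simp
  ring

theorem rho_nonneg (y : ℝ) : 0 ≤ |y| / Real.sqrt 2 := div_nonneg (abs_nonneg _) sqrt2_pos.le
theorem rho_le (y : ℝ) : |y| / Real.sqrt 2 ≤ |y| := div_le_self (abs_nonneg _) (Real.one_le_sqrt.mpr (by norm_num))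
theorem le_rho (y : ℝ) : |y| ≤ 2 * (|y| / Real.sqrt 2) := by
  have h2 : Real.sqrt 2 ≤ 2 := by rw [Real.sqrt_le_left (by norm_num)]; norm_num
  rw [← mul_div_assoc, le_div_iff₀ sqrt2_pos, mul_comm]
  exact mul_le_mul_of_nonneg_right h2 (abs_nonneg _)
theorem rho_sq (y : ℝ) : 2 * (|y| / Real.sqrt 2) ^ 2 = |y| ^ 2 := by
  rw [div_pow, sqrt2_sq]; ring

theorem gP_norm_le (y : ℝ) : ‖gammaP (-1) y‖ ≤ 1 + |y| := by
  have h := gP_nsq 0 1 y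
  have hr := rho_nonneg y
  have hs := rho_sq y
  have hy := abs_nonneg y
  rw [ofReal_zero, zero_add, ofReal_one, one_mul, Complex.normSq_eq_norm_sq] at h
  refine le_of_sq_le_sq ?_ (by linarith)
  rw [h]
  nlinarith
where le_of_sq_le_sq {a b : ℝ} (h : a ^ 2 ≤ b ^ 2) (hb : 0 ≤ b) : a ≤ b := (abs_le_of_sq_le_sq' h hb).2

theorem gP_norm_ge (y a : ℝ) (ha : 0 ≤ a) : (1 + a) / 2 ≤ ‖gammaP (-1) y - a‖ := by
  have h := gP_nsq (-a) 1 y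
  rw [ofReal_neg, ofReal_one, one_mul, Complex.normSq_eq_norm_sq, neg_add_eq_sub] at h
  refine gP_norm_le.le_of_sq_le_sq ?_ (norm_nonneg _)
  rw [h]
  nlinarith [sq_nonneg (2 * (|y| / Real.sqrt 2) - (1 + a))]

theorem gP_ne_zero (y : ℝ) : gammaP (-1) y ≠ 0 := by
  have := gP_norm_ge y 0 le_rfl
  intro h
  rw [h] at this
  norm_num at this

theorem exp_neg_le_quad {u : ℝ} (hu : 0 ≤ u) : Real.exp (-(2 * u)) ≤ 1 - 2 * u + 2 * u ^ 2 := by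
  have h : 1 + 2 * u + (2 * u) ^ 2 / 2 ≤ Real.exp (2 * u) := Real.quadratic_le_exp_of_nonneg (by linarith)
  rw [Real.exp_neg, inv_le_iff_one_le_mul₀ (Real.exp_pos _)]
  have : 0 ≤ 1 - 2 * u + 2 * u ^ 2 := by nlinarith [sq_nonneg (1 - 2 * u), sq_nonneg u]
  have h4 : 0 ≤ u ^ 4 := by positivity
  nlinarith [mul_le_mul_of_nonneg_left h this]

theorem gP_inv_bd {a : ℝ} (ha : 0 ≤ a) (y : ℝ) : Real.exp (-(a * |y|)) ≤ ‖1 - a * gammaP (-1) y‖ := by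
  have h := gP_nsq 1 (-a) y
  have hr := rho_nonneg y
  rw [ofReal_neg, ofReal_one, neg_mul, ← sub_eq_add_neg, Complex.normSq_eq_norm_sq] at h
  refine gP_norm_le.le_of_sq_le_sq ?_ (norm_nonneg _)
  rw [h]
  set ρ := |y| / Real.sqrt 2
  have h1 : Real.exp (-(a * |y|)) ^ 2 ≤ Real.exp (-(2 * (a * ρ))) := by
    rw [← Real.exp_nat_mul, Real.exp_le_exp]
    have := mul_le_mul_of_nonneg_left (rho_le y) ha
    push_cast
    simp only [ρ]
    linarith
  refine h1.trans ?_
  have hu : 0 ≤ a * ρ := mul_nonneg ha hr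
  by_cases h2 : a * ρ ≤ 1
  · refine (exp_neg_le_quad hu).trans ?_
    nlinarith [mul_nonneg ha (sub_nonneg.mpr h2)]
  · have : Real.exp (-(2 * (a * ρ))) ≤ 1 := Real.exp_le_one_iff.mpr (by linarith)
    nlinarith [sq_nonneg (1 - -a + -a * ρ)]

def fac (a b : ℝ) (z : ℂ) : ℂ := (1 + b * z) / (1 - a * z)
def fam (a b : ℝ) (z : ℂ) : ℂ := (1 + b / z) / (1 - a / z)

theorem fac_neg (a b : ℝ) (z : ℂ) : (fac a b (-z))⁻¹ = fac b a z := by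
  unfold fac; rw [inv_div]; congr 1 <;> ring
theorem fam_neg (a b : ℝ) (z : ℂ) : (fam a b (-z))⁻¹ = fam b a z := by
  unfold fam; rw [inv_div, div_neg, div_neg]; congr 1; ring

theorem fac_bd {a b : ℝ} (ha : 0 ≤ a) (hb : 0 ≤ b) (y : ℝ) :
    ‖fac a b (gammaP (-1) y)‖ ≤ Real.exp ((a + b) * (1 + |y|)) := by
  unfold fac
  rw [norm_div]
  have h1 : ‖1 + (b:ℂ) * gammaP (-1) y‖ ≤ Real.exp (b * (1 + |y|)) := by
    refine (norm_add_le _ _).trans ?_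
    rw [norm_one, norm_mul, Complex.norm_real, Real.norm_eq_abs, abs_of_nonneg hb]
    have := Real.add_one_le_exp (b * (1 + |y|))
    have := mul_le_mul_of_nonneg_left (gP_norm_le y) hb
    linarith
  have h2 := gP_inv_bd ha y
  rw [div_le_iff₀ ((Real.exp_pos _).trans_le h2)]
  refine h1.trans (le_trans ?_ (mul_le_mul_of_nonneg_left h2 (Real.exp_pos _).le))
  rw [← Real.exp_add, Real.exp_le_exp]
  nlinarith

theorem fam_bd {a b : ℝ} (ha : 0 ≤ a) (hb : 0 ≤ b) (y : ℝ) :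
    ‖fam a b (gammaP (-1) y)‖ ≤ Real.exp ((2 * (a + b)) * (1 + |y|)) := by
  have hz := gP_ne_zero y
  have h0 := gP_norm_ge y 0 le_rfl
  have ha1 := gP_norm_ge y a ha
  rw [ofReal_zero, sub_zero] at h0
  have hza : gammaP (-1) y - a ≠ 0 := fun h => by rw [h, norm_zero] at ha1; linarith
  have e : fam a b (gammaP (-1) y) = (1 + b / gammaP (-1) y) * (1 + a / (gammaP (-1) y - a)) := by
    unfold fam
    have : 1 - a / gammaP (-1) y = (gammaP (-1) y - a) / gammaP (-1) y := by field_simp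
    rw [this]; field_simp; ring
  have bd : ∀ (c : ℝ) (w : ℂ), 0 ≤ c → (c = 0 ∨ 1/2 ≤ ‖w‖) → ‖1 + (c:ℂ) / w‖ ≤ Real.exp (2 * c) := by
    intro c w hc hw
    refine (norm_add_le _ _).trans ?_
    rw [norm_one, norm_div, Complex.norm_real, Real.norm_eq_abs, abs_of_nonneg hc]
    have := Real.add_one_le_exp (2 * c)
    have : c / ‖w‖ ≤ 2 * c := by
      rcases hw with h | h
      · simp [h]
      · rw [div_le_iff₀ (by linarith)]; nlinarith
    linarith
  rw [e, norm_mul]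
  have := mul_le_mul (bd b _ hb (Or.inr (by linarith : 1 / 2 ≤ ‖gammaP (-1) y‖))) (bd a _ ha (Or.inr (by linarith : 1 / 2 ≤ ‖gammaP (-1) y - a‖))) (norm_nonneg _) (Real.exp_pos _).le
  refine this.trans ?_
  rw [← Real.exp_add, Real.exp_le_exp]
  nlinarith [mul_nonneg (add_nonneg ha hb) (abs_nonneg y)]

/-- exponentially bounded multipliers -/
structure EB (Q : ℂ → ℂ) (K : ℝ) : Prop where
  ms : Measurable Q
  bP : ∀ y, ‖Q (gammaP (-1) y)‖ ≤ Real.exp (K * (1 + |y|))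
  bM : ∀ y, ‖(Q (gammaM 1 y))⁻¹‖ ≤ Real.exp (K * (1 + |y|))

theorem EB.mul {Q Q' : ℂ → ℂ} {K K' : ℝ} (h : EB Q K) (h' : EB Q' K') : EB (fun z => Q z * Q' z) (K + K') := by
  refine ⟨h.ms.mul h'.ms, fun y => ?_, fun y => ?_⟩
  · rw [norm_mul, add_mul, Real.exp_add]
    exact mul_le_mul (h.bP y) (h'.bP y) (norm_nonneg _) (Real.exp_pos _).le
  · rw [mul_inv, norm_mul, add_mul, Real.exp_add]
    exact mul_le_mul (h.bM y) (h'.bM y) (norm_nonneg _) (Real.exp_pos _).le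

theorem EB.mono {Q : ℂ → ℂ} {K K' : ℝ} (h : EB Q K) (hK : K ≤ K') : EB Q K' := by
  have : ∀ y : ℝ, Real.exp (K * (1 + |y|)) ≤ Real.exp (K' * (1 + |y|)) := fun y =>
    Real.exp_le_exp.mpr (mul_le_mul_of_nonneg_right hK (by positivity))
  exact ⟨h.ms, fun y => (h.bP y).trans (this y), fun y => (h.bM y).trans (this y)⟩

theorem EB.prod {ι : Type*} (s : Finset ι) {Q : ι → ℂ → ℂ} {K : ι → ℝ} (h : ∀ i ∈ s, EB (Q i) (K i)) :
    EB (fun z => ∏ i ∈ s, Q i z) (∑ i ∈ s, K i) := by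
  classical
  induction s using Finset.induction_on with
  | empty => exact ⟨by simp, by simp, by simp⟩
  | insert i s hi ih =>
    simp only [Finset.prod_insert hi, Finset.sum_insert hi]
    exact (h i (Finset.mem_insert_self _ _)).mul (ih fun j hj => h j (Finset.mem_insert_of_mem hj))

theorem EB_fac {a b : ℝ} (ha : 0 ≤ a) (hb : 0 ≤ b) : EB (fac a b) (a + b) := by
  refine ⟨by unfold fac; fun_prop, fac_bd ha hb, fun y => ?_⟩
  rw [gM_neg, fac_neg, ← abs_neg, add_comm a b]
  exact fac_bd hb ha _
theorem EB_fam {a b : ℝ} (ha : 0 ≤ a) (hb : 0 ≤ b) : EB (fam a b) (2 * (a + b)) := by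
  refine ⟨by unfold fam; fun_prop, fam_bd ha hb, fun y => ?_⟩
  rw [gM_neg, fam_neg, ← abs_neg, add_comm a b]
  exact fam_bd hb ha _
theorem EB_exp (c : ℝ) : EB (fun z => cexp (c * z)) |c| := by
  have h : ∀ z : ℂ, ‖cexp (c * z)‖ ≤ Real.exp (|c| * ‖z‖) := fun z => by
    rw [Complex.norm_exp, Real.exp_le_exp]
    refine (Complex.re_le_norm _).trans ?_
    rw [norm_mul, Complex.norm_real, Real.norm_eq_abs]
  have h2 : ∀ y : ℝ, Real.exp (|c| * ‖gammaP (-1) y‖) ≤ Real.exp (|c| * (1 + |y|)) := fun y =>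
    Real.exp_le_exp.mpr (mul_le_mul_of_nonneg_left (gP_norm_le y) (abs_nonneg _))
  refine ⟨by fun_prop, fun y => (h _).trans (h2 y), fun y => ?_⟩
  rw [gM_neg, ← Complex.exp_neg, mul_neg, neg_neg, ← abs_neg y]
  exact (h _).trans (h2 _)

theorem LimTo.mulEB {Ψn Qn : ℕ → ℂ → ℂ} {Ψ Q : ℂ → ℂ} (h : LimTo Ψn Ψ) {K : ℝ} (hQ : ∀ᶠ n in atTop, EB (Qn n) K)
    (lP : ∀ y, Tendsto (fun n => Qn n (gammaP (-1) y)) atTop (𝓝 (Q (gammaP (-1) y))))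
    (lM : ∀ y, Tendsto (fun n => (Qn n (gammaM 1 y))⁻¹) atTop (𝓝 (Q (gammaM 1 y))⁻¹)) : LimTo (fun n z => Ψn n z * Qn n z) (fun z => Ψ z * Q z) := by
  refine ⟨fun M => ?_, fun y => (h.limP y).mul (lP y), fun y => by simpa only [mul_inv] using (h.limM y).mul (lM y)⟩
  obtain ⟨C, hC⟩ := h.dec (M + K)
  refine ⟨C * Real.exp K, ?_⟩
  have e : ∀ y : ℝ, C * Real.exp (-((M + K) * |y|)) * Real.exp (K * (1 + |y|)) = C * Real.exp K * Real.exp (-(M * |y|)) := by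
    intro y
    rw [mul_assoc, mul_assoc, ← Real.exp_add, ← Real.exp_add]
    congr 2; ring
  filter_upwards [hC, hQ] with n hn hq
  refine ⟨hn.mP.mul (hq.ms.comp (gammaP_cont _).measurable), hn.mM.mul (hq.ms.comp (gammaM_cont _).measurable), fun y => ?_, fun y => ?_⟩
  · rw [norm_mul, ← e]
    exact mul_le_mul (hn.dP y) (hq.bP y) (norm_nonneg _) ((norm_nonneg _).trans (hn.dP y))
  · rw [mul_inv, norm_mul, ← e]
    exact mul_le_mul (hn.dM y) (hq.bM y) (norm_nonneg _) ((norm_nonneg _).trans (hn.dM y))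

theorem LimTo.const {Ψn : ℕ → ℂ → ℂ} {Ψ : ℂ → ℂ} (h : LimTo Ψn Ψ) : LimTo (fun _ => Ψ) Ψ := by
  refine ⟨fun M => ?_, fun y => tendsto_const_nhds, fun y => tendsto_const_nhds⟩
  obtain ⟨C, hC⟩ := h.decL M
  exact ⟨C, Eventually.of_forall fun _ => hC⟩

theorem kap_smul {Ψ Ψ' : ℂ → ℂ} {c : ℂ} (hc : c ≠ 0) (hP : ∀ y, Ψ' (gammaP (-1) y) = c * Ψ (gammaP (-1) y))
    (hM : ∀ y, Ψ' (gammaM 1 y) = c * Ψ (gammaM 1 y)) (t₁ x₁ t₂ x₂ : ℝ) : kap Ψ' t₁ x₁ t₂ x₂ = kap Ψ t₁ x₁ t₂ x₂ := by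
  unfold kap
  congr 3
  funext p
  unfold kcore
  simp only [hP, hM]
  congr 3
  rw [div_eq_mul_inv, div_eq_mul_inv, mul_inv]
  field_simp

theorem posC_smul {m : ℕ} {t : Fin (m+1) → ℝ} {L : ℕ} {Ψ Ψ' : ℂ → ℂ} {c : ℂ} (h : PosC t L Ψ) (hc : c ≠ 0)
    (hP : ∀ y, Ψ' (gammaP (-1) y) = c * Ψ (gammaP (-1) y))
    (hM : ∀ y, Ψ' (gammaM 1 y) = c * Ψ (gammaM 1 y)) : PosC t L Ψ' := by
  have e : kR Ψ' t = kR Ψ t := by funext a b; unfold kR; rw [kap_smul hc hP hM]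
  refine ⟨fun a ha b hb => ?_, ?_⟩
  · rw [kap_smul hc hP hM]; exact h.1 a ha b hb
  · rw [e]; exact h.2

end AW
namespace AW

theorem cub_step {F F' : ℝ → ℝ} (h : ∀ ρ, HasDerivAt F (F' ρ) ρ) {η K M R : ℝ} (hη : 0 ≤ η) (hK : 0 ≤ K) (hM : 0 ≤ M)
    (hR : 0 ≤ R) (h0 : F 0 ≤ 0) (h1 : ∀ ρ, 0 ≤ ρ → F' ρ ≤ K * η) (h2 : ∀ ρ, R ≤ ρ → F' ρ ≤ -M * η) {ρ : ℝ} (hρ : 0 ≤ ρ) :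
    F ρ ≤ η * ((K + M) * R - M * ρ) := by
  have hd : Differentiable ℝ F := fun x => (h x).differentiableAt
  have s1 : ∀ r, 0 ≤ r → F r - F 0 ≤ K * η * (r - 0) := fun r hr =>
    Convex.image_sub_le_mul_sub_of_deriv_le (convex_Ici 0) hd.continuous.continuousOn hd.differentiableOn
      (fun x hx => by rw [(h x).deriv]; exact h1 x (interior_subset hx)) 0 (Set.mem_Ici.mpr le_rfl) r hr hr
  rcases le_total ρ R with hr | hr
  · have := s1 ρ hρ
    have e1 : K * η * ρ ≤ K * η * R := mul_le_mul_of_nonneg_left hr (by positivity)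
    have e2 : M * η * ρ ≤ M * η * R := mul_le_mul_of_nonneg_left hr (by positivity)
    nlinarith
  · have a1 := s1 R hR
    have a2 : F ρ - F R ≤ -M * η * (ρ - R) :=
      Convex.image_sub_le_mul_sub_of_deriv_le (convex_Ici R) hd.continuous.continuousOn hd.differentiableOn
        (fun x hx => by rw [(h x).deriv]; exact h2 x (interior_subset hx)) R (Set.mem_Ici.mpr le_rfl) ρ hr hr
    nlinarith

def qc (δ ρ : ℝ) : ℝ := (1 + δ - δ * ρ) ^ 2 + δ ^ 2 * ρ ^ 2
def Fc (δ ρ : ℝ) : ℝ := -(1/2) * Real.log (qc δ ρ) - δ * (ρ - 1) - δ ^ 2 / 2 * (1 - 2 * ρ)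
def Nc (δ ρ : ℝ) : ℝ := 1 - 2 * ρ ^ 2 + δ * (1 - 2 * ρ + 2 * ρ ^ 2)

theorem qc_ge (δ ρ : ℝ) : (1 + δ) ^ 2 / 2 ≤ qc δ ρ := by
  unfold qc; nlinarith [sq_nonneg (1 + δ - 2 * (δ * ρ))]
theorem qc_pos {δ : ℝ} (hδ : -1 < δ) (ρ : ℝ) : 0 < qc δ ρ :=
  lt_of_lt_of_le (by have : 0 < 1 + δ := by linarith
                     positivity) (qc_ge δ ρ)

theorem Fc_deriv {δ : ℝ} (hδ : -1 < δ) (ρ : ℝ) : HasDerivAt (Fc δ) (δ ^ 3 * Nc δ ρ / qc δ ρ) ρ := by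
  have hq := qc_pos hδ ρ
  have h1 : HasDerivAt (qc δ) (2 * (1 + δ - δ * ρ) * (-δ) + δ ^ 2 * (2 * ρ)) ρ := by
    unfold qc
    have a := ((hasDerivAt_id ρ).const_mul δ).const_sub (1 + δ)
    have b := (hasDerivAt_id ρ).pow 2
    refine ((a.pow 2).add (b.const_mul (δ^2))).congr_deriv ?_
    simp
  have h2 := ((h1.log hq.ne').const_mul (-(1/2) : ℝ)).sub (((hasDerivAt_id ρ).sub_const 1).const_mul δ)
  have h3 := h2.sub ((((hasDerivAt_id ρ).const_mul 2).const_sub 1).const_mul (δ ^ 2 / 2))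
  refine h3.congr_deriv ?_
  field_simp
  unfold Nc qc
  ring

theorem Fc_bd {M ε σ : ℝ} (hM : 0 ≤ M) (hσ : σ = 1 ∨ σ = -1) (h0 : 0 < ε) (h1 : ε ≤ 1 / (2 * (1 + M))) {ρ : ℝ} (hρ : 0 ≤ ρ) :
    σ * Fc (σ * ε) ρ ≤ ε ^ 3 * ((12 + M) * (3 + 5 * M) - M * ρ) := by
  have e1 : ε * (2 * (1 + M)) ≤ 1 := by rwa [le_div_iff₀ (by positivity)] at h1
  have e2 : ε ≤ 1 / 2 := by nlinarith
  have e3 : M * ε ^ 2 ≤ 1 / 8 := by nlinarith [mul_nonneg hM h0.le, mul_nonneg (mul_nonneg hM h0.le) h0.le]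
  have hs2 : (σ * ε) ^ 2 = ε ^ 2 := by rcases hσ with rfl | rfl <;> ring
  have hs4 : σ * (σ * ε) ^ 3 = ε ^ 3 := by rcases hσ with rfl | rfl <;> ring
  have hlo : -(1 / 2) ≤ σ * ε := by rcases hσ with rfl | rfl <;> linarith
  have hhi : σ * ε ≤ 1 / 2 := by rcases hσ with rfl | rfl <;> linarith
  have hN : ∀ ρ, 0 ≤ ρ → Nc (σ * ε) ρ ≤ 3 / 2 - ρ ^ 2 := by
    intro ρ hρ
    unfold Nc
    nlinarith [mul_nonneg (sub_nonneg.mpr hhi) (show 0 ≤ 1 - 2 * ρ + 2 * ρ ^ 2 by nlinarith [sq_nonneg (2 * ρ - 1)])]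
  have hd : ∀ ρ, HasDerivAt (fun ρ => σ * Fc (σ * ε) ρ) (ε ^ 3 * Nc (σ * ε) ρ / qc (σ * ε) ρ) ρ := fun ρ => by
    refine ((Fc_deriv (by linarith) ρ).const_mul σ).congr_deriv ?_
    rw [← hs4]; ring
  refine cub_step hd (by positivity) (by norm_num) hM (by positivity) ?_ ?_ ?_ hρ
  · have : Real.log (qc (σ * ε) 0) = 2 * Real.log (1 + σ * ε) := by
      unfold qc
      rw [show (1 + σ * ε - σ * ε * 0) ^ 2 + (σ * ε) ^ 2 * 0 ^ 2 = (1 + σ * ε) ^ 2 by ring, Real.log_pow]; norm_num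
    simp only [Fc]
    rw [this]
    rcases hσ with rfl | rfl
    · have h3 := Real.le_log_one_add_of_nonneg h0.le
      have : ε - ε ^ 2 / 2 ≤ 2 * ε / (ε + 2) := by
        rw [le_div_iff₀ (by linarith)]; nlinarith [pow_pos h0 3]
      simp only [one_mul]
      linarith
    · have hx : 0 < 1 - ε := by linarith
      have h3 := Real.le_log_one_add_of_nonneg (div_nonneg h0.le hx.le)
      rw [show 1 + ε / (1 - ε) = (1 - ε)⁻¹ by field_simp; ring, Real.log_inv] at h3
      have : ε + ε ^ 2 / 2 ≤ 2 * (ε / (1 - ε)) / (ε / (1 - ε) + 2) := by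
        rw [show 2 * (ε / (1 - ε)) / (ε / (1 - ε) + 2) = 2 * ε / (2 - ε) by
          have : 2 - ε ≠ 0 := by linarith
          rw [div_add' _ _ _ hx.ne', mul_div_assoc', div_div_div_cancel_right₀ hx.ne']; congr 1; ring, le_div_iff₀ (by linarith)]
        nlinarith [pow_pos h0 3]
      simp only [neg_one_mul, ← sub_eq_add_neg] at *
      nlinarith
  · intro ρ hρ
    have := hN ρ hρ
    have hq := qc_ge (σ * ε) ρ
    rw [div_le_iff₀ (qc_pos (by linarith) ρ), mul_comm (12:ℝ), mul_assoc]
    refine mul_le_mul_of_nonneg_left ?_ (by positivity)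
    nlinarith [sq_nonneg ρ]
  · intro ρ hρ
    have hρ0 : 0 ≤ ρ := le_trans (by positivity) hρ
    have := hN ρ hρ0
    rw [div_le_iff₀ (qc_pos (by linarith) ρ), mul_comm (-M), mul_assoc]
    refine mul_le_mul_of_nonneg_left ?_ (by positivity)
    have hq : qc (σ * ε) ρ ≤ 9 / 2 + 3 * ε ^ 2 * ρ ^ 2 := by
      rw [← hs2]
      unfold qc
      nlinarith [sq_nonneg (1 + σ * ε + σ * ε * ρ)]
    have hr2 : 9 + 30 * M ≤ ρ ^ 2 := by nlinarith
    have h5 := mul_le_mul_of_nonneg_left hq hM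
    nlinarith [mul_le_mul_of_nonneg_right e3 (sq_nonneg ρ)]

end AW
namespace AW

def cubF (ε : ℝ) (z : ℂ) : ℂ := cexp (-(ε * z) - ε ^ 2 * z ^ 2 / 2) / (1 - ε * z)

theorem cubF_norm {δ : ℝ} (hδ : -1 < δ) (y : ℝ) : ‖cubF δ (gammaP (-1) y)‖ = Real.exp (Fc δ (|y| / Real.sqrt 2)) := by
  have h := gP_nsq 1 (-δ) y
  have hq := qc_pos hδ (|y| / Real.sqrt 2)
  rw [ofReal_neg, ofReal_one, neg_mul, ← sub_eq_add_neg, Complex.normSq_eq_norm_sq,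
    show (1 - -δ + -δ * (|y| / Real.sqrt 2)) ^ 2 + (-δ) ^ 2 * (|y| / Real.sqrt 2) ^ 2 = qc δ (|y| / Real.sqrt 2) by
      unfold qc; ring] at h
  have h2 : ‖1 - δ * gammaP (-1) y‖ = Real.exp ((1/2) * Real.log (qc δ (|y| / Real.sqrt 2))) := by
    refine (sq_eq_sq₀ (norm_nonneg _) (Real.exp_pos _).le).mp ?_
    rw [h, ← Real.exp_nat_mul]
    push_cast
    rw [← mul_assoc, show (2:ℝ) * (1/2) = 1 by norm_num, one_mul, Real.exp_log hq]
  unfold cubF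
  rw [norm_div, h2, Complex.norm_exp, ← Real.exp_sub]
  congr 1
  have hz : (-(δ * gammaP (-1) y) - δ ^ 2 * gammaP (-1) y ^ 2 / 2).re =
      -(δ * (-1 + |y| / Real.sqrt 2)) - δ ^ 2 / 2 * ((-1 + |y| / Real.sqrt 2) ^ 2 - (|y| / Real.sqrt 2) ^ 2) := by
    have : (|y| / Real.sqrt 2) ^ 2 = (y / Real.sqrt 2) ^ 2 := by rw [div_pow, div_pow, sq_abs]
    rw [this, gammaP_eq]
    generalize |y| / Real.sqrt 2 = u at *
    generalize y / Real.sqrt 2 = v at *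
    rw [show ∀ w : ℂ, -(δ * w) - δ ^ 2 * w ^ 2 / 2 = -((δ : ℝ) * w) - ((δ ^ 2 / 2 : ℝ):ℂ) * (w * w) from fun w => by push_cast; ring,
      Complex.sub_re, Complex.neg_re, Complex.re_ofReal_mul, Complex.re_ofReal_mul]
    simp
    left
    ring
  rw [hz]
  unfold Fc
  ring

theorem cubF_neg (ε : ℝ) (z : ℂ) : cubF ε (-z) = cubF (-ε) z := by
  unfold cubF; push_cast; congr 2 <;> ring

theorem cubF_exp {ε : ℝ} {z : ℂ} (h : ‖(ε:ℂ) * z‖ ≤ 1 / 2) :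
    ∃ e : ℂ, cubF ε z = cexp e ∧ ‖e - ε ^ 3 * (z ^ 3 / 3)‖ ≤ ‖(ε:ℂ) * z‖ ^ 4 := by
  refine ⟨Complex.log (1 - ε * z)⁻¹ - ε * z - ε ^ 2 * z ^ 2 / 2, ?_, ?_⟩
  · have : (1 - ε * z) ≠ 0 := fun h0 => by
      have : (ε:ℂ) * z = 1 := (sub_eq_zero.mp h0).symm
      rw [this] at h; norm_num at h
    unfold cubF
    rw [sub_sub, sub_eq_add_neg (Complex.log _), Complex.exp_add, Complex.exp_log (inv_ne_zero this), div_eq_mul_inv, mul_comm]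
    congr 2; ring
  · have := Complex.norm_log_one_sub_inv_add_logTaylor_neg_le 3 (z := ε * z) (by linarith)
    simp only [Complex.logTaylor_succ, Complex.logTaylor_zero, Pi.add_apply] at this
    refine le_trans (le_of_eq ?_) (this.trans ?_)
    · congr 1; push_cast; ring
    · have h2 : (1 - ‖(ε:ℂ) * z‖)⁻¹ ≤ 2 := by
        rw [inv_le_comm₀ (by linarith) (by norm_num)]; linarith
      have := mul_le_mul_of_nonneg_left h2 (pow_nonneg (norm_nonneg ((ε:ℂ) * z)) 4)
      have h4 : 0 ≤ ‖(ε:ℂ) * z‖ ^ 4 := by positivity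
      push_cast
      norm_num only at this ⊢
      linarith

def ep (k i : ℕ) : ℝ := 1 / (k + i / k ^ 3)
def cub (k : ℕ) (z : ℂ) : ℂ := ∏ i ∈ Finset.range (k ^ 3), cubF (ep k i) z

theorem ep_bd {k i : ℕ} (hk : 0 < k) (hi : i < k ^ 3) : (1 / (k + 1) : ℝ) ≤ ep k i ∧ ep k i ≤ 1 / k := by
  have hk' : (0:ℝ) < k := by exact_mod_cast hk
  have h1 : (i:ℝ) / k ^ 3 ≤ 1 := by
    rw [div_le_one (by positivity)]; exact_mod_cast hi.le
  unfold ep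
  have h0 : (0:ℝ) ≤ i / k ^ 3 := by positivity
  exact ⟨one_div_le_one_div_of_le (by positivity) (by linarith), one_div_le_one_div_of_le hk' (by linarith)⟩

theorem ep_sum {k : ℕ} (hk : 0 < k) (p : ℕ) : (k ^ 3 * (1 / (k + 1)) ^ p : ℝ) ≤ ∑ i ∈ Finset.range (k ^ 3), ep k i ^ p ∧
    ∑ i ∈ Finset.range (k ^ 3), ep k i ^ p ≤ (k ^ 3 * (1 / k) ^ p : ℝ) := by
  have h1 := Finset.card_nsmul_le_sum (Finset.range (k ^ 3)) (fun i => ep k i ^ p) ((1 / (k + 1) : ℝ) ^ p) fun i hi =>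
    pow_le_pow_left₀ (by positivity) (ep_bd hk (Finset.mem_range.mp hi)).1 p
  have h2 := Finset.sum_le_card_nsmul (Finset.range (k ^ 3)) (fun i => ep k i ^ p) ((1 / k : ℝ) ^ p) fun i hi =>
    pow_le_pow_left₀ (le_trans (by positivity) (ep_bd hk (Finset.mem_range.mp hi)).1) (ep_bd hk (Finset.mem_range.mp hi)).2 p
  simp only [Finset.card_range, nsmul_eq_mul, Nat.cast_pow] at h1 h2
  exact ⟨h1, h2⟩

theorem ep_lim : Tendsto (fun k : ℕ => ∑ i ∈ Finset.range (k ^ 3), ep k i ^ 3) atTop (𝓝 1) := by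
  have h1 : Tendsto (fun k : ℕ => ((k : ℝ) / (k + 1)) ^ 3) atTop (𝓝 1) := by
    simpa using (tendsto_natCast_div_add_atTop (1:ℝ)).pow 3
  refine tendsto_of_tendsto_of_tendsto_of_le_of_le' h1 tendsto_const_nhds ?_ ?_
  · filter_upwards [eventually_gt_atTop 0] with k hk
    refine le_trans (le_of_eq ?_) (ep_sum hk 3).1
    rw [← mul_pow]; congr 1; ring
  · filter_upwards [eventually_gt_atTop 0] with k hk
    refine (ep_sum hk 3).2.trans (le_of_eq ?_)
    have : (k:ℝ) ≠ 0 := by positivity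
    rw [← mul_pow, mul_one_div_cancel this, one_pow]

theorem cub_lim (z : ℂ) : Tendsto (fun k => cub k z) atTop (𝓝 (cexp (z ^ 3 / 3))) := by
  have key : ∀ᶠ k : ℕ in atTop, ∃ e : ℂ, cub k z = cexp e ∧
      ‖e - (∑ i ∈ Finset.range (k ^ 3), ep k i ^ 3 : ℝ) * (z ^ 3 / 3)‖ ≤ ‖z‖ ^ 4 / k := by
    filter_upwards [eventually_gt_atTop 0, eventually_ge_atTop ⌈2 * ‖z‖⌉₊] with k hk hz
    have hk' : (0:ℝ) < k := by exact_mod_cast hk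
    have hb : ∀ i ∈ Finset.range (k ^ 3), ‖(ep k i : ℂ) * z‖ ≤ ‖z‖ / k := fun i hi => by
      have := ep_bd hk (Finset.mem_range.mp hi)
      have h0 : 0 ≤ ep k i := le_trans (by positivity) this.1
      rw [norm_mul, Complex.norm_real, Real.norm_eq_abs, abs_of_nonneg h0, div_eq_inv_mul, ← one_div]
      exact mul_le_mul_of_nonneg_right this.2 (norm_nonneg _)
    have hz2 : ‖z‖ / k ≤ 1 / 2 := by
      have := Nat.ceil_le.mp hz
      rw [div_le_iff₀ hk']; linarith
    choose! e he1 he2 using fun i hi => cubF_exp ((hb i hi).trans hz2)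
    refine ⟨∑ i ∈ Finset.range (k ^ 3), e i, ?_, ?_⟩
    · unfold cub; rw [Complex.exp_sum]; exact Finset.prod_congr rfl he1
    · push_cast
      rw [Finset.sum_mul, ← Finset.sum_sub_distrib]
      refine (norm_sum_le_of_le _ fun i hi => (he2 i hi).trans (pow_le_pow_left₀ (norm_nonneg _) (hb i hi) 4)).trans (le_of_eq ?_)
      rw [Finset.sum_const, Finset.card_range, nsmul_eq_mul]
      push_cast
      field_simp
  choose! e he1 he2 using fun k (h : ∃ e : ℂ, cub k z = cexp e ∧
      ‖e - (∑ i ∈ Finset.range (k ^ 3), ep k i ^ 3 : ℝ) * (z ^ 3 / 3)‖ ≤ ‖z‖ ^ 4 / k) => h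
  have h0 : Tendsto (fun k => e k - (∑ i ∈ Finset.range (k ^ 3), ep k i ^ 3 : ℝ) * (z ^ 3 / 3)) atTop (𝓝 0) :=
    squeeze_zero_norm' (key.mono fun k h => he2 k h) (tendsto_const_div_atTop_nhds_zero_nat _)
  have h1 : Tendsto (fun k : ℕ => ((∑ i ∈ Finset.range (k ^ 3), ep k i ^ 3 : ℝ):ℂ) * (z ^ 3 / 3)) atTop (𝓝 (z ^ 3 / 3)) := by
    simpa using ((Complex.continuous_ofReal.tendsto 1).comp ep_lim).mul_const (z ^ 3 / 3)
  have h2 := h0.add h1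
  simp only [sub_add_cancel, zero_add] at h2
  exact ((Complex.continuous_exp.tendsto _).comp h2).congr' (key.mono fun k h => (he1 k h).symm)

theorem cub_limTo : LimTo cub (fun z => cexp (z ^ 3 / 3)) := by
  refine ⟨fun M₀ => ?_, fun y => cub_lim _, fun y => (cub_lim _).inv₀ (Complex.exp_ne_zero _)⟩
  obtain ⟨M, hM, hMM⟩ : ∃ M : ℝ, 0 ≤ M ∧ M₀ ≤ M / 16 := ⟨16 * |M₀|, by positivity, by linarith [le_abs_self M₀]⟩
  refine ⟨Real.exp ((12 + M) * (3 + 5 * M)), ?_⟩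
  have hms : ∀ k, Measurable (cub k) := fun k => by unfold cub cubF; fun_prop
  filter_upwards [eventually_gt_atTop 0, eventually_ge_atTop ⌈2 * (1 + M)⌉₊] with k hk hkM
  have hk' : (1:ℝ) ≤ k := by exact_mod_cast hk
  have S1 : (1/8:ℝ) ≤ ∑ i ∈ Finset.range (k ^ 3), ep k i ^ 3 := by
    refine le_trans ?_ (ep_sum hk 3).1
    rw [← mul_pow, mul_one_div]
    have : (1/2:ℝ) ≤ k / (k + 1) := by rw [le_div_iff₀ (by positivity)]; linarith
    calc (1/8:ℝ) = (1/2) ^ 3 := by norm_num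
      _ ≤ _ := pow_le_pow_left₀ (by norm_num) this 3
  have S2 : ∑ i ∈ Finset.range (k ^ 3), ep k i ^ 3 ≤ 1 := by
    refine (ep_sum hk 3).2.trans (le_of_eq ?_)
    have : (k:ℝ) ≠ 0 := by positivity
    rw [← mul_pow, mul_one_div_cancel this, one_pow]
  have hep : ∀ i ∈ Finset.range (k ^ 3), 0 < ep k i ∧ ep k i ≤ 1 / (2 * (1 + M)) := fun i hi => by
    have := ep_bd hk (Finset.mem_range.mp hi)
    exact ⟨lt_of_lt_of_le (by positivity) this.1, this.2.trans (one_div_le_one_div_of_le (by positivity) (Nat.ceil_le.mp hkM))⟩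
  have fin : ∀ (y : ℝ) (f : ℕ → ℝ), (∀ i ∈ Finset.range (k ^ 3), f i ≤ ep k i ^ 3 * ((12 + M) * (3 + 5 * M) - M * (|y| / Real.sqrt 2))) →
      ∏ i ∈ Finset.range (k ^ 3), Real.exp (f i) ≤ Real.exp ((12 + M) * (3 + 5 * M)) * Real.exp (-(M₀ * |y|)) := by
    intro y f hf
    rw [← Real.exp_sum, ← Real.exp_add, Real.exp_le_exp]
    refine (Finset.sum_le_sum hf).trans ?_
    rw [← Finset.sum_mul, mul_sub, sub_eq_add_neg]
    refine add_le_add (mul_le_of_le_one_left (by positivity) S2) (neg_le_neg ?_)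
    have a1 := mul_le_mul_of_nonneg_right S1 (mul_nonneg hM (rho_nonneg y))
    have a2 := mul_le_mul_of_nonneg_left (le_rho y) hM
    have a3 := mul_le_mul_of_nonneg_right hMM (abs_nonneg y)
    linarith
  refine ⟨(hms k).comp (gammaP_cont _).measurable, (hms k).comp (gammaM_cont _).measurable, fun y => ?_, fun y => ?_⟩
  · unfold cub
    rw [norm_prod, Finset.prod_congr rfl fun i hi => cubF_norm (by linarith [(hep i hi).1]) y]
    refine fin y _ fun i hi => ?_
    have := Fc_bd hM (Or.inl rfl) (hep i hi).1 (hep i hi).2 (rho_nonneg y)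
    simpa only [one_mul] using this
  · unfold cub
    have hlt : ∀ i ∈ Finset.range (k ^ 3), -1 < -ep k i := fun i hi => by
      have := (hep i hi).2
      have : 1 / (2 * (1 + M)) ≤ 1 / 2 := one_div_le_one_div_of_le (by norm_num) (by linarith)
      linarith
    simp only [gM_neg, cubF_neg]
    rw [norm_inv, norm_prod, Finset.prod_congr rfl fun i hi => cubF_norm (hlt i hi) (-y), ← Finset.prod_inv_distrib]
    simp only [← Real.exp_neg, abs_neg]
    refine fin y _ fun i hi => ?_
    have := Fc_bd hM (Or.inr rfl) (hep i hi).1 (hep i hi).2 (rho_nonneg y)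
    simpa only [neg_one_mul] using this

end AW
namespace AW
variable {m : ℕ} {t : Fin (m+1) → ℝ} {L : ℕ}

theorem posC_fac {ι : Type} [Fintype ι] {a b : ι → ℝ} (ha : Function.Injective a) (hb : Function.Injective b)
    (ha0 : ∀ i, 0 < a i) (hb0 : ∀ i, 0 < b i) {T l : ℝ} (ht : StrictMono t)
    (h1 : ∀ k, 0 < t k + T) (h2 : ∀ k, 2 * (t k + T) < -L - l) :
    PosC t L (fun z => (∏ i, fac (a i) (b i) z) * E2 (-T) l z) := by
  have e := Fintype.equivFin ι
  have hm := posC_model (A := fun i => (a (e.symm i))⁻¹) (B := fun i => (b (e.symm i))⁻¹)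
    (fun i j h => e.symm.injective (ha (inv_injective h))) (fun i j h => e.symm.injective (hb (inv_injective h)))
    (fun i => inv_pos.mpr (ha0 _)) (fun i => inv_pos.mpr (hb0 _)) ht h1 h2
  have key : ∀ z, (∏ i, fac (a i) (b i) z) * E2 (-T) l z = (∏ i, ((b i : ℂ) / a i)) *
      (Rat (fun i => (a (e.symm i))⁻¹) (fun i => (b (e.symm i))⁻¹) z * E2 (-T) l z) := by
    intro z
    unfold Rat
    rw [← mul_assoc, ← Finset.prod_div_distrib, ← Equiv.prod_comp e]
    simp only [Equiv.symm_apply_apply]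
    rw [← Finset.prod_mul_distrib]
    congr 1
    refine Finset.prod_congr rfl fun i _ => ?_
    have h3 : (a i : ℂ) ≠ 0 := by exact_mod_cast (ha0 i).ne'
    have h4 : (b i : ℂ) ≠ 0 := by exact_mod_cast (hb0 i).ne'
    unfold fac
    push_cast
    rw [div_mul_div_comm, mul_add, mul_sub, mul_inv_cancel₀ h3, mul_inv_cancel₀ h4, add_comm]
  refine posC_smul hm (Finset.prod_ne_zero_iff.mpr fun i _ => ?_) (fun y => key _) (fun y => key _)
  exact div_ne_zero (by exact_mod_cast (hb0 i).ne') (by exact_mod_cast (ha0 i).ne')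

def exb (k : ℕ) (z : ℂ) : ℂ := ∏ i ∈ Finset.range (k ^ 3), fac 0 (1 / (k ^ 4 + i)) z

theorem exb_lim (z : ℂ) : Tendsto (fun k => exb k z) atTop (𝓝 1) := by
  have hs : ∀ k : ℕ, 0 < k → ∑ i ∈ Finset.range (k ^ 3), ‖((1 / (k ^ 4 + i) : ℝ) : ℂ) * z‖ ≤ ‖z‖ / k := by
    intro k hk
    have hk' : (0:ℝ) < k := by exact_mod_cast hk
    refine (Finset.sum_le_card_nsmul _ _ (1 / k ^ 4 * ‖z‖) fun i hi => ?_).trans (le_of_eq ?_)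
    · rw [norm_mul, Complex.norm_real, Real.norm_eq_abs, abs_of_nonneg (by positivity)]
      exact mul_le_mul_of_nonneg_right (one_div_le_one_div_of_le (by positivity) (by linarith [Nat.cast_nonneg (α := ℝ) i])) (norm_nonneg _)
    · rw [Finset.card_range, nsmul_eq_mul]; push_cast; field_simp
  rw [tendsto_iff_norm_sub_tendsto_zero]
  have h0 : Tendsto (fun k : ℕ => Real.exp (‖z‖ / k) - 1) atTop (𝓝 0) := by
    have := ((Real.continuous_exp.tendsto 0).comp (tendsto_const_div_atTop_nhds_zero_nat ‖z‖)).sub_const 1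
    simpa using this
  refine squeeze_zero' (Eventually.of_forall fun _ => norm_nonneg _) ?_ h0
  filter_upwards [eventually_gt_atTop 0] with k hk
  unfold exb fac
  simp only [ofReal_zero, zero_mul, sub_zero, div_one]
  refine (Finset.norm_prod_one_add_sub_one_le _ _).trans ?_
  have := Real.exp_le_exp.mpr (hs k hk)
  linarith

theorem exb_EB {k : ℕ} (hk : 0 < k) : EB (exb k) 1 := by
  have hk' : (1:ℝ) ≤ k := by exact_mod_cast hk
  refine (EB.prod (Finset.range (k ^ 3)) (K := fun i => 0 + 1 / (k ^ 4 + i)) fun i hi => EB_fac le_rfl (by positivity)).mono ?_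
  refine (Finset.sum_le_card_nsmul _ _ (1 / (k:ℝ) ^ 4) fun i hi => ?_).trans ?_
  · rw [zero_add]
    exact one_div_le_one_div_of_le (by positivity) (by linarith [Nat.cast_nonneg (α := ℝ) i])
  · rw [Finset.card_range, nsmul_eq_mul, mul_one_div, div_le_one (by positivity)]
    push_cast
    exact pow_le_pow_right₀ hk' (by norm_num)

theorem fin_EB {ι : Type} [Fintype ι] {a b : ι → ℝ} (ha : ∀ i, 0 ≤ a i) (hb : ∀ i, 0 ≤ b i) (c : ℝ) :
    EB (fun z => cexp (c * z) * ∏ i, fac (a i) (b i) z) (|c| + ∑ i, (a i + b i)) :=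
  (EB_exp c).mul (EB.prod _ fun i _ => EB_fac (ha i) (hb i))

theorem posC_inj {ι : Type} [Fintype ι] {a b : ι → ℝ} (ha : Function.Injective a) (hb : Function.Injective b)
    (ha0 : ∀ i, 0 < a i) (hb0 : ∀ i, 0 < b i) (ht : StrictMono t) (c : ℝ) :
    PosC t L (fun z => cexp (z ^ 3 / 3) * (cexp (c * z) * ∏ i, fac (a i) (b i) z)) := by
  have h0 : LimTo (fun k z => cub k z * (exb k z * (cexp (c * z) * ∏ i, fac (a i) (b i) z)))
      (fun z => cexp (z ^ 3 / 3) * (cexp (c * z) * ∏ i, fac (a i) (b i) z)) := by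
    refine cub_limTo.mulEB (K := 1 + (|c| + ∑ i, (a i + b i))) ?_ (fun y => ?_) (fun y => ?_)
    · filter_upwards [eventually_gt_atTop 0] with k hk
      exact (exb_EB hk).mul (fin_EB (fun i => (ha0 i).le) (fun i => (hb0 i).le) c)
    · simpa using (exb_lim (gammaP (-1) y)).mul_const _
    · simp only [mul_inv]
      simpa using ((exb_lim (gammaM 1 y)).inv₀ one_ne_zero).mul_const _
  refine h0.posC ?_
  obtain ⟨R, hR⟩ : ∃ R : ℝ, ∀ k, |t k| ≤ R := by
    obtain ⟨R, hR⟩ := (Set.finite_range fun k => |t k|).bddAbove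
    exact ⟨R, fun k => hR ⟨k, rfl⟩⟩
  have v : Tendsto (fun k : ℕ => 1 / (k:ℝ)) atTop (𝓝 0) := tendsto_one_div_atTop_nhds_zero_nat
  filter_upwards [eventually_ge_atTop 4, eventually_all.mpr fun i => v.eventually_lt_const (ha0 i),
    eventually_all.mpr fun i => v.eventually_lt_const (hb0 i), eventually_gt_atTop ⌈8 * R⌉₊,
    eventually_gt_atTop ⌈2 * R + L + c⌉₊] with k hk4 ka kb kR kC
  have hk : 0 < k := by lia
  have hk' : (4:ℝ) ≤ k := by exact_mod_cast hk4
  have kR' := Nat.lt_of_ceil_lt kR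
  have kC' := Nat.lt_of_ceil_lt kC
  have s2 := ep_sum hk 2
  have s1 := ep_sum hk 1
  have hT1 : (k:ℝ) / 4 ≤ ∑ i ∈ Finset.range (k ^ 3), ep k i ^ 2 := by
    refine le_trans ?_ s2.1
    rw [div_pow, one_pow, mul_one_div, div_le_div_iff₀ (by norm_num) (by positivity)]
    nlinarith [mul_pos (show (0:ℝ) < k by linarith) (show (0:ℝ) < k by linarith), sq_nonneg ((k:ℝ) - 1),
      mul_nonneg (show (0:ℝ) ≤ k by linarith) (show (0:ℝ) ≤ (k - 1) * (3 * k + 1) by nlinarith)]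
  have hT2 : ∑ i ∈ Finset.range (k ^ 3), ep k i ^ 2 ≤ k := s2.2.trans (le_of_eq (by field_simp))
  have hl : (k:ℝ) ^ 2 / 2 ≤ ∑ i ∈ Finset.range (k ^ 3), ep k i := by
    simp only [pow_one] at s1
    refine le_trans ?_ s1.1
    rw [mul_one_div, div_le_div_iff₀ (by norm_num) (by positivity)]
    nlinarith [mul_nonneg (sq_nonneg (k:ℝ)) (show (0:ℝ) ≤ k - 1 by linarith)]
  have epos : ∀ i : Fin (k ^ 3), 0 < ep k i := fun i => lt_of_lt_of_le (by positivity) (ep_bd hk i.2).1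
  have bpos : ∀ i : Fin (k ^ 3), (0:ℝ) < 1 / (k ^ 4 + (i:ℕ)) := fun i => by positivity
  have ble : ∀ i : Fin (k ^ 3), (1 / (k ^ 4 + (i:ℕ)) : ℝ) ≤ 1 / k := fun i => by
    refine one_div_le_one_div_of_le (by positivity) ?_
    have : (k:ℝ) ^ 1 ≤ k ^ 4 := pow_le_pow_right₀ (by linarith) (by norm_num)
    rw [pow_one] at this
    linarith [Nat.cast_nonneg (α := ℝ) (i:ℕ)]
  have hinj : ∀ {f : ι → ℝ} {g : Fin (k ^ 3) → ℝ}, Function.Injective f → Function.Injective g →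
      (∀ i, 1 / (k:ℝ) < f i) → (∀ i, g i ≤ 1 / k) → Function.Injective (Sum.elim f g) := fun hf hg h1 h2 =>
    Function.Injective.sumElim hf hg fun i j => ((h2 j).trans_lt (h1 i)).ne'
  have key := posC_fac (ι := ι ⊕ Fin (k ^ 3)) (a := Sum.elim a fun i => ep k i) (b := Sum.elim b fun i => 1 / (k ^ 4 + (i:ℕ)))
    (T := (∑ i ∈ Finset.range (k ^ 3), ep k i ^ 2) / 2) (l := c - ∑ i ∈ Finset.range (k ^ 3), ep k i) (L := L)
    (hinj ha (fun i j h => Fin.ext (by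
      have h3 : (k:ℝ) ^ 3 ≠ 0 := by positivity
      simp only [ep] at h
      rw [one_div, one_div] at h
      exact_mod_cast (div_left_inj' h3).mp (add_left_cancel (inv_injective h)))) ka fun i => (ep_bd hk i.2).2)
    (hinj hb (fun i j h => Fin.ext (by
      simp only [one_div] at h
      exact_mod_cast (add_left_cancel (inv_injective h)))) kb ble)
    (by rintro (i | i); exacts [ha0 i, epos i]) (by rintro (i | i); exacts [hb0 i, bpos i]) ht
    (fun j => by have := abs_le.mp (hR j); linarith)
    (fun j => by have := abs_le.mp (hR j); nlinarith)
  have e : ∀ z, cub k z * (exb k z * (cexp (c * z) * ∏ i, fac (a i) (b i) z)) = 1 *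
      ((∏ i, fac (Sum.elim a (fun i : Fin (k ^ 3) => ep k i) i) (Sum.elim b (fun i : Fin (k ^ 3) => 1 / (k ^ 4 + (i:ℕ))) i) z) *
      E2 (-((∑ i ∈ Finset.range (k ^ 3), ep k i ^ 2) / 2)) (c - ∑ i ∈ Finset.range (k ^ 3), ep k i) z) := by
    intro z
    rw [Fintype.prod_sum_type]
    simp only [Sum.elim_inl, Sum.elim_inr]
    rw [Fin.prod_univ_eq_prod_range (fun i => fac (ep k i) (1 / (k ^ 4 + (i:ℕ))) z) (k ^ 3), one_mul]
    have h5 : cub k z * exb k z = (∏ i ∈ Finset.range (k ^ 3), fac (ep k i) (1 / (k ^ 4 + (i:ℕ))) z) *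
        cexp (∑ i ∈ Finset.range (k ^ 3), (-(ep k i * z) - ep k i ^ 2 * z ^ 2 / 2)) := by
      unfold cub exb
      rw [Complex.exp_sum, ← Finset.prod_mul_distrib, ← Finset.prod_mul_distrib]
      refine Finset.prod_congr rfl fun i _ => ?_
      unfold cubF fac
      simp only [ofReal_zero, zero_mul, sub_zero, div_one]
      ring
    rw [← mul_assoc, h5]
    have h6 : E2 (-((∑ i ∈ Finset.range (k ^ 3), ep k i ^ 2) / 2)) (c - ∑ i ∈ Finset.range (k ^ 3), ep k i) z =
        cexp (∑ i ∈ Finset.range (k ^ 3), (-(ep k i * z) - ep k i ^ 2 * z ^ 2 / 2)) * cexp (c * z) := by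
      unfold E2
      rw [← Complex.exp_add, Finset.sum_sub_distrib, Finset.sum_neg_distrib, ← Finset.sum_mul, ← Finset.sum_div, ← Finset.sum_mul]
      push_cast
      congr 1; ring
    rw [h6]; ring
  exact posC_smul key one_ne_zero (fun y => e _) (fun y => e _)

end AW
namespace AW
variable {m : ℕ} {t : Fin (m+1) → ℝ} {L : ℕ}

theorem cub_const : LimTo (fun _ => fun z => cexp (z ^ 3 / 3)) (fun z => cexp (z ^ 3 / 3)) := cub_limTo.const

theorem gP_den_ne {a : ℝ} (ha : 0 ≤ a) (y : ℝ) : 1 - a * gammaP (-1) y ≠ 0 := fun h => by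
  have := gP_inv_bd ha y
  rw [h, norm_zero] at this
  exact absurd this (not_le.mpr (Real.exp_pos _))
theorem gP_den_ne' {a : ℝ} (ha : 0 ≤ a) (y : ℝ) : 1 - a / gammaP (-1) y ≠ 0 := fun h => by
  have h1 := gP_norm_ge y a ha
  have : gammaP (-1) y - a = 0 := by
    have := congrArg (· * gammaP (-1) y) h
    simpa [sub_mul, div_mul_cancel₀ _ (gP_ne_zero y)] using this
  rw [this, norm_zero] at h1
  linarith

theorem fac_lim {a b : ℝ} {an bn : ℕ → ℝ} (ha0 : 0 ≤ a) (ha : Tendsto an atTop (𝓝 a)) (hb : Tendsto bn atTop (𝓝 b)) (y : ℝ) :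
    Tendsto (fun n => fac (an n) (bn n) (gammaP (-1) y)) atTop (𝓝 (fac a b (gammaP (-1) y))) := by
  have ha' := (Complex.continuous_ofReal.tendsto a).comp ha
  have hb' := (Complex.continuous_ofReal.tendsto b).comp hb
  exact ((hb'.mul_const _).const_add 1).div ((ha'.mul_const _).const_sub 1) (gP_den_ne ha0 y)
theorem fam_lim {a b : ℝ} {an bn : ℕ → ℝ} (ha0 : 0 ≤ a) (ha : Tendsto an atTop (𝓝 a)) (hb : Tendsto bn atTop (𝓝 b)) (y : ℝ) :
    Tendsto (fun n => fam (an n) (bn n) (gammaP (-1) y)) atTop (𝓝 (fam a b (gammaP (-1) y))) := by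
  have ha' := (Complex.continuous_ofReal.tendsto a).comp ha
  have hb' := (Complex.continuous_ofReal.tendsto b).comp hb
  exact ((hb'.div_const _).const_add 1).div ((ha'.div_const _).const_sub 1) (gP_den_ne' ha0 y)

theorem pert_inj {ι : Type} [Fintype ι] (a : ι → ℝ) (e : ι ≃ Fin (Fintype.card ι)) :
    ∀ᶠ n : ℕ in atTop, Function.Injective fun i => a i + ((e i : ℕ) + 1) * (1 / ((n:ℝ) + 1)) := by
  have h : ∀ i j : ι, ∀ᶠ n : ℕ in atTop, a i + ((e i : ℕ) + 1) * (1 / ((n:ℝ) + 1)) = a j + ((e j : ℕ) + 1) * (1 / ((n:ℝ) + 1)) → i = j := by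
    intro i j
    by_cases hij : a i = a j
    · refine Eventually.of_forall fun n hn => e.injective (Fin.ext ?_)
      have hn0 : (1 / ((n:ℝ) + 1)) ≠ 0 := by positivity
      rw [hij] at hn
      have := mul_right_cancel₀ hn0 (add_left_cancel hn)
      exact_mod_cast add_right_cancel this
    · have l : ∀ i, Tendsto (fun n : ℕ => a i + ((e i : ℕ) + 1) * (1 / ((n:ℝ) + 1))) atTop (𝓝 (a i)) := fun i => by
        simpa using ((tendsto_one_div_add_atTop_nhds_zero_nat (𝕜 := ℝ)).const_mul (((e i : ℕ) : ℝ) + 1)).const_add (a i)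
      filter_upwards [((l i).sub (l j)).eventually_ne (sub_ne_zero.mpr hij)] with n hn h
      exact absurd (sub_eq_zero.mpr h) hn
  filter_upwards [eventually_all.mpr fun i => eventually_all.mpr (h i)] with n hn i j hij
  exact hn i j hij

theorem posC_fin {ι : Type} [Fintype ι] {a b : ι → ℝ} (ha0 : ∀ i, 0 ≤ a i) (hb0 : ∀ i, 0 ≤ b i) (ht : StrictMono t) (c : ℝ) :
    PosC t L (fun z => cexp (z ^ 3 / 3) * (cexp (c * z) * ∏ i, fac (a i) (b i) z)) := by
  have e := Fintype.equivFin ι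
  have l : ∀ (a : ι → ℝ) i, Tendsto (fun n : ℕ => a i + ((e i : ℕ) + 1) * (1 / ((n:ℝ) + 1))) atTop (𝓝 (a i)) := fun a i => by
    simpa using ((tendsto_one_div_add_atTop_nhds_zero_nat (𝕜 := ℝ)).const_mul (((e i : ℕ) : ℝ) + 1)).const_add (a i)
  have hp : ∀ {a : ι → ℝ}, (∀ i, 0 ≤ a i) → ∀ (n : ℕ) i, 0 < a i + ((e i : ℕ) + 1) * (1 / ((n:ℝ) + 1)) := fun h n i =>
    add_pos_of_nonneg_of_pos (h i) (by positivity)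
  have h0 := cub_const.mulEB (K := |c| + ∑ i, (a i + b i) + 1) (Q := fun z => cexp (c * z) * ∏ i, fac (a i) (b i) z)
    (Qn := fun n z => cexp (c * z) * ∏ i, fac (a i + ((e i : ℕ) + 1) * (1 / ((n:ℝ) + 1))) (b i + ((e i : ℕ) + 1) * (1 / ((n:ℝ) + 1))) z)
    ?_ (fun y => ?_) (fun y => ?_)
  · refine h0.posC ?_
    filter_upwards [pert_inj a e, pert_inj b e] with n h1 h2
    exact posC_inj h1 h2 (hp ha0 n) (hp hb0 n) ht c
  · have s := (tendsto_finsetSum Finset.univ fun i _ => (l a i).add (l b i)).const_add |c|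
    filter_upwards [s.eventually_le_const (lt_add_one _)] with n hn
    exact (fin_EB (fun i => (hp ha0 n i).le) (fun i => (hp hb0 n i).le) c).mono hn
  · exact (tendsto_finsetProd _ fun i _ => fac_lim (ha0 i) (l a i) (l b i) y).const_mul _
  · simp only [gM_neg, mul_inv, ← Finset.prod_inv_distrib, fac_neg]
    exact (tendsto_finsetProd _ fun i _ => fac_lim (hb0 i) (l b i) (l a i) _).const_mul _

theorem posC_fam {ι κ : Type} [Fintype ι] [Fintype κ] {a b : ι → ℝ} {a' b' : κ → ℝ} (ha0 : ∀ i, 0 ≤ a i) (hb0 : ∀ i, 0 ≤ b i)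
    (ha1 : ∀ i, 0 ≤ a' i) (hb1 : ∀ i, 0 ≤ b' i) (ht : StrictMono t) (c : ℝ) :
    PosC t L (fun z => cexp (z ^ 3 / 3) * ((cexp (c * z) * ∏ i, fac (a i) (b i) z) * ∏ i, fam (a' i) (b' i) z)) := by
  have l : ∀ (a : κ → ℝ) i, Tendsto (fun n : ℕ => a i + 1 / ((n:ℝ) + 1)) atTop (𝓝 (a i)) := fun a i => by
    simpa using (tendsto_one_div_add_atTop_nhds_zero_nat (𝕜 := ℝ)).const_add (a i)
  have hp : ∀ {a : κ → ℝ}, (∀ i, 0 ≤ a i) → ∀ (n : ℕ) i, 0 < a i + 1 / ((n:ℝ) + 1) := fun h n i =>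
    add_pos_of_nonneg_of_pos (h i) (by positivity)
  have h0 := cub_const.mulEB (K := |c| + ∑ i, (a i + b i) + (∑ i, 2 * (a' i + b' i) + 1))
    (Q := fun z => (cexp (c * z) * ∏ i, fac (a i) (b i) z) * ∏ i, fam (a' i) (b' i) z)
    (Qn := fun n z => (cexp (c * z) * ∏ i, fac (a i) (b i) z) * ∏ i, fam (a' i + 1 / ((n:ℝ) + 1)) (b' i + 1 / ((n:ℝ) + 1)) z)
    ?_ (fun y => ?_) (fun y => ?_)
  · refine h0.posC (Eventually.of_forall fun n => ?_)
    have h1 := posC_fin (L := L) (ι := ι ⊕ κ) (a := Sum.elim a fun i => (a' i + 1 / ((n:ℝ) + 1))⁻¹)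
      (b := Sum.elim b fun i => (b' i + 1 / ((n:ℝ) + 1))⁻¹)
      (by rintro (i | i); exacts [ha0 i, inv_nonneg.mpr (hp ha1 n i).le])
      (by rintro (i | i); exacts [hb0 i, inv_nonneg.mpr (hp hb1 n i).le]) ht c
    have e : ∀ z : ℂ, z ≠ 0 → cexp (z ^ 3 / 3) * ((cexp (c * z) * ∏ i, fac (a i) (b i) z) * ∏ i, fam (a' i + 1 / ((n:ℝ) + 1)) (b' i + 1 / ((n:ℝ) + 1)) z)
        = (∏ i, (-((b' i + 1 / ((n:ℝ) + 1) : ℝ):ℂ) / ((a' i + 1 / ((n:ℝ) + 1) : ℝ):ℂ))) * (cexp (z ^ 3 / 3) * (cexp (c * z) * ∏ i, fac (Sum.elim a (fun i => (a' i + 1 / ((n:ℝ) + 1))⁻¹) i)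
          (Sum.elim b (fun i => (b' i + 1 / ((n:ℝ) + 1))⁻¹) i) z)) := by
      intro z hz
      rw [Fintype.prod_sum_type]
      simp only [Sum.elim_inl, Sum.elim_inr]
      have : ∏ i, fam (a' i + 1 / ((n:ℝ) + 1)) (b' i + 1 / ((n:ℝ) + 1)) z = (∏ i, (-((b' i + 1 / ((n:ℝ) + 1) : ℝ):ℂ) / ((a' i + 1 / ((n:ℝ) + 1) : ℝ):ℂ)))
          * ∏ i, fac (a' i + 1 / ((n:ℝ) + 1))⁻¹ (b' i + 1 / ((n:ℝ) + 1))⁻¹ z := by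
        rw [← Finset.prod_mul_distrib]
        refine Finset.prod_congr rfl fun i _ => ?_
        have g1 : ((a' i + 1 / ((n:ℝ) + 1) : ℝ):ℂ) ≠ 0 := by exact_mod_cast (hp ha1 n i).ne'
        have g2 : ((b' i + 1 / ((n:ℝ) + 1) : ℝ):ℂ) ≠ 0 := by exact_mod_cast (hp hb1 n i).ne'
        unfold fam fac
        rw [ofReal_inv, ofReal_inv]
        generalize ((a' i + 1 / ((n:ℝ) + 1) : ℝ):ℂ) = A at *
        generalize ((b' i + 1 / ((n:ℝ) + 1) : ℝ):ℂ) = B at *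
        rw [show 1 + B / z = (z + B) / z by field_simp, show 1 - A / z = (z - A) / z by field_simp,
          div_div_div_cancel_right₀ hz, div_mul_div_comm, show -B * (1 + B⁻¹ * z) = -(z + B) by field_simp; ring,
          show A * (1 - A⁻¹ * z) = -(z - A) by field_simp; ring, neg_div_neg_eq]
      rw [this]; ring
    refine posC_smul h1 (Finset.prod_ne_zero_iff.mpr fun i _ => ?_) (fun y => e _ (gP_ne_zero y))
      (fun y => e _ (by rw [gM_neg, neg_ne_zero]; exact gP_ne_zero _))
    exact div_ne_zero (neg_ne_zero.mpr (by exact_mod_cast (hp hb1 n i).ne')) (by exact_mod_cast (hp ha1 n i).ne')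
  · have s := tendsto_finsetSum Finset.univ fun i _ => ((l a' i).add (l b' i)).const_mul 2
    filter_upwards [s.eventually_le_const (lt_add_one _)] with n hn
    exact ((fin_EB ha0 hb0 c).mul (EB.prod _ fun i _ => EB_fam (hp ha1 n i).le (hp hb1 n i).le)).mono (add_le_add_right hn _)
  · exact (tendsto_finsetProd _ fun i _ => fam_lim (ha1 i) (l a' i) (l b' i) y).const_mul _
  · simp only [gM_neg, mul_inv, ← Finset.prod_inv_distrib, fam_neg]
    exact (tendsto_finsetProd _ fun i _ => fam_lim (hb1 i) (l b' i) (l a' i) _).const_mul _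

end AW
namespace AW
variable {m : ℕ} {t : Fin (m+1) → ℝ} {L : ℕ}

theorem fam_eq (a b : ℝ) (z : ℂ) : fam a b z = fac a b z⁻¹ := by
  unfold fam fac; rw [div_eq_mul_inv (b:ℂ), div_eq_mul_inv (a:ℂ)]

theorem fac_mult {a b : ℕ → ℝ} (ha : Summable a) (hb : Summable b) (z : ℂ) : Multipliable fun i => fac (a i) (b i) z := by
  have h : Summable fun i => fac (a i) (b i) z - 1 := by
    refine Summable.of_norm_bounded_eventually_nat (g := fun i => 2 * (‖((a i : ℝ):ℂ) * z‖ + ‖((b i : ℝ):ℂ) * z‖)) ?_ ?_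
    · simp only [norm_mul, Complex.norm_real]
      exact ((ha.norm.mul_right _).add (hb.norm.mul_right _)).mul_left 2
    · have h0 : Tendsto (fun i => ‖((a i : ℝ):ℂ) * z‖) atTop (𝓝 0) := by
        have := (((Complex.continuous_ofReal.tendsto 0).comp ha.tendsto_atTop_zero).mul_const z).norm
        simpa using this
      filter_upwards [h0.eventually_le_const (show (0:ℝ) < 1/2 by norm_num)] with i hi
      have h1 : 1 / 2 ≤ ‖1 - (a i : ℂ) * z‖ := by
        have := norm_sub_norm_le (1:ℂ) (a i * z)
        rw [norm_one] at this; linarith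
      have h2 : 1 - (a i : ℂ) * z ≠ 0 := fun h => by rw [h, norm_zero] at h1; norm_num at h1
      unfold fac
      rw [div_sub_one h2, norm_div, div_le_iff₀ (by linarith), show 1 + (b i:ℂ) * z - (1 - a i * z) = a i * z + b i * z by ring]
      refine (norm_add_le _ _).trans ?_
      nlinarith [norm_nonneg ((a i : ℂ) * z), norm_nonneg ((b i : ℂ) * z)]
  have := multipliable_one_add_of_summable h.norm
  simpa only [add_sub_cancel] using this

theorem prod_inv_lim {f : ℕ → ℂ} {p p' : ℂ} (h : Tendsto (fun n => ∏ i ∈ Finset.range n, f i) atTop (𝓝 p))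
    (h' : Tendsto (fun n => ∏ i ∈ Finset.range n, (f i)⁻¹) atTop (𝓝 p')) : p' = p⁻¹ := by
  by_cases h0 : ∀ i, f i ≠ 0
  · have h1 := h.mul h'
    simp only [← Finset.prod_mul_distrib, mul_inv_cancel₀ (h0 _), Finset.prod_const_one] at h1
    exact eq_inv_of_mul_eq_one_right (tendsto_nhds_unique h1 tendsto_const_nhds)
  · push Not at h0
    obtain ⟨i, hi⟩ := h0
    have e : ∀ {g : ℕ → ℂ} {q : ℂ}, g i = 0 → Tendsto (fun n => ∏ i ∈ Finset.range n, g i) atTop (𝓝 q) → q = 0 := by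
      intro g q hg hq
      refine tendsto_nhds_unique hq (tendsto_const_nhds.congr' ?_)
      filter_upwards [eventually_gt_atTop i] with n hn
      exact (Finset.prod_eq_zero (Finset.mem_range.mpr hn) hg).symm
    rw [e hi h, e (by rw [hi, inv_zero]) h', inv_zero]

def Ps (P : AWParams) (n : ℕ) (z : ℂ) : ℂ :=
  (cexp (P.cp * z) * ∏ i : Fin n, fac (P.ap i) (P.bp i) z) *
    ∏ i : Fin n ⊕ Fin n, fam (Sum.elim (fun i : Fin n => P.am i) (fun _ : Fin n => 0) i) (Sum.elim (fun i : Fin n => P.bm i) (fun _ : Fin n => P.cm / n) i) z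

theorem Ps_eq (P : AWParams) (n : ℕ) (z : ℂ) : Ps P n z = cexp (P.cp * z) * (1 + P.cm / z / n) ^ n *
    ∏ i ∈ Finset.range n, (fac (P.ap i) (P.bp i) z * fam (P.am i) (P.bm i) z) := by
  unfold Ps
  rw [Fintype.prod_sum_type]
  simp only [Sum.elim_inl, Sum.elim_inr]
  rw [Fin.prod_univ_eq_prod_range (fun i => fac (P.ap i) (P.bp i) z), Fin.prod_univ_eq_prod_range (fun i => fam (P.am i) (P.bm i) z),
    Finset.prod_mul_distrib, Finset.prod_const, Finset.card_univ, Fintype.card_fin,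
    show fam 0 (P.cm / n) z = 1 + P.cm / z / n by unfold fam; push_cast; rw [zero_div, sub_zero, div_one, div_right_comm]]
  ring

theorem P_sum (P : AWParams) : Summable P.ap ∧ Summable P.am ∧ Summable P.bp ∧ Summable P.bm := by
  refine ⟨?_, ?_, ?_, ?_⟩ <;> refine Summable.of_nonneg_of_le ?_ (fun i => ?_) P.sum_fin
  any_goals first | exact P.ap_nonneg | exact P.am_nonneg | exact P.bp_nonneg | exact P.bm_nonneg
  all_goals linarith [P.ap_nonneg i, P.am_nonneg i, P.bp_nonneg i, P.bm_nonneg i]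

theorem pp_lim {a b a' b' : ℕ → ℝ} (ha : Summable a) (hb : Summable b) (ha' : Summable a') (hb' : Summable b') (z : ℂ) :
    Tendsto (fun n => ∏ i ∈ Finset.range n, (fac (a i) (b i) z * fam (a' i) (b' i) z)) atTop
      (𝓝 (∏' i, (fac (a i) (b i) z * fam (a' i) (b' i) z))) := by
  have h2 := fac_mult ha' hb' z⁻¹
  simp only [← fam_eq] at h2
  exact ((fac_mult ha hb z).mul h2).hasProd.tendsto_prod_nat

theorem Phi_eq (P : AWParams) (z : ℂ) : P.Phi z = cexp (P.cp * z) * cexp (P.cm / z) *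
    ∏' i, (fac (P.ap i) (P.bp i) z * fam (P.am i) (P.bm i) z) := by
  unfold AWParams.Phi fac fam
  rw [Complex.exp_add]
  simp only [div_mul_div_comm]

theorem Ps_lim (P : AWParams) (z : ℂ) : Tendsto (fun n => Ps P n z) atTop (𝓝 (P.Phi z)) := by
  obtain ⟨h1, h2, h3, h4⟩ := P_sum P
  simp only [Ps_eq, Phi_eq]
  exact ((Complex.tendsto_one_add_div_pow_exp _).const_mul _).mul (pp_lim h1 h3 h2 h4 z)

theorem Ps_lim_inv (P : AWParams) (z : ℂ) : Tendsto (fun n => (Ps P n (-z))⁻¹) atTop (𝓝 (P.Phi (-z))⁻¹) := by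
  obtain ⟨h1, h2, h3, h4⟩ := P_sum P
  have hi := pp_lim h3 h1 h4 h2 z
  have e : ∀ i, fac (P.bp i) (P.ap i) z * fam (P.bm i) (P.am i) z = (fac (P.ap i) (P.bp i) (-z) * fam (P.am i) (P.bm i) (-z))⁻¹ := by
    intro i; rw [mul_inv, fac_neg, fam_neg]
  simp only [e] at hi
  have hf := pp_lim h1 h3 h2 h4 (-z)
  rw [prod_inv_lim hf hi] at hi
  simp only [Ps_eq, Phi_eq, mul_inv, ← Finset.prod_inv_distrib] at hi ⊢
  exact (((Complex.tendsto_one_add_div_pow_exp _).inv₀ (Complex.exp_ne_zero _)).const_mul _).mul hi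

theorem Ps_EB (P : AWParams) : ∃ K, ∀ n, EB (Ps P n) K := by
  obtain ⟨h1, h2, h3, h4⟩ := P_sum P
  refine ⟨|P.cp| + ∑' i, (P.ap i + P.bp i) + (∑' i, 2 * (P.am i + P.bm i) + 2 * P.cm), fun n => ?_⟩
  refine ((fin_EB (fun i => P.ap_nonneg _) (fun i => P.bp_nonneg _) P.cp).mul (EB.prod Finset.univ fun i _ => EB_fam (a := Sum.elim (fun i : Fin n => P.am i) (fun _ : Fin n => 0) i) (b := Sum.elim (fun i : Fin n => P.bm i) (fun _ : Fin n => P.cm / n) i) ?_ ?_)).mono ?_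
  · rcases i with i | i
    exacts [P.am_nonneg _, le_rfl]
  · rcases i with i | i
    exacts [P.bm_nonneg _, div_nonneg P.cm_nonneg (Nat.cast_nonneg _)]
  · rw [Fintype.sum_sum_type]
    simp only [Sum.elim_inl, Sum.elim_inr]
    rw [Fin.sum_univ_eq_sum_range (fun i => P.ap i + P.bp i), Fin.sum_univ_eq_sum_range (fun i => 2 * (P.am i + P.bm i)),
      Finset.sum_const, Finset.card_univ, Fintype.card_fin, nsmul_eq_mul]
    refine add_le_add (add_le_add_right ((h1.add h3).sum_le_tsum _ fun i _ => add_nonneg (P.ap_nonneg i) (P.bp_nonneg i)) _)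
      (add_le_add (((h2.add h4).mul_left 2).sum_le_tsum _ fun i _ => mul_nonneg zero_le_two (add_nonneg (P.am_nonneg i) (P.bm_nonneg i))) ?_)
    rcases Nat.eq_zero_or_pos n with rfl | hn
    · simpa using P.cm_nonneg
    · have : (n:ℝ) ≠ 0 := by positivity
      refine le_of_eq ?_
      field_simp
      ring

def Psi (P : AWParams) (z : ℂ) : ℂ := cexp (z ^ 3 / 3) * P.Phi z

theorem Psi_limTo (P : AWParams) : LimTo (fun n z => cexp (z ^ 3 / 3) * Ps P n z) (Psi P) := by
  obtain ⟨K, hK⟩ := Ps_EB P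
  refine cub_const.mulEB (Eventually.of_forall hK) (fun y => Ps_lim P _) (fun y => ?_)
  simp only [gM_neg]
  exact Ps_lim_inv P _

theorem Psi_posC (P : AWParams) (ht : StrictMono t) : PosC t L (Psi P) := by
  refine (Psi_limTo P).posC (Eventually.of_forall fun n => ?_)
  refine posC_fam (fun i => P.ap_nonneg _) (fun i => P.bp_nonneg _) ?_ ?_ ht P.cp
  · rintro (i | i)
    exacts [P.am_nonneg _, le_rfl]
  · rintro (i | i)
    exacts [P.bm_nonneg _, div_nonneg P.cm_nonneg (Nat.cast_nonneg _)]

end AW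
namespace AW

theorem K3_g (P : AWParams) (t₁ x₁ t₂ x₂ : ℝ) (p : ℝ × ℝ) :
    K3param P (-t₁ - 1) (-t₂ + 1) t₁ x₁ t₂ x₂ p.1 p.2 = cexp ((x₁ * t₁ - t₁ ^ 3 / 3 : ℝ) - (x₂ * t₂ - t₂ ^ 3 / 3 : ℝ)) *
      kcore (fun y => E2 (-t₁) (-(x₁ - t₁ ^ 2)) (gammaP (-1) y) * Psi P (gammaP (-1) y))
        (fun y => E2 t₂ (x₂ - t₂ ^ 2) (gammaM 1 y) / Psi P (gammaM 1 y)) p := by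
  have h1 : gammaP (-t₁ - 1) p.1 = gammaP (-1) p.1 - t₁ := by unfold gammaP; push_cast; ring
  have h2 : gammaM (-t₂ + 1) p.2 = gammaM 1 p.2 - t₂ := by unfold gammaM; push_cast; ring
  unfold K3param K3Integrand kcore Psi E2
  rw [h1, h2]
  dsimp only
  generalize gammaP (-1) p.1 = z
  generalize gammaM 1 p.2 = w
  rw [sub_add_cancel, sub_add_cancel, sub_sub z, sub_add_cancel,
    show (z - t₁) ^ 3 / 3 - x₁ * (z - t₁) - (w - t₂) ^ 3 / 3 + x₂ * (w - t₂) =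
      ((x₁ * t₁ - t₁ ^ 3 / 3 : ℝ) - (x₂ * t₂ - t₂ ^ 3 / 3 : ℝ)) + (((-t₁ : ℝ) * z ^ 2 + (-(x₁ - t₁ ^ 2) : ℝ) * z) + z ^ 3 / 3 + (((t₂ : ℝ) * w ^ 2 + (x₂ - t₂ ^ 2 : ℝ) * w) - w ^ 3 / 3)) by
        push_cast; ring, Complex.exp_add, Complex.exp_add, Complex.exp_add, Complex.exp_sub (_ + _)]
  ring

theorem Kabc_g (P : AWParams) (t₁ x₁ t₂ x₂ : ℝ) :
    Kabc P t₁ x₁ t₂ x₂ = cexp ((x₁ * t₁ - t₁ ^ 3 / 3 : ℝ) - (x₂ * t₂ - t₂ ^ 3 / 3 : ℝ)) *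
      kap (Psi P) t₁ (x₁ - t₁ ^ 2) t₂ (x₂ - t₂ ^ 2) := by
  unfold Kabc KabcAt kap
  rw [mul_add, mul_add, add_comm (K1 _ _ _ _ _ _)]
  congr 1; congr 1
  · unfold K2
    split_ifs with h
    · have h' : t₂ - t₁ ≠ 0 := by linarith
      rw [hk, show -(x₂ - x₁) ^ 2 / (4 * (t₂ - t₁)) - (t₂ - t₁) * (x₂ + x₁) / 2 + (t₂ - t₁) ^ 3 / 12 =
        ((x₁ * t₁ - t₁ ^ 3 / 3) - (x₂ * t₂ - t₂ ^ 3 / 3)) + -(x₂ - t₂ ^ 2 - (x₁ - t₁ ^ 2)) ^ 2 / (4 * (t₂ - t₁)) by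
          field_simp; ring, Complex.ofReal_add, Complex.exp_add, Complex.ofReal_mul, Complex.ofReal_exp, Complex.ofReal_sub]
      ring
    · rw [mul_zero]
  · unfold K1
    rw [if_pos (by linarith), mul_left_comm]
    congr 1
    rw [← intervalIntegral.integral_const_mul]
    rw [show (-t₂ + 1 + t₂ - (-t₁ - 1 + t₁)) / 2 = 1 by ring]
    refine intervalIntegral.integral_congr fun (s : ℝ) _ => ?_
    have e : K1seg (-t₁ - 1) (-t₂ + 1) t₁ t₂ s = s * I := by
      unfold K1seg; rw [show -t₁ - 1 + t₁ + (-t₂ + 1) + t₂ = 0 by ring]; simp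
    simp only [e, E2]
    rw [← mul_assoc (cexp _), ← Complex.exp_add]
    congr 2
    push_cast; ring
  · unfold K3
    rw [mul_left_comm]
    congr 1
    rw [← MeasureTheory.integral_const_mul]
    exact integral_congr_ae (Eventually.of_forall fun p => K3_g P t₁ x₁ t₂ x₂ p)

theorem det_g {ι : Type} [Fintype ι] [DecidableEq ι] (g : ι → ℂ) (A : Matrix ι ι ℂ) :
    Matrix.det (Matrix.of fun i j => cexp (g i - g j) * A i j) = A.det := by
  have : Matrix.of (fun i j => cexp (g i - g j) * A i j) =
      Matrix.diagonal (fun i => cexp (g i)) * A * Matrix.diagonal (fun i => cexp (-g i)) := by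
    ext i j
    rw [Matrix.mul_diagonal, Matrix.diagonal_mul, Matrix.of_apply, sub_eq_add_neg, Complex.exp_add]; ring
  rw [this, Matrix.det_mul, Matrix.det_mul, mul_right_comm, ← Matrix.det_mul, Matrix.diagonal_mul_diagonal]
  simp [← Complex.exp_add]

end AW
namespace AW
variable {m : ℕ} {s : Fin (m+1) → ℝ}

def phi (s : Fin (m+1) → ℝ) (p : Fin (m+1) × ℝ) : ℝ × ℝ := (s p.1, p.2 + s p.1 ^ 2)

theorem phi_ms : Measurable (phi s) := by
  have h : Measurable fun p : Fin (m+1) × ℝ => s p.1 := (measurable_of_countable s).comp measurable_fst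
  exact h.prodMk (measurable_snd.add (h.pow_const 2))

theorem phi_inj (hs : StrictMono s) : Function.Injective (phi s) := by
  rintro ⟨i, x⟩ ⟨j, y⟩ h
  simp only [phi, Prod.mk.injEq] at h
  obtain rfl := hs.injective h.1
  simpa using h.2

theorem phi_mp : MeasurePreserving (phi s) (muW m) ((muA s).prod volume) := by
  refine ⟨phi_ms, Measure.ext fun S hS => ?_⟩
  rw [Measure.map_apply phi_ms hS, muW, Measure.prod_apply (phi_ms hS), Measure.prod_apply hS, muA,
    MeasureTheory.lintegral_sum_measure, MeasureTheory.lintegral_count]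
  refine tsum_congr fun k => ?_
  rw [MeasureTheory.lintegral_dirac, ← measure_preimage_add_right volume (s k ^ 2) (Prod.mk (s k) ⁻¹' S)]
  rfl

theorem phi_win {B : Set (ℝ × ℝ)} (hB : Bornology.IsBounded B) : ∃ L, phi s ⁻¹' B ⊆ Win m L := by
  obtain ⟨R, hR⟩ := hB.exists_norm_le
  obtain ⟨L, hL⟩ := exists_nat_gt (R + R ^ 2)
  refine ⟨L, fun p hp => ?_⟩
  have h := norm_prod_le_iff.mp (hR _ hp)
  simp only [phi, Real.norm_eq_abs, abs_le] at h
  refine ⟨trivial, ?_, ?_⟩ <;> nlinarith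

theorem det_phi (P : AWParams) (hs : StrictMono s) {L : ℕ} {ι : Type} [Fintype ι] [DecidableEq ι] (y : ι → Fin (m+1) × ℝ)
    (hy : ∀ p, y p ∈ Win m L) :
    Matrix.det (Matrix.of fun p q => Kabc P (phi s (y p)).1 (phi s (y p)).2 (phi s (y q)).1 (phi s (y q)).2) =
      (detK (kR (Psi P) s) y : ℝ) := by
  simp only [Kabc_g]
  rw [det_g (fun p => (((phi s (y p)).2 * (phi s (y p)).1 - (phi s (y p)).1 ^ 3 / 3 : ℝ) : ℂ))
    fun p q => kap (Psi P) (phi s (y p)).1 ((phi s (y p)).2 - (phi s (y p)).1 ^ 2) (phi s (y q)).1 ((phi s (y q)).2 - (phi s (y q)).1 ^ 2),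
    detK_eq, ← Complex.ofRealHom_eq_coe, RingHom.map_det]
  congr 1
  ext p q
  simp only [phi, add_sub_cancel_right, RingHom.mapMatrix_apply, Matrix.map_apply, Matrix.of_apply, Complex.ofRealHom_eq_coe, kR]
  exact Complex.ext (by simp) (by rw [(Psi_posC P hs).1 _ (hy p) _ (hy q), Complex.ofReal_im])

theorem sysP (P : AWParams) (hs : StrictMono s) : ∃ C, Sys (muW m) (kR (Psi P) s) (Win m) C := by
  have h : ∀ L, ∃ D, WK (muW m) (Win m L) (kR (Psi P) s) D := fun L => by
    obtain ⟨M, hM⟩ := kR_WK s L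
    obtain ⟨C, hC⟩ := (Psi_limTo P).decL M
    obtain ⟨D, hD⟩ := hM C
    exact ⟨D, hD _ hC⟩
  choose C hC using h
  refine ⟨C, fun a b hab => Set.prod_mono le_rfl (Set.Ico_subset_Ico ?_ ?_), by simp [Win], hC, fun L => (Psi_posC P hs).2⟩
  · exact neg_le_neg (Nat.cast_le.mpr hab)
  · exact Nat.cast_le.mpr hab

theorem main (P : AWParams) (hs : StrictMono s) :
    ∃ (Ω : Type) (_ : MeasurableSpace Ω) (Pr : Measure Ω), IsProbabilityMeasure Pr ∧
      ∃ M : Ω → Measure (ℝ × ℝ), IsPointProcess2 M ∧ IsDeterminantalOn Pr M (Kabc P) s := by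
  obtain ⟨C, hS⟩ := sysP P hs
  have : SigmaFinite (muW m) := by unfold muW; infer_instance
  obtain ⟨Q, M, hQ, hM, hn, hd⟩ := hS.exists_process
  refine ⟨_, _, Q, hQ, fun ω => (M ω).map (phi s), ⟨fun A hA => ?_, fun ω B hB hb => ?_⟩, fun r n B _ _ hB hb hdis => ?_⟩
  · simp only [Measure.map_apply phi_ms hA]
    exact hM _ (phi_ms hA)
  · obtain ⟨L, hL⟩ := phi_win (s := s) hb
    rw [Measure.map_apply phi_ms hB]
    exact hn ω L _ (phi_ms hB) hL
  · obtain ⟨L, hL⟩ := phi_win (s := s) (Bornology.isBounded_iUnion.mpr hb)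
    have hL' : ∀ j, phi s ⁻¹' B j ⊆ Win m L := fun j => (Set.preimage_mono (Set.subset_iUnion B j)).trans hL
    obtain ⟨h1, h2⟩ := hd r n (fun j => phi s ⁻¹' B j) L (fun j => phi_ms (hB j)) hL' fun i j hij => (hdis i j hij).preimage _
    simp only [Measure.map_apply phi_ms (hB _)]
    rw [h1, ENNReal.toReal_ofReal h2]
    refine ⟨ENNReal.ofReal_ne_top, ?_⟩
    have hmp := measurePreserving_pi (ι := (j : Fin r) × Fin (n j)) (fun _ => muW m) _ fun _ => phi_mp (s := s)
    have hem := hmp.measurable.measurableEmbedding fun x y h => funext fun p => phi_inj hs (congrFun h p)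
    have hSm : MeasurableSet {y : ((j : Fin r) × Fin (n j)) → Fin (m+1) × ℝ | ∀ p, y p ∈ phi s ⁻¹' B p.1} := by
      rw [Set.ofPred_forall]
      exact MeasurableSet.iInter fun p => measurable_pi_apply p (phi_ms (hB p.1))
    rw [← hmp.setIntegral_preimage_emb hem]
    trans ∫ y in {y : ((j : Fin r) × Fin (n j)) → Fin (m+1) × ℝ | ∀ p, y p ∈ phi s ⁻¹' B p.1}, ((detK (kR (Psi P) s) y : ℝ) : ℂ)
        ∂(Measure.pi fun _ => muW m)
    · rw [integral_complex_ofReal, ← MeasureTheory.integral_indicator hSm]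
      congr 2
      ext y
      classical
      by_cases h : ∀ p, y p ∈ phi s ⁻¹' B p.1
      · rw [Set.indicator_apply, if_pos (by exact h), Finset.prod_eq_one fun p _ => Set.indicator_of_mem (h p) _, one_mul]
      · rw [Set.indicator_apply, if_neg (by exact h)]
        push Not at h
        obtain ⟨p, hp⟩ := h
        rw [Finset.prod_eq_zero (Finset.mem_univ p) (Set.indicator_of_notMem hp _), zero_mul]
    · exact setIntegral_congr_fun hSm fun y hy => (det_phi P hs y fun p => hL' _ (hy p)).symm

end AW
/-- Theorem 1.1 (`T1`): existence of the Airy wanderer point process, a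
determinantal point process on `ℝ²` with correlation kernel `K_{a,b,c}` and
reference measure `μ_𝒜 × λ`. -/
theorem stmt1 (P : AWParams) (m : ℕ) (hm : 0 < m)
    (s : Fin m → ℝ) (hs : StrictMono s) :
    ∃ (Ω : Type) (_ : MeasurableSpace Ω) (Pr : Measure Ω),
      IsProbabilityMeasure Pr ∧
      ∃ M : Ω → Measure (ℝ × ℝ),
        IsPointProcess2 M ∧ IsDeterminantalOn Pr M (Kabc P) s := by
  obtain ⟨m, rfl⟩ := Nat.exists_eq_succ_of_ne_zero hm.ne'
  exact AW.main P hs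

end
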